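/- Let (M,p) be a germ of a generic real-analytic submanifold of ℂ^N which is minimal at p, and let a deformation (M'_ε)_{ε ∈ X} of targets through p' ∈ ℂ^{N'} with defining function ρ = (ρ_1,…,ρ_d) be given. Fix ℓ ∈ ℕ, let S be a semi-analytic subset of the mapping locus E_ℓ ⊆ X, and let S^reg be the set of points of S near which S is a real-analytic submanifold of ℝ^m. Then there exists an open dense subset D of S^reg such that for every δ ∈ D: (i) there exist an open neighborhood V of δ in S^reg, an open neighborhood V' of p in ℂ^N, and a map 𝐇 : V × V' → ℂ^{N'}, real-analytic in the first variable and holomorphic in the second, such that for every η ∈ V the map H^η := 𝐇(η, ·) satisfies H^η(p) = p', H^η(M ∩ V') ⊆ M'_η, and H^η is finitely nondegenerate of order at most ℓ at p with respect to I_{p'}(M'_η); and (ii) the tangent space T_δ S^reg is contained in the set of all v ∈ ℝ^m for which there exists a holomorphic map Y on a neighborhood of p with values in ℂ^{N'}, Y(p) = 0, such that 2·Re(∂_w ρ_i(H^δ(z), δ) · Y(z)) + (∂ρ_i/∂ε)(H^δ(z), δ) · v = 0 for all z ∈ M near p and i = 1,…,d, where ∂_w ρ_i(·, ε) denotes the Wirtinger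 gradient of ρ_i(·, ε) in the ℂ^{N'} variable and (∂ρ_i/∂ε)(w, ε) · v is the real directional derivative in ε in the direction v. -/

import Mathlib

open Complex Topology

noncomputable section

/-- `ℂ^n`. -/
abbrev Cn (n : ℕ) : Type := EuclideanSpace ℂ (Fin n)

/-- `ℝ^m`. -/
abbrev Rm (m : ℕ) : Type := EuclideanSpace ℝ (Fin m)

/-- The vector of `ℂ^n` with entry `c` in the `j`-th coordinate and `0` elsewhere. -/
def cbasis {n : ℕ} (j : Fin n) (c : ℂ) : Cn n := EuclideanSpace.single j c

/-- The `j`-th component of the Wirtinger gradient `∂f(q)` of a real-valued function `f`. -/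
def wirtD {n : ℕ} (f : Cn n → ℝ) (q : Cn n) : Fin n → ℂ := fun j =>
  (1 / 2 : ℂ) * ((fderiv ℝ f q (cbasis j 1) : ℂ)
    - Complex.I * (fderiv ℝ f q (cbasis j Complex.I) : ℂ))

/-- The `j`-th component of `∂̄g(q)` for a complex-valued function `g`. -/
def wirtDBar {n : ℕ} (g : Cn n → ℂ) (q : Cn n) : Fin n → ℂ := fun j =>
  (1 / 2 : ℂ) * (fderiv ℝ g q (cbasis j 1) + Complex.I * fderiv ℝ g q (cbasis j Complex.I))

/-- The `j`-th component of `∂̄f(q)` for a real-valued function `f`. -/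
def wirtDBarR {n : ℕ} (f : Cn n → ℝ) (q : Cn n) : Fin n → ℂ := fun j =>
  (1 / 2 : ℂ) * ((fderiv ℝ f q (cbasis j 1) : ℂ)
    + Complex.I * (fderiv ℝ f q (cbasis j Complex.I) : ℂ))

/-- `M` is a generic real-analytic submanifold of codimension `d` near `p`. -/
def IsGenericAt {n : ℕ} (M : Set (Cn n)) (d : ℕ) (p : Cn n) : Prop :=
  p ∈ M ∧ ∃ (U : Set (Cn n)) (ρ : Cn n → Fin d → ℝ),
    IsOpen U ∧ p ∈ U ∧ (∀ k, AnalyticOnNhd ℝ (fun z => ρ z k) U) ∧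
    (M ∩ U = {z | z ∈ U ∧ ∀ k, ρ z k = 0}) ∧
    ∀ q ∈ M ∩ U, LinearIndependent ℂ (fun k : Fin d => wirtD (fun z => ρ z k) q)

/-- `S` is, near its point `q`, a real-analytic submanifold of (real) dimension `mdim`. -/
def IsRASubmanifoldAt {E : Type*} [NormedAddCommGroup E] [NormedSpace ℝ E]
    (S : Set E) (q : E) (mdim : ℕ) : Prop :=
  ∃ (c : ℕ) (U : Set E) (ρ : E → Fin c → ℝ),
    IsOpen U ∧ q ∈ U ∧ mdim + c = Module.finrank ℝ E ∧
    (∀ k, AnalyticOnNhd ℝ (fun z => ρ z k) U) ∧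
    (S ∩ U = {z | z ∈ U ∧ ∀ k, ρ z k = 0}) ∧
    ∀ x ∈ S ∩ U, LinearIndependent ℝ (fun k : Fin c => fderiv ℝ (fun z => ρ z k) x)

/-- The tangent space of a set at a point: the span of the tangent cone. -/
def tangentSpaceAt {E : Type*} [NormedAddCommGroup E] [NormedSpace ℝ E] (S : Set E) (q : E) :
    Submodule ℝ E := Submodule.span ℝ (tangentConeAt ℝ S q)

/-- Multiplication by `i` on `ℂ^n` as an `ℝ`-linear map. -/
def mulI {n : ℕ} : Cn n →ₗ[ℝ] Cn n :=
  (LinearMap.lsmul ℂ (Cn n) Complex.I).restrictScalars ℝ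

/-- `M` (a generic submanifold of codimension `d`, hence of real dimension `2n - d`) is
minimal at `p`: there is no real-analytic submanifold `S ⊆ M` through `p` of strictly
smaller dimension whose tangent spaces contain the complex tangent spaces of `M`. -/
def IsMinimalAt {n : ℕ} (M : Set (Cn n)) (d : ℕ) (p : Cn n) : Prop :=
  ¬ ∃ (S : Set (Cn n)) (mdim : ℕ), S ⊆ M ∧ p ∈ S ∧ mdim < 2 * n - d ∧
      (∀ q ∈ S, IsRASubmanifoldAt S q mdim) ∧
      ∀ q ∈ S, tangentSpaceAt M q ⊓ (tangentSpaceAt M q).map mulI ≤ tangentSpaceAt S q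

/-- A real-analytic CR vector field of `M` near `p`. -/
structure CRVectorField {N : ℕ} (M : Set (Cn N)) (p : Cn N) where
  coeff : Cn N → Fin N → ℂ
  dom : Set (Cn N)
  isOpen : IsOpen dom
  mem : p ∈ dom
  analytic : ∀ j, AnalyticOnNhd ℝ (fun z => coeff z j) dom
  tangent : ∀ (f : Cn N → ℝ) (U : Set (Cn N)), IsOpen U → p ∈ U → AnalyticOnNhd ℝ f U →
    (∀ z ∈ M ∩ U, f z = 0) →
    ∃ V, IsOpen V ∧ p ∈ V ∧ ∀ z ∈ M ∩ V, (∑ j, coeff z j * wirtDBarR f z j) = 0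

/-- Application of a CR vector field to a complex-valued function. -/
def CRVectorField.apply {N : ℕ} {M : Set (Cn N)} {p : Cn N} (L : CRVectorField M p)
    (g : Cn N → ℂ) : Cn N → ℂ := fun z => ∑ j, L.coeff z j * wirtDBar g z j

/-- Iterated application `L̄₁ ⋯ L̄ₖ g` of a list of CR vector fields. -/
def CRApplyList {N : ℕ} {M : Set (Cn N)} {p : Cn N} (Ls : List (CRVectorField M p))
    (g : Cn N → ℂ) : Cn N → ℂ := Ls.foldr CRVectorField.apply g

/-- `H` is finitely nondegenerate of order at most `ℓ` at `p` (as a map of `M` into `M'`). -/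
def FinNondeg {N N' : ℕ} (M : Set (Cn N)) (p : Cn N) (M' : Set (Cn N')) (ℓ : ℕ)
    (H : Cn N → Cn N') : Prop :=
  Submodule.span ℂ
    { v : Fin N' → ℂ | ∃ (Ls : List (CRVectorField M p)) (ρ' : Cn N' → ℝ) (U' : Set (Cn N')),
        Ls.length ≤ ℓ ∧ IsOpen U' ∧ H p ∈ U' ∧ AnalyticOnNhd ℝ ρ' U' ∧
        (∀ w ∈ M' ∩ U', ρ' w = 0) ∧
        v = fun j => CRApplyList Ls (fun z => wirtD ρ' (H z) j) p } = ⊤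

/-- The mapping locus `E_ℓ ⊆ M'`. -/
def MappingLocus {N N' : ℕ} (M : Set (Cn N)) (p : Cn N) (M' : Set (Cn N')) (ℓ : ℕ) :
    Set (Cn N') :=
  { p' | p' ∈ M' ∧ ∃ (Ω : Set (Cn N)) (H : Cn N → Cn N'),
      IsOpen Ω ∧ p ∈ Ω ∧ DifferentiableOn ℂ H Ω ∧ H p = p' ∧
      (∀ z ∈ M ∩ Ω, H z ∈ M') ∧ FinNondeg M p M' ℓ H }

/-- A semi-analytic subset of a real vector space. -/
def SemiAnalyticSet {E : Type*} [NormedAddCommGroup E] [NormedSpace ℝ E] (A : Set E) : Prop :=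
  ∀ x : E, ∃ U : Set E, IsOpen U ∧ x ∈ U ∧
    ∃ (n k : ℕ) (f : Fin n → Fin k → E → ℝ) (iseq : Fin n → Fin k → Bool),
      (∀ i j, AnalyticOnNhd ℝ (f i j) U) ∧
      A ∩ U = ⋃ i, ⋂ j, {x | x ∈ U ∧ if iseq i j then f i j x = 0 else 0 < f i j x}

/-- `A` is locally semi-analytic along `M'`. -/
def LocallySemiAnalyticOn {E : Type*} [NormedAddCommGroup E] [NormedSpace ℝ E]
    (M' A : Set E) : Prop :=
  ∀ q ∈ M', ∃ U : Set E, IsOpen U ∧ q ∈ U ∧ SemiAnalyticSet (A ∩ U)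

/-- A real-analytic deformation `(M'_ε)_{ε ∈ X}` of generic submanifolds of codimension `d`
through `p' ∈ ℂ^{N'}`, parametrized by a compact semi-analytic set `X ⊆ ℝ^m`. -/
structure Deformation (N' m d : ℕ) (p' : Cn N') where
  X : Set (Rm m)
  compact_X : IsCompact X
  semiAnalytic_X : SemiAnalyticSet X
  W : Set (Rm m)
  isOpen_W : IsOpen W
  X_subset_W : X ⊆ W
  U' : Set (Cn N')
  isOpen_U' : IsOpen U'
  basept_mem : p' ∈ U'
  ρ : Cn N' → Rm m → Fin d → ℝ
  analytic_ρ : ∀ k, AnalyticOnNhd ℝ (fun we : Cn N' × Rm m => ρ we.1 we.2 k) (U' ×ˢ W)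
  basept : ∀ ε ∈ W, ∀ k, ρ p' ε k = 0
  generic : ∀ ε ∈ X, ∀ q ∈ U', (∀ k, ρ q ε k = 0) →
    LinearIndependent ℂ (fun k : Fin d => wirtD (fun w => ρ w ε k) q)

/-- The fiber `M'_ε` of a deformation. -/
def Deformation.Mfib {N' m d : ℕ} {p' : Cn N'} (D : Deformation N' m d p') (ε : Rm m) :
    Set (Cn N') := {w | w ∈ D.U' ∧ ∀ k, D.ρ w ε k = 0}

/-- The mapping locus `E_ℓ ⊆ X` of a deformation. -/
def DefLocus {N N' m d : ℕ} (M : Set (Cn N)) (p : Cn N) {p' : Cn N'}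
    (D : Deformation N' m d p') (ℓ : ℕ) : Set (Rm m) :=
  { ε | ε ∈ D.X ∧ ∃ (Ω : Set (Cn N)) (H : Cn N → Cn N'),
      IsOpen Ω ∧ p ∈ Ω ∧ DifferentiableOn ℂ H Ω ∧ H p = p' ∧
      (∀ z ∈ M ∩ Ω, H z ∈ D.Mfib ε) ∧ FinNondeg M p (D.Mfib ε) ℓ H }


/-- The regular part of a set `S ⊆ ℝ^m`: points near which `S` is a real-analytic
submanifold. -/
def regPart {E : Type*} [NormedAddCommGroup E] [NormedSpace ℝ E] (S : Set E) : Set E :=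
  {x | x ∈ S ∧ ∃ k : ℕ, IsRASubmanifoldAt S x k}

set_option linter.all false
open scoped ContDiff


/-! ## Part 1: calculus lemmas -/

section omegaAn
variable {𝕜 : Type*} [NontriviallyNormedField 𝕜]
variable {E F : Type*} [NormedAddCommGroup E] [NormedSpace 𝕜 E] [NormedAddCommGroup F]
  [NormedSpace 𝕜 F]

lemma cd_omega_iff [CompleteSpace F] {f : E → F} {a : E} :
    ContDiffAt 𝕜 ω f a ↔ AnalyticAt 𝕜 f a := by
  rw [← contDiffWithinAt_univ, contDiffWithinAt_omega_iff_analyticWithinAt, analyticWithinAt_univ]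
end omegaAn

section calculusOne
variable {𝕜 : Type*} [RCLike 𝕜]
variable {E F G : Type*} [NormedAddCommGroup E] [NormedSpace 𝕜 E] [NormedAddCommGroup F]
  [NormedSpace 𝕜 F] [NormedAddCommGroup G] [NormedSpace 𝕜 G]

lemma analytic_inv [FiniteDimensional 𝕜 E] [FiniteDimensional 𝕜 F] {f : E → F} {a : E}
    (hf : AnalyticAt 𝕜 f a) (hb : Function.Bijective (fderiv 𝕜 f a)) :
    ∃ g : F → E, AnalyticAt 𝕜 g (f a) ∧ g (f a) = a ∧ (∀ᶠ y in 𝓝 (f a), f (g y) = y) ∧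
      ∀ᶠ x in 𝓝 a, g (f x) = x := by
  have : CompleteSpace E := FiniteDimensional.complete 𝕜 E
  have : CompleteSpace F := FiniteDimensional.complete 𝕜 F
  let e : E ≃L[𝕜] F :=
    (LinearEquiv.ofBijective (fderiv 𝕜 f a : E →ₗ[𝕜] F) hb).toContinuousLinearEquiv
  have he : (e : E →L[𝕜] F) = fderiv 𝕜 f a := by
    ext x; rfl
  have hcd : ContDiffAt 𝕜 ω f a := cd_omega_iff.2 hf
  have hd : HasFDerivAt f (e : E →L[𝕜] F) a := by
    rw [he]; exact hf.differentiableAt.hasFDerivAt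
  have hs := hcd.hasStrictFDerivAt' hd (by simp)
  refine ⟨hcd.localInverse hd (by simp), ?_, hcd.localInverse_apply_image hd (by simp), ?_, ?_⟩
  · exact cd_omega_iff.1 (hcd.to_localInverse hd (by simp))
  · exact hs.eventually_right_inverse
  · exact hs.eventually_left_inverse

lemma analytic_rightInv [FiniteDimensional 𝕜 E] [FiniteDimensional 𝕜 F] {f : E → F} {a : E}
    (hf : AnalyticAt 𝕜 f a) (hb : Function.Surjective (fderiv 𝕜 f a)) :
    ∃ s : F → E, AnalyticAt 𝕜 s (f a) ∧ s (f a) = a ∧ (∀ᶠ y in 𝓝 (f a), f (s y) = y) := by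
  obtain ⟨R, hR⟩ := (fderiv 𝕜 f a : E →ₗ[𝕜] F).exists_rightInverse_of_surjective
    (LinearMap.range_eq_top.2 hb)
  let R' : F →L[𝕜] E := LinearMap.toContinuousLinearMap R
  have hR' : ∀ y, fderiv 𝕜 f a (R' y) = y := fun y => LinearMap.congr_fun hR y
  let k : F → F := fun y => f (a + R' (y - f a))
  have hin : AnalyticAt 𝕜 (fun y => a + R' (y - f a)) (f a) := by
    have := (R'.analyticAt (f a - f a)).comp_of_eq
      (f := fun y => y - f a) (analyticAt_id.sub analyticAt_const) rfl
    exact analyticAt_const.add this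
  have ha : a + R' (f a - f a) = a := by simp
  have hk : AnalyticAt 𝕜 k (f a) := AnalyticAt.comp_of_eq hf hin ha
  have hka : k (f a) = f a := by simp [k]
  have hkd : HasFDerivAt k (ContinuousLinearMap.id 𝕜 F) (f a) := by
    have h1 : HasFDerivAt (fun y => a + R' (y - f a)) R' (f a) := by
      have := HasFDerivAt.comp (g := R') (f := fun y => y - f a) (f a) (R'.hasFDerivAt (x := f a - f a)) ((hasFDerivAt_id (f a)).sub_const (f a))
      exact (this.const_add a)
    have h2 : HasFDerivAt f (fderiv 𝕜 f a) (a + R' (f a - f a)) := by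
      rw [ha]; exact hf.differentiableAt.hasFDerivAt
    have := h2.comp (f a) h1
    have h4 : ContinuousLinearMap.id 𝕜 F = (fderiv 𝕜 f a).comp R' := by
      ext y; simp [hR']
    rw [h4]; exact this
  obtain ⟨g, hg, hga, hgr, -⟩ := analytic_inv hk (by
    rw [hkd.fderiv]; exact Function.bijective_id)
  rw [hka] at hg hga hgr
  refine ⟨fun y => a + R' (g y - f a), ?_, by simp [hga], ?_⟩
  · exact AnalyticAt.comp_of_eq (g := fun y => a + R' (y - f a)) hin hg hga
  · exact hgr

/-- Implicit function theorem, analytic form. -/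
lemma analytic_implicit [FiniteDimensional 𝕜 E] [FiniteDimensional 𝕜 F] [FiniteDimensional 𝕜 G]
    {f : E × F → G} {x0 : E} {y0 : F} (hf : AnalyticAt 𝕜 f (x0, y0))
    (hb : Function.Bijective (fun y : F => fderiv 𝕜 f (x0, y0) (0, y))) :
    ∃ ψ : E × G → F, AnalyticAt 𝕜 ψ (x0, f (x0, y0)) ∧ ψ (x0, f (x0, y0)) = y0 ∧
      (∀ᶠ c in 𝓝 (x0, f (x0, y0)), f (c.1, ψ c) = c.2) ∧
      ∀ᶠ x in 𝓝 (x0, y0), ψ (x.1, f x) = x.2 := by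
  let k : E × F → E × G := fun x => (x.1, f x)
  have hk : AnalyticAt 𝕜 k (x0, y0) := analyticAt_fst.prod hf
  have hd : fderiv 𝕜 k (x0, y0) =
      (ContinuousLinearMap.fst 𝕜 E F).prod (fderiv 𝕜 f (x0, y0)) :=
    (hasFDerivAt_fst.prodMk hf.differentiableAt.hasFDerivAt).fderiv
  obtain ⟨g, hg, hga, hgr, hgl⟩ := analytic_inv hk (by
    rw [hd]
    constructor
    · rw [injective_iff_map_eq_zero]
      rintro ⟨x, y⟩ h
      simp only [ContinuousLinearMap.prod_apply, Prod.mk_eq_zero, ContinuousLinearMap.coe_fst'] at h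
      obtain ⟨rfl, h2⟩ := h
      have : y = 0 := hb.1 (by simp only; rw [h2]; exact (map_zero _).symm)
      simp [this]
    · rintro ⟨x, c⟩
      obtain ⟨y, hy⟩ := hb.2 (c - fderiv 𝕜 f (x0, y0) (x, 0))
      refine ⟨(x, y), ?_⟩
      have h3 : ((x, y) : E × F) = (x, 0) + (0, y) := by simp
      have : fderiv 𝕜 f (x0, y0) (x, y) = c := by
        rw [h3, map_add]; simp only at hy; rw [hy]; abel
      simp [this])
  refine ⟨fun c => (g c).2, ?_, by simpa [k] using congrArg Prod.snd hga, ?_, ?_⟩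
  · exact analyticAt_snd.comp_of_eq hg rfl
  · filter_upwards [hgr] with c hc
    have h1 : (g c).1 = c.1 := congrArg Prod.fst hc
    have h2 : f (g c) = c.2 := congrArg Prod.snd hc
    rw [← h1, Prod.mk.eta, h2]
  · filter_upwards [hgl] with x hx
    exact congrArg Prod.snd hx

end calculusOne

section rank
variable {E F G : Type*} [NormedAddCommGroup E] [NormedSpace ℝ E] [NormedAddCommGroup F]
  [NormedSpace ℝ F] [NormedAddCommGroup G] [NormedSpace ℝ G]

/-- rank of a continuous linear map -/
def rk (A : E →L[ℝ] F) : ℕ := Module.finrank ℝ (LinearMap.range (A : E →ₗ[ℝ] F))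

lemma le_rk_iff [FiniteDimensional ℝ E] [FiniteDimensional ℝ F] (A : E →L[ℝ] F) (k : ℕ) :
    k ≤ rk A ↔ ∃ (P : (Fin k → ℝ) →L[ℝ] E) (Q : F →L[ℝ] (Fin k → ℝ)),
      (Q ∘L A ∘L P).det ≠ 0 := by
  constructor
  · intro h
    obtain ⟨v, hv⟩ := exists_linearIndependent_of_le_finrank h
    have hv' : LinearIndependent ℝ (fun i => (v i : F)) :=
      hv.map' (Submodule.subtype _) (Submodule.ker_subtype _)
    choose x hx using fun i => (v i).2
    let P : (Fin k → ℝ) →ₗ[ℝ] E := Fintype.linearCombination ℝ x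
    let B : (Fin k → ℝ) →ₗ[ℝ] F := Fintype.linearCombination ℝ (fun i => (v i : F))
    have hB : LinearMap.ker B = ⊥ := by
      exact linearIndependent_iff_injective_fintypeLinearCombination.1 hv' |> LinearMap.ker_eq_bot.2
    obtain ⟨Q, hQ⟩ := B.exists_leftInverse_of_injective hB
    refine ⟨LinearMap.toContinuousLinearMap P, LinearMap.toContinuousLinearMap Q, ?_⟩
    have : (LinearMap.toContinuousLinearMap Q ∘L A ∘L LinearMap.toContinuousLinearMap P)
        = ContinuousLinearMap.id ℝ _ := by
      ext1 c
      have h1 : A (P c) = B c := by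
        simp only [P, B, Fintype.linearCombination_apply, map_sum, map_smul]
        exact Finset.sum_congr rfl fun i _ => by rw [← hx i]; rfl
      have := LinearMap.congr_fun hQ c
      simpa [h1] using this
    rw [this]
    simp [ContinuousLinearMap.det]
  · rintro ⟨P, Q, hdet⟩
    have hinj : Function.Injective (Q ∘L A ∘L P) := by
      have h2 := LinearMap.equivOfDetNeZero (Q ∘L A ∘L P : (Fin k → ℝ) →ₗ[ℝ] (Fin k → ℝ)) hdet
      have := LinearMap.isUnit_iff_isUnit_det _ |>.2 (isUnit_iff_ne_zero.2 hdet)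
      exact ((Module.End.isUnit_iff _).1 this).1
    let C : (Fin k → ℝ) →ₗ[ℝ] LinearMap.range (A : E →ₗ[ℝ] F) :=
      (A : E →ₗ[ℝ] F).rangeRestrict ∘ₗ (P : (Fin k → ℝ) →ₗ[ℝ] E)
    have : Function.Injective C := by
      intro x y hxy
      apply hinj
      have : A (P x) = A (P y) := congrArg Subtype.val hxy
      simp [this]
    have := LinearMap.finrank_le_finrank_of_injective this
    simpa [rk] using this

lemma rk_eventually_ge [FiniteDimensional ℝ E] [FiniteDimensional ℝ F] (A : E →L[ℝ] F) :
    ∀ᶠ B in 𝓝 A, rk A ≤ rk B := by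
  obtain ⟨P, Q, h⟩ := (le_rk_iff A (rk A)).1 le_rfl
  have hc : Continuous (fun B : E →L[ℝ] F => (Q ∘L B ∘L P).det) := by
    apply ContinuousLinearMap.continuous_det.comp
    exact (continuous_const).clm_comp (continuous_id.clm_comp continuous_const)
  filter_upwards [hc.continuousAt.eventually_ne h] with B hB
  exact (le_rk_iff B _).2 ⟨P, Q, hB⟩

lemma rk_le [FiniteDimensional ℝ F] (A : E →L[ℝ] F) : rk A ≤ Module.finrank ℝ F :=
  Submodule.finrank_le _

lemma analyticAt_fderiv_comp {f : E → F} {x : E} [CompleteSpace F] (hf : AnalyticAt ℝ f x) :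
    ∀ᶠ y in 𝓝 x, DifferentiableAt ℝ f y :=
  hf.eventually_analyticAt.mono fun _ h => h.differentiableAt

end rank


section constrank
variable {E F G : Type*} [NormedAddCommGroup E] [NormedSpace ℝ E] [NormedAddCommGroup F]
  [NormedSpace ℝ F] [NormedAddCommGroup G] [NormedSpace ℝ G]

lemma const_rank [FiniteDimensional ℝ E] [FiniteDimensional ℝ F] {f : E → F} {a : E}
    (hf : AnalyticAt ℝ f a) (hr : ∀ᶠ x in 𝓝 a, rk (fderiv ℝ f x) ≤ rk (fderiv ℝ f a))
    (Pr : F →L[ℝ] F) (h1 : ∀ x, Pr (fderiv ℝ f a x) = fderiv ℝ f a x)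
    (h2 : ∀ y, ∃ x, fderiv ℝ f a x = Pr y) :
    ∃ φ : F → F, AnalyticAt ℝ φ (Pr (f a)) ∧ (∀ y, φ (Pr y) = φ y) ∧
      ∀ᶠ x in 𝓝 a, f x = φ (Pr (f x)) := by
  have : CompleteSpace F := FiniteDimensional.complete ℝ F
  have : CompleteSpace E := FiniteDimensional.complete ℝ E
  set A := fderiv ℝ f a with hA
  let R : Submodule ℝ F := LinearMap.range (A : E →ₗ[ℝ] F)
  let πR : F →L[ℝ] R := Pr.codRestrict R (fun y => h2 y)
  have hπ : ∀ y, (πR y : F) = Pr y := fun y => rfl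
  have hππ : ∀ y, πR (Pr y) = πR y := by
    intro y
    obtain ⟨x, hx⟩ := h2 y
    apply Subtype.ext
    rw [hπ, hπ, ← hx, h1]
  let K : Submodule ℝ E := LinearMap.ker (A : E →ₗ[ℝ] F)
  obtain ⟨L0, hL0⟩ := K.subtype.exists_leftInverse_of_injective (Submodule.ker_subtype K)
  let L : E →L[ℝ] K := LinearMap.toContinuousLinearMap L0
  have hL : ∀ x : K, L x = x := fun x => LinearMap.congr_fun hL0 x
  let k : E → R × K := fun x => (πR (f x), L x)
  have hk : AnalyticAt ℝ k a := (πR.analyticAt _ |>.comp hf).prod (L.analyticAt a)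
  have hkd : HasFDerivAt k ((πR ∘L A).prod L) a :=
    (πR.hasFDerivAt.comp a hf.differentiableAt.hasFDerivAt).prodMk L.hasFDerivAt
  have hinj : Function.Injective ((πR ∘L A).prod L) := by
    rw [injective_iff_map_eq_zero]
    intro x hx
    have hx1 : πR (A x) = 0 := congrArg Prod.fst hx
    have hx2 : L x = 0 := congrArg Prod.snd hx
    have hx3 : A x = 0 := by
      have := congrArg Subtype.val hx1
      rw [hπ, h1] at this; exact this
    have := hL ⟨x, hx3⟩
    have h4 : (⟨x, hx3⟩ : K) = 0 := by rw [← this]; exact hx2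
    exact congrArg Subtype.val h4
  have hfr : Module.finrank ℝ E = Module.finrank ℝ (R × K) := by
    rw [Module.finrank_prod]
    exact ((A : E →ₗ[ℝ] F).finrank_range_add_finrank_ker).symm
  have hsurj : Function.Surjective ((πR ∘L A).prod L) :=
    (LinearMap.injective_iff_surjective_of_finrank_eq_finrank
      (f := (((πR ∘L A).prod L : E →L[ℝ] R × K) : E →ₗ[ℝ] R × K)) hfr).1 hinj
  obtain ⟨h, hh, hha, hhr, hhl⟩ := analytic_inv hk (by rw [hkd.fderiv]; exact ⟨hinj, hsurj⟩)
  -- the composite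
  have hfh : AnalyticAt ℝ (fun c => f (h c)) (k a) := AnalyticAt.comp_of_eq hf hh hha
  have hev : ∀ᶠ c in 𝓝 (k a), AnalyticAt ℝ (fun c => f (h c)) c ∧ AnalyticAt ℝ h c ∧
      AnalyticAt ℝ f (h c) ∧ rk (fderiv ℝ f (h c)) ≤ rk A ∧ ∀ᶠ c' in 𝓝 c, k (h c') = c' := by
    have ht : Filter.Tendsto h (𝓝 (k a)) (𝓝 a) := by
      have := hh.continuousAt.tendsto; rwa [hha] at this
    filter_upwards [hfh.eventually_analyticAt, hh.eventually_analyticAt,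
      ht.eventually hf.eventually_analyticAt, ht.eventually hr, hhr.eventually_nhds]
      with c c1 c2 c3 c4 c5 using ⟨c1, c2, c3, c4, c5⟩
  have hz : ∀ᶠ c in 𝓝 (k a), ∀ κ : K, fderiv ℝ (fun c => f (h c)) c (0, κ) = 0 := by
    filter_upwards [hev] with c ⟨c1, c2, c3, c4, c5⟩ κ
    have hd : HasFDerivAt (fun c => f (h c)) (fderiv ℝ f (h c) ∘L fderiv ℝ h c) c :=
      c3.differentiableAt.hasFDerivAt.comp c c2.differentiableAt.hasFDerivAt
    have hd2 : HasFDerivAt (fun c => πR (f (h c))) (πR ∘L (fderiv ℝ f (h c) ∘L fderiv ℝ h c)) c :=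
      πR.hasFDerivAt.comp c hd
    have hd3 : HasFDerivAt (fun c : R × K => πR (f (h c))) (ContinuousLinearMap.fst ℝ R K) c := by
      refine hasFDerivAt_fst.congr_of_eventuallyEq ?_
      filter_upwards [c5] with c' hc' using congrArg Prod.fst hc'
    have hd4 := hd2.unique hd3
    rw [hd.fderiv]
    -- injectivity of πR on the range
    let R' : Submodule ℝ F := LinearMap.range (fderiv ℝ f (h c) : E →ₗ[ℝ] F)
    let ψ : R' →ₗ[ℝ] R := (πR : F →ₗ[ℝ] R) ∘ₗ R'.subtype
    have hψ : Function.Surjective ψ := by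
      intro t
      refine ⟨⟨fderiv ℝ f (h c) (fderiv ℝ h c (t, 0)), ⟨_, rfl⟩⟩, ?_⟩
      have := DFunLike.congr_fun hd4 ((t, 0) : R × K)
      exact this
    have hle : Module.finrank ℝ R ≤ Module.finrank ℝ R' := LinearMap.finrank_le_finrank_of_surjective hψ
    have heq : Module.finrank ℝ R' = Module.finrank ℝ R := le_antisymm c4 hle
    have hψi : Function.Injective ψ :=
      (LinearMap.injective_iff_surjective_of_finrank_eq_finrank heq).2 hψ
    have h5 : ψ ⟨fderiv ℝ f (h c) (fderiv ℝ h c (0, κ)), ⟨_, rfl⟩⟩ = 0 := by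
      have := DFunLike.congr_fun hd4 ((0, κ) : R × K)
      exact this
    have := hψi (h5.trans (map_zero ψ).symm)
    exact congrArg Subtype.val this
  obtain ⟨ε, hε, hball⟩ := Metric.eventually_nhds_iff_ball.1 (hz.and hev)
  refine ⟨fun y => f (h (πR y, L a)), ?_, fun y => by simp only [hππ], ?_⟩
  · have : AnalyticAt ℝ (fun y : F => ((πR y, L a) : R × K)) (Pr (f a)) :=
      (πR.analyticAt _).prod analyticAt_const
    refine AnalyticAt.comp_of_eq (g := fun c => f (h c)) hfh this ?_
    simp only [k, hππ]
  · have hkc : ∀ᶠ x in 𝓝 a, k x ∈ Metric.ball (k a) ε :=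
      hk.continuousAt.eventually (Metric.ball_mem_nhds _ hε)
    filter_upwards [hkc, hhl] with x hx hx2
    rw [hππ]
    have hx3 : (πR (f x) ∈ Metric.ball (πR (f a)) ε) ∧ L x ∈ Metric.ball (L a) ε := by
      rw [← ball_prod_same] at hx; exact hx
    have key := (Metric.isOpen_ball (x := L a) (ε := ε)).is_const_of_fderiv_eq_zero (𝕜 := ℝ)
      (f := fun c => f (h (πR (f x), c))) (convex_ball _ _).isPreconnected
      (by
        intro c hc
        have hm : (πR (f x), c) ∈ Metric.ball (k a) ε := by
          rw [← ball_prod_same]; exact ⟨hx3.1, hc⟩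
        have h7 := (hball _ hm).2.1.differentiableAt
        exact (h7.comp c (f := fun c => (πR (f x), c)) (by fun_prop)).differentiableWithinAt)
      (by
        intro c hc
        have hm : (πR (f x), c) ∈ Metric.ball (k a) ε := by
          rw [← ball_prod_same]; exact ⟨hx3.1, hc⟩
        have h7 := (hball _ hm).2.1.differentiableAt.hasFDerivAt
        have h8 := h7.comp c (hasFDerivAt_prodMk_right (𝕜 := ℝ) (πR (f x)) c)
        have h9 : fderiv ℝ (fun c => f (h (πR (f x), c))) c = _ := h8.fderiv
        rw [h9]
        ext κ
        exact (hball _ hm).1 κ)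
      hx3.2 (Metric.mem_ball_self hε)
    have : f x = f (h (πR (f x), L x)) := by
      conv_lhs => rw [← hx2]
    exact this.trans key

/-- An analytic function all of whose iterated directional derivatives vanish at a point
vanishes near that point. -/
lemma analytic_zero_of_iter [FiniteDimensional ℝ E] [CompleteSpace F] {u : E → F} {a : E}
    (hu : AnalyticAt ℝ u a)
    (h : ∀ n, iteratedFDeriv ℝ n u a = 0) : ∀ᶠ x in 𝓝 a, u x = 0 := by
  obtain ⟨p, r, hp⟩ := hu

  rw [← map_add_left_nhds_zero, Filter.eventually_map]
  have : Metric.eball (0 : E) r ∈ 𝓝 (0 : E) := Metric.eball_mem_nhds _ hp.r_pos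
  filter_upwards [this] with y hy
  have h1 := hp.hasSum_iteratedFDeriv (y := y) hy
  simp only [h, ContinuousMultilinearMap.zero_apply, smul_zero] at h1
  exact h1.unique hasSum_zero

/-- image of a smooth map from a lower-dimensional space has dense complement -/
lemma no_open_image [FiniteDimensional ℝ E] [FiniteDimensional ℝ F] {R : Submodule ℝ F}
    {φ : R → F} {s : Set R} (hφ : ∀ x ∈ s, AnalyticAt ℝ φ x) (hs : Convex ℝ s)
    (hR : Module.finrank ℝ R < Module.finrank ℝ F) {O : Set F} (hO : IsOpen O)
    (hne : O.Nonempty) (hsub : O ⊆ φ '' s) : False := by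
  have : CompleteSpace F := FiniteDimensional.complete ℝ F
  have h1 : ContDiffOn ℝ 1 φ s := fun x hx => (hφ x hx).contDiffAt.contDiffWithinAt
  have hd : dimH s < Module.finrank ℝ F := by
    refine lt_of_le_of_lt (b := (Module.finrank ℝ R : ENNReal)) ?_ (by exact_mod_cast hR)
    calc dimH s ≤ dimH (Set.univ : Set R) := dimH_mono (Set.subset_univ s)
      _ = _ := Real.dimH_univ_eq_finrank R
  have := h1.dense_compl_image_of_dimH_lt_finrank hs subset_rfl hd
  obtain ⟨x, hx1, hx2⟩ := this.inter_open_nonempty O hO hne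
  exact hx2 (hsub hx1)

end constrank


section sectionA

lemma exists_max_nat {P : ℕ → Prop} (h0 : P 0) (B : ℕ) (hB : ∀ k, P k → k ≤ B) :
    ∃ r, P r ∧ ∀ k, P k → k ≤ r := by
  classical
  refine ⟨Nat.findGreatest P B, Nat.findGreatest_spec (Nat.zero_le B) h0, fun k hk => ?_⟩
  exact Nat.le_findGreatest (hB k hk) hk

/-- irreducible compact subset over a set with interior -/
lemma exists_irreducible {E G : Type} [NormedAddCommGroup E] [NormedSpace ℝ E]
    [NormedAddCommGroup G] [FiniteDimensional ℝ E]
    {C : Set (E × G)} (hC : IsCompact C) (hInt : (interior (Prod.fst '' C)).Nonempty) :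
    ∃ C' ⊆ C, C'.Nonempty ∧ ∀ W : Set (E × G), IsOpen W → (C' ∩ W).Nonempty →
      ∃ O : Set E, IsOpen O ∧ O.Nonempty ∧ O ⊆ Prod.fst '' (C' ∩ W) := by
  have : ProperSpace E := FiniteDimensional.proper ℝ E
  obtain ⟨x0, hx0⟩ := hInt
  obtain ⟨ρ, hρ, hρs⟩ := Metric.nhds_basis_closedBall.mem_iff.1 (mem_interior_iff_mem_nhds.1 hx0)
  let K : Set E := Metric.closedBall x0 ρ
  have hK : IsCompact K := isCompact_closedBall x0 ρ
  let X : Set (E × G) := C ∩ Prod.fst ⁻¹' K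
  have hX : IsCompact X := hC.inter_right (hK.isClosed.preimage continuous_fst)
  have : CompactSpace X := isCompact_iff_compactSpace.1 hX
  have : CompactSpace K := isCompact_iff_compactSpace.1 hK
  let π : X → K := fun x => ⟨x.1.1, x.2.2⟩
  have hπ : Continuous π := by
    apply Continuous.subtype_mk
    exact continuous_fst.comp continuous_subtype_val
  have hπs : Function.Surjective π := by
    rintro ⟨e, he⟩
    obtain ⟨y, hy, rfl⟩ := hρs he
    exact ⟨⟨y, hy, he⟩, rfl⟩
  obtain ⟨D, hD, hDs, hDm⟩ := exists_compact_surjective_zorn_subset hπ hπs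
  refine ⟨Subtype.val '' D, ?_, ?_, ?_⟩
  · rintro _ ⟨x, -, rfl⟩; exact x.2.1
  · have : (⟨x0, Metric.mem_closedBall_self hρ.le⟩ : K) ∈ π '' D := by rw [hDs]; trivial
    obtain ⟨x, hx, -⟩ := this
    exact ⟨x.1, x, hx, rfl⟩
  · rintro W hW ⟨_, ⟨y, hy, rfl⟩, hyW⟩
    have hDc : IsClosed D := by
      exact isCompact_iff_compactSpace.2 hD |>.isClosed
    -- the closed subset obtained by removing `W`
    let D0 : Set X := D ∩ (Subtype.val ⁻¹' W)ᶜ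
    have hD0 : IsClosed D0 := hDc.inter (hW.preimage continuous_subtype_val).isClosed_compl
    have hne : π '' D0 ≠ Set.univ := by
      intro h
      let E0 : Set D := Subtype.val ⁻¹' D0
      have hE0 : E0 ≠ Set.univ := by
        intro h'
        have : (⟨y, hy⟩ : D) ∈ E0 := by rw [h']; trivial
        exact this.2 hyW
      refine hDm E0 hE0 (hD0.preimage continuous_subtype_val) ?_
      rw [Set.eq_univ_iff_forall] at h ⊢
      intro e
      obtain ⟨x, hx, hxe⟩ := h e
      exact ⟨⟨x, hx.1⟩, hx, hxe⟩
    have hcl : IsClosed (Subtype.val '' (π '' D0)) :=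
      ((hD0.isCompact.image hπ).image continuous_subtype_val).isClosed
    obtain ⟨e, he⟩ := (Set.ne_univ_iff_exists_notMem _).1 hne
    have hopen : IsOpen (Subtype.val '' (π '' D0))ᶜ := hcl.isOpen_compl
    have hee : (e : E) ∈ (Subtype.val '' (π '' D0))ᶜ := by
      rintro ⟨e', he', h⟩
      exact he (Subtype.ext h ▸ he')
    have hcl2 : (e : E) ∈ closure (Metric.ball x0 ρ) := by
      rw [closure_ball x0 hρ.ne']; exact e.2
    obtain ⟨e2, h1, h2⟩ := mem_closure_iff.1 hcl2 _ hopen hee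
    refine ⟨(Subtype.val '' (π '' D0))ᶜ ∩ Metric.ball x0 ρ, hopen.inter Metric.isOpen_ball,
      ⟨e2, h1, h2⟩, ?_⟩
    rintro e3 ⟨h3, h4⟩
    have : (⟨e3, Metric.ball_subset_closedBall h4⟩ : K) ∈ π '' D := by rw [hDs]; trivial
    obtain ⟨x, hx, hxe⟩ := this
    refine ⟨x.1, ⟨⟨x, hx, rfl⟩, ?_⟩, congrArg Subtype.val hxe⟩
    by_contra hxW
    exact h3 ⟨π x, ⟨x, ⟨hx, hxW⟩, rfl⟩, by rw [hxe]⟩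

end sectionA

section sectionB
variable {Y : Type} [NormedAddCommGroup Y] [NormedSpace ℝ Y] [FiniteDimensional ℝ Y]

lemma section_B {C : Set Y} (hne : C.Nonempty) :
    ∃ y0 ∈ C, ∃ (T : Submodule ℝ Y) (θ : T → Y) (L : Y →L[ℝ] T),
      AnalyticAt ℝ θ (L y0) ∧ θ (L y0) = y0 ∧ (∀ᶠ τ in 𝓝 (L y0), L (θ τ) = τ) ∧
      (∀ᶠ y in 𝓝 y0, y ∈ C → θ (L y) = y) ∧
      ∀ᶠ y in 𝓝 y0, y ∈ C → ∀ u : T → ℝ, AnalyticAt ℝ u (L y) →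
        (∀ᶠ x in 𝓝 y, x ∈ C → u (L x) = 0) → fderiv ℝ u (L y) = 0 := by
  let P : ℕ → Prop := fun k => ∃ y ∈ C, ∃ g : Fin k → Y → ℝ,
    (∀ i, AnalyticAt ℝ (g i) y ∧ ∀ᶠ x in 𝓝 y, x ∈ C → g i x = 0) ∧
    LinearIndependent ℝ (fun i => fderiv ℝ (g i) y)
  obtain ⟨r, ⟨y0, hy0, g, hg, hli⟩, hmax⟩ := exists_max_nat (P := P)
    (by
      obtain ⟨y, hy⟩ := hne
      exact ⟨y, hy, fun i => i.elim0, fun i => i.elim0, linearIndependent_empty_type⟩)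
    (Module.finrank ℝ (Y →L[ℝ] ℝ))
    (by
      rintro k ⟨y, -, g, -, h⟩
      simpa using h.fintype_card_le_finrank)
  let gg : Y → Fin r → ℝ := fun y i => g i y
  have hgg : AnalyticAt ℝ gg y0 := analyticAt_pi_iff.2 fun i => (hg i).1
  have hd : ∀ y, AnalyticAt ℝ gg y → fderiv ℝ gg y = ContinuousLinearMap.pi (fun i => fderiv ℝ (g i) y) := by
    intro y hy
    exact (hasFDerivAt_pi.2 fun i => (analyticAt_pi_iff.1 hy i).differentiableAt.hasFDerivAt).fderiv
  -- surjectivity versus linear independence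
  have hli_iff : ∀ (y : Y), AnalyticAt ℝ gg y →
      (r ≤ rk (fderiv ℝ gg y) ↔ LinearIndependent ℝ (fun i => fderiv ℝ (g i) y)) := by
    intro y hy
    have hrk : r ≤ rk (fderiv ℝ gg y) ↔ Function.Surjective (fderiv ℝ gg y) := by
      rw [← ContinuousLinearMap.coe_coe, ← LinearMap.range_eq_top]
      constructor
      · intro h
        apply Submodule.eq_top_of_finrank_eq
        apply le_antisymm (Submodule.finrank_le _)
        simpa [rk] using h
      · intro h
        unfold rk; rw [h]; simp
    rw [hrk, hd y hy]
    constructor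
    · intro hs
      rw [Fintype.linearIndependent_iff]
      intro c hc i
      obtain ⟨v, hv⟩ := hs (Pi.single i 1)
      have h2 := DFunLike.congr_fun hc v
      have h3 : ∀ j, fderiv ℝ (g j) y v = (Pi.single i 1 : Fin r → ℝ) j := fun j => congrFun hv j
      simp only [ContinuousLinearMap.sum_apply, ContinuousLinearMap.smul_apply, h3] at h2
      simpa [Pi.single_apply] using h2
    · intro hl
      by_contra hns
      rw [← ContinuousLinearMap.coe_coe, ← LinearMap.range_eq_top] at hns
      obtain ⟨ℓ, hℓ, hℓ2⟩ := Submodule.exists_le_ker_of_lt_top _ (lt_top_iff_ne_top.2 hns)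
      apply hℓ
      have h4 : ∀ i, ℓ (Pi.single i 1) = 0 := by
        refine Fintype.linearIndependent_iff.1 hl _ ?_
        ext v
        have h5 : ℓ (fun i => fderiv ℝ (g i) y v) = 0 := hℓ2 ⟨v, rfl⟩
        rw [LinearMap.pi_apply_eq_sum_univ] at h5
        simp only [ContinuousLinearMap.sum_apply, ContinuousLinearMap.smul_apply,
          ContinuousLinearMap.zero_apply]
        rw [← h5]
        refine Finset.sum_congr rfl fun i _ => ?_
        rw [smul_eq_mul, smul_eq_mul, mul_comm]
        congr 2
        ext j; simp [Pi.single_apply, eq_comm]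
      refine LinearMap.pi_ext' fun i => LinearMap.ext_ring ?_
      simpa using h4 i
  have hsurj : r ≤ rk (fderiv ℝ gg y0) := (hli_iff y0 hgg).2 hli
  let A := fderiv ℝ gg y0
  let T : Submodule ℝ Y := LinearMap.ker (A : Y →ₗ[ℝ] (Fin r → ℝ))
  obtain ⟨L0, hL0⟩ := T.subtype.exists_leftInverse_of_injective (Submodule.ker_subtype T)
  let L : Y →L[ℝ] T := LinearMap.toContinuousLinearMap L0
  have hL : ∀ x : T, L x = x := fun x => LinearMap.congr_fun hL0 x
  let k : Y → (Fin r → ℝ) × T := fun x => (gg x, L x)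
  have hk : AnalyticAt ℝ k y0 := hgg.prod (L.analyticAt y0)
  have hkd : HasFDerivAt k (A.prod L) y0 :=
    (hgg.differentiableAt.hasFDerivAt).prodMk L.hasFDerivAt
  have hinj : Function.Injective (A.prod L) := by
    rw [injective_iff_map_eq_zero]
    intro x hx
    have hx1 : A x = 0 := congrArg Prod.fst hx
    have hx2 : L x = 0 := congrArg Prod.snd hx
    have := hL ⟨x, hx1⟩
    have h4 : (⟨x, hx1⟩ : T) = 0 := by rw [← this]; exact hx2
    exact congrArg Subtype.val h4
  have hrkr : rk A = r := le_antisymm (by simpa using rk_le A) hsurj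
  have hfr : Module.finrank ℝ Y = Module.finrank ℝ ((Fin r → ℝ) × T) := by
    rw [Module.finrank_prod]
    have := (A : Y →ₗ[ℝ] (Fin r → ℝ)).finrank_range_add_finrank_ker
    have h2 : Module.finrank ℝ (LinearMap.range (A : Y →ₗ[ℝ] (Fin r → ℝ))) = r := hrkr
    rw [h2] at this
    simp only [Module.finrank_fintype_fun_eq_card, Fintype.card_fin]
    exact this.symm
  have hsur : Function.Surjective (A.prod L) :=
    (LinearMap.injective_iff_surjective_of_finrank_eq_finrank
      (f := ((A.prod L : Y →L[ℝ] (Fin r → ℝ) × T) : Y →ₗ[ℝ] (Fin r → ℝ) × T)) hfr).1 hinj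
  obtain ⟨h, hh, hha, hhr, hhl⟩ := analytic_inv hk (by rw [hkd.fderiv]; exact ⟨hinj, hsur⟩)
  have hg0 : gg y0 = 0 := by
    ext i; exact (hg i).2.self_of_nhds hy0
  have hk0 : k y0 = (0, L y0) := by simp [k, hg0]
  rw [hk0] at hh hha hhr
  have hι : AnalyticAt ℝ (fun τ : T => ((0, τ) : (Fin r → ℝ) × T)) (L y0) :=
    analyticAt_const.prod analyticAt_id
  have hθ : AnalyticAt ℝ (fun τ : T => h (0, τ)) (L y0) := AnalyticAt.comp_of_eq hh hι rfl
  have hkθ : ∀ᶠ τ in 𝓝 (L y0), k (h (0, τ)) = (0, τ) := hι.continuousAt.eventually hhr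
  have hC0 : ∀ᶠ y in 𝓝 y0, y ∈ C → gg y = 0 := by
    have : ∀ᶠ y in 𝓝 y0, ∀ i, y ∈ C → g i y = 0 := Filter.eventually_all.2 fun i => (hg i).2
    filter_upwards [this] with y hy hyC
    ext i; exact hy i hyC
  have hCθ : ∀ᶠ y in 𝓝 y0, y ∈ C → h (0, L y) = y := by
    filter_upwards [hC0, hhl] with y h1 h2 h3
    have : k y = (0, L y) := by simp [k, h1 h3]
    rw [← this, h2]
  refine ⟨y0, hy0, T, fun τ => h (0, τ), L, hθ, hha, ?_, hCθ, ?_⟩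
  · filter_upwards [hkθ] with τ hτ using congrArg Prod.snd hτ
  · have hrank : ∀ᶠ y in 𝓝 y0, r ≤ rk (fderiv ℝ gg y) := by
      have hc : ContinuousAt (fderiv ℝ gg) y0 := hgg.fderiv.continuousAt
      filter_upwards [hc.eventually (rk_eventually_ge _)] with y hy
      exact hsurj.trans hy
    have hgv : ∀ᶠ y in 𝓝 y0, ∀ i, AnalyticAt ℝ (g i) y ∧ ∀ᶠ x in 𝓝 y, x ∈ C → g i x = 0 :=
      Filter.eventually_all.2 fun i =>
        ((hg i).1.eventually_analyticAt.and (hg i).2.eventually_nhds)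
    have hLc : ContinuousAt L y0 := L.continuous.continuousAt
    filter_upwards [hrank, hgg.eventually_analyticAt, hgv, hCθ,
      hLc.eventually hθ.eventually_analyticAt, hLc.eventually hkθ.eventually_nhds]
      with y h1 h2 h3 h4 h5 h6 hyC u hu hu0
    have hθy := h4 hyC
    -- the germ `u ∘ L`
    have huL : AnalyticAt ℝ (fun x => u (L x)) y := hu.comp (L.analyticAt y)
    have hnot : ¬ P (r + 1) := fun hP => by have := hmax _ hP; omega
    have hspan : fderiv ℝ (fun x => u (L x)) y ∈
        Submodule.span ℝ (Set.range fun i => fderiv ℝ (g i) y) := by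
      by_contra hns
      apply hnot
      refine ⟨y, hyC, Fin.cons (fun x => u (L x)) g, ?_, ?_⟩
      · intro i
        refine Fin.cases ?_ (fun j => ?_) i
        · exact ⟨huL, hu0⟩
        · simpa using h3 j
      · have h7 : (fun i => fderiv ℝ ((Fin.cons (fun x => u (L x)) g : Fin (r + 1) → Y → ℝ) i) y)
            = Fin.cons (fderiv ℝ (fun x => u (L x)) y) (fun i => fderiv ℝ (g i) y) := by
          ext i
          refine Fin.cases ?_ (fun j => ?_) i <;> simp
        rw [h7, linearIndependent_finCons]
        exact ⟨(hli_iff y h2).1 h1, hns⟩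
    have hdθ : HasFDerivAt (fun τ : T => h (0, τ)) (fderiv ℝ (fun τ : T => h (0, τ)) (L y)) (L y) :=
      h5.differentiableAt.hasFDerivAt
    set Dθ := fderiv ℝ (fun τ : T => h (0, τ)) (L y)
    have hcomp : ∀ ψ ∈ Submodule.span ℝ (Set.range fun i => fderiv ℝ (g i) y), ψ ∘L Dθ = 0 := by
      intro ψ hψ
      induction hψ using Submodule.span_induction with
      | mem ψ hψ =>
        obtain ⟨i, rfl⟩ := hψ
        have h8 : HasFDerivAt (g i) (fderiv ℝ (g i) y) (h (0, L y)) := by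
          rw [hθy]; exact (h3 i).1.differentiableAt.hasFDerivAt
        have h9 := h8.comp (L y) hdθ
        have h10 : HasFDerivAt (fun τ : T => g i (h (0, τ))) (0 : T →L[ℝ] ℝ) (L y) := by
          refine (hasFDerivAt_const (0 : ℝ) (L y)).congr_of_eventuallyEq ?_
          filter_upwards [h6] with τ hτ
          exact congrFun (congrArg Prod.fst hτ) i
        exact h9.unique h10
      | zero => simp
      | add a b _ _ ha hb => rw [ContinuousLinearMap.add_comp, ha, hb, add_zero]
      | smul c a _ ha => rw [ContinuousLinearMap.smul_comp, ha, smul_zero]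
    have h11 := hcomp _ hspan
    have h12 : HasFDerivAt (fun x => u (L x)) (fderiv ℝ (fun x => u (L x)) y) (h (0, L y)) := by
      rw [hθy]; exact huL.differentiableAt.hasFDerivAt
    have h13 := h12.comp (L y) hdθ
    rw [h11] at h13
    have h14 : HasFDerivAt u (0 : T →L[ℝ] ℝ) (L y) := by
      refine h13.congr_of_eventuallyEq ?_
      filter_upwards [h6] with τ hτ
      have : L (h (0, τ)) = τ := congrArg Prod.snd hτ
      simp [this]
    exact h14.fderiv

end sectionB


section sectionC

lemma section_B2 {Y T F : Type} [NormedAddCommGroup Y] [NormedSpace ℝ Y] [FiniteDimensional ℝ Y]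
    [NormedAddCommGroup T] [NormedSpace ℝ T] [FiniteDimensional ℝ T]
    [NormedAddCommGroup F] [NormedSpace ℝ F] [CompleteSpace F]
    {C N : Set Y} (hN : IsOpen N) (L : Y →L[ℝ] T)
    (h : ∀ y ∈ N, y ∈ C → ∀ u : T → ℝ, AnalyticAt ℝ u (L y) →
        (∀ᶠ x in 𝓝 y, x ∈ C → u (L x) = 0) → fderiv ℝ u (L y) = 0)
    {y : Y} (hyN : y ∈ N) (hyC : y ∈ C) {u : T → F} (hu : AnalyticAt ℝ u (L y))
    (hu0 : ∀ᶠ x in 𝓝 y, x ∈ C → u (L x) = 0) : ∀ᶠ τ in 𝓝 (L y), u τ = 0 := by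
  -- vector valued version
  have hv : ∀ (H : Type) [NormedAddCommGroup H] [NormedSpace ℝ H] [CompleteSpace H] (u : T → H),
      AnalyticAt ℝ u (L y) → (∀ᶠ x in 𝓝 y, x ∈ C → u (L x) = 0) →
      ∀ᶠ x in 𝓝 y, x ∈ C → fderiv ℝ u (L x) = 0 := by
    intro H _ _ _ u hu hu0
    have hLc : ContinuousAt L y := L.continuous.continuousAt
    filter_upwards [hLc.eventually hu.eventually_analyticAt, hu0.eventually_nhds,
      hN.mem_nhds hyN] with x h1 h2 h3 hxC
    ext v
    rw [ContinuousLinearMap.zero_apply]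
    rw [NormedSpace.eq_zero_iff_forall_dual_eq_zero ℝ]
    intro ℓ
    have h4 := h x h3 hxC (fun τ => ℓ (u τ)) (ℓ.analyticAt _ |>.comp h1)
      (h2.mono fun z hz hzC => by simp [hz hzC])
    have h5 : HasFDerivAt (fun τ => ℓ (u τ)) (ℓ ∘L fderiv ℝ u (L x)) (L x) :=
      ℓ.hasFDerivAt.comp (L x) h1.differentiableAt.hasFDerivAt
    rw [h5.fderiv] at h4
    exact DFunLike.congr_fun h4 v
  have hit : ∀ n, ∀ᶠ x in 𝓝 y, x ∈ C → iteratedFDeriv ℝ n u (L x) = 0 := by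
    intro n
    induction n with
    | zero =>
      filter_upwards [hu0] with x hx hxC
      ext m; simp [hx hxC]
    | succ n ih =>
      have h1 := hv _ (iteratedFDeriv ℝ n u) (by
        have := cd_omega_iff.2 hu
        exact cd_omega_iff.1 (this.iteratedFDeriv_right (m := ω) (i := n) (by simp))) ih
      filter_upwards [h1] with x hx hxC
      ext mm
      rw [iteratedFDeriv_succ_apply_left, hx hxC]; rfl
  exact analytic_zero_of_iter hu fun n => (hit n).self_of_nhds hyC

theorem section_thm {E G : Type} [NormedAddCommGroup E] [NormedSpace ℝ E] [FiniteDimensional ℝ E]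
    [NormedAddCommGroup G] [NormedSpace ℝ G] [FiniteDimensional ℝ G]
    {U C : Set (E × G)} (hU : IsOpen U) (hC : IsCompact C) (hCU : C ⊆ U)
    (hInt : (interior (Prod.fst '' C)).Nonempty) :
    ∃ (O : Set E) (s : E → G), IsOpen O ∧ O.Nonempty ∧ (∀ e ∈ O, AnalyticAt ℝ s e) ∧
      (∀ e ∈ O, (e, s e) ∈ U) ∧
      ∀ h : E × G → ℝ, AnalyticOnNhd ℝ h U → (∀ y ∈ C, h y = 0) → ∀ e ∈ O, h (e, s e) = 0 := by
  have : CompleteSpace E := FiniteDimensional.complete ℝ E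
  have : CompleteSpace G := FiniteDimensional.complete ℝ G
  obtain ⟨C', hC'C, hne, hirr⟩ := exists_irreducible hC hInt
  obtain ⟨y0, hy0, T, θ, L, hθ, hθ0, hLθ, hθL, hB⟩ := section_B hne
  -- ball in `T`
  have hUe : ∀ᶠ τ in 𝓝 (L y0), θ τ ∈ U := by
    apply hθ.continuousAt.eventually
    rw [hθ0]; exact hU.mem_nhds (hCU (hC'C hy0))
  obtain ⟨ε, hε, hball⟩ := Metric.eventually_nhds_iff_ball.1
    ((hθ.eventually_analyticAt.and hUe).and hLθ)
  set B := Metric.ball (L y0) ε with hBdef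
  have hBpre : IsPreconnected B := (convex_ball _ _).isPreconnected
  have hLc : Continuous L := L.continuous
  obtain ⟨N, hNs, hN, hy0N⟩ := eventually_nhds_iff.1
    ((hB.and hθL).and (hLc.continuousAt.eventually (Metric.ball_mem_nhds (L y0) hε)))
  have hB2 : ∀ {H : Type} [NormedAddCommGroup H] [NormedSpace ℝ H] [CompleteSpace H] (u : T → H)
      (y : E × G), y ∈ N → y ∈ C' → AnalyticOnNhd ℝ u B →
      (∀ᶠ x in 𝓝 y, x ∈ C' → u (L x) = 0) → ∀ τ ∈ B, u τ = 0 := by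
    intro H _ _ _ u y hyN hyC hu hu0
    have h1 := section_B2 hN L (fun y hy => (hNs y hy).1.1) hyN hyC (hu _ (hNs y hyN).2) hu0
    exact hu.eqOn_zero_of_preconnected_of_eventuallyEq_zero hBpre (hNs y hyN).2 h1
  let v : T → E := fun τ => (θ τ).1
  have hvan : AnalyticOnNhd ℝ v B := fun τ hτ => analyticAt_fst.comp_of_eq (hball τ hτ).1.1 rfl
  -- maximal rank on `C'`
  obtain ⟨s, ⟨y1, hy1C, hy1N, hs1⟩, hsmax⟩ := exists_max_nat
    (P := fun k => ∃ y ∈ C', y ∈ N ∧ k ≤ rk (fderiv ℝ v (L y)))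
    ⟨y0, hy0, hy0N, Nat.zero_le _⟩ (Module.finrank ℝ E)
    (by rintro k ⟨y, -, -, h⟩; exact h.trans (rk_le _))
  have hrkle : ∀ τ ∈ B, rk (fderiv ℝ v τ) ≤ s := by
    intro τ hτ
    by_contra hlt
    obtain ⟨P, Q, hdet⟩ := (le_rk_iff _ (s + 1)).1 (Nat.lt_of_not_le hlt)
    apply hdet
    refine hB2 (fun τ => (Q ∘L fderiv ℝ v τ ∘L P).det) y1 hy1N hy1C ?_ ?_ τ hτ
    · intro τ hτ
      have h1 : AnalyticAt ℝ (fderiv ℝ v) τ := (hvan τ hτ).fderiv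
      have h2 : ∀ i j, AnalyticAt ℝ (fun τ => LinearMap.toMatrix' ((Q ∘L fderiv ℝ v τ ∘L P :
          (Fin (s+1) → ℝ) →L[ℝ] (Fin (s+1) → ℝ)) : (Fin (s+1) → ℝ) →ₗ[ℝ] (Fin (s+1) → ℝ)) i j) τ := by
        intro i j
        simp only [LinearMap.toMatrix'_apply]
        have : AnalyticAt ℝ (fun τ => (Q ∘L fderiv ℝ v τ ∘L P) (Pi.single j 1)) τ := by
          have := (Q.analyticAt _).comp (((ContinuousLinearMap.apply ℝ E (P (Pi.single j 1))).analyticAt _).comp h1)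
          exact this
        have h3 := (analyticAt_pi_iff.1 this) i
        exact h3
      have h3 : (fun τ => (Q ∘L fderiv ℝ v τ ∘L P).det) = fun τ => Matrix.det
          (LinearMap.toMatrix' ((Q ∘L fderiv ℝ v τ ∘L P :
          (Fin (s+1) → ℝ) →L[ℝ] (Fin (s+1) → ℝ)) : (Fin (s+1) → ℝ) →ₗ[ℝ] (Fin (s+1) → ℝ))) := by
        funext τ
        rw [LinearMap.det_toMatrix']
      rw [h3]
      simp only [Matrix.det_apply]
      apply Finset.analyticAt_fun_sum
      intro σ _
      have h4 : AnalyticAt ℝ (fun τ => ∏ i, LinearMap.toMatrix' ((Q ∘L fderiv ℝ v τ ∘L P :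
          (Fin (s+1) → ℝ) →L[ℝ] (Fin (s+1) → ℝ)) : (Fin (s+1) → ℝ) →ₗ[ℝ] (Fin (s+1) → ℝ)) (σ i) i) τ := by
        apply Finset.analyticAt_fun_prod
        intro i _
        exact h2 (σ i) i
      simp only [Units.smul_def, zsmul_eq_mul]
      exact analyticAt_const.mul h4
    · filter_upwards [hN.mem_nhds hy1N] with x hxN hxC
      by_contra h0
      have := hsmax (s + 1) ⟨x, hxC, hxN, (le_rk_iff _ _).2 ⟨P, Q, h0⟩⟩
      omega
  have hτ1 : L y1 ∈ B := (hNs y1 hy1N).2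
  have hrk1 : rk (fderiv ℝ v (L y1)) = s := le_antisymm (hrkle _ hτ1) hs1
  have hBn : B ∈ 𝓝 (L y1) := Metric.isOpen_ball.mem_nhds hτ1
  have hv1 : v (L y1) = y1.1 := by simp only [v]; rw [(hNs y1 hy1N).1.2 hy1C]
  by_cases hsE : s < Module.finrank ℝ E
  · exfalso
    -- constant rank contradiction
    let R : Submodule ℝ E := LinearMap.range (fderiv ℝ v (L y1) : T →ₗ[ℝ] E)
    obtain ⟨p0, hp0⟩ := R.subtype.exists_leftInverse_of_injective (Submodule.ker_subtype R)
    let pR : E →L[ℝ] R := LinearMap.toContinuousLinearMap p0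
    have hpR : ∀ x : R, pR x = x := fun x => LinearMap.congr_fun hp0 x
    obtain ⟨φ, hφ, -, hφv⟩ := const_rank (hvan _ hτ1)
      (by filter_upwards [hBn] with τ hτ; rw [hrk1]; exact hrkle τ hτ)
      (R.subtypeL ∘L pR)
      (by intro x; exact congrArg Subtype.val (hpR ⟨_, ⟨x, rfl⟩⟩))
      (by intro y; exact (pR y).2)
    let φR : R → E := fun t => φ t
    have hφR : AnalyticAt ℝ φR (pR (v (L y1))) :=
      AnalyticAt.comp_of_eq hφ (R.subtypeL.analyticAt _) rfl
    obtain ⟨δ, hδ, hδb⟩ := Metric.eventually_nhds_iff_ball.1 hφR.eventually_analyticAt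
    have hc1 : ContinuousAt (fun τ => pR (v τ)) (L y1) :=
      pR.continuous.continuousAt.comp (hvan _ hτ1).continuousAt
    have hW := hLc.continuousAt.eventually
      ((hφv.and (hc1.eventually (Metric.ball_mem_nhds _ hδ))))
    obtain ⟨W, hWs, hWo, hWy⟩ := eventually_nhds_iff.1 (hW.and (hN.mem_nhds hy1N))
    obtain ⟨O, hO, hOne, hOs⟩ := hirr W hWo ⟨y1, hy1C, hWy⟩
    refine no_open_image (E := T) (R := R) (φ := φR) (s := Metric.ball (pR (v (L y1))) δ) hδb
      (convex_ball _ _) ?_ hO hOne ?_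
    · have : Module.finrank ℝ R = s := hrk1
      rw [this]; exact hsE
    · refine hOs.trans ?_
      rintro _ ⟨y, ⟨hyC, hyW⟩, rfl⟩
      obtain ⟨⟨h1, h2⟩, h3⟩ := hWs y hyW
      refine ⟨pR (v (L y)), h2, ?_⟩
      have h4 : v (L y) = y.1 := by simp only [v]; rw [(hNs y h3).1.2 hyC]
      rw [← h4]
      exact h1.symm
  · have hsurj : Function.Surjective (fderiv ℝ v (L y1)) := by
      rw [← ContinuousLinearMap.coe_coe, ← LinearMap.range_eq_top]
      apply Submodule.eq_top_of_finrank_eq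
      apply le_antisymm (Submodule.finrank_le _)
      have : Module.finrank ℝ (LinearMap.range (fderiv ℝ v (L y1) : T →ₗ[ℝ] E)) = s := hrk1
      rw [this]; exact not_lt.1 hsE
    obtain ⟨s0, hs0, hs0y, hs0v⟩ := analytic_rightInv (hvan _ hτ1) hsurj
    rw [hv1] at hs0 hs0y hs0v
    have hs0B : ∀ᶠ e in 𝓝 y1.1, s0 e ∈ B := by
      apply hs0.continuousAt.eventually
      rw [hs0y]; exact hBn
    obtain ⟨O, hOs, hO, hyO⟩ := eventually_nhds_iff.1
      ((hs0.eventually_analyticAt.and hs0v).and hs0B)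
    have hpair : ∀ e ∈ O, (e, (θ (s0 e)).2) = θ (s0 e) := by
      intro e he
      have := (hOs e he).1.2
      exact Prod.ext this.symm rfl
    refine ⟨O, fun e => (θ (s0 e)).2, hO, ⟨_, hyO⟩, ?_, ?_, ?_⟩
    · intro e he
      obtain ⟨⟨h1, h2⟩, h3⟩ := hOs e he
      exact analyticAt_snd.comp_of_eq ((hball _ h3).1.1.comp_of_eq h1 rfl) rfl
    · intro e he
      rw [hpair e he]; exact (hball _ (hOs e he).2).1.2
    · intro h hh hC0 e he
      rw [hpair e he]
      refine hB2 (fun τ => h (θ τ)) y1 hy1N hy1C ?_ ?_ _ (hOs e he).2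
      · intro τ hτ
        exact (hh _ (hball _ hτ).1.2).comp_of_eq (hball _ hτ).1.1 rfl
      · filter_upwards [hN.mem_nhds hy1N] with x hxN hxC
        show h (θ (L x)) = 0
        rw [(hNs x hxN).1.2 hxC]; exact hC0 x (hC'C hxC)

end sectionC


section osgood

variable {E F : Type*} [NormedAddCommGroup E] [NormedSpace ℂ E]
  [NormedAddCommGroup F] [NormedSpace ℂ F]

/-- Cauchy estimate for the Fréchet derivative -/
lemma cauchy_est {f : E → F} {c : E} {R M : ℝ} (hR : 0 < R)
    (hd : DifferentiableOn ℂ f (Metric.ball c R)) (hM : ∀ x ∈ Metric.ball c R, ‖f x‖ ≤ M) :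
    ‖fderiv ℂ f c‖ ≤ 2 * M / R := by
  apply Complex.norm_fderiv_le_div_of_mapsTo_ball hd _ hR
  intro x hx
  rw [mem_closedBall_iff_norm]
  have h1 := hM x hx
  have h2 := hM c (Metric.mem_ball_self hR)
  linarith [norm_sub_le (f x) (f c)]

lemma cauchy_est_ball {f : E → F} {c : E} {R M : ℝ} (hR : 0 < R) {δ : ℝ} (hδ : 0 < δ)
    (hd : DifferentiableOn ℂ f (Metric.ball c (R + δ)))
    (hM : ∀ x ∈ Metric.ball c (R + δ), ‖f x‖ ≤ M) :
    ∀ x ∈ Metric.ball c R, ‖fderiv ℂ f x‖ ≤ 2 * M / δ := by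
  intro x hx
  have hs : Metric.ball x δ ⊆ Metric.ball c (R + δ) := by
    intro y hy
    rw [Metric.mem_ball] at *
    linarith [dist_triangle y x c]
  exact cauchy_est hδ (hd.mono hs) fun y hy => hM y (hs hy)

/-- the derivative is locally Lipschitz -/
lemma fderiv_lip {f : E → F} {c : E} {R M : ℝ} (hR : 0 < R)
    (hd : DifferentiableOn ℂ f (Metric.ball c (3 * R)))
    (hM : ∀ x ∈ Metric.ball c (3 * R), ‖f x‖ ≤ M) :
    ContinuousOn (fderiv ℂ f) (Metric.ball c R) := by
  have hM0 : 0 ≤ M := (norm_nonneg _).trans (hM c (Metric.mem_ball_self (by linarith)))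
  have h2 : ∀ x ∈ Metric.ball c (2 * R), ‖fderiv ℂ f x‖ ≤ 2 * M / R :=
    cauchy_est_ball (by linarith) hR (by convert hd using 2; ring)
      (by convert hM using 4; ring)
  have hdi : ∀ x ∈ Metric.ball c (3 * R), DifferentiableAt ℂ f x := fun x hx =>
    hd.differentiableAt (Metric.isOpen_ball.mem_nhds hx)
  intro x hx
  apply ContinuousAt.continuousWithinAt
  rw [Metric.continuousAt_iff]
  intro ε hε
  rw [Metric.mem_ball] at hx
  set r := (R - dist x c) / 3 with hr
  have hr0 : 0 < r := by rw [hr]; linarith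
  obtain ⟨δ, hδ, hδ1, hδ2⟩ : ∃ δ > 0, δ < r ∧ 2 * ((2 * M / R) * δ) / r < ε := by
    refine ⟨min (r / 2) (ε * r / (2 * (2 * (2 * M / R) + 1))), by positivity,
      (min_le_left _ _).trans_lt (by linarith), ?_⟩
    set K := 2 * (2 * M / R) with hK
    have hK0 : 0 ≤ K := by positivity
    have h3 : 2 * ((2 * M / R) * min (r / 2) (ε * r / (2 * (K + 1)))) ≤
        K * (ε * r / (2 * (K + 1))) := by
      rw [hK, ← mul_assoc]
      apply mul_le_mul_of_nonneg_left (min_le_right _ _) hK0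
    rw [div_lt_iff₀ hr0]
    refine h3.trans_lt ?_
    rw [← mul_div_assoc, div_lt_iff₀ (by positivity)]
    nlinarith [mul_pos hε hr0]
  refine ⟨δ, hδ, fun {y} hy => ?_⟩
  rw [dist_eq_norm] at hy ⊢
  have hball : ∀ z ∈ Metric.ball x r, z ∈ Metric.ball c (2 * R) ∧
      (y - x) + z ∈ Metric.ball c (2 * R) := by
    intro z hz
    rw [Metric.mem_ball] at hz
    have h4 : dist z c < R := by
      have := dist_triangle z x c
      linarith
    refine ⟨by rw [Metric.mem_ball]; linarith, ?_⟩
    rw [Metric.mem_ball]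
    have h5 : dist ((y - x) + z) z < r := by
      rw [dist_eq_norm, add_sub_cancel_right]; linarith
    have := dist_triangle ((y - x) + z) z c
    have hrR : r ≤ R := by rw [hr]; linarith [dist_nonneg (x := x) (y := c)]
    linarith
  have hsub : Metric.ball c (2 * R) ⊆ Metric.ball c (3 * R) :=
    Metric.ball_subset_ball (by linarith)
  have hg : ‖fderiv ℂ (fun z => f ((y - x) + z) - f z) x‖ ≤ 2 * ((2 * M / R) * δ) / r := by
    apply cauchy_est hr0
    · intro z hz
      obtain ⟨h5, h6⟩ := hball z hz
      have h7 : DifferentiableAt ℂ (fun z => f ((y - x) + z)) z :=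
        DifferentiableAt.comp z (g := f) (f := fun z => (y - x) + z) (hdi _ (hsub h6))
          (by fun_prop)
      exact (h7.sub (hdi _ (hsub h5))).differentiableWithinAt
    · intro z hz
      obtain ⟨h5, h6⟩ := hball z hz
      refine ((convex_ball c (2 * R)).norm_image_sub_le_of_norm_fderiv_le (𝕜 := ℂ)
        (fun z hz => hdi z (hsub hz)) h2 h5 h6).trans ?_
      rw [add_sub_cancel_right]
      gcongr
  have hxx : x ∈ Metric.ball x r := Metric.mem_ball_self hr0
  have h8 : fderiv ℂ (fun z => f ((y - x) + z) - f z) x = fderiv ℂ f y - fderiv ℂ f x := by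
    obtain ⟨h5, h6⟩ := hball x hxx
    have h7 : DifferentiableAt ℂ (fun z => f ((y - x) + z)) x :=
      DifferentiableAt.comp x (g := f) (f := fun z => (y - x) + z) (hdi _ (hsub h6))
        (by fun_prop)
    rw [fderiv_fun_sub h7 (hdi _ (hsub h5)), fderiv_comp_add_left, sub_add_cancel]
  rw [← h8]
  exact hg.trans_lt hδ2

lemma exists_ball_bound {f : E → F} {x : E} (h : ∀ᶠ y in 𝓝 x, DifferentiableAt ℂ f y) :
    ∃ R > 0, ∃ M, 0 ≤ M ∧ DifferentiableOn ℂ f (Metric.ball x R) ∧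
      ∀ y ∈ Metric.ball x R, ‖f y‖ ≤ M := by
  have hc : ContinuousAt f x := h.self_of_nhds.continuousAt
  have h2 : ∀ᶠ y in 𝓝 x, ‖f y‖ < ‖f x‖ + 1 := hc.norm.eventually_lt_const (by linarith)
  obtain ⟨R, hR, hb⟩ := Metric.eventually_nhds_iff_ball.1 (h.and h2)
  exact ⟨R, hR, ‖f x‖ + 1, by positivity, fun y hy => (hb y hy).1.differentiableWithinAt,
    fun y hy => (hb y hy).2.le⟩

variable [CompleteSpace F]

lemma fderiv_apply_diff {f : E → F} {x : E} (h : ∀ᶠ y in 𝓝 x, DifferentiableAt ℂ f y) (v : E) :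
    DifferentiableAt ℂ (fun y => fderiv ℂ f y v) x := by
  obtain ⟨R0, hR0, M, hM0, hd, hM⟩ := exists_ball_bound h
  set R := R0 / 9 with hRdef
  have hR : 0 < R := by positivity
  have hdi : ∀ y ∈ Metric.ball x R0, DifferentiableAt ℂ f y := fun y hy =>
    hd.differentiableAt (Metric.isOpen_ball.mem_nhds hy)
  have hcont : ContinuousOn (fderiv ℂ f) (Metric.ball x (3 * R)) :=
    fderiv_lip (by linarith) (hd.mono (Metric.ball_subset_ball (by linarith)))
      fun y hy => hM y (Metric.ball_subset_ball (by linarith) hy)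
  have hbd : ∀ y ∈ Metric.ball x (3 * R), ‖fderiv ℂ f y‖ ≤ 2 * M / R :=
    cauchy_est_ball (by linarith) hR (hd.mono (Metric.ball_subset_ball (by linarith)))
      fun y hy => hM y (Metric.ball_subset_ball (by linarith) hy)
  -- small `v`
  have key : ∀ v : E, ‖v‖ < R → DifferentiableAt ℂ (fun y => fderiv ℂ f y v) x := by
    intro v hv
    have hin : ∀ y ∈ Metric.ball x R, ∀ t : ℂ, ‖t‖ ≤ 1 → y + t • v ∈ Metric.ball x (3 * R) := by
      intro y hy t ht
      rw [mem_ball_iff_norm] at *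
      have : ‖t • v‖ ≤ ‖v‖ := by
        rw [norm_smul]; exact mul_le_of_le_one_left (norm_nonneg _) ht
      have h2 : y + t • v - x = (y - x) + t • v := by abel
      rw [h2]
      linarith [norm_add_le (y - x) (t • v)]
    have hsub3 : Metric.ball x (3 * R) ⊆ Metric.ball x R0 :=
      Metric.ball_subset_ball (by linarith)
    let c : ℝ → ℂ := fun θ => deriv (circleMap 0 1) θ * ((circleMap 0 1 θ - 0) ^ 2)⁻¹
    have hcm : Continuous (circleMap 0 1) := continuous_circleMap 0 1
    have hcn : ∀ θ, ‖circleMap 0 1 θ‖ = 1 := by intro θ; simp [circleMap]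
    have hcc : Continuous c := by
      have : c = fun θ => (circleMap 0 1 θ * I) * ((circleMap 0 1 θ - 0) ^ 2)⁻¹ := by
        funext θ; simp only [c, deriv_circleMap]
      rw [this]
      refine (hcm.mul continuous_const).mul (Continuous.inv₀ ((hcm.sub continuous_const).pow 2) ?_)
      intro θ h0
      have := hcn θ
      rw [sub_zero, sq_eq_zero_iff] at h0
      rw [h0] at this; simp at this
    have hformula : ∀ y ∈ Metric.ball x R, fderiv ℂ f y v =
        (2 * Real.pi * I : ℂ)⁻¹ • ∫ θ in (0:ℝ)..2 * Real.pi, c θ • f (y + circleMap 0 1 θ • v) := by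
      intro y hy
      let g : ℂ → F := fun t => f (y + t • v)
      let O : Set ℂ := {t | y + t • v ∈ Metric.ball x (3 * R)}
      have hO : IsOpen O := Metric.isOpen_ball.preimage (by fun_prop)
      have hgd : ∀ t ∈ O, HasDerivAt g (fderiv ℂ f (y + t • v) v) t := by
        intro t ht
        have h1 := (hdi _ (hsub3 ht)).hasFDerivAt
        have h2 : HasDerivAt (fun t : ℂ => y + t • v) v t := by
          simpa using ((hasDerivAt_id t).smul_const v).const_add y
        exact h1.comp_hasDerivAt t h2
      have h3 := Complex.two_pi_I_inv_smul_circleIntegral_sub_sq_inv_smul_of_differentiable hO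
        (c := 0) (w₀ := 0) (R := 1) (f := g)
        (fun t ht => hin y hy t (by simpa using ht))
        (fun t ht => (hgd t ht).differentiableAt.differentiableWithinAt) (by simp)
      have h4 := (hgd 0 (by
        have := hin y hy 0 (by simp)
        exact this)).deriv
      rw [zero_smul, add_zero] at h4
      rw [← h4, ← h3, circleIntegral]
      congr 1
      apply intervalIntegral.integral_congr
      intro θ _
      simp only [c, g, smul_smul]
    have hder := intervalIntegral.hasFDerivAt_integral_of_dominated_of_fderiv_le (𝕜 := ℂ)
      (μ := MeasureTheory.volume)
      (a := 0) (b := 2 * Real.pi) (s := Metric.ball x R) (x₀ := x)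
      (F := fun y θ => c θ • f (y + circleMap 0 1 θ • v))
      (F' := fun y θ => c θ • fderiv ℂ f (y + circleMap 0 1 θ • v))
      (bound := fun θ => ‖c θ‖ * (2 * M / R)) (Metric.ball_mem_nhds x hR) ?_ ?_ ?_ ?_ ?_ ?_
    · have h5 := (hder.const_smul (2 * Real.pi * I : ℂ)⁻¹).differentiableAt
      refine h5.congr_of_eventuallyEq ?_
      filter_upwards [Metric.ball_mem_nhds x hR] with y hy
      exact hformula y hy
    · filter_upwards [Metric.ball_mem_nhds x hR] with y hy
      apply Continuous.aestronglyMeasurable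
      apply hcc.smul
      rw [continuous_iff_continuousAt]
      intro θ
      refine ContinuousAt.comp (g := f) (f := fun θ => y + circleMap 0 1 θ • v)
        (hdi _ (hsub3 (hin y hy _ (hcn θ).le))).continuousAt ?_
      exact (by fun_prop : Continuous fun θ => y + circleMap 0 1 θ • v).continuousAt
    · apply Continuous.intervalIntegrable
      apply hcc.smul
      rw [continuous_iff_continuousAt]
      intro θ
      refine ContinuousAt.comp (g := f) (f := fun θ => x + circleMap 0 1 θ • v)
        (hdi _ (hsub3 (hin x (Metric.mem_ball_self hR) _ (hcn θ).le))).continuousAt ?_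
      exact (by fun_prop : Continuous fun θ => x + circleMap 0 1 θ • v).continuousAt
    · apply Continuous.aestronglyMeasurable
      apply hcc.smul
      rw [continuous_iff_continuousAt]
      intro θ
      refine ContinuousAt.comp (g := fderiv ℂ f) (f := fun θ => x + circleMap 0 1 θ • v)
        (hcont.continuousAt (Metric.isOpen_ball.mem_nhds
          (hin x (Metric.mem_ball_self hR) _ (hcn θ).le))) ?_
      exact (by fun_prop : Continuous fun θ => x + circleMap 0 1 θ • v).continuousAt
    · refine Filter.Eventually.of_forall fun θ _ y hy => ?_
      rw [norm_smul]
      exact mul_le_mul_of_nonneg_left (hbd _ (hin y hy _ (hcn θ).le)) (norm_nonneg _)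
    · exact (hcc.norm.mul continuous_const).intervalIntegrable _ _
    · refine Filter.Eventually.of_forall fun θ _ y hy => ?_
      have h6 := (hdi _ (hsub3 (hin y hy _ (hcn θ).le))).hasFDerivAt
      have h7 : HasFDerivAt (fun y => f (y + circleMap 0 1 θ • v))
          (fderiv ℂ f (y + circleMap 0 1 θ • v)) y := by
        have := h6.comp y ((hasFDerivAt_id y).add_const (circleMap 0 1 θ • v))
        simpa [Function.comp_def] using this
      exact h7.const_smul (c θ)
  -- scaling
  obtain ⟨s, hs0, hs⟩ : ∃ s : ℂ, s ≠ 0 ∧ ‖s • v‖ < R := by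
    refine ⟨((R / (‖v‖ + 1) / 2 : ℝ) : ℂ), ?_, ?_⟩
    · norm_cast; positivity
    · rw [norm_smul, Complex.norm_real, Real.norm_of_nonneg (by positivity)]
      have : ‖v‖ / (‖v‖ + 1) ≤ 1 := by
        rw [div_le_one (by positivity)]; linarith
      have h2 : R / (‖v‖ + 1) / 2 * ‖v‖ = R / 2 * (‖v‖ / (‖v‖ + 1)) := by ring
      rw [h2]; nlinarith
  have h1 := (key _ hs).const_smul s⁻¹
  have h2 : (s⁻¹ • fun y => fderiv ℂ f y (s • v)) = fun y => fderiv ℂ f y v := by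
    funext y
    simp [smul_smul, hs0]
  rw [← h2]; exact h1

variable [FiniteDimensional ℂ E]

lemma fderiv_diff {f : E → F} {x : E} (h : ∀ᶠ y in 𝓝 x, DifferentiableAt ℂ f y) :
    DifferentiableAt ℂ (fderiv ℂ f) x := by
  let b := Module.finBasis ℂ E
  let C : Fin (Module.finrank ℂ E) → E →L[ℂ] ℂ := fun i => LinearMap.toContinuousLinearMap (b.coord i)
  have h1 : fderiv ℂ f = fun y => ∑ i, ContinuousLinearMap.smulRightL ℂ E F (C i) (fderiv ℂ f y (b i)) := by
    funext y
    ext v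
    conv_lhs => rw [← b.sum_repr v, map_sum]
    simp [C]
  rw [h1]
  apply DifferentiableAt.fun_sum
  intro i _
  exact (ContinuousLinearMap.differentiableAt _).comp x (fderiv_apply_diff h (b i))

lemma iter_diff {f : E → F} {x : E} (h : ∀ᶠ y in 𝓝 x, DifferentiableAt ℂ f y) (n : ℕ) :
    ∀ᶠ y in 𝓝 x, DifferentiableAt ℂ (iteratedFDeriv ℂ n f) y := by
  induction n with
  | zero =>
    filter_upwards [h] with y hy
    rw [iteratedFDeriv_zero_eq_comp]
    exact (LinearIsometryEquiv.differentiableAt _).comp y hy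
  | succ n ih =>
    filter_upwards [ih.eventually_nhds] with y hy
    rw [iteratedFDeriv_succ_eq_comp_left]
    exact (LinearIsometryEquiv.differentiableAt _).comp y (fderiv_diff hy)

lemma iter_bound {f : E → F} {x : E} {R M : ℝ} (hd : DifferentiableOn ℂ f (Metric.ball x R))
    (hM : ∀ y ∈ Metric.ball x R, ‖f y‖ ≤ M) {δ : ℝ} (hδ : 0 < δ) (k : ℕ) (hk : k * δ < R) :
    ∀ y ∈ Metric.ball x (R - k * δ), ‖iteratedFDeriv ℂ k f y‖ ≤ (2 / δ) ^ k * M := by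
  induction k with
  | zero => intro y hy; simpa using hM y (by simpa using hy)
  | succ k ih =>
    push_cast at hk ⊢
    have ih := ih (by nlinarith)
    intro y hy
    rw [← norm_fderiv_iteratedFDeriv]
    have h1 : R - (k + 1) * δ + δ = R - k * δ := by ring
    have := cauchy_est_ball (f := iteratedFDeriv ℂ k f) (c := x) (R := R - (k + 1) * δ)
      (M := (2 / δ) ^ k * M) (by linarith) hδ ?_ (by rw [h1]; exact ih) y hy
    · refine this.trans (le_of_eq ?_); ring
    · intro z hz
      rw [h1] at hz
      have hz' : z ∈ Metric.ball x R := Metric.ball_subset_ball (by nlinarith [mul_nonneg (Nat.cast_nonneg (α := ℝ) k) hδ.le]) hz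
      refine DifferentiableAt.differentiableWithinAt ?_
      refine (iter_diff (f := f) (x := z) ?_ k).self_of_nhds
      filter_upwards [Metric.isOpen_ball.mem_nhds hz'] with w hw
      exact hd.differentiableAt (Metric.isOpen_ball.mem_nhds hw)

/-- Osgood: complex differentiability near a point implies analyticity. -/
theorem osgood {f : E → F} {x : E} (h : ∀ᶠ y in 𝓝 x, DifferentiableAt ℂ f y) :
    AnalyticAt ℂ f x := by
  obtain ⟨R, hR, M, hM0, hd, hM⟩ := exists_ball_bound h
  let p : FormalMultilinearSeries ℂ E F := fun n => ((n.factorial : ℂ)⁻¹) • iteratedFDeriv ℂ n f x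
  have hb : ∀ n, ‖p n‖ * (R / (2 * Real.exp 1)) ^ n ≤ M * Real.exp 1 := by
    intro n
    have h1 := iter_bound hd hM (δ := R / (n + 1)) (by positivity) n (by
      rw [← mul_div_assoc, div_lt_iff₀ (by positivity)]; nlinarith) x
      (Metric.mem_ball_self (by
        have : n * (R / (n + 1)) < R := by
          rw [← mul_div_assoc, div_lt_iff₀ (by positivity)]; nlinarith
        linarith))
    have h2 : ‖p n‖ = (n.factorial : ℝ)⁻¹ * ‖iteratedFDeriv ℂ n f x‖ := by
      simp only [p, norm_smul, norm_inv, Complex.norm_natCast]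
    have h3 := Real.pow_div_factorial_le_exp (n + 1 : ℝ) (by positivity) n
    rw [h2]
    have h4 : Real.exp (n + 1) = Real.exp 1 ^ n * Real.exp 1 := by
      rw [Real.exp_add, ← Real.exp_nat_mul, mul_one]
    rw [h4] at h3
    calc (n.factorial : ℝ)⁻¹ * ‖iteratedFDeriv ℂ n f x‖ * (R / (2 * Real.exp 1)) ^ n
        ≤ (n.factorial : ℝ)⁻¹ * ((2 / (R / (n + 1))) ^ n * M) * (R / (2 * Real.exp 1)) ^ n := by
          gcongr
      _ = (((n + 1 : ℝ) ^ n / n.factorial) * M) * ((2 / R) ^ n * (R / (2 * Real.exp 1)) ^ n) := by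
          have : (2 / (R / (n + 1 : ℝ))) ^ n = (n + 1 : ℝ) ^ n * (2 / R) ^ n := by
            rw [← mul_pow]; congr 1; field_simp
          rw [this]; ring
      _ = (((n + 1 : ℝ) ^ n / n.factorial) * M) * ((Real.exp 1) ^ n)⁻¹ := by
          rw [← mul_pow, ← inv_pow]; congr 2; field_simp
      _ ≤ ((Real.exp 1 ^ n * Real.exp 1) * M) * ((Real.exp 1) ^ n)⁻¹ := by gcongr
      _ = M * Real.exp 1 := by field_simp
  have hr0 : 0 < R / (2 * Real.exp 1) := by positivity
  have hrad : (ENNReal.ofReal (R / (2 * Real.exp 1))) ≤ p.radius := by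
    have := p.le_radius_of_bound (M * Real.exp 1) (r := ⟨R / (2 * Real.exp 1), hr0.le⟩) hb
    convert this using 1
    rw [ENNReal.ofReal, Real.toNNReal_of_nonneg hr0.le]
    rfl
  have he : (1:ℝ) ≤ Real.exp 1 := by simpa using Real.add_one_le_exp 1 |>.trans' (by norm_num)
  have hdi : ∀ y ∈ Metric.ball x R, DifferentiableAt ℂ f y := fun y hy =>
    hd.differentiableAt (Metric.isOpen_ball.mem_nhds hy)
  have hps : HasFPowerSeriesOnBall f p x (ENNReal.ofReal (R / (2 * Real.exp 1))) := by
    refine ⟨hrad, by simpa using hr0, ?_⟩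
    intro y hy
    have hy1 : ‖y‖ < R / 2 := by
      rw [Metric.mem_eball, edist_lt_ofReal, dist_zero_right] at hy
      refine hy.trans_le ?_
      rw [div_le_div_iff₀ (by positivity) (by norm_num)]
      nlinarith
    let g : ℂ → F := fun s => f (x + s • y)
    have hin : ∀ s ∈ Metric.ball (0:ℂ) 2, x + s • y ∈ Metric.ball x R := by
      intro s hs
      rw [mem_ball_iff_norm, add_sub_cancel_left, norm_smul]
      rw [mem_ball_zero_iff] at hs
      nlinarith [norm_nonneg y, norm_nonneg s]
    have hder : ∀ n, ∀ s ∈ Metric.ball (0:ℂ) 2, iteratedDeriv n g s =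
        iteratedFDeriv ℂ n f (x + s • y) (fun _ => y) := by
      intro n
      induction n with
      | zero => intro s hs; simp [g]
      | succ n ih =>
        intro s hs
        rw [iteratedDeriv_succ]
        have h1 : iteratedDeriv n g =ᶠ[𝓝 s] fun s => iteratedFDeriv ℂ n f (x + s • y) (fun _ => y) := by
          filter_upwards [Metric.isOpen_ball.mem_nhds hs] with t ht
          exact ih t ht
        rw [h1.deriv_eq]
        have h2 : DifferentiableAt ℂ (iteratedFDeriv ℂ n f) (x + s • y) := by
          refine (iter_diff (f := f) ?_ n).self_of_nhds
          filter_upwards [Metric.isOpen_ball.mem_nhds (hin s hs)] with w hw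
          exact hdi w hw
        have h3 : HasDerivAt (fun t : ℂ => x + t • y) y s := by
          simpa using ((hasDerivAt_id s).smul_const y).const_add x
        have h4 := h2.hasFDerivAt.comp_hasDerivAt s h3
        have h5 := ((ContinuousMultilinearMap.apply ℂ (fun _ : Fin n => E) F
          (fun _ => y)).hasFDerivAt.comp_hasDerivAt s h4)
        rw [iteratedFDeriv_succ_apply_left]
        exact h5.deriv
    have hgd : DifferentiableOn ℂ g (Metric.ball 0 2) := by
      intro s hs
      refine DifferentiableAt.differentiableWithinAt ?_
      exact DifferentiableAt.comp s (g := f) (f := fun s : ℂ => x + s • y) (hdi _ (hin s hs))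
        (by fun_prop)
    have h6 := Complex.hasSum_taylorSeries_on_ball (f := g) (c := 0) (r := 2) hgd (z := 1) (by simp)
    simp only [sub_zero, one_pow, one_smul, g] at h6
    convert h6 using 2 with n
    have := hder n 0 (by simp)
    rw [zero_smul, add_zero] at this
    simp only [g] at this
    simp [p, this]
  exact ⟨p, _, hps⟩

lemma diffAt_iff_analytic {f : E → F} {x : E} (h : AnalyticAt ℂ f x) :
    ∀ᶠ y in 𝓝 x, DifferentiableAt ℂ f y :=
  h.eventually_analyticAt.mono fun _ hy => hy.differentiableAt

/-- conjugating a holomorphic function by antilinear maps gives a holomorphic function -/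
lemma conj_hasFDerivAt {f : E → F} {x : E} {E' F' : Type*} [NormedAddCommGroup E'] [NormedSpace ℂ E']
    [NormedAddCommGroup F'] [NormedSpace ℂ F']
    (c1 : E' →SL[starRingEnd ℂ] E) (c2 : F →SL[starRingEnd ℂ] F') {x : E'}
    {f' : E →L[ℂ] F} (h : HasFDerivAt f f' (c1 x)) :
    HasFDerivAt (fun y => c2 (f (c1 y))) (c2.comp (f'.comp c1)) x := by
  rw [hasFDerivAt_iff_isLittleO] at h ⊢
  have h1 := h.comp_tendsto (c1.continuous.tendsto x)
  have h2 : (fun y => c2 (f (c1 y)) - c2 (f (c1 x)) - (c2.comp (f'.comp c1)) (y - x)) =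
      fun y => c2 ((fun x' => f x' - f (c1 x) - f' (x' - c1 x)) (c1 y)) := by
    funext y; simp
  rw [h2]
  refine (ContinuousLinearMap.isBigO_comp c2 _ _).trans_isLittleO (h1.trans_isBigO ?_)
  have h3 : ((fun x' => x' - c1 x) ∘ ⇑c1) = fun y => c1 (y - x) := by
    funext y; simp
  rw [h3]
  exact ContinuousLinearMap.isBigO_comp c1 _ _

lemma conj_analytic {E' F' : Type*} [NormedAddCommGroup E'] [NormedSpace ℂ E']
    [NormedAddCommGroup F'] [NormedSpace ℂ F'] [CompleteSpace F'] [FiniteDimensional ℂ E']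
    (c1 : E' →SL[starRingEnd ℂ] E) (c2 : F →SL[starRingEnd ℂ] F') {f : E → F} {x : E'}
    (h : AnalyticAt ℂ f (c1 x)) : AnalyticAt ℂ (fun y => c2 (f (c1 y))) x := by
  apply osgood
  have h1 := (c1.continuous.tendsto x).eventually (diffAt_iff_analytic h)
  filter_upwards [h1] with y hy
  exact (conj_hasFDerivAt (x := c1 y) c1 c2 hy.hasFDerivAt).differentiableAt

end osgood

section orders

variable {E F : Type*} [NormedAddCommGroup E] [NormedSpace ℂ E]
  [NormedAddCommGroup F] [NormedSpace ℂ F]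

/-- `f (x+v) = O(‖v‖^k)` -/
def OrdGE (k : ℕ) (f : E → F) (x : E) : Prop :=
  (fun v => f (x + v)) =O[𝓝 0] fun v => ‖v‖ ^ k

lemma OrdGE.fderiv {k : ℕ} {f : E → F} {x : E} (hf : ∀ᶠ y in 𝓝 x, DifferentiableAt ℂ f y)
    (h : OrdGE (k + 1) f x) : OrdGE k (fderiv ℂ f) x := by
  obtain ⟨C, hC⟩ := h.bound
  have hf' : ∀ᶠ v in 𝓝 (0 : E), DifferentiableAt ℂ f (x + v) := by
    have : Filter.Tendsto (fun v : E => x + v) (𝓝 0) (𝓝 x) := by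
      simpa using (by fun_prop : Continuous fun v : E => x + v).tendsto 0
    exact this.eventually hf
  obtain ⟨R, hR, hb⟩ := Metric.eventually_nhds_iff_ball.1 (hC.and hf')
  rcases Nat.eq_zero_or_pos k with hk | hk
  · subst hk
    refine Asymptotics.IsBigO.of_bound (2 * (|C| * R) / (R / 2)) ?_
    filter_upwards [Metric.ball_mem_nhds (0:E) (half_pos hR)] with v hv
    rw [mem_ball_zero_iff] at hv
    simp only [pow_zero, norm_one, mul_one]
    refine cauchy_est (half_pos hR) ?_ ?_
    · intro y hy
      have := (hb (y - x) ?_).2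
      · rw [add_sub_cancel] at this
        exact this.differentiableWithinAt
      · rw [mem_ball_iff_norm] at *
        have h2 : y - x - 0 = (y - (x + v)) + v := by abel
        rw [h2]; linarith [norm_add_le (y - (x + v)) v]
    · intro y hy
      have hyR : ‖y - x‖ < R := by
        rw [mem_ball_iff_norm] at *
        have h2 : y - x = (y - (x + v)) + v := by abel
        rw [h2]; linarith [norm_add_le (y - (x + v)) v]
      have := (hb (y - x) (by simpa using hyR)).1
      rw [add_sub_cancel, zero_add, pow_one, norm_norm] at this
      refine this.trans ?_
      exact mul_le_mul (le_abs_self C) hyR.le (norm_nonneg _) (abs_nonneg _)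
  · refine Asymptotics.IsBigO.of_bound (2 * (|C| * 2 ^ (k + 1))) ?_
    filter_upwards [Metric.ball_mem_nhds (0:E) (half_pos hR)] with v hv
    rw [mem_ball_zero_iff] at hv
    by_cases hv0 : v = 0
    · subst hv0
      have h3 : HasFDerivAt f (0 : E →L[ℂ] F) x := by
        rw [hasFDerivAt_iff_isLittleO_nhds_zero]
        have h4 : f x = 0 := by
          have := (hb 0 (Metric.mem_ball_self hR)).1
          simpa using this
        simp only [h4, sub_zero, ContinuousLinearMap.zero_apply]
        refine h.trans_isLittleO ?_
        simpa using Asymptotics.isLittleO_norm_pow_id (E' := E) (n := k + 1) (by omega)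
      rw [add_zero, h3.fderiv, norm_zero]
      positivity
    · have hvp : 0 < ‖v‖ := norm_pos_iff.2 hv0
      have key := cauchy_est (f := f) (c := x + v) (R := ‖v‖) (M := |C| * (2 * ‖v‖) ^ (k + 1)) hvp ?_ ?_
      · refine key.trans (le_of_eq ?_)
        rw [norm_pow, norm_norm]
        field_simp
        ring
      · intro y hy
        have := (hb (y - x) ?_).2
        · rw [add_sub_cancel] at this
          exact this.differentiableWithinAt
        · rw [mem_ball_iff_norm] at *
          have h2 : y - x - 0 = (y - (x + v)) + v := by abel
          rw [h2]; linarith [norm_add_le (y - (x + v)) v]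
      · intro y hy
        have hyR : ‖y - x‖ < 2 * ‖v‖ := by
          rw [mem_ball_iff_norm] at *
          have h2 : y - x = (y - (x + v)) + v := by abel
          rw [h2]; linarith [norm_add_le (y - (x + v)) v]
        have := (hb (y - x) (by rw [mem_ball_zero_iff]; linarith)).1
        rw [add_sub_cancel, norm_pow, norm_norm] at this
        refine this.trans ?_
        refine mul_le_mul (le_abs_self C) ?_ (by positivity) (abs_nonneg _)
        gcongr

lemma OrdGE.of_fderiv {k : ℕ} {f : E → F} {x : E} (hf : ∀ᶠ y in 𝓝 x, DifferentiableAt ℂ f y)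
    (h0 : f x = 0) (h : OrdGE k (_root_.fderiv ℂ f) x) : OrdGE (k + 1) f x := by
  obtain ⟨C, hC⟩ := h.bound
  have hf' : ∀ᶠ v in 𝓝 (0 : E), DifferentiableAt ℂ f (x + v) := by
    have : Filter.Tendsto (fun v : E => x + v) (𝓝 0) (𝓝 x) := by
      simpa using (by fun_prop : Continuous fun v : E => x + v).tendsto 0
    exact this.eventually hf
  obtain ⟨R, hR, hb⟩ := Metric.eventually_nhds_iff_ball.1 (hC.and hf')
  refine Asymptotics.IsBigO.of_bound |C| ?_
  filter_upwards [Metric.ball_mem_nhds (0:E) hR] with v hv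
  rw [mem_ball_zero_iff] at hv
  have hin : ∀ y ∈ Metric.closedBall x ‖v‖, DifferentiableAt ℂ f y ∧
      ‖_root_.fderiv ℂ f y‖ ≤ |C| * ‖v‖ ^ k := by
    intro y hy
    rw [mem_closedBall_iff_norm] at hy
    have := hb (y - x) (by rw [mem_ball_zero_iff]; linarith)
    rw [add_sub_cancel, norm_pow, norm_norm] at this
    refine ⟨this.2, this.1.trans ?_⟩
    refine mul_le_mul (le_abs_self C) ?_ (by positivity) (abs_nonneg _)
    gcongr
  have := (convex_closedBall x ‖v‖).norm_image_sub_le_of_norm_fderiv_le (𝕜 := ℂ) (f := f)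
    (fun y hy => (hin y hy).1) (fun y hy => (hin y hy).2) (x := x) (y := x + v) (by simp) (by simp)
  rw [h0, sub_zero, add_sub_cancel_left] at this
  rw [norm_pow, norm_norm, pow_succ, ← mul_assoc]
  exact this

lemma OrdGE.mono {k l : ℕ} {f : E → F} {x : E} (h : OrdGE k f x) (hl : l ≤ k) : OrdGE l f x := by
  refine Asymptotics.IsBigO.trans h ?_
  refine Asymptotics.IsBigO.of_bound 1 ?_
  filter_upwards [Metric.ball_mem_nhds (0:E) one_pos] with v hv
  rw [mem_ball_zero_iff] at hv
  rw [norm_pow, norm_norm, norm_pow, norm_norm, one_mul]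
  exact pow_le_pow_of_le_one (norm_nonneg _) hv.le hl

lemma OrdGE.eq_zero {k : ℕ} {f : E → F} {x : E} (h : OrdGE (k + 1) f x) : f x = 0 := by
  obtain ⟨C, hC⟩ := h.bound
  simpa using hC.self_of_nhds

end orders

section jets

variable {E F Q : Type*} [NormedAddCommGroup E] [NormedSpace ℂ E]
  [NormedAddCommGroup F] [NormedSpace ℂ F] [NormedAddCommGroup Q] [NormedSpace ℂ Q]

/-- space of `k`-jets -/
abbrev JetSp (k : ℕ) (E F : Type*) [NormedAddCommGroup E] [NormedSpace ℂ E]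
    [NormedAddCommGroup F] [NormedSpace ℂ F] : Type _ :=
  (i : Fin (k + 1)) → (E [×(i : ℕ)]→L[ℂ] F)

/-- the `k`-jet of `f` at `x` -/
def jet (k : ℕ) (f : E → F) (x : E) : JetSp k E F := fun i => iteratedFDeriv ℂ i f x

/-- the polynomial with a given jet -/
def jetP {k : ℕ} (J : JetSp k E F) (v : E) : F :=
  ∑ i : Fin (k + 1), ((Nat.factorial (i : ℕ) : ℂ)⁻¹) • J i (fun _ => v)

/-- truncation of jets -/
def jetLow {k l : ℕ} (h : k ≤ l) : JetSp l E F →L[ℂ] JetSp k E F :=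
  ContinuousLinearMap.pi fun i : Fin (k + 1) =>
    ContinuousLinearMap.proj (R := ℂ) (φ := fun j : Fin (l + 1) => (E [×(j : ℕ)]→L[ℂ] F))
      ⟨i, by omega⟩

lemma jetLow_jet {k l : ℕ} (h : k ≤ l) (f : E → F) (x : E) : jetLow h (jet l f x) = jet k f x := rfl

lemma jet_congr {k : ℕ} {f g : E → F} {x : E} (h : f =ᶠ[𝓝 x] g) : jet k f x = jet k g x := by
  funext i
  exact (h.iteratedFDeriv ℂ i).self_of_nhds

/-- translation -/
lemma jet_translate (k : ℕ) (f : E → F) (x : E) : jet k (fun v => f (x + v)) 0 = jet k f x := by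
  funext i
  simp only [jet]
  rw [iteratedFDeriv_comp_add_left, add_zero]

lemma jet_sub {k : ℕ} {f g : E → F} {x : E} [CompleteSpace F] (hf : AnalyticAt ℂ f x) (hg : AnalyticAt ℂ g x) :
    jet k (fun y => f y - g y) x = jet k f x - jet k g x := by
  funext i
  exact iteratedFDeriv_sub_apply (f := f) (g := g) hf.contDiffAt hg.contDiffAt

lemma OrdGE.congr {k : ℕ} {f g : E → F} {x : E} (h : OrdGE k f x) (hfg : f =ᶠ[𝓝 x] g) :
    OrdGE k g x := by
  refine Asymptotics.IsBigO.congr' h ?_ (Filter.EventuallyEq.refl _ _)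
  have : Filter.Tendsto (fun v : E => x + v) (𝓝 0) (𝓝 x) := by
    simpa using (by fun_prop : Continuous fun v : E => x + v).tendsto 0
  exact this.eventually hfg

lemma OrdGE.clm {G : Type*} [NormedAddCommGroup G] [NormedSpace ℂ G] {k : ℕ} {f : E → F} {x : E}
    (h : OrdGE k f x) (L : F →L[ℂ] G) : OrdGE k (fun y => L (f y)) x :=
  (L.isBigO_comp _ _).trans h

lemma OrdGE.add {k : ℕ} {f g : E → F} {x : E} (h : OrdGE k f x) (hg : OrdGE k g x) :
    OrdGE k (fun y => f y + g y) x := Asymptotics.IsBigO.add h hg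

lemma OrdGE.sub {k : ℕ} {f g : E → F} {x : E} (h : OrdGE k f x) (hg : OrdGE k g x) :
    OrdGE k (fun y => f y - g y) x := Asymptotics.IsBigO.sub h hg

/-- pullback of the order under a map -/
lemma OrdGE.comp {k : ℕ} {f : E → F} {x : E} (h : OrdGE k f x) {γ : Q → E} {q : Q} (hq : γ q = x)
    (hγ : DifferentiableAt ℂ γ q) : OrdGE k (fun y => f (γ y)) q := by
  subst hq
  have h1 : (fun v => γ (q + v) - γ q) =O[𝓝 0] fun v => v := by
    have := hγ.hasFDerivAt.isBigO_sub
    have ht : Filter.Tendsto (fun v : Q => q + v) (𝓝 0) (𝓝 q) := by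
      simpa using (by fun_prop : Continuous fun v : Q => q + v).tendsto 0
    have h2 := this.comp_tendsto ht
    refine h2.congr (fun v => rfl) (fun v => by simp)
  have ht : Filter.Tendsto (fun v => γ (q + v) - γ q) (𝓝 0) (𝓝 0) := by
    exact h1.trans_tendsto Filter.tendsto_id
  have h3 := Asymptotics.IsBigO.comp_tendsto h ht
  unfold OrdGE
  refine (h3.congr_left fun v => ?_).trans ?_
  · simp
  · exact (h1.norm_norm.pow k)

variable [CompleteSpace F]

lemma AnalyticAt.iterF {f : E → F} {x : E} (hf : AnalyticAt ℂ f x) (i : ℕ) :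
    AnalyticAt ℂ (iteratedFDeriv ℂ i f) x := by
  induction i with
  | zero =>
    rw [iteratedFDeriv_zero_eq_comp]
    exact ((continuousMultilinearCurryFin0 ℂ E F).symm.toContinuousLinearEquiv.toContinuousLinearMap.analyticAt _).comp hf
  | succ n ih =>
    rw [iteratedFDeriv_succ_eq_comp_left]
    exact ((continuousMultilinearCurryLeftEquiv ℂ (fun _ : Fin (n + 1) => E) F).symm.toContinuousLinearEquiv.toContinuousLinearMap.analyticAt _).comp ih.fderiv

lemma OrdGE.iter {f : E → F} {x : E} (hf : AnalyticAt ℂ f x) (i : ℕ) {k : ℕ}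
    (h : OrdGE (k + i) f x) : OrdGE k (iteratedFDeriv ℂ i f) x := by
  induction i generalizing k with
  | zero =>
    rw [iteratedFDeriv_zero_eq_comp]
    exact h.clm (continuousMultilinearCurryFin0 ℂ E F).symm.toContinuousLinearEquiv.toContinuousLinearMap
  | succ n ih =>
    rw [iteratedFDeriv_succ_eq_comp_left]
    have h1 : OrdGE (k + 1) (iteratedFDeriv ℂ n f) x := ih (by convert h using 1; omega)
    exact (h1.fderiv ((hf.iterF n).eventually_analyticAt.mono fun _ h => h.differentiableAt)).clm (continuousMultilinearCurryLeftEquiv ℂ (fun _ : Fin (n + 1) => E) F).symm.toContinuousLinearEquiv.toContinuousLinearMap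

lemma jet_eq_zero_iff {k : ℕ} {f : E → F} {x : E} (hf : AnalyticAt ℂ f x) :
    jet k f x = 0 ↔ OrdGE (k + 1) f x := by
  constructor
  · intro h
    have key : ∀ j ≤ k + 1, OrdGE j (iteratedFDeriv ℂ (k + 1 - j) f) x := by
      intro j
      induction j with
      | zero =>
        intro _
        refine ((hf.iterF _).continuousAt.comp_of_eq (g := iteratedFDeriv ℂ (k + 1 - 0) f) (f := fun v => x + v) (x := (0:E)) (by fun_prop) (by simp)).norm.isBoundedUnder_le.isBigO_one ℝ |>.congr_right ?_
        intro v; simp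
      | succ j ih =>
        intro hj
        have h1 := ih (by omega)
        have h2 : k + 1 - j = (k + 1 - (j + 1)) + 1 := by omega
        refine OrdGE.of_fderiv ((hf.iterF _).eventually_analyticAt.mono fun _ h => h.differentiableAt) ?_ ?_
        · have := congrFun h ⟨k + 1 - (j + 1), by omega⟩
          exact this
        · rw [h2, iteratedFDeriv_succ_eq_comp_left] at h1
          have h3 := Asymptotics.IsBigO.norm_left h1
          refine Asymptotics.IsBigO.of_norm_left (h3.congr_left fun v => ?_)
          exact LinearIsometryEquiv.norm_map _ _
    have h1 := key (k + 1) le_rfl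
    rw [Nat.sub_self, iteratedFDeriv_zero_eq_comp] at h1
    have := h1.clm (continuousMultilinearCurryFin0 ℂ E F).toContinuousLinearEquiv.toContinuousLinearMap
    simpa using this
  · intro h
    funext i
    have hi : i.1 ≤ k := by omega
    have h1 : OrdGE ((k - i) + 1) (iteratedFDeriv ℂ i f) x :=
      OrdGE.iter hf i (by convert h using 1; omega)
    exact h1.eq_zero

lemma jet_eq_iff {k : ℕ} {f g : E → F} {x : E} (hf : AnalyticAt ℂ f x) (hg : AnalyticAt ℂ g x) :
    jet k f x = jet k g x ↔ OrdGE (k + 1) (fun y => f y - g y) x := by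
  rw [← jet_eq_zero_iff (hf.fun_sub hg), jet_sub hf hg, sub_eq_zero]

lemma jetP_analytic {k : ℕ} (a : JetSp k E F × E) :
    AnalyticAt ℂ (fun c : JetSp k E F × E => jetP c.1 c.2) a := by
  unfold jetP
  apply Finset.analyticAt_fun_sum
  intro i _
  have h1 : AnalyticAt ℂ (fun p : (E [×(i : ℕ)]→L[ℂ] F) × (Fin i → E) => p.1 p.2)
      (a.1 i, fun _ => a.2) :=
    (ContinuousLinearMap.id ℂ (E [×(i : ℕ)]→L[ℂ] F)).analyticAt_uncurry_of_multilinear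
  have h2 : AnalyticAt ℂ (fun c : JetSp k E F × E => ((c.1 i, fun _ => c.2) : (E [×(i : ℕ)]→L[ℂ] F) × (Fin i → E))) a := by
    refine AnalyticAt.prod ?_ ?_
    · exact (((ContinuousLinearMap.proj (R := ℂ) (φ := fun j : Fin (k + 1) => (E [×(j : ℕ)]→L[ℂ] F)) i).comp (ContinuousLinearMap.fst ℂ _ _)).analyticAt a)
    · exact analyticAt_pi_iff.2 fun _ => analyticAt_snd
  exact (AnalyticAt.comp_of_eq (g := fun p : (E [×(i : ℕ)]→L[ℂ] F) × (Fin i → E) => p.1 p.2) h1 h2 rfl).const_smul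

lemma jetP_zero {k : ℕ} (f : E → F) (x : E) : jetP (jet k f x) 0 = f x := by
  unfold jetP
  rw [Finset.sum_eq_single 0]
  · simp [jet]
    exact iteratedFDeriv_zero_apply _
  · intro b _ hb
    have hb' : (b : ℕ) ≠ 0 := fun h => hb (Fin.ext h)
    have : Nonempty (Fin b) := ⟨⟨0, by omega⟩⟩
    have h2 : (jet k f x b) (fun _ => 0) = 0 :=
      ContinuousMultilinearMap.map_zero _
    rw [h2, smul_zero]
  · simp

/-- Taylor -/
lemma jetP_approx (k : ℕ) {f : E → F} {x : E} (hf : AnalyticAt ℂ f x) :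
    OrdGE (k + 1) (fun y => f y - jetP (jet k f x) (y - x)) x := by
  obtain ⟨p, r, hp⟩ := hf
  have h1 := hp.hasFPowerSeriesAt.isBigO_sub_partialSum_pow (k + 1)
  refine h1.congr_left fun v => ?_
  simp only [add_sub_cancel_left]
  congr 1
  unfold FormalMultilinearSeries.partialSum jetP
  rw [Finset.sum_range]
  refine Finset.sum_congr rfl fun i _ => ?_
  simp only [jet]
  rw [← hp.factorial_smul v i, ← Nat.cast_smul_eq_nsmul ℂ, smul_smul, inv_mul_cancel₀, one_smul]
  exact_mod_cast Nat.factorial_ne_zero _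

/-- restriction of multilinear maps to the second factor -/
def compR (Q E F : Type*) [NormedAddCommGroup E] [NormedSpace ℂ E]
  [NormedAddCommGroup F] [NormedSpace ℂ F] [NormedAddCommGroup Q] [NormedSpace ℂ Q] (i : ℕ) :
    ((Q × E) [×i]→L[ℂ] F) →L[ℂ] (E [×i]→L[ℂ] F) :=
  ContinuousMultilinearMap.compContinuousLinearMapL (fun _ => ContinuousLinearMap.inr ℂ Q E)

/-- iterated partial derivatives as iterated derivatives -/
lemma iter_partial {G : Q × E → F} {c : Q × E} (hG : AnalyticAt ℂ G c) (i : ℕ) :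
    iteratedFDeriv ℂ i (fun x => G (c.1, x)) c.2 =
      (iteratedFDeriv ℂ i G c).compContinuousLinearMap (fun _ => ContinuousLinearMap.inr ℂ Q E) := by
  induction i generalizing c with
  | zero => ext v; simp
  | succ i ih =>
    have h1 : iteratedFDeriv ℂ i (fun x => G (c.1, x)) =ᶠ[𝓝 c.2] fun x =>
        compR Q E F i
          (iteratedFDeriv ℂ i G (c.1, x)) := by
      have ht : Filter.Tendsto (fun x : E => (c.1, x)) (𝓝 c.2) (𝓝 c) :=
        (by fun_prop : Continuous fun x : E => (c.1, x)).tendsto c.2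
      filter_upwards [ht.eventually hG.eventually_analyticAt] with x hx
      exact ih hx
    have h2 : HasFDerivAt (fun x => iteratedFDeriv ℂ i G (c.1, x))
        ((fderiv ℂ (iteratedFDeriv ℂ i G) c).comp (ContinuousLinearMap.inr ℂ Q E)) c.2 := by
      have h3 : HasFDerivAt (iteratedFDeriv ℂ i G) (fderiv ℂ (iteratedFDeriv ℂ i G) c) (c.1, c.2) :=
        (hG.iterF i).differentiableAt.hasFDerivAt
      exact h3.comp c.2 (hasFDerivAt_prodMk_right c.1 c.2)
    ext v
    have h4 : HasFDerivAt (fun x => compR Q E F i (iteratedFDeriv ℂ i G (c.1, x))) _ c.2 :=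
      (((compR Q E F i).hasFDerivAt).comp c.2 h2)
    rw [iteratedFDeriv_succ_apply_left, h1.fderiv_eq, h4.fderiv]
    rw [ContinuousMultilinearMap.compContinuousLinearMap_apply, iteratedFDeriv_succ_apply_left]
    rfl

/-- joint analyticity of jets -/
lemma jet_analytic (k : ℕ) {G : Q × E → F} {c : Q × E} (hG : AnalyticAt ℂ G c) :
    AnalyticAt ℂ (fun c : Q × E => jet k (fun x => G (c.1, x)) c.2) c := by
  rw [analyticAt_pi_iff]
  intro i
  have h1 : (fun c : Q × E => jet k (fun x => G (c.1, x)) c.2 i) =ᶠ[𝓝 c] fun c =>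
      compR Q E F i
          (iteratedFDeriv ℂ i G c) := by
    filter_upwards [hG.eventually_analyticAt] with c hc
    exact iter_partial hc i
  refine AnalyticAt.congr ?_ h1.symm
  exact ((compR Q E F i).analyticAt _).comp (hG.iterF i)

/-- derivative of jets with respect to parameters -/
lemma jet_fderiv_param (k : ℕ) {G : Q × E → F} {c : Q × E} (hG : AnalyticAt ℂ G c) (u : Q) :
    fderiv ℂ (fun q => jet k (fun x => G (q, x)) c.2) c.1 u =
      jet k (fun x => fderiv ℂ (fun q => G (q, x)) c.1 u) c.2 := by
  have hja := jet_analytic k hG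
  have hjd : DifferentiableAt ℂ (fun q => jet k (fun x => G (q, x)) c.2) c.1 := by
    have h1 : DifferentiableAt ℂ (fun c : Q × E => jet k (fun x => G (c.1, x)) c.2) (c.1, c.2) :=
      hja.differentiableAt
    exact h1.comp c.1 (f := fun q => (q, c.2)) (by fun_prop)
  funext i
  have h0 : fderiv ℂ (fun q => jet k (fun x => G (q, x)) c.2) c.1 u i =
      fderiv ℂ (fun q => jet k (fun x => G (q, x)) c.2 i) c.1 u := by
    rw [hasFDerivAt_pi'.1 hjd.hasFDerivAt i |>.fderiv]; rfl
  rw [h0]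
  set C := compR Q E F i with hC
  have h1 : (fun q => jet k (fun x => G (q, x)) c.2 i) =ᶠ[𝓝 c.1] fun q => C (iteratedFDeriv ℂ i G (q, c.2)) := by
    have ht : Filter.Tendsto (fun x : Q => (x, c.2)) (𝓝 c.1) (𝓝 c) :=
      (by fun_prop : Continuous fun x : Q => (x, c.2)).tendsto c.1
    filter_upwards [ht.eventually hG.eventually_analyticAt] with x hx
    exact iter_partial hx i
  have h2 : HasFDerivAt (fun q => iteratedFDeriv ℂ i G (q, c.2))
      ((fderiv ℂ (iteratedFDeriv ℂ i G) c).comp (ContinuousLinearMap.inl ℂ Q E)) c.1 := by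
    have h3 : HasFDerivAt (iteratedFDeriv ℂ i G) (fderiv ℂ (iteratedFDeriv ℂ i G) c) (c.1, c.2) :=
      (hG.iterF i).differentiableAt.hasFDerivAt
    exact h3.comp c.1 (hasFDerivAt_prodMk_left c.1 c.2)
  have h3 : HasFDerivAt (fun q => C (iteratedFDeriv ℂ i G (q, c.2))) _ c.1 := C.hasFDerivAt.comp c.1 h2
  rw [h1.fderiv_eq, h3.fderiv]
  have hGd : ∀ᶠ x in 𝓝 c.2, fderiv ℂ (fun q => G (q, x)) c.1 u = fderiv ℂ G (c.1, x) (u, 0) := by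
    have ht : Filter.Tendsto (fun x : E => (c.1, x)) (𝓝 c.2) (𝓝 c) :=
        (by fun_prop : Continuous fun x : E => (c.1, x)).tendsto c.2
    filter_upwards [ht.eventually hG.eventually_analyticAt] with x hx
    have h3 : HasFDerivAt (fun q => G (q, x)) _ c.1 :=
      hx.differentiableAt.hasFDerivAt.comp c.1 (hasFDerivAt_prodMk_left c.1 x)
    rw [h3.fderiv]
    rfl
  rw [jet_congr hGd]
  have hGu : AnalyticAt ℂ (fun y => fderiv ℂ G y (u, 0)) c :=
    ((ContinuousLinearMap.apply ℂ F ((u, 0) : Q × E)).analyticAt _).comp hG.fderiv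
  have h4 := iter_partial hGu i
  simp only [jet]
  rw [h4]
  ext v
  have h5 : iteratedFDeriv ℂ i (fun y => fderiv ℂ G y (u, 0)) c =
      (ContinuousLinearMap.apply ℂ F ((u, 0) : Q × E)).compContinuousMultilinearMap
        (iteratedFDeriv ℂ i (fderiv ℂ G) c) :=
    (ContinuousLinearMap.apply ℂ F ((u, 0) : Q × E)).iteratedFDeriv_comp_left
      (f := fderiv ℂ G) (n := ω) hG.fderiv.contDiffAt le_top
  rw [h5]
  simp only [C]
  let w : Fin i → Q × E := fun j => ContinuousLinearMap.inr ℂ Q E (v j)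
  have h6 : iteratedFDeriv ℂ (i + 1) G c (Fin.cons (u, 0) w) =
      iteratedFDeriv ℂ (i + 1) G c (Fin.snoc w (u, 0)) := by
    have h7 := (hG.contDiffAt (n := ω)).iteratedFDeriv_comp_perm (Fin.cons (u, 0) w) (finRotate (i + 1))
    rw [← h7, Fin.snoc_eq_cons_rotate]
    rfl
  rw [iteratedFDeriv_succ_apply_left, iteratedFDeriv_succ_apply_right] at h6
  simp only [Fin.cons_zero, Fin.tail_cons, Fin.init_snoc, Fin.snoc_last] at h6
  exact h6

/-- Cauchy estimates for jets -/
lemma jet_small [FiniteDimensional ℂ E] (k : ℕ) {R : ℝ} (hR : 0 < R) :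
    ∃ C : ℝ, 0 ≤ C ∧ ∀ (f : E → F) (x : E) (M : ℝ), DifferentiableOn ℂ f (Metric.ball x R) →
      (∀ y ∈ Metric.ball x R, ‖f y‖ ≤ M) → ∀ y ∈ Metric.ball x (R / 2), ‖jet k f y‖ ≤ C * M := by
  set δ := R / (2 * (k + 1)) with hδ
  have hδ0 : 0 < δ := by positivity
  refine ⟨(max 1 (2 / δ)) ^ k, by positivity, fun f x M hd hM y hy => ?_⟩
  have hM0 : 0 ≤ M := (norm_nonneg _).trans (hM x (Metric.mem_ball_self hR))
  rw [pi_norm_le_iff_of_nonneg (by positivity)]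
  intro i
  have hi : (i : ℝ) * δ < R / 2 := by
    have h2 : (i : ℝ) < k + 1 := by exact_mod_cast i.2
    have h3 : (k + 1 : ℝ) * δ = R / 2 := by rw [hδ]; field_simp
    nlinarith
  have h1 := iter_bound hd hM hδ0 i (by linarith) y (Metric.ball_subset_ball (by linarith) hy)
  refine h1.trans ?_
  gcongr
  calc (2 / δ) ^ (i : ℕ) ≤ (max 1 (2 / δ)) ^ (i : ℕ) := by gcongr; exact le_max_right _ _
    _ ≤ (max 1 (2 / δ)) ^ k := by
      apply pow_le_pow_right₀ (le_max_left _ _); omega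

instance cmm_fd [FiniteDimensional ℂ E] [FiniteDimensional ℂ F] (i : ℕ) :
    FiniteDimensional ℂ (E [×i]→L[ℂ] F) := by
  let L : (E [×i]→L[ℂ] F) →ₗ[ℂ] MultilinearMap ℂ (fun _ : Fin i => E) F :=
    { toFun := fun f => f.toMultilinearMap, map_add' := fun _ _ => rfl, map_smul' := fun _ _ => rfl }
  exact Module.Finite.of_injective L ContinuousMultilinearMap.toMultilinearMap_injective

end jets

section cplx

/-- coordinatewise conjugation -/
def cj (n : ℕ) : Cn n →SL[starRingEnd ℂ] Cn n where
  toFun z := WithLp.toLp 2 fun j => starRingEnd ℂ (z j)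
  map_add' x y := by ext j; simp
  map_smul' c x := by ext j; simp
  cont := by
    refine (PiLp.continuous_toLp 2 _).comp (continuous_pi fun j => ?_)
    exact Complex.continuous_conj.comp (by fun_prop)

@[simp] lemma cj_apply {n : ℕ} (z : Cn n) (j : Fin n) : cj n z j = starRingEnd ℂ (z j) := rfl

@[simp] lemma cj_cj {n : ℕ} (z : Cn n) : cj n (cj n z) = z := by ext j; simp

/-- an antilinear continuous map is real linear -/
def antiR {E F : Type*} [NormedAddCommGroup E] [NormedSpace ℂ E] [NormedAddCommGroup F]
    [NormedSpace ℂ F] (c : E →SL[starRingEnd ℂ] F) : E →L[ℝ] F where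
  toFun := c
  map_add' := c.map_add
  map_smul' r x := by
    have : r • x = (r : ℂ) • x := (Complex.coe_smul r x).symm
    rw [this, c.map_smulₛₗ]; simp
  cont := c.cont

@[simp] lemma antiR_apply {E F : Type*} [NormedAddCommGroup E] [NormedSpace ℂ E] [NormedAddCommGroup F]
    [NormedSpace ℂ F] (c : E →SL[starRingEnd ℂ] F) (x : E) : antiR c x = c x := rfl

/-- `Ec` is a complexification of `E` -/
structure Cplx (E Ec : Type*) [NormedAddCommGroup E] [NormedSpace ℝ E]
    [NormedAddCommGroup Ec] [NormedSpace ℂ Ec] where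
  ι : E →L[ℝ] Ec
  X : Ec →L[ℝ] E
  Y : Ec →L[ℝ] E
  hX : ∀ v, X (I • v) = - Y v
  hY : ∀ v, Y (I • v) = X v
  Xι : ∀ x, X (ι x) = x
  Yι : ∀ x, Y (ι x) = 0
  dec : ∀ v, ι (X v) + I • ι (Y v) = v

/-- `z ↦ (z, z̄)` -/
def cplxC (n : ℕ) : Cplx (Cn n) (Cn n × Cn n) where
  ι := (ContinuousLinearMap.id ℝ (Cn n)).prod (antiR (cj n))
  X := (2⁻¹ : ℂ) • (ContinuousLinearMap.fst ℝ _ _ + (antiR (cj n)).comp (ContinuousLinearMap.snd ℝ _ _))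
  Y := (2 * I : ℂ)⁻¹ • (ContinuousLinearMap.fst ℝ _ _ - (antiR (cj n)).comp (ContinuousLinearMap.snd ℝ _ _))
  hX v := by
    ext j; simp
    field_simp
    ring_nf
  hY v := by
    ext j; simp
    field_simp
    ring_nf; simp; try ring
  Xι x := by ext j; simp; ring
  Yι x := by ext j; simp
  dec v := by
    apply Prod.ext
    · ext j; simp; field_simp; ring_nf; simp [I_sq]; try ring
    · have h2 : (starRingEnd ℂ) 2 = 2 := Complex.conj_ofNat 2
      ext j; simp; field_simp; ring_nf; simp [I_sq, h2]; try ring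

/-- `ℝ^m ⊂ ℂ^m` -/
def cplxR (m : ℕ) : Cplx (Rm m) (Cn m) where
  ι := LinearMap.toContinuousLinearMap
    { toFun := fun x => WithLp.toLp 2 fun j => (x j : ℂ)
      map_add' := fun x y => by ext j; simp
      map_smul' := fun c x => by ext j; simp }
  X := LinearMap.toContinuousLinearMap
    { toFun := fun x => WithLp.toLp 2 fun j => (x j).re
      map_add' := fun x y => by ext j; simp
      map_smul' := fun c x => by ext j; simp }
  Y := LinearMap.toContinuousLinearMap
    { toFun := fun x => WithLp.toLp 2 fun j => (x j).im
      map_add' := fun x y => by ext j; simp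
      map_smul' := fun c x => by ext j; simp }
  hX v := by ext j; simp
  hY v := by ext j; simp
  Xι x := by ext j; simp
  Yι x := by ext j; simp
  dec v := by
    ext j
    simp [mul_comm I]

/-- `Fin d → ℝ ⊂ Fin d → ℂ` -/
def cplxPi (d : ℕ) : Cplx (Fin d → ℝ) (Fin d → ℂ) where
  ι := LinearMap.toContinuousLinearMap
    { toFun := fun x => fun j => (x j : ℂ)
      map_add' := fun x y => by ext j; simp
      map_smul' := fun c x => by ext j; simp }
  X := LinearMap.toContinuousLinearMap
    { toFun := fun x => fun j => (x j).re
      map_add' := fun x y => by ext j; simp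
      map_smul' := fun c x => by ext j; simp }
  Y := LinearMap.toContinuousLinearMap
    { toFun := fun x => fun j => (x j).im
      map_add' := fun x y => by ext j; simp
      map_smul' := fun c x => by ext j; simp }
  hX v := by ext j; simp
  hY v := by ext j; simp
  Xι x := by ext j; simp
  Yι x := by ext j; simp
  dec v := by
    ext j
    simp [mul_comm I]

variable {E Ec E' Ec' F : Type*} [NormedAddCommGroup E] [NormedSpace ℝ E]
    [NormedAddCommGroup Ec] [NormedSpace ℂ Ec] [NormedAddCommGroup E'] [NormedSpace ℝ E']
    [NormedAddCommGroup Ec'] [NormedSpace ℂ Ec'] [NormedAddCommGroup F] [NormedSpace ℂ F]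

def cplxProd (K : Cplx E Ec) (K' : Cplx E' Ec') : Cplx (E × E') (Ec × Ec') where
  ι := K.ι.prodMap K'.ι
  X := K.X.prodMap K'.X
  Y := K.Y.prodMap K'.Y
  hX v := Prod.ext (by simpa using K.hX v.1) (by simpa using K'.hX v.2)
  hY v := Prod.ext (by simpa using K.hY v.1) (by simpa using K'.hY v.2)
  Xι v := Prod.ext (by simpa using K.Xι v.1) (by simpa using K'.Xι v.2)
  Yι v := Prod.ext (by simpa using K.Yι v.1) (by simpa using K'.Yι v.2)
  dec v := by
    apply Prod.ext
    · simpa using K.dec v.1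
    · simpa using K'.dec v.2

/-- complex-linear functional extending a real one -/
def Cplx.ext (K : Cplx E Ec) (l : E →L[ℝ] ℝ) : Ec →L[ℂ] ℂ where
  toFun v := (l (K.X v) : ℂ) + I * (l (K.Y v) : ℂ)
  map_add' u v := by simp; ring
  map_smul' c v := by
    have h1 : c • v = c.re • v + c.im • (I • v) := by
      rw [← Complex.coe_smul, ← Complex.coe_smul, smul_smul, ← add_smul, Complex.re_add_im]
    rw [h1]
    simp only [map_add, map_smul, K.hX, K.hY, map_neg, smul_eq_mul, RingHom.id_apply]
    apply Complex.ext
    · simp <;> ring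
    · simp <;> ring
  cont := by fun_prop

lemma Cplx.ext_ι (K : Cplx E Ec) (l : E →L[ℝ] ℝ) (x : E) : K.ext l (K.ι x) = l x := by
  simp [Cplx.ext, K.Xι, K.Yι]

/-- Complexification of real-analytic germs -/
theorem Cplx.exists_ext [FiniteDimensional ℝ E] [CompleteSpace F] (K : Cplx E Ec) {f : E → F} {x0 : E}
    (hf : AnalyticAt ℝ f x0) :
    ∃ Fc : Ec → F, AnalyticAt ℂ Fc (K.ι x0) ∧ ∀ᶠ x in 𝓝 x0, Fc (K.ι x) = f x := by
  obtain ⟨p, r, hp⟩ := hf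
  let b := Module.finBasis ℝ E
  let n := Module.finrank ℝ E
  let l : Fin n → Ec →L[ℂ] ℂ := fun i => K.ext (LinearMap.toContinuousLinearMap (b.coord i))
  let T : (k : ℕ) → (Fin k → Fin n) → (Ec [×k]→L[ℂ] F) := fun k φ =>
    (((ContinuousMultilinearMap.mkPiAlgebra ℂ (Fin k) ℂ).compContinuousLinearMap
      fun i => l (φ i)).smulRight (p k fun i => b (φ i)))
  let q : FormalMultilinearSeries ℂ Ec F := fun k => ∑ φ : Fin k → Fin n, T k φ
  obtain ⟨Λ, hΛ0, hΛ⟩ : ∃ Λ : ℝ, 0 < Λ ∧ ∀ i, ‖l i‖ ≤ Λ :=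
    ⟨∑ i, ‖l i‖ + 1, by positivity, fun i => by
      have := Finset.single_le_sum (f := fun i => ‖l i‖) (fun _ _ => norm_nonneg _) (Finset.mem_univ i)
      linarith⟩
  obtain ⟨B, hB0, hB⟩ : ∃ Λ : ℝ, 0 < Λ ∧ ∀ i, ‖b i‖ ≤ Λ :=
    ⟨∑ i, ‖b i‖ + 1, by positivity, fun i => by
      have := Finset.single_le_sum (f := fun i => ‖b i‖) (fun _ _ => norm_nonneg _) (Finset.mem_univ i)
      linarith⟩
  have hT : ∀ k φ, ‖T k φ‖ ≤ Λ ^ k * (‖p k‖ * B ^ k) := by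
    intro k φ
    apply ContinuousMultilinearMap.opNorm_le_bound (by positivity)
    intro v
    simp only [T, ContinuousMultilinearMap.smulRight_apply,
      ContinuousMultilinearMap.compContinuousLinearMap_apply, ContinuousMultilinearMap.mkPiAlgebra_apply]
    rw [norm_smul, norm_prod]
    have h1 : ∏ i, ‖(l (φ i)) (v i)‖ ≤ Λ ^ k * ∏ i, ‖v i‖ := by
      calc ∏ i, ‖(l (φ i)) (v i)‖ ≤ ∏ i, (Λ * ‖v i‖) := by
            apply Finset.prod_le_prod (fun _ _ => norm_nonneg _)
            intro i _
            exact ((l (φ i)).le_opNorm _).trans (by gcongr; exact hΛ _)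
        _ = Λ ^ k * ∏ i, ‖v i‖ := by rw [Finset.prod_mul_distrib]; simp
    have h2 : ‖p k fun i => b (φ i)‖ ≤ ‖p k‖ * B ^ k := by
      refine ((p k).le_opNorm _).trans ?_
      gcongr
      calc ∏ i, ‖b (φ i)‖ ≤ ∏ i : Fin k, B := Finset.prod_le_prod (fun _ _ => norm_nonneg _) fun i _ => hB _
        _ = B ^ k := by simp
    calc _ ≤ (Λ ^ k * ∏ i, ‖v i‖) * (‖p k‖ * B ^ k) := by gcongr
      _ = _ := by ring
  have hq : ∀ k, ‖q k‖ ≤ (n * Λ * B) ^ k * ‖p k‖ := by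
    intro k
    refine (norm_sum_le _ _).trans ?_
    refine (Finset.sum_le_sum fun φ _ => hT k φ).trans (le_of_eq ?_)
    simp
    ring
  have hrp : 0 < p.radius := hp.r_pos.trans_le hp.r_le
  obtain ⟨ρ, hρ0, hρ⟩ := ENNReal.lt_iff_exists_nnreal_btwn.1 hrp
  have hρ0' : 0 < (ρ : ℝ) := by exact_mod_cast hρ0
  obtain ⟨C, hC0, hC⟩ := p.norm_mul_pow_le_of_lt_radius hρ
  have hD : 0 < (n * Λ * B + 1) := by positivity
  have hqr : ENNReal.ofReal (ρ / (n * Λ * B + 1)) ≤ q.radius := by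
    have := q.le_radius_of_bound C (r := (ρ / (n * Λ * B + 1)).toNNReal) (by
      intro k
      rw [Real.coe_toNNReal _ (by positivity)]
      calc ‖q k‖ * (ρ / (n * Λ * B + 1)) ^ k
          ≤ ((n * Λ * B + 1) ^ k * ‖p k‖) * (ρ / (n * Λ * B + 1)) ^ k := by
            gcongr
            refine (hq k).trans ?_
            gcongr
            linarith
        _ = ‖p k‖ * ρ ^ k := by
            rw [div_pow]; field_simp
        _ ≤ C := hC k)
    exact this
  have hqpos : 0 < q.radius := lt_of_lt_of_le (by simp; positivity) hqr
  refine ⟨fun w => q.sum (w - K.ι x0), ?_, ?_⟩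
  · have h1 := (q.hasFPowerSeriesOnBall hqpos).analyticAt
    exact AnalyticAt.comp_of_eq (g := q.sum) h1 (by fun_prop) (by simp)
  · have h2 : ∀ᶠ x in 𝓝 x0, x - x0 ∈ Metric.eball (0 : E) r := by
      have : Filter.Tendsto (fun x : E => x - x0) (𝓝 x0) (𝓝 0) := by
        simpa using (by fun_prop : Continuous fun x : E => x - x0).tendsto x0
      exact this.eventually (Metric.isOpen_eball.mem_nhds (by simpa using hp.r_pos))
    filter_upwards [h2] with x hx
    have h3 := hp.hasSum hx
    rw [add_sub_cancel] at h3
    rw [← h3.tsum_eq]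
    unfold FormalMultilinearSeries.sum
    congr 1
    funext k
    rw [← map_sub]
    simp only [q, T, ContinuousMultilinearMap.sum_apply, ContinuousMultilinearMap.smulRight_apply,
      ContinuousMultilinearMap.compContinuousLinearMap_apply, ContinuousMultilinearMap.mkPiAlgebra_apply,
      l, Cplx.ext_ι]
    set y := x - x0
    have h4 : (fun _ : Fin k => y) = fun _ => ∑ j, b.repr y j • b j := by
      funext _; exact (b.sum_repr y).symm
    have h5 : (p k fun _ => y) = ∑ φ : Fin k → Fin n, p k fun i => b.repr y (φ i) • b (φ i) := by
      rw [h4]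
      exact (p k).toMultilinearMap.map_sum (fun _ j => b.repr y j • b j)
    rw [h5]
    refine Finset.sum_congr rfl fun φ _ => ?_
    rw [(p k).map_smul_univ (fun i => b.repr y (φ i)) (fun i => b (φ i))]
    rw [← Complex.coe_smul]
    simp

/-- Totally real uniqueness -/
theorem Cplx.uniq (K : Cplx E Ec) {f : Ec → F} [CompleteSpace F] {x0 : E} (hf : AnalyticAt ℂ f (K.ι x0))
    (h0 : ∀ᶠ x in 𝓝 x0, f (K.ι x) = 0) : ∀ᶠ v in 𝓝 (K.ι x0), f v = 0 := by
  obtain ⟨R, hR, hb⟩ := Metric.eventually_nhds_iff_ball.1 hf.eventually_analyticAt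
  obtain ⟨R', hR', hb'⟩ := Metric.eventually_nhds_iff_ball.1 h0
  -- smallness
  have hX : ∀ᶠ v in 𝓝 (K.ι x0), ‖K.X (v - K.ι x0)‖ < R' / 3 ∧ ‖K.Y (v - K.ι x0)‖ < R' / 3 ∧
      ‖K.ι (K.X (v - K.ι x0))‖ < R / 3 ∧ ‖K.ι (K.Y (v - K.ι x0))‖ < R / 3 := by
    have hc : ∀ (L : Ec → E) (hL : Continuous L) (h0 : L 0 = 0) (r : ℝ), 0 < r →
        ∀ᶠ v in 𝓝 (K.ι x0), ‖L (v - K.ι x0)‖ < r := by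
      intro L hL h0 r hr
      have h1 : ContinuousAt (fun v => ‖L (v - K.ι x0)‖) (K.ι x0) := by fun_prop
      exact h1.eventually_lt_const (by simpa [h0] using hr)
    have hc' : ∀ (L : Ec → Ec) (hL : Continuous L) (h0 : L 0 = 0) (r : ℝ), 0 < r →
        ∀ᶠ v in 𝓝 (K.ι x0), ‖L (v - K.ι x0)‖ < r := by
      intro L hL h0 r hr
      have h1 : ContinuousAt (fun v => ‖L (v - K.ι x0)‖) (K.ι x0) := by fun_prop
      exact h1.eventually_lt_const (by simpa [h0] using hr)
    exact (hc K.X K.X.continuous (map_zero _) _ (by positivity)).and <|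
      (hc K.Y K.Y.continuous (map_zero _) _ (by positivity)).and <|
      (hc' (fun v => K.ι (K.X v)) (by fun_prop) (by simp) _ (by positivity)).and
      (hc' (fun v => K.ι (K.Y v)) (by fun_prop) (by simp) _ (by positivity))
  filter_upwards [hX] with v ⟨h1, h2, h3, h4⟩
  set a := K.X (v - K.ι x0)
  set c := K.Y (v - K.ι x0)
  let g : ℂ → F := fun s => f (K.ι x0 + (K.ι a + s • K.ι c))
  have hin : ∀ s ∈ Metric.ball (0:ℂ) 2, K.ι x0 + (K.ι a + s • K.ι c) ∈ Metric.ball (K.ι x0) R := by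
    intro s hs
    rw [mem_ball_zero_iff] at hs
    rw [mem_ball_iff_norm, add_sub_cancel_left]
    refine (norm_add_le _ _).trans_lt ?_
    rw [norm_smul]
    nlinarith [norm_nonneg (K.ι c), norm_nonneg s]
  have hg : AnalyticOnNhd ℂ g (Metric.ball 0 2) := by
    intro s hs
    exact AnalyticAt.comp_of_eq (g := f) (hb _ (hin s hs)) (by fun_prop) rfl
  have hfreq : ∃ᶠ s in 𝓝[≠] (0:ℂ), g s = 0 := by
    have h5 : ∀ t : ℝ, |t| < 2 → g (t : ℂ) = 0 := by
      intro t ht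
      have h6 : K.ι x0 + (K.ι a + (t : ℂ) • K.ι c) = K.ι (x0 + (a + t • c)) := by simp
      simp only [g]
      rw [h6]
      apply hb'
      rw [mem_ball_iff_norm, add_sub_cancel_left]
      refine (norm_add_le _ _).trans_lt ?_
      rw [norm_smul, Real.norm_eq_abs]
      nlinarith [norm_nonneg c, abs_nonneg t]
    have h7 : Filter.Tendsto (fun t : ℝ => (t : ℂ)) (𝓝[≠] 0) (𝓝[≠] 0) := by
      refine tendsto_nhdsWithin_of_tendsto_nhds_of_eventually_within _ ?_ ?_
      · exact ((Complex.continuous_ofReal.tendsto 0).mono_left nhdsWithin_le_nhds)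
      · filter_upwards [self_mem_nhdsWithin] with t ht
        simpa using ht
    refine h7.frequently (Filter.Eventually.frequently ?_)
    have h8 : ∀ᶠ t : ℝ in 𝓝 0, |t| < 2 :=
      (by fun_prop : ContinuousAt (fun t : ℝ => |t|) 0).eventually_lt_const (by norm_num)
    exact (h8.mono h5).filter_mono nhdsWithin_le_nhds
  have hzero := hg.eqOn_zero_of_preconnected_of_frequently_eq_zero
    (convex_ball (0:ℂ) 2).isPreconnected (by simp) hfreq
  have := hzero (x := I) (by simp)
  simp only [g] at this
  rw [K.dec, add_sub_cancel] at this
  exact this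

end cplx

section toolkit

@[simp] lemma cplxC_ι (n : ℕ) (z : Cn n) : (cplxC n).ι z = (z, cj n z) := rfl

/-- coordinatewise conjugation on `Fin d → ℂ` -/
def cf (d : ℕ) : (Fin d → ℂ) →SL[starRingEnd ℂ] (Fin d → ℂ) where
  toFun z := fun j => starRingEnd ℂ (z j)
  map_add' x y := by ext j; simp
  map_smul' c x := by ext j; simp
  cont := by
    refine (continuous_pi fun j => ?_)
    exact Complex.continuous_conj.comp (by fun_prop)

@[simp] lemma cf_apply {n : ℕ} (z : Fin n → ℂ) (j : Fin n) : cf n z j = starRingEnd ℂ (z j) := rfl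
@[simp] lemma cf_cf {n : ℕ} (z : Fin n → ℂ) : cf n (cf n z) = z := by ext j; simp

/-- the antiholomorphic involution -/
def sg (n : ℕ) : Cn n × Cn n →SL[starRingEnd ℂ] Cn n × Cn n where
  toFun X := (cj n X.2, cj n X.1)
  map_add' x y := by simp
  map_smul' c x := by simp
  cont := by fun_prop

@[simp] lemma sg_apply {n : ℕ} (X : Cn n × Cn n) : sg n X = (cj n X.2, cj n X.1) := rfl
@[simp] lemma sg_sg {n : ℕ} (X : Cn n × Cn n) : sg n (sg n X) = X := by simp

/-- extension of the equation along a real-analytic map -/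
lemma cbasis_I {n : ℕ} (j : Fin n) : cbasis j I = I • cbasis j (1:ℂ) := by
  ext i; simp [cbasis, EuclideanSpace.single_apply]

lemma cbasis_sum {n : ℕ} (v : Cn n) : v = ∑ j, v j • cbasis j (1:ℂ) := by
  ext i
  simp [cbasis, EuclideanSpace.single_apply, Finset.sum_apply, Pi.single_apply]

lemma cj_cbasis {n : ℕ} (j : Fin n) : cj n (cbasis j 1) = cbasis j 1 := by
  ext i; simp only [cj_apply, cbasis, EuclideanSpace.single_apply]; split_ifs <;> simp

lemma hasFDerivAt_ι {n : ℕ} {F : Type*} [NormedAddCommGroup F] [NormedSpace ℂ F]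
    {fc : Cn n × Cn n → F} {z : Cn n} (h : DifferentiableAt ℂ fc (z, cj n z)) :
    HasFDerivAt (fun z => fc (z, cj n z))
      (((fderiv ℂ fc (z, cj n z)).restrictScalars ℝ).comp (cplxC n).ι) z := by
  have h1 := h.hasFDerivAt.restrictScalars ℝ
  exact HasFDerivAt.comp (g := fc) (f := fun z => (cplxC n).ι z) z h1 (cplxC n).ι.hasFDerivAt

lemma fderiv_of_ext {n : ℕ} {F : Type*} [NormedAddCommGroup F] [NormedSpace ℂ F]
    {fc : Cn n × Cn n → F} {f : Cn n → F} {z : Cn n} (h : DifferentiableAt ℂ fc (z, cj n z))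
    (he : ∀ᶠ z in 𝓝 z, fc (z, cj n z) = f z) (u : Cn n) :
    fderiv ℝ f z u = fderiv ℂ fc (z, cj n z) (u, cj n u) := by
  rw [((hasFDerivAt_ι h).congr_of_eventuallyEq (he.mono fun _ h => h.symm)).fderiv]
  simp

lemma wirtDBar_of_ext {n : ℕ} {fc : Cn n × Cn n → ℂ} {f : Cn n → ℂ} {z : Cn n}
    (h : DifferentiableAt ℂ fc (z, cj n z)) (he : ∀ᶠ z in 𝓝 z, fc (z, cj n z) = f z) (j : Fin n) :
    wirtDBar f z j = fderiv ℂ fc (z, cj n z) (0, cbasis j 1) := by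
  have h1 : ((cbasis j (1:ℂ) : Cn n), (cbasis j 1 : Cn n)) = ((cbasis j 1, 0) : Cn n × Cn n) + (0, cbasis j 1) := by simp
  have h2 : ((I • cbasis j (1:ℂ) : Cn n), (cj n (I • cbasis j 1) : Cn n)) =
     I • ((cbasis j 1, 0) : Cn n × Cn n) - I • (0, cbasis j 1) := by
    simp [cj_cbasis]
  simp only [wirtDBar, fderiv_of_ext h he, cbasis_I]
  rw [h2, cj_cbasis, h1]
  simp only [map_add, map_sub, map_smul, smul_eq_mul]
  linear_combination (-(1/2) * (fderiv ℂ fc (z, cj n z) (0, cbasis j 1)) +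
    (1/2) * (fderiv ℂ fc (z, cj n z) (cbasis j 1, 0))) * I_sq

lemma fderiv_ofReal {n : ℕ} {f : Cn n → ℝ} {z : Cn n} (hf : DifferentiableAt ℝ f z) (u : Cn n) :
    fderiv ℝ (fun z => (f z : ℂ)) z u = (fderiv ℝ f z u : ℂ) := by
  have : HasFDerivAt (fun z => (f z : ℂ)) (Complex.ofRealCLM.comp (fderiv ℝ f z)) z :=
    Complex.ofRealCLM.hasFDerivAt.comp z hf.hasFDerivAt
  rw [this.fderiv]; simp

lemma wirtDBarR_of_ext {n : ℕ} {fc : Cn n × Cn n → ℂ} {f : Cn n → ℝ} {z : Cn n}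
    (hf : DifferentiableAt ℝ f z)
    (h : DifferentiableAt ℂ fc (z, cj n z)) (he : ∀ᶠ z in 𝓝 z, fc (z, cj n z) = f z) (j : Fin n) :
    wirtDBarR f z j = fderiv ℂ fc (z, cj n z) (0, cbasis j 1) := by
  rw [← wirtDBar_of_ext h he]
  simp only [wirtDBar, wirtDBarR, fderiv_ofReal hf]

lemma wirtD_of_ext {n : ℕ} {fc : Cn n × Cn n → ℂ} {f : Cn n → ℝ} {z : Cn n}
    (hf : DifferentiableAt ℝ f z)
    (h : DifferentiableAt ℂ fc (z, cj n z)) (he : ∀ᶠ z in 𝓝 z, fc (z, cj n z) = f z) (j : Fin n) :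
    wirtD f z j = fderiv ℂ fc (z, cj n z) (cbasis j 1, 0) := by
  have h1 : ((cbasis j (1:ℂ) : Cn n), (cbasis j 1 : Cn n)) = ((cbasis j 1, 0) : Cn n × Cn n) + (0, cbasis j 1) := by simp
  have h2 : ((I • cbasis j (1:ℂ) : Cn n), (cj n (I • cbasis j 1) : Cn n)) =
     I • ((cbasis j 1, 0) : Cn n × Cn n) - I • (0, cbasis j 1) := by
    simp [cj_cbasis]
  simp only [wirtD, ← fderiv_ofReal hf, fderiv_of_ext h he, cbasis_I]
  rw [h2, cj_cbasis, h1]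
  simp only [map_add, map_sub, map_smul, smul_eq_mul]
  linear_combination ((1/2) * (fderiv ℂ fc (z, cj n z) (0, cbasis j 1)) -
    (1/2) * (fderiv ℂ fc (z, cj n z) (cbasis j 1, 0))) * I_sq

lemma surj_of_linIndep {n d : ℕ} (a : Fin d → Fin n → ℂ) (ha : LinearIndependent ℂ a) (y : Fin d → ℂ) :
    ∃ u : Cn n, (fun k => ∑ j, u j * a k j) = y := by
  let T : Cn n →ₗ[ℂ] (Fin d → ℂ) :=
    { toFun := fun u k => ∑ j, u j * a k j
      map_add' := fun u v => by ext k; simp [add_mul, Finset.sum_add_distrib]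
      map_smul' := fun c v => by ext k; simp [Finset.mul_sum, mul_assoc] }
  by_contra hcon
  have hlt : LinearMap.range T < ⊤ := by
    rw [lt_top_iff_ne_top]
    intro h
    obtain ⟨u, hu⟩ := LinearMap.range_eq_top.1 h y
    exact hcon ⟨u, hu⟩
  obtain ⟨f, hf0, hf⟩ := Submodule.exists_le_ker_of_lt_top _ hlt
  apply hf0
  have hc : ∀ k, f (Pi.single k 1) = 0 := by
    refine Fintype.linearIndependent_iff.1 ha _ ?_
    ext j
    have h1 : f (T (cbasis j 1)) = 0 := hf ⟨_, rfl⟩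
    have h2 : T (cbasis j 1) = fun k => a k j := by
      ext k; simp [T, cbasis, EuclideanSpace.single_apply]
    rw [h2, LinearMap.pi_apply_eq_sum_univ] at h1
    rw [Pi.zero_apply, ← h1, Finset.sum_apply]
    refine Finset.sum_congr rfl fun i _ => ?_
    have : (fun j => if i = j then (1:ℂ) else 0) = Pi.single i 1 := by
      ext j; simp [Pi.single_apply, eq_comm]
    rw [this]
    simp [mul_comm]
  ext k
  simp [hc k]

/-- Data of a complexified generic submanifold -/
structure Gen (n d : ℕ) where
  p : Cn n
  r : Cn n → Fin d → ℝ
  rc : Cn n × Cn n → Fin d → ℂ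
  hr : AnalyticAt ℝ r p
  rp : r p = 0
  hrc : AnalyticAt ℂ rc (p, cj n p)
  ext : ∀ᶠ z in 𝓝 p, rc (z, cj n z) = fun k => (r z k : ℂ)
  sym : ∀ᶠ X in 𝓝 ((p, cj n p) : Cn n × Cn n), rc (sg n X) = cf d (rc X)
  surj1 : ∀ y, ∃ u, fderiv ℂ rc (p, cj n p) (u, 0) = y
  surj2 : ∀ y, ∃ u, fderiv ℂ rc (p, cj n p) (0, u) = y

lemma fderiv_pi_apply {𝕜 E : Type*} [NontriviallyNormedField 𝕜] [NormedAddCommGroup E] [NormedSpace 𝕜 E]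
    {d : ℕ} {F : Type*} [NormedAddCommGroup F] [NormedSpace 𝕜 F] {f : E → Fin d → F} {x : E}
    (h : DifferentiableAt 𝕜 f x) (k : Fin d) (u : E) :
    fderiv 𝕜 (fun x => f x k) x u = fderiv 𝕜 f x u k := by
  have := (hasFDerivAt_pi'.1 h.hasFDerivAt) k
  rw [this.fderiv]; rfl

lemma exists_Gen {n d : ℕ} {p : Cn n} {r : Cn n → Fin d → ℝ} {rc : Cn n × Cn n → Fin d → ℂ}
    (hr : AnalyticAt ℝ r p) (rp : r p = 0) (hrc : AnalyticAt ℂ rc (p, cj n p))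
    (ext : ∀ᶠ z in 𝓝 p, rc (z, cj n z) = fun k => (r z k : ℂ))
    (hli : LinearIndependent ℂ (fun k : Fin d => wirtD (fun z => r z k) p)) :
    ∃ G : Gen n d, G.p = p ∧ G.r = r ∧ G.rc = rc := by
  have sym : ∀ᶠ X in 𝓝 ((p, cj n p) : Cn n × Cn n), rc (sg n X) = cf d (rc X) := by
    have hP : sg n (p, cj n p) = (p, cj n p) := by simp
    have h1 : AnalyticAt ℂ (fun X => cf d (rc (sg n X)) - rc X) (p, cj n p) := by
      refine AnalyticAt.sub ?_ hrc
      exact conj_analytic (sg n) (cf d) (f := rc) (by rw [hP]; exact hrc)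
    have h2 := Cplx.uniq (cplxC n) (f := fun X => cf d (rc (sg n X)) - rc X) (x0 := p) h1 (by
      filter_upwards [ext] with z hz
      simp [hz]
      ext k; simp)
    rw [cplxC_ι] at h2
    filter_upwards [h2] with X hX
    rw [sub_eq_zero] at hX
    rw [← hX, cf_cf]
  have hd : ∀ j k, wirtD (fun z => r z k) p j = fderiv ℂ rc (p, cj n p) (cbasis j 1, 0) k := by
    intro j k
    rw [← fderiv_pi_apply hrc.differentiableAt]
    exact wirtD_of_ext (fc := fun X => rc X k)
      (differentiableAt_pi.1 hr.differentiableAt k)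
      (differentiableAt_pi.1 hrc.differentiableAt k) (ext.mono fun z hz => by simp [hz]) j
  have hs1 : ∀ y, ∃ u, fderiv ℂ rc (p, cj n p) (u, 0) = y := by
    intro y
    obtain ⟨u, hu⟩ := surj_of_linIndep _ hli y
    refine ⟨u, ?_⟩
    rw [← hu]
    ext k
    have h3 : ((u, 0) : Cn n × Cn n) = ∑ j, u j • (cbasis j (1:ℂ), (0 : Cn n)) := by
      apply Prod.ext
      · simp [Prod.fst_sum]; exact cbasis_sum u
      · simp [Prod.snd_sum]
    rw [h3, map_sum]
    simp only [map_smul, Finset.sum_apply, hd, Pi.smul_apply, smul_eq_mul]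
  have hsym' : ∀ X, fderiv ℂ rc (p, cj n p) (sg n X) = cf d (fderiv ℂ rc (p, cj n p) X) := by
    intro X
    have h1 : HasFDerivAt (fun X => rc (sg n X)) ((fderiv ℂ rc (p, cj n p)).restrictScalars ℝ ∘L antiR (sg n)) (p, cj n p) := by
      have h2 := (hrc.differentiableAt.hasFDerivAt.restrictScalars ℝ)
      have hP : antiR (sg n) (p, cj n p) = (p, cj n p) := by simp
      rw [← hP] at h2
      have := HasFDerivAt.comp (p, cj n p) h2 (antiR (sg n)).hasFDerivAt
      rw [hP] at this
      exact this
    have h2 : HasFDerivAt (fun X => cf d (rc X)) (antiR (cf d) ∘L (fderiv ℂ rc (p, cj n p)).restrictScalars ℝ) (p, cj n p) :=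
      (antiR (cf d)).hasFDerivAt.comp _ (hrc.differentiableAt.hasFDerivAt.restrictScalars ℝ)
    have h3 := (h2.congr_of_eventuallyEq sym).unique h1
    exact (congrArg (fun L => L X) h3).symm
  refine ⟨⟨p, r, rc, hr, rp, hrc, ext, sym, hs1, ?_⟩, rfl, rfl, rfl⟩
  intro y
  obtain ⟨u, hu⟩ := hs1 (cf d y)
  refine ⟨cj n u, ?_⟩
  have := hsym' (u, 0)
  simp only [sg_apply, map_zero, hu, cf_cf] at this
  exact this

end toolkit

section ip

lemma exists_compl {E G : Type*} [NormedAddCommGroup E] [NormedSpace ℝ E] [FiniteDimensional ℝ E]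
    [NormedAddCommGroup G] [NormedSpace ℝ G] (L : E →L[ℝ] G) (hL : Function.Surjective L) :
    ∃ (k : ℕ) (lam : E →L[ℝ] (Fin k → ℝ)), Function.Bijective fun x => (L x, lam x) := by
  let K := LinearMap.ker (L : E →ₗ[ℝ] G)
  obtain ⟨π, hπ⟩ := (Submodule.subtype K).exists_leftInverse_of_injective (by simp)
  have hπ' : ∀ x : K, π x = x := fun x => congrArg (fun l => l x) hπ
  let e : K ≃ₗ[ℝ] (Fin (Module.finrank ℝ K) → ℝ) := (Module.finBasis ℝ K).equivFun
  refine ⟨Module.finrank ℝ K, LinearMap.toContinuousLinearMap (e.toLinearMap ∘ₗ π), ?_, ?_⟩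
  · intro x y hxy
    simp only [Prod.mk.injEq, LinearMap.coe_toContinuousLinearMap', LinearMap.comp_apply,
      LinearEquiv.coe_coe, e.injective.eq_iff] at hxy
    have h1 : x - y ∈ K := by
      rw [LinearMap.mem_ker]; simp [hxy.1]
    have h2 := hπ' ⟨x - y, h1⟩
    simp only [map_sub, hxy.2, sub_self] at h2
    have h3 := congrArg Subtype.val h2
    simp only [ZeroMemClass.coe_zero] at h3
    exact sub_eq_zero.1 h3.symm
  · rintro ⟨a, b⟩
    obtain ⟨x, hx⟩ := hL a
    let u : K := e.symm b - π x
    refine ⟨x + u, ?_⟩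
    have h1 : L (u : E) = 0 := u.2
    simp [hx, h1, hπ', u]

lemma Cplx.bij {E Ec E' Ec' : Type*} [NormedAddCommGroup E] [NormedSpace ℝ E]
    [NormedAddCommGroup Ec] [NormedSpace ℂ Ec] [NormedAddCommGroup E'] [NormedSpace ℝ E']
    [NormedAddCommGroup Ec'] [NormedSpace ℂ Ec'] (K : Cplx E Ec) (K' : Cplx E' Ec')
    (T : Ec →L[ℂ] Ec') (L : E → E') (hL : Function.Bijective L) (h : ∀ x, T (K.ι x) = K'.ι (L x)) :
    Function.Bijective T := by
  have hT : ∀ v, T v = K'.ι (L (K.X v)) + I • K'.ι (L (K.Y v)) := by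
    intro v
    conv_lhs => rw [← K.dec v]
    rw [map_add, map_smul, h, h]
  have hX : ∀ v, K'.X (T v) = L (K.X v) := by
    intro v; rw [hT]; simp [K'.Xι, K'.hX, K'.Yι]
  have hY : ∀ v, K'.Y (T v) = L (K.Y v) := by
    intro v; rw [hT]; simp [K'.Xι, K'.hY, K'.Yι]
  constructor
  · intro v w hvw
    rw [← K.dec v, ← K.dec w, hL.1 ((hX v).symm.trans ((congrArg K'.X hvw).trans (hX w))),
      hL.1 ((hY v).symm.trans ((congrArg K'.Y hvw).trans (hY w)))]
  · intro w
    obtain ⟨a, ha⟩ := hL.2 (K'.X w)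
    obtain ⟨b, hb⟩ := hL.2 (K'.Y w)
    refine ⟨K.ι a + I • K.ι b, ?_⟩
    rw [map_add, map_smul, h, h, ha, hb, K'.dec]

lemma analytic_prod_lin {𝕜 E F G : Type*} [RCLike 𝕜] [NormedAddCommGroup E] [NormedSpace 𝕜 E]
    [NormedAddCommGroup F] [NormedSpace 𝕜 F] [NormedAddCommGroup G] [NormedSpace 𝕜 G] {f : E → F}
    {a : E} (hf : AnalyticAt 𝕜 f a) (l : E →L[𝕜] G) : AnalyticAt 𝕜 (fun x => (f x, l (x - a))) a :=
  hf.prod ((l.analyticAt (a - a)).comp_of_eq (f := fun x => x - a) (by fun_prop) rfl)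

lemma fderiv_prod_lin {𝕜 E F G : Type*} [RCLike 𝕜] [NormedAddCommGroup E] [NormedSpace 𝕜 E]
    [NormedAddCommGroup F] [NormedSpace 𝕜 F] [NormedAddCommGroup G] [NormedSpace 𝕜 G] {f : E → F}
    {a : E} (hf : AnalyticAt 𝕜 f a) (l : E →L[𝕜] G) (u : E) :
    fderiv 𝕜 (fun x => (f x, l (x - a))) a u = (fderiv 𝕜 f a u, l u) := by
  have h1 : HasFDerivAt (fun x => l (x - a)) l a := by
    simpa using (l.hasFDerivAt (x := a)).sub_const (l a)
  rw [(hf.differentiableAt.hasFDerivAt.prodMk h1).fderiv]; rfl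

variable {n d : ℕ}

/-- The base point of the complexification -/
def Gen.P0 (G : Gen n d) : Cn n × Cn n := (G.p, cj n G.p)

lemma Gen.hrc' (G : Gen n d) : AnalyticAt ℂ G.rc G.P0 := G.hrc

lemma Gen.rcP0 (G : Gen n d) : G.rc G.P0 = 0 := by
  have := G.ext.self_of_nhds
  rw [Gen.P0, this, G.rp]; ext; simp

lemma Gen.fderiv_r (G : Gen n d) (u : Cn n) :
    fderiv ℂ G.rc G.P0 (u, cj n u) = (cplxPi d).ι (fderiv ℝ G.r G.p u) := by
  have h1 := fderiv_of_ext G.hrc.differentiableAt G.ext u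
  rw [Gen.P0, ← h1]
  have : HasFDerivAt (fun z => fun k => (G.r z k : ℂ)) ((cplxPi d).ι.comp (fderiv ℝ G.r G.p)) G.p :=
    (cplxPi d).ι.hasFDerivAt.comp G.p G.hr.differentiableAt.hasFDerivAt
  rw [this.fderiv]; rfl

lemma Gen.surj_r (G : Gen n d) : Function.Surjective (fderiv ℝ G.r G.p) := by
  intro y
  obtain ⟨u, hu⟩ := G.surj1 ((cplxPi d).ι y)
  obtain ⟨v, hv⟩ := G.surj2 0
  -- decompose the vector `(u,0)` into real and imaginary part
  refine ⟨(cplxC n).X (u, 0), ?_⟩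
  have h1 := (cplxC n).dec (u, 0)
  have h2 := congrArg (fderiv ℂ G.rc G.P0) h1
  rw [map_add, map_smul, cplxC_ι, cplxC_ι, G.fderiv_r, G.fderiv_r] at h2
  rw [Gen.P0] at h2
  rw [hu] at h2
  have h3 := congrArg (cplxPi d).X h2
  simpa [(cplxPi d).Xι, (cplxPi d).hX, (cplxPi d).Yι] using h3

/-- Identity principle along the complexification, uniform in the function -/
theorem Gen.IP (G : Gen n d) {R : ℝ} (hR : 0 < R) {F : Type} [NormedAddCommGroup F]
    [NormedSpace ℂ F] [CompleteSpace F] :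
    ∃ V ∈ 𝓝 G.P0, ∀ f : Cn n × Cn n → F, AnalyticOnNhd ℂ f (Metric.ball G.P0 R) →
      (∀ᶠ z in 𝓝 G.p, G.r z = 0 → f (z, cj n z) = 0) → ∀ X ∈ V, G.rc X = 0 → f X = 0 := by
  obtain ⟨k, lam, hlam⟩ := exists_compl _ G.surj_r
  let lc : Cn n × Cn n →L[ℂ] (Fin k → ℂ) := ContinuousLinearMap.pi fun i =>
    (cplxC n).ext ((ContinuousLinearMap.proj i).comp lam)
  have hlc : ∀ u, lc (u, cj n u) = (cplxPi k).ι (lam u) := by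
    intro u
    ext i
    simp only [lc, ContinuousLinearMap.coe_pi', ← cplxC_ι]
    rw [Cplx.ext_ι]
    rfl
  let g : Cn n → (Fin d → ℝ) × (Fin k → ℝ) := fun z => (G.r z, lam (z - G.p))
  let gc : Cn n × Cn n → (Fin d → ℂ) × (Fin k → ℂ) := fun X => (G.rc X, lc (X - G.P0))
  have hg : AnalyticAt ℝ g G.p := analytic_prod_lin G.hr lam
  have hgc : AnalyticAt ℂ gc G.P0 := analytic_prod_lin G.hrc' lc
  have hdg : ∀ u, fderiv ℝ g G.p u = (fderiv ℝ G.r G.p u, lam u) := fderiv_prod_lin G.hr lam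
  have hdgc : ∀ u, fderiv ℂ gc G.P0 u = (fderiv ℂ G.rc G.P0 u, lc u) := fderiv_prod_lin G.hrc' lc
  have hbij : Function.Bijective (fderiv ℂ gc G.P0) := by
    refine Cplx.bij (cplxC n) (cplxProd (cplxPi d) (cplxPi k)) _
      (fun u => (fderiv ℝ G.r G.p u, lam u)) hlam ?_
    intro u
    rw [hdgc, cplxC_ι, G.fderiv_r, hlc]
    rfl
  obtain ⟨s, hs, hsp, hs1, -⟩ := analytic_inv hg (by
    rw [show ⇑(fderiv ℝ g G.p) = fun u => (fderiv ℝ G.r G.p u, lam u) from funext hdg]; exact hlam)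
  obtain ⟨Sc, hSc, hScp, hSc1, hSc2⟩ := analytic_inv hgc hbij
  have hgp : g G.p = 0 := by simp [g, G.rp]
  have hgcp : gc G.P0 = 0 := by simp [gc, G.rcP0]
  rw [hgp] at hs hsp hs1
  rw [hgcp] at hSc hScp hSc1
  -- real points
  have hreal : ∀ᶠ t in 𝓝 (0 : Fin k → ℝ), Sc (0, (cplxPi k).ι t) = (s (0, t), cj n (s (0, t))) ∧
      G.r (s (0, t)) = 0 := by
    have hst : Filter.Tendsto (fun t : Fin k → ℝ => s (0, t)) (𝓝 0) (𝓝 G.p) := by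
      have h1 : ContinuousAt (fun t : Fin k → ℝ => s (0, t)) 0 :=
        ContinuousAt.comp (g := s) (f := fun t => (0, t)) hs.continuousAt (by fun_prop)
      have := h1.tendsto
      rwa [show ((0 : Fin d → ℝ), (0 : Fin k → ℝ)) = 0 from rfl, hsp] at this
    have h0 : Filter.Tendsto (fun t : Fin k → ℝ => ((0 : Fin d → ℝ), t)) (𝓝 0) (𝓝 0) :=
      (by fun_prop : Continuous (fun t : Fin k → ℝ => ((0 : Fin d → ℝ), t))).tendsto 0
    have hst2 : Filter.Tendsto (fun t : Fin k → ℝ => (s (0, t), cj n (s (0, t)))) (𝓝 0) (𝓝 G.P0) :=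
      hst.prodMk_nhds (((cj n).continuous.tendsto _).comp hst)
    filter_upwards [h0.eventually hs1, hst.eventually G.ext, hst2.eventually hSc2] with t h1 h2 h3
    have h4 : G.r (s (0, t)) = 0 := congrArg Prod.fst h1
    have h5 : lam (s (0, t) - G.p) = t := congrArg Prod.snd h1
    refine ⟨?_, h4⟩
    rw [← h3]
    congr 1
    simp only [gc]
    apply Prod.ext
    · simp only [h2, h4]; ext; simp
    · simp only [Gen.P0, Prod.mk_sub_mk, ← map_sub]
      rw [hlc, h5]
  have hcont : ContinuousAt (fun t : Fin k → ℂ => Sc (0, t)) 0 :=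
    ContinuousAt.comp (g := Sc) (f := fun t => (0, t)) hSc.continuousAt (by fun_prop)
  have hS0 : Sc ((0 : Fin d → ℂ), (0 : Fin k → ℂ)) = G.P0 := hScp
  have hev : ∀ᶠ t in 𝓝 (0 : Fin k → ℂ), AnalyticAt ℂ (fun t : Fin k → ℂ => Sc (0, t)) t ∧
      Sc (0, t) ∈ Metric.ball G.P0 R := by
    refine (AnalyticAt.eventually_analyticAt ?_).and (hcont.eventually ?_)
    · exact AnalyticAt.comp_of_eq (g := Sc) (f := fun t => (0, t)) hSc (by fun_prop) rfl
    · simp only [hS0]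
      exact Metric.ball_mem_nhds _ hR
  obtain ⟨R', hR', hball⟩ := Metric.eventually_nhds_iff_ball.1 hev
  have hV : ∀ᶠ X in 𝓝 G.P0, Sc (gc X) = X ∧ lc (X - G.P0) ∈ Metric.ball (0 : Fin k → ℂ) R' := by
    refine hSc2.and ?_
    have h1 : ContinuousAt (fun X => lc (X - G.P0)) G.P0 := by fun_prop
    refine h1.eventually ?_
    simp only [sub_self, map_zero]
    exact Metric.ball_mem_nhds _ hR'
  refine ⟨_, hV, ?_⟩
  rintro f hf hfM X ⟨hX1, hX2⟩ hX0
  have hfS : AnalyticOnNhd ℂ (fun t : Fin k → ℂ => f (Sc (0, t))) (Metric.ball 0 R') := by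
    intro t ht
    exact AnalyticAt.comp_of_eq (g := f) (f := fun t => Sc (0, t)) (hf _ (hball t ht).2) (hball t ht).1 rfl
  have hst : Filter.Tendsto (fun t : Fin k → ℝ => s (0, t)) (𝓝 0) (𝓝 G.p) := by
    have h1 : ContinuousAt (fun t : Fin k → ℝ => s (0, t)) 0 :=
      ContinuousAt.comp (g := s) (f := fun t => (0, t)) hs.continuousAt (by fun_prop)
    have := h1.tendsto
    rwa [show ((0 : Fin d → ℝ), (0 : Fin k → ℝ)) = 0 from rfl, hsp] at this
  have hz : ∀ᶠ t in 𝓝 (0 : Fin k → ℂ), f (Sc (0, t)) = 0 := by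
    have := (cplxPi k).uniq (f := fun t : Fin k → ℂ => f (Sc (0, t))) (x0 := 0)
      (by rw [map_zero]; exact hfS 0 (by simpa using hR')) (by
        filter_upwards [hreal, hst.eventually hfM] with t h1 h2
        rw [h1.1]
        exact h2 h1.2)
    rwa [map_zero] at this
  have hzero := hfS.eqOn_zero_of_preconnected_of_eventuallyEq_zero
    (convex_ball (0 : Fin k → ℂ) R').isPreconnected (by simpa using hR') hz
  have h1 := hzero hX2
  simp only [Pi.zero_apply] at h1
  rw [← hX1]
  simp only [gc, hX0]
  exact h1

end ip

section B2

variable {E F G : Type} [NormedAddCommGroup E] [NormedSpace ℂ E] [FiniteDimensional ℂ E]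
  [NormedAddCommGroup F] [NormedSpace ℂ F] [FiniteDimensional ℂ F]
  [NormedAddCommGroup G] [NormedSpace ℂ G] [FiniteDimensional ℂ G]

lemma exists_rinv (L : E →L[ℂ] G) (h : ∀ y, ∃ u, L u = y) : ∃ κ : G →L[ℂ] E, ∀ y, L (κ y) = y := by
  obtain ⟨g, hg⟩ := (L : E →ₗ[ℂ] G).exists_rightInverse_of_surjective
    (LinearMap.range_eq_top.2 h)
  exact ⟨LinearMap.toContinuousLinearMap g, fun y => congrArg (fun l => l y) hg⟩

/-- Properties of the solution operator of `rc (z, ·) = c` near `ζ`. -/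
structure IsB2 (rc : E × F → G) (P : E × F) (B : (E × F) × G → F) : Prop where
  an : AnalyticAt ℂ B (P, rc P)
  base : B (P, rc P) = P.2
  sol : ∀ᶠ c in 𝓝 (P, rc P), rc (c.1.1, B c) = c.2
  fix : ∀ᶠ X in 𝓝 P, B (X, rc X) = X.2
  rev : ∀ᶠ c in 𝓝 ((0 : F), P),
    B ((c.2.1, B ((c.2.1, c.2.2 + c.1), rc c.2) + (- c.1)), rc c.2) = c.2.2

theorem exists_B2 {rc : E × F → G} {P : E × F} (hrc : AnalyticAt ℂ rc P)
    (hs : ∀ y, ∃ u, fderiv ℂ rc P (0, u) = y) : ∃ B, IsB2 rc P B := by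
  obtain ⟨κ, hκ⟩ := exists_rinv ((fderiv ℂ rc P).comp (ContinuousLinearMap.inr ℂ E F)) hs
  let f : (E × F) × G → G := fun c => rc (c.1.1, c.1.2 + κ c.2)
  let m : (E × F) × G →L[ℂ] E × F :=
    ((ContinuousLinearMap.fst ℂ E F).comp (ContinuousLinearMap.fst ℂ _ _)).prod
      ((ContinuousLinearMap.snd ℂ E F).comp (ContinuousLinearMap.fst ℂ _ _) +
        κ.comp (ContinuousLinearMap.snd ℂ _ _))
  have hm : m (P, 0) = P := by simp [m]
  have hfm : f = rc ∘ m := by ext c; simp [f, m]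
  have hf : AnalyticAt ℂ f (P, 0) := by
    rw [hfm]; exact AnalyticAt.comp_of_eq hrc (m.analyticAt _) hm
  have hf0 : f (P, 0) = rc P := by simp [f]
  have hdf : ∀ y, fderiv ℂ f (P, 0) (0, y) = y := by
    intro y
    have h1 : HasFDerivAt f ((fderiv ℂ rc P).comp m) (P, 0) := by
      rw [hfm]
      refine HasFDerivAt.comp _ ?_ m.hasFDerivAt
      rw [hm]; exact hrc.differentiableAt.hasFDerivAt
    rw [h1.fderiv]
    have := hκ y
    simpa [m] using this
  obtain ⟨ψ, hψ, hψ0, hψ1, hψ2⟩ := analytic_implicit hf (by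
    rw [show (fun y => fderiv ℂ f (P, 0) (0, y)) = id from funext hdf]; exact Function.bijective_id)
  rw [hf0] at hψ hψ0 hψ1
  refine ⟨fun c => c.1.2 + κ (ψ c), ?_, ?_, ?_, ?_, ?_⟩
  · have h1 : AnalyticAt ℂ (fun c => κ (ψ c)) (P, rc P) := (κ.analyticAt _).comp hψ
    exact AnalyticAt.add (f := fun c : (E × F) × G => c.1.2)
      (((ContinuousLinearMap.snd ℂ E F).comp (ContinuousLinearMap.fst ℂ (E × F) G)).analyticAt _) h1
  · simp [hψ0]
  · exact hψ1
  · have h1 : Filter.Tendsto (fun X : E × F => (X, (0 : G))) (𝓝 P) (𝓝 (P, 0)) :=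
      (by fun_prop : Continuous fun X : E × F => (X, (0 : G))).tendsto P
    filter_upwards [h1.eventually hψ2] with X hX
    simp only [f, map_zero, add_zero, Prod.mk.eta] at hX
    simp [hX]
  · have h1 : ContinuousAt (fun c : F × (E × F) => (((c.2.1, c.2.2 + c.1), rc c.2) : (E × F) × G)) (0, P) := by
      refine ContinuousAt.prodMk (by fun_prop) ?_
      exact ContinuousAt.comp (g := rc) (f := fun c : F × (E × F) => c.2) hrc.continuousAt (by fun_prop)
    have h2 : ContinuousAt (fun c : F × (E × F) => ψ ((c.2.1, c.2.2 + c.1), rc c.2)) (0, P) := by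
      refine ContinuousAt.comp_of_eq (g := ψ) hψ.continuousAt h1 (by simp)
    have h3 : ContinuousAt (fun c : F × (E × F) => (((c.2.1, c.2.2 + κ (ψ ((c.2.1, c.2.2 + c.1), rc c.2))),
        - ψ ((c.2.1, c.2.2 + c.1), rc c.2)) : (E × F) × G)) (0, P) := by
      have := κ.continuous.continuousAt.comp h2
      refine ContinuousAt.prodMk (ContinuousAt.prodMk (by fun_prop) (ContinuousAt.add (by fun_prop) this)) h2.neg
    have h4 := h3.tendsto
    simp only [add_zero, Prod.mk.eta, hψ0, map_zero, neg_zero] at h4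
    filter_upwards [h4.eventually hψ2] with c hc
    simp only [f, map_neg, add_neg_cancel_right, Prod.mk.eta] at hc
    have h5 : c.2.2 + c.1 + κ (ψ ((c.2.1, c.2.2 + c.1), rc c.2)) + -c.1 =
        c.2.2 + κ (ψ ((c.2.1, c.2.2 + c.1), rc c.2)) := by abel
    simp only [h5, hc]
    simp

variable {rc : E × F → G} {P : E × F} {B : (E × F) × G → F}

/-- the sliding derivative -/
lemma IsB2.deriv (hrc : AnalyticAt ℂ rc P) (hB : IsB2 rc P B) : ∀ᶠ X in 𝓝 P, ∀ v,
    fderiv ℂ rc X (0, v) = 0 →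
      HasFDerivAt (fun t => B ((X.1, X.2 + t), rc X)) ((fderiv ℂ B (X, rc X)).comp
        ((ContinuousLinearMap.inl ℂ (E × F) G).comp (ContinuousLinearMap.inr ℂ E F))) 0 ∧
      fderiv ℂ B (X, rc X) ((0, v), 0) = v := by
  have h1 : Filter.Tendsto (fun X : E × F => (X, rc X)) (𝓝 P) (𝓝 (P, rc P)) :=
    Filter.tendsto_id.prodMk_nhds hrc.continuousAt
  filter_upwards [h1.eventually hB.an.eventually_analyticAt, hB.fix.eventually_nhds,
    hrc.eventually_analyticAt] with X hX1 hX2 hX3 v hv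
  constructor
  · let m : F → (E × F) × G := fun t => ((X.1, X.2 + t), rc X)
    have h2 : HasFDerivAt m ((ContinuousLinearMap.inl ℂ (E × F) G).comp (ContinuousLinearMap.inr ℂ E F)) 0 := by
      have := (((hasFDerivAt_const (𝕜 := ℂ) X.1 (0:F)).prodMk ((hasFDerivAt_id (𝕜 := ℂ) (0:F)).const_add X.2)).prodMk
        (hasFDerivAt_const (rc X) (0:F)))
      exact this
    have h3 : m 0 = (X, rc X) := by simp [m]
    refine HasFDerivAt.comp (g := B) 0 ?_ h2
    change HasFDerivAt B _ (m 0)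
    rw [h3]; exact hX1.differentiableAt.hasFDerivAt
  · have h4 : HasFDerivAt (fun X => B (X, rc X)) ((fderiv ℂ B (X, rc X)).comp
        ((ContinuousLinearMap.id ℂ (E × F)).prod (fderiv ℂ rc X))) X := by
      refine HasFDerivAt.comp (g := B) (f := fun X => (X, rc X)) X hX1.differentiableAt.hasFDerivAt ?_
      exact (hasFDerivAt_id X).prodMk hX3.differentiableAt.hasFDerivAt
    have h5 := (h4.congr_of_eventuallyEq (hX2.mono fun _ h => h.symm)).unique (hasFDerivAt_snd)
    have h6 := congrArg (fun l => l (0, v)) h5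
    simpa [hv] using h6

lemma IsB2.deriv' (hrc : AnalyticAt ℂ rc P) (hB : IsB2 rc P B) : ∀ᶠ X in 𝓝 P, ∀ v,
    fderiv ℂ rc X (0, v) = 0 → fderiv ℂ (fun t => B ((X.1, X.2 + t), rc X)) 0 v = v := by
  filter_upwards [hB.deriv hrc] with X hX v hv
  obtain ⟨h1, h2⟩ := hX v hv
  rw [h1.fderiv]
  exact h2

/-- a function vanishing on `rc = 0` has vanishing derivative in tangential directions -/
lemma IsB2.tangent {H : Type} [NormedAddCommGroup H] [NormedSpace ℂ H] [CompleteSpace H] (hrc : AnalyticAt ℂ rc P)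
    (hB : IsB2 rc P B) (hP : rc P = 0)
    {f : E × F → H} (hf : AnalyticAt ℂ f P) (h0 : ∀ᶠ X in 𝓝 P, rc X = 0 → f X = 0) :
    ∀ᶠ X in 𝓝 P, rc X = 0 → ∀ v, fderiv ℂ rc X (0, v) = 0 → fderiv ℂ f X (0, v) = 0 := by
  have hf' : ∀ᶠ X in 𝓝 P, DifferentiableAt ℂ f X := hf.eventually_analyticAt.mono fun _ h => h.differentiableAt
  have htd : Filter.Tendsto (fun X : E × F => (X, rc X)) (𝓝 P) (𝓝 (P, rc P)) :=
    Filter.tendsto_id.prodMk_nhds hrc.continuousAt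
  have h1 : Filter.Tendsto (fun c : (E × F) × G => (c.1.1, B c)) (𝓝 (P, rc P)) (𝓝 P) := by
    have : ContinuousAt (fun c : (E × F) × G => (c.1.1, B c)) (P, rc P) :=
      ContinuousAt.prodMk (by fun_prop) hB.an.continuousAt
    have := this.tendsto
    rwa [hB.base] at this
  filter_upwards [hf', hB.deriv hrc, htd.eventually (h1.eventually h0).eventually_nhds,
    htd.eventually hB.sol.eventually_nhds, hB.fix] with X h2 h3 h4 h5 h6 hX v hv
  obtain ⟨h7, h8⟩ := h3 v hv
  let m : F → E × F := fun t => (X.1, B ((X.1, X.2 + t), rc X))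
  have hm0 : m 0 = X := by simp [m, h6]
  have hm := (hasFDerivAt_const X.1 (0:F)).prodMk h7
  have hfm : HasFDerivAt (f ∘ m) _ 0 := HasFDerivAt.comp (g := f) (f := m) 0 (by rw [hm0]; exact h2.hasFDerivAt) hm
  have hz : ∀ᶠ t in 𝓝 (0:F), (f ∘ m) t = 0 := by
    have h9 : Filter.Tendsto (fun t : F => (((X.1, X.2 + t), rc X) : (E × F) × G)) (𝓝 0) (𝓝 (X, rc X)) := by
      have : Continuous (fun t : F => (((X.1, X.2 + t), rc X) : (E × F) × G)) := by fun_prop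
      simpa using this.tendsto 0
    filter_upwards [h9.eventually h4, h9.eventually h5] with t h10 h11
    apply h10
    rw [h11, hX]
  have h12 := (hfm.congr_of_eventuallyEq (f₁ := fun _ => 0) (hz.mono fun _ h => h.symm)).unique (hasFDerivAt_const 0 0)
  have h13 := congrArg (fun l => l v) h12
  simpa [h8] using h13

end B2

section adm

variable {N d : ℕ}

abbrev YY (N : ℕ) := Cn N × Cn N

def Bm (rc : YY N → Fin d → ℂ) (B2 : YY N × (Fin d → ℂ) → Cn N) : Cn N × YY N → YY N :=
  fun c => (c.2.1, B2 ((c.2.1, c.2.2 + c.1), rc c.2))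

def Am (rc : YY N → Fin d → ℂ) (B2 : YY N × (Fin d → ℂ) → Cn N) : Cn N × YY N → YY N :=
  fun c => sg N (Bm rc B2 (cj N c.1, sg N c.2))

/-- finite compositions of the two elementary maps -/
inductive Adm (A B : Cn N × YY N → YY N) : (V : Type) → [NormedAddCommGroup V] →
    [NormedSpace ℂ V] → [FiniteDimensional ℂ V] → (V × YY N → YY N) → Prop
  | A : Adm A B (Cn N) A
  | B : Adm A B (Cn N) B
  | comp {V W : Type} [NormedAddCommGroup V] [NormedSpace ℂ V] [FiniteDimensional ℂ V]
      [NormedAddCommGroup W] [NormedSpace ℂ W] [FiniteDimensional ℂ W]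
      {f : V × YY N → YY N} {g : W × YY N → YY N} : Adm A B V f → Adm A B W g →
      Adm A B (V × W) (fun c => g (c.1.2, f (c.1.1, c.2)))

structure FlowOK (rc : YY N → Fin d → ℂ) (P0 : YY N) (A B : Cn N × YY N → YY N) : Prop where
  fixP : sg N P0 = P0
  anA : AnalyticAt ℂ A (0, P0)
  anB : AnalyticAt ℂ B (0, P0)
  idA : ∀ᶠ X in 𝓝 P0, A (0, X) = X
  idB : ∀ᶠ X in 𝓝 P0, B (0, X) = X
  invA : ∀ᶠ c in 𝓝 ((0 : Cn N), P0), rc (A c) = rc c.2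
  invB : ∀ᶠ c in 𝓝 ((0 : Cn N), P0), rc (B c) = rc c.2
  revA : ∀ᶠ c in 𝓝 ((0 : Cn N), P0), A (- c.1, A c) = c.2
  revB : ∀ᶠ c in 𝓝 ((0 : Cn N), P0), B (- c.1, B c) = c.2
  conjA : ∀ c, sg N (A c) = B (cj N c.1, sg N c.2)
  conjB : ∀ c, sg N (B c) = A (cj N c.1, sg N c.2)

structure AdmProps (rc : YY N → Fin d → ℂ) (P0 : YY N) (A B : Cn N × YY N → YY N)
    (V : Type) [NormedAddCommGroup V] [NormedSpace ℂ V] [FiniteDimensional ℂ V]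
    (f : V × YY N → YY N) : Prop where
  an : AnalyticAt ℂ f (0, P0)
  idm : ∀ᶠ X in 𝓝 P0, f (0, X) = X
  inv : ∀ᶠ c in 𝓝 ((0 : V), P0), rc (f c) = rc c.2
  rev : ∃ (W : Type) (_ : NormedAddCommGroup W) (_ : NormedSpace ℂ W) (_ : FiniteDimensional ℂ W)
    (g : W × YY N → YY N) (L : V →L[ℂ] W), Adm A B W g ∧ ∀ᶠ c in 𝓝 ((0 : V), P0), g (L c.1, f c) = c.2
  cnj : ∃ (W : Type) (_ : NormedAddCommGroup W) (_ : NormedSpace ℂ W) (_ : FiniteDimensional ℂ W)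
    (g : W × YY N → YY N) (L : V →SL[starRingEnd ℂ] W) (L' : W →SL[starRingEnd ℂ] V), Adm A B W g ∧
    (∀ v, L' (L v) = v) ∧ (∀ w, L (L' w) = w) ∧ ∀ c, sg N (f c) = g (L c.1, sg N c.2)

lemma AdmProps.base {rc : YY N → Fin d → ℂ} {P0 : YY N} {A B : Cn N × YY N → YY N}
    {V : Type} [NormedAddCommGroup V] [NormedSpace ℂ V] [FiniteDimensional ℂ V]
    {f : V × YY N → YY N} (h : AdmProps rc P0 A B V f) : f (0, P0) = P0 := h.idm.self_of_nhds

lemma AdmProps.tend {rc : YY N → Fin d → ℂ} {P0 : YY N} {A B : Cn N × YY N → YY N}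
    {V : Type} [NormedAddCommGroup V] [NormedSpace ℂ V] [FiniteDimensional ℂ V]
    {f : V × YY N → YY N} (h : AdmProps rc P0 A B V f) :
    Filter.Tendsto f (𝓝 (0, P0)) (𝓝 P0) := by
  have := h.an.continuousAt.tendsto
  rwa [h.base] at this

lemma AdmProps.tend2 {rc : YY N → Fin d → ℂ} {P0 : YY N} {A B : Cn N × YY N → YY N}
    {V W : Type} [NormedAddCommGroup V] [NormedSpace ℂ V] [FiniteDimensional ℂ V]
    [NormedAddCommGroup W] [NormedSpace ℂ W] [FiniteDimensional ℂ W]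
    {f : V × YY N → YY N} (h : AdmProps rc P0 A B V f) :
    Filter.Tendsto (fun c : (V × W) × YY N => (c.1.2, f (c.1.1, c.2))) (𝓝 (0, P0)) (𝓝 (0, P0)) := by
  have h2 : Filter.Tendsto (fun c : (V × W) × YY N => (c.1.1, c.2)) (𝓝 (0, P0)) (𝓝 (0, P0)) :=
    (by fun_prop : Continuous (fun c : (V × W) × YY N => (c.1.1, c.2))).tendsto (0, P0)
  have h3 : Filter.Tendsto (fun c : (V × W) × YY N => c.1.2) (𝓝 (0, P0)) (𝓝 0) :=
    (by fun_prop : Continuous (fun c : (V × W) × YY N => c.1.2)).tendsto (0, P0)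
  exact h3.prodMk_nhds (h.tend.comp h2)

lemma analyticAt_clm_comp {𝕜 E F G : Type*} [NontriviallyNormedField 𝕜] [NormedAddCommGroup E] [NormedSpace 𝕜 E]
    [NormedAddCommGroup F] [NormedSpace 𝕜 F] [NormedAddCommGroup G] [NormedSpace 𝕜 G] {f : F → G}
    (L : E →L[𝕜] F) {x : E} (h : AnalyticAt 𝕜 f (L x)) : AnalyticAt 𝕜 (fun y => f (L y)) x :=
  h.comp (L.analyticAt x)

lemma Adm.props {rc : YY N → Fin d → ℂ} {P0 : YY N} {A B : Cn N × YY N → YY N}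
    (hF : FlowOK rc P0 A B)
    {V : Type} [NormedAddCommGroup V] [NormedSpace ℂ V] [FiniteDimensional ℂ V]
    {f : V × YY N → YY N} (h : Adm A B V f) : AdmProps rc P0 A B V f := by
  induction h with
  | A =>
    refine ⟨hF.anA, hF.idA, hF.invA, ⟨_, _, _, inferInstance, A, -ContinuousLinearMap.id ℂ _, Adm.A, ?_⟩,
      ⟨_, _, _, inferInstance, B, cj N, cj N, Adm.B, cj_cj, cj_cj, hF.conjA⟩⟩
    exact hF.revA
  | B =>
    refine ⟨hF.anB, hF.idB, hF.invB, ⟨_, _, _, inferInstance, B, -ContinuousLinearMap.id ℂ _, Adm.B, ?_⟩,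
      ⟨_, _, _, inferInstance, A, cj N, cj N, Adm.A, cj_cj, cj_cj, hF.conjB⟩⟩
    exact hF.revB
  | @comp V W _ _ _ _ _ _ f g hf hg ihf ihg =>
    have t1 : Filter.Tendsto (fun c : (V × W) × YY N => (c.1.1, c.2)) (𝓝 (0, P0)) (𝓝 (0, P0)) :=
      (by fun_prop : Continuous (fun c : (V × W) × YY N => (c.1.1, c.2))).tendsto (0, P0)
    refine ⟨?_, ?_, ?_, ?_, ?_⟩
    · have h1 : AnalyticAt ℂ (fun c : (V × W) × YY N => f (c.1.1, c.2)) (0, P0) :=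
        analyticAt_clm_comp (((ContinuousLinearMap.fst ℂ V W).comp (ContinuousLinearMap.fst ℂ _ (YY N))).prod
          (ContinuousLinearMap.snd ℂ _ _)) ihf.an
      have h2 : AnalyticAt ℂ (fun c : (V × W) × YY N => c.1.2) (0, P0) :=
        ((ContinuousLinearMap.snd ℂ V W).comp (ContinuousLinearMap.fst ℂ _ (YY N))).analyticAt _
      refine AnalyticAt.comp_of_eq (g := g) ihg.an (h2.prod h1) ?_
      simp [ihf.base]
    · filter_upwards [ihf.idm, ihg.idm] with X h1 h2
      simp [h1, h2]
    · filter_upwards [t1.eventually ihf.inv, ihf.tend2.eventually ihg.inv] with c h1 h2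
      rw [h2]; exact h1
    · obtain ⟨V', _, _, _, f', L, hf', hfr⟩ := ihf.rev
      obtain ⟨W', _, _, _, g', L', hg', hgr⟩ := ihg.rev
      refine ⟨W' × V', inferInstance, inferInstance, inferInstance, _,
        (L'.comp (ContinuousLinearMap.snd ℂ _ _)).prod (L.comp (ContinuousLinearMap.fst ℂ _ _)),
        Adm.comp hg' hf', ?_⟩
      filter_upwards [t1.eventually hfr, ihf.tend2.eventually hgr] with c h1 h2
      simp only [ContinuousLinearMap.prod_apply, ContinuousLinearMap.comp_apply,
        ContinuousLinearMap.coe_fst', ContinuousLinearMap.coe_snd'] at h1 h2 ⊢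
      rw [h2, h1]
    · obtain ⟨V', _, _, _, f', L, Li, hf', hL1, hL2, hfc⟩ := ihf.cnj
      obtain ⟨W', _, _, _, g', L', Li', hg', hL1', hL2', hgc⟩ := ihg.cnj
      refine ⟨V' × W', inferInstance, inferInstance, inferInstance, _,
        { toFun := fun c => (L c.1, L' c.2), map_add' := by simp, map_smul' := by simp, cont := by fun_prop },
        { toFun := fun c => (Li c.1, Li' c.2), map_add' := by simp, map_smul' := by simp, cont := by fun_prop },
        Adm.comp hf' hg', ?_, ?_, ?_⟩
      · intro v; simp [hL1, hL1']
      · intro v; simp [hL2, hL2']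
      · intro c
        rw [hgc, hfc]
        rfl

theorem flowOK (G : Gen N d) {B2 : YY N × (Fin d → ℂ) → Cn N} (hB : IsB2 G.rc G.P0 B2) :
    FlowOK G.rc G.P0 (Am G.rc B2) (Bm G.rc B2) := by
  have hfix : sg N G.P0 = G.P0 := by simp [Gen.P0]
  have tσ : Filter.Tendsto (fun X => sg N X) (𝓝 G.P0) (𝓝 G.P0) := by
    have := (sg N).continuous.tendsto G.P0
    rwa [hfix] at this
  let cσ : Cn N × YY N →SL[starRingEnd ℂ] Cn N × YY N :=
    { toFun := fun c => (cj N c.1, sg N c.2), map_add' := by simp, map_smul' := by simp, cont := by fun_prop }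
  have hcσ : ∀ c, cσ c = (cj N c.1, sg N c.2) := fun _ => rfl
  have tcσ : Filter.Tendsto (fun c => cσ c) (𝓝 (0, G.P0)) (𝓝 (0, G.P0)) := by
    have := cσ.continuous.tendsto (0, G.P0)
    rwa [hcσ, hfix, map_zero] at this
  let m : Cn N × YY N → YY N × (Fin d → ℂ) := fun c => ((c.2.1, c.2.2 + c.1), G.rc c.2)
  have hm : AnalyticAt ℂ m (0, G.P0) := by
    have h1 : AnalyticAt ℂ (fun c : Cn N × YY N => (c.2.1, c.2.2 + c.1)) (0, G.P0) :=
      (((ContinuousLinearMap.fst ℂ _ _).comp (ContinuousLinearMap.snd ℂ (Cn N) (YY N))).prod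
        ((ContinuousLinearMap.snd ℂ _ _).comp (ContinuousLinearMap.snd ℂ (Cn N) (YY N)) +
          ContinuousLinearMap.fst ℂ (Cn N) (YY N))).analyticAt _
    exact h1.prod (analyticAt_clm_comp (ContinuousLinearMap.snd ℂ (Cn N) (YY N)) G.hrc')
  have hm0 : m (0, G.P0) = (G.P0, G.rc G.P0) := by simp [m]
  have tm : Filter.Tendsto m (𝓝 (0, G.P0)) (𝓝 (G.P0, G.rc G.P0)) := by
    have := hm.continuousAt.tendsto
    rwa [hm0] at this
  have anB : AnalyticAt ℂ (Bm G.rc B2) (0, G.P0) := by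
    have h1 : AnalyticAt ℂ (fun c => B2 (m c)) (0, G.P0) :=
      AnalyticAt.comp_of_eq hB.an hm hm0
    have h2 : AnalyticAt ℂ (fun c : Cn N × YY N => c.2.1) (0, G.P0) :=
      ((ContinuousLinearMap.fst ℂ _ _).comp (ContinuousLinearMap.snd ℂ (Cn N) (YY N))).analyticAt _
    exact h2.prod h1
  have invB : ∀ᶠ c in 𝓝 ((0 : Cn N), G.P0), G.rc (Bm G.rc B2 c) = G.rc c.2 := tm.eventually hB.sol
  have idB : ∀ᶠ X in 𝓝 G.P0, Bm G.rc B2 (0, X) = X := by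
    filter_upwards [hB.fix] with X hX
    simp [Bm, hX]
  have tB : Filter.Tendsto (Bm G.rc B2) (𝓝 (0, G.P0)) (𝓝 G.P0) := by
    have := anB.continuousAt.tendsto
    rwa [idB.self_of_nhds] at this
  have revB : ∀ᶠ c in 𝓝 ((0 : Cn N), G.P0), Bm G.rc B2 (- c.1, Bm G.rc B2 c) = c.2 := by
    filter_upwards [hB.rev, invB] with c h1 h2
    unfold Bm at h2 ⊢
    simp only [h2, h1]
  have conjA : ∀ c, sg N (Am G.rc B2 c) = Bm G.rc B2 (cj N c.1, sg N c.2) := by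
    intro c; rw [Am, sg_sg]
  have conjB : ∀ c, sg N (Bm G.rc B2 c) = Am G.rc B2 (cj N c.1, sg N c.2) := by
    intro c; rw [Am, cj_cj, sg_sg]
  have t2 : Filter.Tendsto (fun c : Cn N × YY N => c.2) (𝓝 (0, G.P0)) (𝓝 G.P0) :=
    (by fun_prop : Continuous (fun c : Cn N × YY N => c.2)).tendsto (0, G.P0)
  refine ⟨hfix, ?_, anB, ?_, idB, ?_, invB, ?_, revB, conjA, conjB⟩
  · exact conj_analytic cσ (sg N) (f := Bm G.rc B2) (x := (0, G.P0)) (by rw [hcσ, hfix, map_zero]; exact anB)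
  · filter_upwards [tσ.eventually idB] with X hX
    rw [Am, map_zero, hX, sg_sg]
  · filter_upwards [tcσ.eventually invB, (tB.comp tcσ).eventually G.sym, t2.eventually G.sym] with c h1 h2 h3
    rw [Am]
    change G.rc (sg N (Bm G.rc B2 (cσ c))) = _
    simp only [Function.comp_apply] at h2
    rw [h2, h1, hcσ, h3, cf_cf]
  · filter_upwards [tcσ.eventually revB] with c h1
    rw [Am, map_neg, conjA, ]
    rw [hcσ] at h1
    rw [h1, sg_sg]

end adm

section leaf

variable {N d : ℕ}

lemma fderiv_sub_map {E E' F : Type*} [NormedAddCommGroup E] [NormedSpace ℝ E] [NormedAddCommGroup E']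
    [NormedSpace ℝ E'] [NormedAddCommGroup F] [NormedSpace ℝ F] {Q : E → F} {m : E' → E} {e : E' → F}
    {a : E'} {b : E} (hb : m a = b) (hm : DifferentiableAt ℝ m a) (hQ : DifferentiableAt ℝ Q b)
    (he : ∀ᶠ y in 𝓝 a, e y = Q (m y)) (u : E') :
    fderiv ℝ e a u = fderiv ℝ Q b (fderiv ℝ m a u) := by
  subst hb
  have h1 : HasFDerivAt (fun y => Q (m y)) ((fderiv ℝ Q (m a)).comp (fderiv ℝ m a)) a :=
    HasFDerivAt.comp a hQ.hasFDerivAt hm.hasFDerivAt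
  rw [(h1.congr_of_eventuallyEq he).fderiv]; rfl

lemma rk_comp_inj {E E' F G : Type*} [NormedAddCommGroup E] [NormedSpace ℝ E] [NormedAddCommGroup E'] [NormedSpace ℝ E']
    [NormedAddCommGroup F] [NormedSpace ℝ F] [NormedAddCommGroup G] [NormedSpace ℝ G]
    [FiniteDimensional ℝ G] [FiniteDimensional ℝ F] 
    (L : E →L[ℝ] F) (J : F → G) (J' : F →L[ℝ] G) (hJ : Function.Injective J') (K : E' →L[ℝ] G)
    (h : ∀ u, ∃ u', K u' = J' (L u)) : rk L ≤ rk K := by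
  unfold rk
  have h1 : Module.finrank ℝ (LinearMap.range (L : E →ₗ[ℝ] F)) =
      Module.finrank ℝ ((LinearMap.range (L : E →ₗ[ℝ] F)).map (J' : F →ₗ[ℝ] G)) :=
    (LinearEquiv.finrank_eq (Submodule.equivMapOfInjective (J' : F →ₗ[ℝ] G) hJ _))
  rw [h1]
  apply Submodule.finrank_mono
  rintro _ ⟨_, ⟨u, rfl⟩, rfl⟩
  obtain ⟨u', hu'⟩ := h u
  exact ⟨u', hu'⟩

/-- an equivariant projection onto an invariant subspace -/
lemma exists_equiv_proj (T : Submodule ℝ (YY N)) (hT : ∀ x ∈ T, sg N x ∈ T) :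
    ∃ Pr : YY N →L[ℝ] YY N, (∀ x, Pr x ∈ T) ∧ (∀ x ∈ T, Pr x = x) ∧ ∀ x, Pr (sg N x) = sg N (Pr x) := by
  obtain ⟨π, hπ⟩ := (Submodule.subtype T).exists_leftInverse_of_injective (by simp)
  have hπ' : ∀ x : T, π x = x := fun x => congrArg (fun l => l x) hπ
  let P1 : YY N →L[ℝ] YY N := LinearMap.toContinuousLinearMap (T.subtype ∘ₗ π)
  have h1 : ∀ x, P1 x ∈ T := fun x => (π x).2
  have h2 : ∀ x ∈ T, P1 x = x := fun x hx => congrArg Subtype.val (hπ' ⟨x, hx⟩)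
  let S := antiR (sg N)
  have hS : ∀ x, S x = sg N x := fun _ => rfl
  refine ⟨(1/2 : ℝ) • (P1 + S.comp (P1.comp S)), ?_, ?_, ?_⟩
  · intro x
    exact T.smul_mem _ (T.add_mem (h1 x) (hT _ (h1 _)))
  · intro x hx
    simp only [ContinuousLinearMap.smul_apply, ContinuousLinearMap.add_apply, ContinuousLinearMap.comp_apply]
    rw [h2 x hx, hS x, h2 _ (hT x hx), hS, sg_sg, ← two_smul ℝ x, smul_smul]
    norm_num
  · intro x
    simp only [ContinuousLinearMap.smul_apply, ContinuousLinearMap.add_apply, ContinuousLinearMap.comp_apply]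
    rw [← hS (_ • _), map_smul, map_add, hS (sg N x), sg_sg, hS (S (P1 (S x))), hS (P1 (S x)), sg_sg,
      hS (P1 x), hS x, add_comm]


theorem leaf_core {rc : YY N → Fin d → ℂ} {P0 : YY N} {A B : Cn N × YY N → YY N} (hσ : sg N P0 = P0)
    {Y E : Type} [NormedAddCommGroup Y] [NormedSpace ℝ Y] [FiniteDimensional ℝ Y]
    [NormedAddCommGroup E] [NormedSpace ℝ E] [FiniteDimensional ℝ E]
    {e : Y → YY N} {F : E → YY N} {y0 : Y} {q0 : E} {m1 m2 : Y → E} {mA mB : Y × Cn N → E}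
    (he : AnalyticAt ℝ e y0) (hF : AnalyticAt ℝ F q0) (he0 : e y0 = P0)
    (hm1 : DifferentiableAt ℝ m1 y0) (hm2 : DifferentiableAt ℝ m2 y0) (hm10 : m1 y0 = q0) (hm20 : m2 y0 = q0)
    (hmA : ContinuousAt mA (y0, 0)) (hmA0 : mA (y0, 0) = q0)
    (hmB : ContinuousAt mB (y0, 0)) (hmB0 : mB (y0, 0) = q0)
    (h1 : ∀ᶠ y in 𝓝 y0, e y = F (m1 y)) (h2 : ∀ᶠ y in 𝓝 y0, sg N (e y) = F (m2 y))
    (h3 : ∀ᶠ c in 𝓝 (y0, (0 : Cn N)), A (c.2, e c.1) = F (mA c))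
    (h4 : ∀ᶠ c in 𝓝 (y0, (0 : Cn N)), B (c.2, e c.1) = F (mB c))
    (h5 : ∀ᶠ y in 𝓝 y0, rc (e y) = 0) {r : ℕ} (hr1 : r ≤ rk (fderiv ℝ e y0))
    (hr2 : ∀ᶠ q in 𝓝 q0, rk (fderiv ℝ F q) ≤ r) :
      ∃ (Pr : YY N →L[ℝ] YY N) (φ : YY N → YY N),
        (∀ x, Pr x ∈ LinearMap.range (fderiv ℝ e y0).toLinearMap) ∧
        (∀ u, Pr (fderiv ℝ e y0 u) = fderiv ℝ e y0 u) ∧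
        (∀ x, Pr (sg N x) = sg N (Pr x)) ∧ AnalyticAt ℝ φ P0 ∧ (∀ x, φ (Pr x) = φ x) ∧ φ P0 = P0 ∧
        (∀ᶠ x in 𝓝 P0, Pr (φ x) = Pr x) ∧ (∀ᶠ x in 𝓝 P0, rc (φ x) = 0) ∧
        (∀ᶠ x in 𝓝 P0, sg N x = x → sg N (φ x) = φ x) ∧
        ∀ᶠ x in 𝓝 P0, ∀ᶠ u in 𝓝 (0 : Cn N), φ (A (u, φ x)) = A (u, φ x) ∧
          φ (B (u, φ x)) = B (u, φ x) := by
  have d1 : ∀ u, fderiv ℝ e y0 u = fderiv ℝ F q0 (fderiv ℝ m1 y0 u) :=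
    fderiv_sub_map hm10 hm1 hF.differentiableAt h1
  set T := LinearMap.range (fderiv ℝ e y0).toLinearMap with hT
  have hle : T ≤ LinearMap.range (fderiv ℝ F q0).toLinearMap := by
    rintro _ ⟨u, rfl⟩
    exact ⟨_, (d1 u).symm⟩
  have hTF : T = LinearMap.range (fderiv ℝ F q0).toLinearMap := by
    apply Submodule.eq_of_le_of_finrank_le hle
    exact (hr2.self_of_nhds).trans hr1
  have hrF : rk (fderiv ℝ F q0) = rk (fderiv ℝ e y0) := by
    unfold rk; rw [← hTF]
  have hσT : ∀ x ∈ T, sg N x ∈ T := by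
    rintro _ ⟨u, rfl⟩
    rw [hTF]
    have hs : HasFDerivAt (fun y => antiR (sg N) (e y)) ((antiR (sg N)).comp (fderiv ℝ e y0)) y0 :=
      (antiR (sg N)).hasFDerivAt.comp y0 he.differentiableAt.hasFDerivAt
    have h := fderiv_sub_map (e := fun y => antiR (sg N) (e y)) hm20 hm2 hF.differentiableAt h2 u
    rw [hs.fderiv] at h
    exact ⟨_, h.symm⟩
  obtain ⟨Pr, p1, p2, p3⟩ := exists_equiv_proj T hσT
  have hPD : ∀ u, Pr (fderiv ℝ e y0 u) = fderiv ℝ e y0 u := fun u => p2 _ ⟨u, rfl⟩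
  have hF0 : F q0 = P0 := by rw [← he0, h1.self_of_nhds, hm10]
  obtain ⟨φ, hφ, φP, φF⟩ := const_rank hF (hr2.mono fun q hq => hq.trans (hrF ▸ hr1)) Pr
    (fun x => p2 _ (by rw [hTF]; exact ⟨x, rfl⟩)) (fun y => by
      have := p1 y
      rw [hTF] at this
      exact this)
  have φF' : ∀ᶠ q in 𝓝 q0, φ (F q) = F q := by
    filter_upwards [φF] with q hq
    rw [φP] at hq; exact hq.symm
  rw [hF0] at hφ
  have hφ' : AnalyticAt ℝ φ P0 := by
    have h := analyticAt_clm_comp Pr hφ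
    exact h.congr (Filter.Eventually.of_forall φP)
  have t1 : Filter.Tendsto m1 (𝓝 y0) (𝓝 q0) := by
    have := hm1.continuousAt.tendsto; rwa [hm10] at this
  have t2 : Filter.Tendsto m2 (𝓝 y0) (𝓝 q0) := by
    have := hm2.continuousAt.tendsto; rwa [hm20] at this
  have tA : Filter.Tendsto mA (𝓝 (y0, 0)) (𝓝 q0) := by
    have := hmA.tendsto; rwa [hmA0] at this
  have tB : Filter.Tendsto mB (𝓝 (y0, 0)) (𝓝 q0) := by
    have := hmB.tendsto; rwa [hmB0] at this
  have e1 : ∀ᶠ y in 𝓝 y0, φ (e y) = e y := by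
    filter_upwards [h1, t1.eventually φF'] with y a b
    rw [a, b]
  have e2 : ∀ᶠ y in 𝓝 y0, φ (sg N (e y)) = sg N (e y) := by
    filter_upwards [h2, t2.eventually φF'] with y a b
    rw [a, b]
  have e3 : ∀ᶠ c in 𝓝 (y0, (0 : Cn N)), φ (A (c.2, e c.1)) = A (c.2, e c.1) ∧
      φ (B (c.2, e c.1)) = B (c.2, e c.1) := by
    filter_upwards [h3, tA.eventually φF', h4, tB.eventually φF'] with y a b a' b'
    rw [a, b, a', b']; simp
  -- local section
  let PT : YY N →L[ℝ] T := Pr.codRestrict T p1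
  have hPT : ∀ x, (PT x : YY N) = Pr x := fun _ => rfl
  have hm : HasFDerivAt (fun y => PT (e y)) (PT.comp (fderiv ℝ e y0)) y0 :=
    PT.hasFDerivAt.comp y0 he.differentiableAt.hasFDerivAt
  have hman : AnalyticAt ℝ (fun y => PT (e y)) y0 := (PT.analyticAt _).comp he
  obtain ⟨s, hs, hs0, hs1⟩ := analytic_rightInv hman (by
    rw [hm.fderiv]
    rintro ⟨_, u, rfl⟩
    exact ⟨u, Subtype.ext (hPD u)⟩)
  have ts : Filter.Tendsto (fun x => s (PT x)) (𝓝 P0) (𝓝 y0) := by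
    have h : ContinuousAt (fun x => s (PT x)) P0 := by
      refine ContinuousAt.comp (g := s) ?_ PT.continuous.continuousAt
      rw [← he0]; exact hs.continuousAt
    have h' := h.tendsto
    rw [← he0, hs0] at h'
    rwa [← he0]
  have tP : Filter.Tendsto (fun x => PT x) (𝓝 P0) (𝓝 (PT (e y0))) := by
    rw [he0]; exact PT.continuous.tendsto P0
  have k0 : ∀ᶠ x in 𝓝 P0, Pr (e (s (PT x))) = Pr x := by
    filter_upwards [tP.eventually hs1] with x hx
    exact congrArg Subtype.val hx
  have k1 : ∀ᶠ x in 𝓝 P0, φ x = e (s (PT x)) := by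
    filter_upwards [k0, ts.eventually e1] with x hx h
    rw [← h, ← φP, ← hx, φP]
  refine ⟨Pr, φ, p1, hPD, p3, hφ', φP, ?_, ?_, ?_, ?_, ?_⟩
  · have := e1.self_of_nhds
    rwa [he0] at this
  · filter_upwards [k0, k1] with x a b
    rw [b, a]
  · filter_upwards [k1, ts.eventually h5] with x a b
    rw [a, b]
  · filter_upwards [k0, k1, ts.eventually e2] with x a b c hx
    have h : φ (sg N (φ x)) = sg N (φ x) := by rw [b, c]
    rw [← h, ← φP, p3, b, a, ← p3, φP, hx, b]
  · have ts2 : Filter.Tendsto (fun c : YY N × Cn N => (s (PT c.1), c.2)) (𝓝 (P0, 0)) (𝓝 (y0, 0)) := by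
      exact (ts.comp (continuous_fst.tendsto (P0, (0 : Cn N)))).prodMk_nhds
        (continuous_snd.tendsto (P0, (0 : Cn N)))
    filter_upwards [(ts2.eventually e3).curry_nhds, k1] with x hx b
    filter_upwards [hx] with u hu
    rw [b]; exact hu

lemma rk_aux {V W Z : Type} [NormedAddCommGroup V] [NormedSpace ℂ V] 
    [NormedAddCommGroup W] [NormedSpace ℂ W] [NormedAddCommGroup Z] [NormedSpace ℂ Z] [FiniteDimensional ℂ Z]
    {f : V × Z → Z} {f' : W × Z → Z} {v : V} {w : W} {P0 : Z}
    (anf : AnalyticAt ℂ f (v, P0)) (anf' : AnalyticAt ℂ f' (w, f (v, P0)))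
    (hid : ∀ᶠ X in 𝓝 P0, f' (w, f (v, X)) = X) :
    rk (fderiv ℝ (fun v => f (v, P0)) v) ≤ rk (fderiv ℝ (fun y : V × W => f' (y.2, f (y.1, P0))) (v, w)) := by
  have hfv : AnalyticAt ℂ (fun v => f (v, P0)) v :=
    AnalyticAt.comp (g := f) (f := fun z : V => (z, P0)) anf (analyticAt_id.prod analyticAt_const)
  have df : DifferentiableAt ℝ (fun v => f (v, P0)) v := hfv.differentiableAt.restrictScalars ℝ
  have dfX : DifferentiableAt ℝ (fun X => f (v, X)) P0 :=
    (AnalyticAt.comp (g := f) (f := fun X : Z => (v, X)) anf (analyticAt_const.prod analyticAt_id)).differentiableAt.restrictScalars ℝ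
  have df' : DifferentiableAt ℝ (fun X => f' (w, X)) (f (v, P0)) :=
    (AnalyticAt.comp (g := f') (f := fun X : Z => (w, X)) anf' (analyticAt_const.prod analyticAt_id)).differentiableAt.restrictScalars ℝ
  have de : DifferentiableAt ℝ (fun y : V × W => f' (y.2, f (y.1, P0))) (v, w) := by
    refine DifferentiableAt.comp (g := f') (f := fun y : V × W => (y.2, f (y.1, P0))) (v, w)
      (anf'.differentiableAt.restrictScalars ℝ) ?_
    exact differentiableAt_snd.prodMk (DifferentiableAt.comp (g := fun v => f (v, P0)) (f := fun y : V × W => y.1)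
      (v, w) df differentiableAt_fst)
  refine rk_comp_inj (fderiv ℝ (fun v => f (v, P0)) v) id (fderiv ℝ (fun X => f' (w, X)) (f (v, P0))) ?_ (fderiv ℝ (fun y : V × W => f' (y.2, f (y.1, P0))) (v, w)) ?_
  · have hs : Function.Surjective (fderiv ℝ (fun X => f' (w, X)) (f (v, P0))).toLinearMap := by
      intro u
      refine ⟨fderiv ℝ (fun X => f (v, X)) P0 u, ?_⟩
      have := fderiv_sub_map (e := fun X => X) (m := fun X => f (v, X)) (Q := fun X => f' (w, X)) (a := P0) rfl dfX df'
        (hid.mono fun X hX => hX.symm) u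
      rw [fderiv_id'] at this
      exact this.symm
    exact LinearMap.injective_iff_surjective.mpr hs
  · intro u
    have dm : DifferentiableAt ℝ (fun v' : V => (v', w)) v := differentiableAt_id.prodMk (differentiableAt_const _)
    have e1 := fderiv_sub_map (e := fun v' => f' (w, f (v', P0))) (m := fun v' : V => (v', w))
      (Q := fun y : V × W => f' (y.2, f (y.1, P0))) (a := v) (b := (v, w)) rfl dm de (Filter.Eventually.of_forall fun _ => rfl) u
    have e2 := fderiv_sub_map (e := fun v' => f' (w, f (v', P0))) (m := fun v' => f (v', P0))
      (Q := fun X => f' (w, X)) (a := v) rfl df df' (Filter.Eventually.of_forall fun _ => rfl) u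
    exact ⟨_, e1.symm.trans e2⟩

set_option maxHeartbeats 1000000 in
theorem leaf {rc : YY N → Fin d → ℂ} {P0 : YY N} {A B : Cn N × YY N → YY N}
    (hF : FlowOK rc P0 A B) (hP0 : rc P0 = 0) :
    ∃ (V : Type) (_ : NormedAddCommGroup V) (_ : NormedSpace ℂ V) (_ : FiniteDimensional ℂ V)
      (g : V × YY N → YY N), Adm A B V g ∧ ∃ᶠ y in 𝓝 (0 : V), g (y, P0) = P0 ∧
      AnalyticAt ℂ (fun y => g (y, P0)) y ∧ (∀ᶠ y' in 𝓝 y, rc (g (y', P0)) = 0) ∧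
      ∃ (Pr : YY N →L[ℝ] YY N) (φ : YY N → YY N),
        (∀ x, Pr x ∈ LinearMap.range (fderiv ℂ (fun y => g (y, P0)) y).toLinearMap) ∧
        (∀ u, Pr (fderiv ℂ (fun y => g (y, P0)) y u) = fderiv ℂ (fun y => g (y, P0)) y u) ∧
        (∀ x, Pr (sg N x) = sg N (Pr x)) ∧ AnalyticAt ℝ φ P0 ∧ (∀ x, φ (Pr x) = φ x) ∧ φ P0 = P0 ∧
        (∀ᶠ x in 𝓝 P0, Pr (φ x) = Pr x) ∧ (∀ᶠ x in 𝓝 P0, rc (φ x) = 0) ∧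
        (∀ᶠ x in 𝓝 P0, sg N x = x → sg N (φ x) = φ x) ∧
        ∀ᶠ x in 𝓝 P0, ∀ᶠ u in 𝓝 (0 : Cn N), φ (A (u, φ x)) = A (u, φ x) ∧
          φ (B (u, φ x)) = B (u, φ x) := by
  -- maximal rank
  let IsR : ℕ → Prop := fun k => ∃ (V : Type) (_ : NormedAddCommGroup V) (_ : NormedSpace ℂ V)
    (_ : FiniteDimensional ℂ V) (f : V × YY N → YY N), Adm A B V f ∧
    ∃ᶠ v in 𝓝 (0 : V), k ≤ rk (fderiv ℝ (fun v => f (v, P0)) v)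
  obtain ⟨r, ⟨V, _, _, _, f, hf, hfr⟩, hmax⟩ := exists_max_nat (P := IsR)
    ⟨_, _, _, inferInstance, A, Adm.A, Filter.Frequently.of_forall fun _ => Nat.zero_le _⟩
    (Module.finrank ℝ (YY N)) (by
      rintro k ⟨V, _, _, _, f, hf, hfr⟩
      obtain ⟨v, hv⟩ := hfr.exists
      exact hv.trans (rk_le _))
  have hub : ∀ (V : Type) [NormedAddCommGroup V] [NormedSpace ℂ V]
      [FiniteDimensional ℂ V] (f : V × YY N → YY N), Adm A B V f →
      ∀ᶠ v in 𝓝 (0 : V), rk (fderiv ℝ (fun v => f (v, P0)) v) ≤ r := by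
    intro V _ _ _ f hf
    by_contra hcon
    rw [Filter.not_eventually] at hcon
    have := hmax (r + 1) ⟨V, _, _, _, f, hf, hcon.mono fun v hv => by omega⟩
    omega
  have pf := hf.props hF
  obtain ⟨W, _, _, _, f', L, hf', hrev⟩ := pf.rev
  have pf' := hf'.props hF
  have hg := hf.comp hf'
  set g : (V × W) × YY N → YY N := fun c => f' (c.1.2, f (c.1.1, c.2)) with hgdef
  have pg := hg.props hF
  obtain ⟨Z, _, _, _, gt, c, ci, hgt, hc1, hc2, hcg⟩ := pg.cnj
  have pgt := hgt.props hF
  set Q : ((((V × W) × Z) × Cn N) × Cn N) × YY N → YY N :=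
    fun c => B (c.1.2, A (c.1.1.2, gt (c.1.1.1.2, g (c.1.1.1.1, c.2)))) with hQdef
  have hQ : Adm A B ((((V × W) × Z) × Cn N) × Cn N) Q := ((hg.comp hgt).comp Adm.A).comp Adm.B
  have pQ := hQ.props hF
  refine ⟨V × W, inferInstance, inferInstance, inferInstance, g, hg, ?_⟩
  let ys : V → V × W := fun v => (v, L v)
  have hys : Continuous ys := by fun_prop
  have hys0 : ys 0 = 0 := by simp [ys]
  have tys : Filter.Tendsto ys (𝓝 0) (𝓝 0) := by simpa [hys0] using hys.tendsto 0
  let qs : V → (((V × W) × Z) × Cn N) × Cn N := fun v => (((ys v, c (ys v)), 0), 0)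
  have hqs : Continuous qs := by
    have := c.continuous
    fun_prop
  have tqs : Filter.Tendsto qs (𝓝 0) (𝓝 0) := by
    have := hqs.tendsto 0
    have h0 : qs 0 = 0 := by simp [qs, hys0]
    rwa [h0] at this
  have tmk : ∀ {Z : Type} [NormedAddCommGroup Z], Filter.Tendsto (fun z : Z => (z, P0)) (𝓝 0) (𝓝 (0, P0)) :=
    fun {Z} _ => (by fun_prop : Continuous (fun z : Z => (z, P0))).tendsto 0
  have tff : Filter.Tendsto (fun v => (L v, f (v, P0))) (𝓝 0) (𝓝 (0, P0)) := by
    refine Filter.Tendsto.prodMk_nhds ?_ (pf.tend.comp tmk)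
    simpa using L.continuous.tendsto 0
  refine tys.frequently ((hfr.and_eventually (((hrev.curry_nhds.and ((tmk.eventually pf.an.eventually_analyticAt).and
    (tff.eventually pf'.an.eventually_analyticAt))).and (((tmk.comp tys).eventually pg.an.eventually_analyticAt).and
    ((tmk.comp tqs).eventually pQ.an.eventually_analyticAt))).and
    ((tqs.eventually (hub _ Q hQ).eventually_nhds).and ((tmk.comp tys).eventually pg.inv.eventually_nhds)))).mono ?_)
  rintro v ⟨hrv, ⟨⟨hid, anf, anf'⟩, ang, anQ⟩, hrQ, hinv⟩
  simp only [Function.comp_apply] at hid ang anQ hinv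
  set y0 : V × W := ys v with hy0
  have gid : ∀ᶠ X in 𝓝 P0, g (y0, X) = X := hid
  have g0 : g (y0, P0) = P0 := gid.self_of_nhds
  have lin1 : ∀ {Z : Type} [NormedAddCommGroup Z] [NormedSpace ℂ Z] (z : Z),
      AnalyticAt ℂ (fun z : Z => (z, P0)) z := fun z => analyticAt_id.prod analyticAt_const
  have hean : AnalyticAt ℂ (fun y => g (y, P0)) y0 := AnalyticAt.comp (g := g) ang (lin1 y0)
  have hFan : AnalyticAt ℂ (fun q => Q (q, P0)) (qs v) := AnalyticAt.comp (g := Q) anQ (lin1 (qs v))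
  have te : Filter.Tendsto (fun y => g (y, P0)) (𝓝 y0) (𝓝 P0) := by
    have := hean.continuousAt.tendsto
    rwa [g0] at this
  have tσ : Filter.Tendsto (fun X => sg N X) (𝓝 P0) (𝓝 P0) := by
    have := (sg N).continuous.tendsto P0
    rwa [hF.fixP] at this
  have gtid : ∀ᶠ X in 𝓝 P0, gt (c y0, X) = X := by
    filter_upwards [tσ.eventually gid] with X hX
    have := hcg (y0, sg N X)
    simp only at this
    rw [hX, sg_sg] at this
    exact this.symm
  have hreal : ∀ {Z : Type} [NormedAddCommGroup Z] [NormedSpace ℂ Z] {k : Z → YY N} {z : Z},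
      AnalyticAt ℂ k z → fderiv ℝ k z = (fderiv ℂ k z).restrictScalars ℝ := fun h =>
    h.differentiableAt.fderiv_restrictScalars ℝ
  have hrk : r ≤ rk (fderiv ℝ (fun y => g (y, P0)) y0) := hrv.trans (rk_aux anf anf' hid)
  have dc : DifferentiableAt ℝ (fun y => c y) y0 := (antiR c).differentiableAt
  have tu : Filter.Tendsto (fun k : (V × W) × Cn N => g (k.1, P0)) (𝓝 (y0, 0)) (𝓝 P0) :=
    te.comp (continuous_fst.tendsto (y0, (0 : Cn N)))
  have tu2 : Filter.Tendsto (fun k : (V × W) × Cn N => (k.2, g (k.1, P0))) (𝓝 (y0, 0)) (𝓝 (0, P0)) :=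
    (continuous_snd.tendsto (y0, (0 : Cn N))).prodMk_nhds tu
  have tA : Filter.Tendsto A (𝓝 (0, P0)) (𝓝 P0) := (Adm.A.props hF).tend
  obtain ⟨Pr, φ, a1, a2, a3⟩ := leaf_core (rc := rc) (P0 := P0) (A := A) (B := B) hF.fixP
    (e := fun y => g (y, P0)) (F := fun q => Q (q, P0)) (y0 := y0) (q0 := qs v)
    (m1 := fun y => (((y, c y0), 0), 0)) (m2 := fun y => (((y0, c y), 0), 0))
    (mA := fun k => (((k.1, c y0), k.2), 0)) (mB := fun k => (((k.1, c y0), 0), k.2))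
    (hean.restrictScalars) (hFan.restrictScalars) g0 (by fun_prop) (by fun_prop) rfl rfl
    (by fun_prop) rfl (by fun_prop) rfl
    (by filter_upwards [te.eventually gtid, te.eventually hF.idA, te.eventually hF.idB] with y k1 k2 k3
        simp only [hQdef]
        rw [k1, k2, k3])
    (by filter_upwards [(tσ.comp te).eventually hF.idA, (tσ.comp te).eventually hF.idB] with y k2 k3
        have := hcg (y, P0)
        simp only [hF.fixP, Function.comp_apply] at this k2 k3
        simp only [hQdef]
        rw [g0, ← this, k2, k3])
    (by filter_upwards [tu.eventually gtid, (tA.comp tu2).eventually hF.idB] with y k1 k2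
        simp only [Function.comp_apply] at k2
        simp only [hQdef]
        rw [k1, k2])
    (by filter_upwards [tu.eventually gtid, tu.eventually hF.idA] with y k1 k2
        simp only [hQdef]
        rw [k1, k2])
    (by have t : Filter.Tendsto (fun y => (y, P0)) (𝓝 y0) (𝓝 (y0, P0)) :=
          (by fun_prop : Continuous (fun y : V × W => (y, P0))).tendsto y0
        filter_upwards [t.eventually hinv] with y k1
        rw [k1, hP0]) hrk hrQ
  refine ⟨g0, hean, ?_, Pr, φ, ?_, ?_, a3⟩
  · have t : Filter.Tendsto (fun y => (y, P0)) (𝓝 y0) (𝓝 (y0, P0)) :=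
      (by fun_prop : Continuous (fun y : V × W => (y, P0))).tendsto y0
    filter_upwards [t.eventually hinv] with y k1
    rw [k1, hP0]
  · intro x
    obtain ⟨u, hu⟩ := a1 x
    rw [hreal hean] at hu
    exact ⟨u, hu⟩
  · intro u
    have := a2 u
    rwa [hreal hean] at this

end leaf

section minimal

lemma graph_submanifold {E : Type} [NormedAddCommGroup E] [NormedSpace ℝ E] [FiniteDimensional ℝ E]
    {π : E →L[ℝ] E} {φ : E → E} {U : Set E} (hπ : ∀ x, π (π x) = π x) (hU : IsOpen U)
    (hφ : ∀ z ∈ U, AnalyticAt ℝ φ z) (h1 : ∀ z, φ (π z) = φ z) (h2 : ∀ z ∈ U, π (φ z) = π z)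
    {q : E} (hq : q ∈ U) : IsRASubmanifoldAt {z | z ∈ U ∧ φ z = z} q
      (Module.finrank ℝ (LinearMap.range π.toLinearMap)) := by
  set K := LinearMap.ker π.toLinearMap with hK
  let c := Module.finrank ℝ K
  let e : K ≃L[ℝ] (Fin c → ℝ) := ContinuousLinearEquiv.ofFinrankEq (by simp [c])
  have hmem : ∀ x, x - π x ∈ K := by
    intro x
    rw [hK, LinearMap.mem_ker]
    change π (x - π x) = 0
    rw [map_sub, hπ, sub_self]
  let Λ : E →L[ℝ] K := (ContinuousLinearMap.id ℝ E - π).codRestrict K hmem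
  have hΛ : ∀ x, (Λ x : E) = x - π x := fun _ => rfl
  let ρ : E → Fin c → ℝ := fun z => e (Λ (z - φ z))
  have han : ∀ z ∈ U, AnalyticAt ℝ ρ z := by
    intro z hz
    have := ((e.toContinuousLinearMap.comp Λ).analyticAt (z - φ z)).comp_of_eq
      (f := fun z => z - φ z) (analyticAt_id.sub (hφ z hz)) rfl
    exact this
  refine ⟨c, U, ρ, hU, hq, ?_, ?_, ?_, ?_⟩
  · exact LinearMap.finrank_range_add_finrank_ker π.toLinearMap
  · intro k z hz
    exact (analyticAt_pi_iff.1 (han z hz)) k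
  · ext z
    constructor
    · rintro ⟨⟨a, b⟩, _⟩
      refine ⟨a, fun k => ?_⟩
      simp [ρ, b]
    · rintro ⟨a, b⟩
      refine ⟨⟨a, ?_⟩, a⟩
      have h3 : e (Λ (z - φ z)) = 0 := funext b
      have h4 : Λ (z - φ z) = 0 := (map_eq_zero_iff e e.injective).1 h3
      have h5 : (z - φ z) - π (z - φ z) = 0 := by rw [← hΛ, h4]; rfl
      rw [map_sub, h2 z a, sub_self, sub_zero, sub_eq_zero] at h5
      exact h5.symm
  · rintro x ⟨⟨hx, hx'⟩, _⟩
    have hd : HasFDerivAt ρ ((e.toContinuousLinearMap.comp Λ).comp (ContinuousLinearMap.id ℝ E - fderiv ℝ φ x)) x :=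
      (e.toContinuousLinearMap.comp Λ).hasFDerivAt.comp (f := fun z => z - φ z) x
        ((hasFDerivAt_id x).sub (hφ x hx).differentiableAt.hasFDerivAt)
    have hdφ : ∀ w ∈ K, fderiv ℝ φ x w = 0 := by
      intro w hw
      have hw' : π w = 0 := hw
      have h : HasDerivAt (fun t : ℝ => φ (x + t • w)) (fderiv ℝ φ x w) 0 :=
        (hφ x hx).differentiableAt.hasFDerivAt.hasLineDerivAt w
      have h' : (fun t : ℝ => φ (x + t • w)) = fun _ => φ x := by
        funext t
        rw [← h1, map_add, map_smul, hw', smul_zero, add_zero, h1]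
      rw [h'] at h
      exact h.unique (hasDerivAt_const _ _)
    rw [Fintype.linearIndependent_iff]
    intro a ha i
    have h := congrArg (fun l => l ((e.symm (Pi.single i 1) : K) : E)) ha
    simp only [ContinuousLinearMap.sum_apply, ContinuousLinearMap.smul_apply, ContinuousLinearMap.zero_apply] at h
    have hk : ∀ k, fderiv ℝ (fun z => ρ z k) x ((e.symm (Pi.single i 1) : K) : E) = (Pi.single i 1 : Fin c → ℝ) k := by
      intro k
      rw [fderiv_pi_apply hd.differentiableAt, hd.fderiv]
      have hw := hdφ _ (e.symm (Pi.single i 1)).2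
      have hw2 : π ((e.symm (Pi.single i 1) : K) : E) = 0 := (e.symm (Pi.single i 1)).2
      have : Λ (((e.symm (Pi.single i 1) : K) : E)) = e.symm (Pi.single i 1) := by
        apply Subtype.ext
        rw [hΛ, hw2, sub_zero]
      simp [hw, this]
    simp only [hk] at h
    simpa [Pi.single_apply] using h

lemma graph_tangent {E : Type} [NormedAddCommGroup E] [NormedSpace ℝ E]
    {π : E →L[ℝ] E} {φ : E → E} {U : Set E} (hU : IsOpen U)
    (hφ : ∀ z ∈ U, AnalyticAt ℝ φ z) (h1 : ∀ z, φ (π z) = φ z) (h2 : ∀ z ∈ U, π (φ z) = π z)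
    {q w : E} (hq : q ∈ U) (hq' : φ q = q) (hw : fderiv ℝ φ q w = w) :
    w ∈ tangentConeAt ℝ {z | z ∈ U ∧ φ z = z} q := by
  have hc : ∀ᶠ z in 𝓝 q, z ∈ U ∧ φ z ∈ U := by
    have hcont := (hφ q hq).continuousAt
    refine Filter.Eventually.and (hU.mem_nhds hq) (hcont.eventually ?_)
    rw [hq']; exact hU.mem_nhds hq
  have h := (hφ q hq).differentiableAt.hasFDerivAt.hasFDerivWithinAt (s := {z | z ∈ U ∧ φ z ∈ U})
  have h3 := h.mapsTo_tangent_cone (by rw [tangentConeAt_of_mem_nhds hc]; trivial : w ∈ tangentConeAt ℝ {z | z ∈ U ∧ φ z ∈ U} q)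
  rw [hw, hq'] at h3
  refine tangentConeAt_mono ?_ h3
  rintro _ ⟨z, ⟨hz, hz'⟩, rfl⟩
  exact ⟨hz', by rw [← h1, h2 z hz, h1]⟩

lemma tangentSpace_le_ker {E F : Type} [NormedAddCommGroup E] [NormedSpace ℝ E] [NormedAddCommGroup F] [NormedSpace ℝ F]
    {M : Set E} {r : E → F} {q : E} (hr : DifferentiableAt ℝ r q) (h : ∀ᶠ z in 𝓝 q, z ∈ M → r z = 0) (hq : r q = 0)
    {w : E} (hw : w ∈ tangentSpaceAt M q) : fderiv ℝ r q w = 0 := by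
  have hle : tangentSpaceAt M q ≤ LinearMap.ker (fderiv ℝ r q).toLinearMap := by
    refine Submodule.span_le.2 ?_
    intro w hw
    have hz : HasFDerivWithinAt r (0 : E →L[ℝ] F) M q := by
      refine (hasFDerivWithinAt_const (0 : F) q M).congr_of_eventuallyEq ?_ hq
      exact eventually_nhdsWithin_iff.2 h
    exact hr.hasFDerivAt.hasFDerivWithinAt.unique_on hz hw
  exact hle hw

variable {N d : ℕ}

/-- the directional derivatives of the leaf map in CR directions -/
lemma leaf_CR {rc : YY N → Fin d → ℂ} {P0 X : YY N} {B2 : YY N × (Fin d → ℂ) → Cn N} {φ : YY N → YY N} {w : Cn N}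
    {L : Cn N →L[ℂ] Cn N}
    (hB : HasFDerivAt (fun t => B2 ((X.1, X.2 + t), rc X)) L 0) (hL : L (cj N w) = cj N w)
    (hφ : DifferentiableAt ℝ φ X) (hX : sg N X = X) (hAX : Am rc B2 (0, X) = X) (hBX : Bm rc B2 (0, X) = X)
    (h : ∀ᶠ u in 𝓝 (0 : Cn N), φ (Am rc B2 (u, X)) = Am rc B2 (u, X) ∧ φ (Bm rc B2 (u, X)) = Bm rc B2 (u, X)) :
    fderiv ℝ φ X (w, cj N w) = (w, cj N w) := by
  have hb : HasFDerivAt (fun u => Bm rc B2 (u, X)) ((0 : Cn N →L[ℝ] Cn N).prod (L.restrictScalars ℝ)) 0 :=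
    (hasFDerivAt_const X.1 (0 : Cn N)).prodMk (hB.restrictScalars ℝ)
  have hcj : HasFDerivAt (fun u => cj N u) (antiR (cj N)) (0 : Cn N) := (antiR (cj N)).hasFDerivAt
  have ha : HasFDerivAt (fun u => Am rc B2 (u, X))
      ((antiR (sg N)).comp (((0 : Cn N →L[ℝ] Cn N).prod (L.restrictScalars ℝ)).comp (antiR (cj N)))) 0 := by
    have h1 : HasFDerivAt (fun u => Bm rc B2 (cj N u, X)) (((0 : Cn N →L[ℝ] Cn N).prod (L.restrictScalars ℝ)).comp (antiR (cj N))) 0 :=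
      HasFDerivAt.comp (g := fun u => Bm rc B2 (u, X)) (f := fun u => cj N u) 0 (by rw [map_zero]; exact hb) hcj
    have h2 := (antiR (sg N)).hasFDerivAt.comp (0 : Cn N) h1
    refine h2.congr_of_eventuallyEq (Filter.Eventually.of_forall fun u => ?_)
    simp only [Am, hX]
    rfl
  have key : ∀ {c : Cn N → YY N} {D : Cn N →L[ℝ] YY N}, HasFDerivAt c D 0 → c 0 = X →
      (∀ᶠ u in 𝓝 (0 : Cn N), φ (c u) = c u) → ∀ u, fderiv ℝ φ X (D u) = D u := by
    intro c D hc hc0 hc1 u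
    have h1 : HasFDerivAt (fun u => φ (c u)) ((fderiv ℝ φ X).comp D) 0 :=
      HasFDerivAt.comp (g := φ) 0 (by rw [hc0]; exact hφ.hasFDerivAt) hc
    have h2 := (hc.congr_of_eventuallyEq hc1).unique h1
    exact (congrArg (fun l => l u) h2).symm
  have k1 := key ha hAX (h.mono fun _ h => h.1) w
  have k2 := key hb hBX (h.mono fun _ h => h.2) (cj N w)
  have e1 : ((antiR (sg N)).comp (((0 : Cn N →L[ℝ] Cn N).prod (L.restrictScalars ℝ)).comp (antiR (cj N)))) w = (w, 0) := by
    change sg N ((0 : Cn N), L (cj N w)) = _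
    rw [hL]; simp
  have e2 : ((0 : Cn N →L[ℝ] Cn N).prod (L.restrictScalars ℝ)) (cj N w) = (0, cj N w) := by
    change ((0 : Cn N), L (cj N w)) = _
    rw [hL]
  rw [e1] at k1
  rw [e2] at k2
  have : ((w, cj N w) : YY N) = (w, 0) + (0, cj N w) := by simp
  rw [this, map_add, k1, k2]

lemma cr_dir (G : Gen N d) : ∀ᶠ q in 𝓝 G.p, ∀ w, fderiv ℝ G.r q w = 0 → fderiv ℝ G.r q (I • w) = 0 →
    fderiv ℂ G.rc (q, cj N q) (0, cj N w) = 0 := by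
  have t : Filter.Tendsto (fun q => (q, cj N q)) (𝓝 G.p) (𝓝 G.P0) :=
    (by fun_prop : Continuous (fun q => (q, cj N q))).tendsto G.p
  filter_upwards [t.eventually G.hrc'.eventually_analyticAt, G.ext.eventually_nhds,
    G.hr.eventually_analyticAt] with q h1 h2 h3 w hw hw'
  have hι : HasFDerivAt (fun z => fun k => (G.r z k : ℂ)) ((cplxPi d).ι.comp (fderiv ℝ G.r q)) q :=
    (cplxPi d).ι.hasFDerivAt.comp q h3.differentiableAt.hasFDerivAt
  have k : ∀ u, fderiv ℂ G.rc (q, cj N q) (u, cj N u) = (cplxPi d).ι (fderiv ℝ G.r q u) := by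
    intro u
    have := fderiv_of_ext h1.differentiableAt h2 u
    rw [← this, hι.fderiv]; rfl
  have e1 := k w
  have e2 := k (I • w)
  rw [hw, map_zero] at e1
  rw [hw', map_zero] at e2
  have d1 : ((0, cj N w) : YY N) = (2⁻¹ : ℂ) • ((w, cj N w) + I • (I • w, cj N (I • w))) := by
    ext j <;> simp [smul_smul]
    ring_nf
  rw [d1, map_smul, map_add, map_smul, e1, e2]; simp

theorem leaf_dim (G : Gen N d) {M U : Set (Cn N)} (hU : IsOpen U) (hpU : G.p ∈ U)
    (hMU : M ∩ U = {z | z ∈ U ∧ G.r z = 0}) (hmin : IsMinimalAt M d G.p)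
    {B2 : YY N × (Fin d → ℂ) → Cn N} (hB : IsB2 G.rc G.P0 B2) {Pr : YY N →L[ℝ] YY N} {φ : YY N → YY N}
    (a1 : ∀ x, Pr (Pr x) = Pr x) (a2 : ∀ x, Pr (sg N x) = sg N (Pr x)) (a3 : AnalyticAt ℝ φ G.P0)
    (a4 : ∀ x, φ (Pr x) = φ x) (a5 : φ G.P0 = G.P0) (a6 : ∀ᶠ x in 𝓝 G.P0, Pr (φ x) = Pr x)
    (a7 : ∀ᶠ x in 𝓝 G.P0, G.rc (φ x) = 0) (a8 : ∀ᶠ x in 𝓝 G.P0, sg N x = x → sg N (φ x) = φ x)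
    (a9 : ∀ᶠ x in 𝓝 G.P0, ∀ᶠ u in 𝓝 (0 : Cn N), φ (Am G.rc B2 (u, φ x)) = Am G.rc B2 (u, φ x) ∧
          φ (Bm G.rc B2 (u, φ x)) = Bm G.rc B2 (u, φ x)) :
    ∃ π : Cn N →L[ℝ] Cn N, (∀ z, (π z, cj N (π z)) = Pr (z, cj N z)) ∧
      2 * N - d ≤ Module.finrank ℝ (LinearMap.range π.toLinearMap) := by
  have hF := flowOK G hB
  let j : Cn N →L[ℝ] YY N := (cplxC N).ι
  have hj : ∀ z, j z = (z, cj N z) := cplxC_ι N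
  have hσj : ∀ z, sg N (j z) = j z := fun z => by simp [hj]
  have hj' : ∀ x, sg N x = x → x = j x.1 := by
    intro x hx
    rw [hj]
    have := congrArg Prod.snd hx
    simp only [sg_apply] at this
    rw [this]
  let π : Cn N →L[ℝ] Cn N := (ContinuousLinearMap.fst ℝ (Cn N) (Cn N)).comp (Pr.comp j)
  have hjπ : ∀ z, j (π z) = Pr (j z) := fun z => (hj' (Pr (j z)) (by rw [← a2, hσj])).symm
  have hπ : ∀ z, π (π z) = π z := by
    intro z
    change (Pr (j (π z))).1 = (Pr (j z)).1
    rw [hjπ, a1]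
  refine ⟨π, fun z => by rw [← hj, ← hj, hjπ], ?_⟩
  by_contra hlt
  rw [not_le] at hlt
  apply hmin
  let φ0 : Cn N → Cn N := fun z => (φ (j z)).1
  have h1 : ∀ z, φ0 (π z) = φ0 z := fun z => by
    change (φ (j (π z))).1 = (φ (j z)).1
    rw [hjπ, a4]
  have tj : Filter.Tendsto j (𝓝 G.p) (𝓝 G.P0) := by
    have := j.continuous.tendsto G.p
    rwa [hj] at this
  have hp : φ0 G.p = G.p := by
    change (φ (j G.p)).1 = _
    rw [hj]
    change (φ G.P0).1 = _
    rw [a5]; rfl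
  have b3 : AnalyticAt ℝ φ0 G.p := by
    have h := analyticAt_clm_comp j (f := φ) (x := G.p) (by rw [hj]; exact a3)
    exact ((ContinuousLinearMap.fst ℝ (Cn N) (Cn N)).analyticAt _).comp h
  have tφ0 : Filter.Tendsto φ0 (𝓝 G.p) (𝓝 G.p) := by
    have := b3.continuousAt.tendsto
    rwa [hp] at this
  have ev := ((tj.eventually a3.eventually_analyticAt).and ((tj.eventually a6).and ((tj.eventually a7).and
    ((tj.eventually a8).and (tj.eventually a9))))).and ((tφ0.eventually G.ext).and ((hU.eventually_mem hpU).and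
    ((cr_dir G).and ((tj.eventually (hB.deriv G.hrc')).and ((tj.eventually hF.idA).and ((tj.eventually hF.idB).and
    (G.hr.eventually_analyticAt.and b3.eventually_analyticAt)))))))
  obtain ⟨U0, hU0, hU0o, hpU0⟩ := eventually_nhds_iff.1 ev
  have hφU : ∀ z ∈ U0, AnalyticAt ℝ φ0 z := fun z hz => (hU0 z hz).2.2.2.2.2.2.2.2
  have hjφ : ∀ z ∈ U0, φ (j z) = j (φ0 z) := fun z hz => hj' _ ((hU0 z hz).1.2.2.2.1 (hσj z))
  have h2 : ∀ z ∈ U0, π (φ0 z) = π z := by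
    intro z hz
    change (Pr (j (φ0 z))).1 = (Pr (j z)).1
    rw [← hjφ z hz, (hU0 z hz).1.2.1]
  have hrz : ∀ z ∈ U0, G.r (φ0 z) = 0 := by
    intro z hz
    have e1 := (hU0 z hz).2.1
    have e2 := (hU0 z hz).1.2.2.1
    rw [hjφ z hz, hj, e1] at e2
    funext k
    have := congrFun e2 k
    simpa using this
  refine ⟨{z | z ∈ U0 ∧ φ0 z = z}, _, ?_, ⟨hpU0, hp⟩, hlt, ?_, ?_⟩
  · rintro z ⟨hz, hz'⟩
    have : z ∈ M ∩ U := by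
      rw [hMU]
      refine ⟨(hU0 z hz).2.2.1, ?_⟩
      rw [← hz']; exact hrz z hz
    exact this.1
  · rintro q ⟨hq, hq'⟩
    exact graph_submanifold hπ hU0o hφU h1 h2 hq
  · rintro q ⟨hq, hq'⟩ w ⟨hw1, w', hw'1, hw'2⟩
    obtain ⟨⟨c1, c2, c3, c4, c5⟩, c6, c7, c8, c9, c10, c11, c12, c13⟩ := hU0 q hq
    have hrq : G.r q = 0 := by rw [← hq']; exact hrz q hq
    have hMev : ∀ᶠ z in 𝓝 q, z ∈ M → G.r z = 0 := by
      filter_upwards [hU.mem_nhds c7] with z hz hzM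
      have : z ∈ M ∩ U := ⟨hzM, hz⟩
      rw [hMU] at this
      exact this.2
    have e1 := tangentSpace_le_ker c12.differentiableAt hMev hrq hw1
    have e2 := tangentSpace_le_ker c12.differentiableAt hMev hrq hw'1
    have hw2 : I • w = - w' := by
      rw [← hw'2]
      change I • (I • w') = -w'
      rw [smul_smul]; simp
    have e3 := c8 w e1 (by rw [hw2, map_neg, e2, neg_zero])
    have hjq : j q = (q, cj N q) := hj q
    rw [← hjq] at e3
    obtain ⟨f1, f2⟩ := c9 _ e3
    have hφj : φ (j q) = j q := by rw [hjφ q hq, hq']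
    rw [hφj] at c5
    have k := leaf_CR (P0 := G.P0) (w := w) f1 f2 c1.differentiableAt (hσj q) c10 c11 c5
    refine Submodule.subset_span (graph_tangent hU0o hφU h1 h2 hq hq' ?_)
    have hd : HasFDerivAt φ0 ((ContinuousLinearMap.fst ℝ (Cn N) (Cn N)).comp ((fderiv ℝ φ (j q)).comp j)) q :=
      (ContinuousLinearMap.fst ℝ (Cn N) (Cn N)).hasFDerivAt.comp q
        (HasFDerivAt.comp (g := φ) q c1.differentiableAt.hasFDerivAt j.hasFDerivAt)
    rw [hd.fderiv]
    change (fderiv ℝ φ (j q) (j w)).1 = w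
    rw [hj w, k]

theorem minimal_flow (G : Gen N d) {M U : Set (Cn N)} (hU : IsOpen U) (hpU : G.p ∈ U)
    (hMU : M ∩ U = {z | z ∈ U ∧ G.r z = 0}) (hmin : IsMinimalAt M d G.p)
    {B2 : YY N × (Fin d → ℂ) → Cn N} (hB : IsB2 G.rc G.P0 B2) :
    ∃ (V : Type) (_ : NormedAddCommGroup V) (_ : NormedSpace ℂ V) (_ : FiniteDimensional ℂ V)
      (g : V × YY N → YY N), Adm (Am G.rc B2) (Bm G.rc B2) V g ∧ ∃ᶠ y in 𝓝 (0 : V), g (y, G.P0) = G.P0 ∧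
      AnalyticAt ℂ (fun y => g (y, G.P0)) y ∧ 
      Function.Surjective (fderiv ℂ (fun y => (g (y, G.P0)).1) y) := by
  obtain ⟨V, i1, i2, i3, g, hg, hfr⟩ := leaf (flowOK G hB) G.rcP0
  refine ⟨V, i1, i2, i3, g, hg, hfr.mono ?_⟩
  rintro y ⟨h0, han, hrc, Pr, φ, b1, b2, a2, a3, a4, a5, a6, a7, a8, a9⟩
  refine ⟨h0, han, ?_⟩
  set T := LinearMap.range (fderiv ℂ (fun y => g (y, G.P0)) y).toLinearMap with hT
  have a1 : ∀ x, Pr (Pr x) = Pr x := by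
    intro x
    obtain ⟨u, hu⟩ := b1 x
    rw [← hu]; exact b2 u
  obtain ⟨π, hπ, hdim⟩ := leaf_dim G hU hpU hMU hmin hB a1 a2 a3 a4 a5 a6 a7 a8 a9
  have hTk : ∀ x ∈ T, fderiv ℂ G.rc G.P0 x = 0 := by
    rintro _ ⟨u, rfl⟩
    have h1 : HasFDerivAt (fun y => G.rc (g (y, G.P0))) ((fderiv ℂ G.rc G.P0).comp (fderiv ℂ (fun y => g (y, G.P0)) y)) y :=
      HasFDerivAt.comp (g := G.rc) y (by rw [h0]; exact G.hrc'.differentiableAt.hasFDerivAt) han.differentiableAt.hasFDerivAt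
    have h2 : HasFDerivAt (fun y => G.rc (g (y, G.P0))) (0 : V →L[ℂ] Fin d → ℂ) y :=
      (hasFDerivAt_const (0 : Fin d → ℂ) y).congr_of_eventuallyEq hrc
    exact congrArg (fun l => l u) (h1.unique h2)
  have hle : LinearMap.range π.toLinearMap ≤ LinearMap.ker (fderiv ℝ G.r G.p).toLinearMap := by
    rintro _ ⟨z, rfl⟩
    have h1 := G.fderiv_r (π z)
    rw [hπ, hTk _ (b1 _)] at h1
    have h2 := congrArg (cplxPi d).X h1
    rw [map_zero, (cplxPi d).Xι] at h2
    exact h2.symm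
  have hrank := LinearMap.finrank_range_add_finrank_ker (fderiv ℝ G.r G.p).toLinearMap
  have hsurj : LinearMap.range (fderiv ℝ G.r G.p).toLinearMap = ⊤ := LinearMap.range_eq_top.2 G.surj_r
  have hfN : Module.finrank ℝ (Cn N) = 2 * N := by
    rw [← Module.finrank_mul_finrank ℝ ℂ (Cn N)]
    simp
  rw [hsurj, hfN] at hrank
  simp only [finrank_top, Module.finrank_fintype_fun_eq_card, Fintype.card_fin] at hrank
  have heq := Submodule.eq_of_le_of_finrank_le hle (by omega)
  have hker : ∀ a, fderiv ℝ G.r G.p a = 0 → ((a, cj N a) : YY N) ∈ T := by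
    intro a ha
    have : a ∈ LinearMap.range π.toLinearMap := by rw [heq]; exact ha
    obtain ⟨z, rfl⟩ := this
    have := b1 (z, cj N z)
    rw [← hπ] at this
    exact this
  intro u
  obtain ⟨ζ, hζ⟩ := G.surj2 (- fderiv ℂ G.rc G.P0 (u, 0))
  have hz : fderiv ℂ G.rc G.P0 (u, ζ) = 0 := by
    have : ((u, ζ) : YY N) = (u, 0) + (0, ζ) := by simp
    rw [this, map_add]
    change _ + fderiv ℂ G.rc (G.p, cj N G.p) (0, ζ) = 0
    rw [hζ]; simp
  have hdec := (cplxC N).dec (u, ζ)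
  set a := (cplxC N).X (u, ζ)
  set b := (cplxC N).Y (u, ζ)
  rw [← hdec, map_add, map_smul, cplxC_ι, cplxC_ι, G.fderiv_r, G.fderiv_r] at hz
  have ha : fderiv ℝ G.r G.p a = 0 := by
    have := congrArg (cplxPi d).X hz
    rw [map_add, (cplxPi d).Xι, (cplxPi d).hX, (cplxPi d).Yι] at this
    simpa using this
  have hb : fderiv ℝ G.r G.p b = 0 := by
    have := congrArg (cplxPi d).Y hz
    rw [map_add, (cplxPi d).Yι, (cplxPi d).hY, (cplxPi d).Xι] at this
    simpa using this
  have hmem : ((u, ζ) : YY N) ∈ T := by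
    rw [← hdec, cplxC_ι, cplxC_ι]
    exact T.add_mem (hker a ha) (T.smul_mem I (hker b hb))
  obtain ⟨v, hv⟩ := hmem
  refine ⟨v, ?_⟩
  have h1 : HasFDerivAt (fun y => (g (y, G.P0)).1) ((ContinuousLinearMap.fst ℂ _ _).comp (fderiv ℂ (fun y => g (y, G.P0)) y)) y :=
    (ContinuousLinearMap.fst ℂ (Cn N) (Cn N)).hasFDerivAt.comp y han.differentiableAt.hasFDerivAt
  rw [h1.fderiv]
  exact congrArg Prod.fst hv

end minimal

section FNt
variable {N N' d : ℕ} {M : Set (Cn N)} {p : Cn N}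

lemma wirtDBar_analytic {g : Cn N → ℂ} (hg : AnalyticAt ℝ g p) (j : Fin N) :
    AnalyticAt ℝ (fun z => wirtDBar g z j) p := by
  have h1 : ∀ v, AnalyticAt ℝ (fun z => fderiv ℝ g z v) p := fun v =>
    ((ContinuousLinearMap.apply ℝ ℂ v).analyticAt _).comp hg.fderiv
  exact analyticAt_const.mul ((h1 _).add (analyticAt_const.mul (h1 _)))

lemma CRVectorField.apply_analytic (L : CRVectorField M p) {g : Cn N → ℂ} (hg : AnalyticAt ℝ g p) :
    AnalyticAt ℝ (L.apply g) p := by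
  unfold CRVectorField.apply
  exact Finset.analyticAt_fun_sum _ fun j _ => (L.analytic j p L.mem).mul (wirtDBar_analytic hg j)

lemma CRApplyList_analytic (Ls : List (CRVectorField M p)) {g : Cn N → ℂ} (hg : AnalyticAt ℝ g p) :
    AnalyticAt ℝ (CRApplyList Ls g) p := by
  induction Ls with
  | nil => exact hg
  | cons L Ls ih => exact L.apply_analytic ih

lemma CRVectorField.tang (L : CRVectorField M p) {f : Cn N → ℂ} (hf : AnalyticAt ℝ f p)
    (h0 : ∀ᶠ z in 𝓝 p, z ∈ M → f z = 0) : ∀ᶠ z in 𝓝 p, z ∈ M → L.apply f z = 0 := by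
  have hre : AnalyticAt ℝ (fun z => (f z).re) p := (Complex.reCLM.analyticAt _).comp hf
  have him : AnalyticAt ℝ (fun z => (f z).im) p := (Complex.imCLM.analyticAt _).comp hf
  have key : ∀ g : Cn N → ℝ, AnalyticAt ℝ g p → (∀ᶠ z in 𝓝 p, z ∈ M → g z = 0) →
      ∀ᶠ z in 𝓝 p, z ∈ M → (∑ j, L.coeff z j * wirtDBarR g z j) = 0 := by
    intro g hg hg0
    obtain ⟨U, hU, hUo, hpU⟩ := eventually_nhds_iff.1 (hg.eventually_analyticAt.and hg0)
    obtain ⟨V, hV, hpV, hVz⟩ := L.tangent g U hUo hpU (fun z hz => (hU z hz).1)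
      (fun z hz => (hU z hz.2).2 hz.1)
    filter_upwards [hV.mem_nhds hpV] with z hz hzM using hVz z ⟨hzM, hz⟩
  have k1 := key _ hre (h0.mono fun z hz hm => by simp [hz hm])
  have k2 := key _ him (h0.mono fun z hz hm => by simp [hz hm])
  filter_upwards [k1, k2, hf.eventually_analyticAt] with z h1 h2 h3 hzM
  have hd := h3.differentiableAt
  have e1 : ∀ u, fderiv ℝ (fun z => (f z).re) z u = (fderiv ℝ f z u).re := fun u => by
    have := (Complex.reCLM.hasFDerivAt.comp z hd.hasFDerivAt).fderiv
    have h' : (fun z => (f z).re) = Complex.reCLM ∘ f := rfl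
    rw [h', this]; rfl
  have e2 : ∀ u, fderiv ℝ (fun z => (f z).im) z u = (fderiv ℝ f z u).im := fun u => by
    have := (Complex.imCLM.hasFDerivAt.comp z hd.hasFDerivAt).fderiv
    have h' : (fun z => (f z).im) = Complex.imCLM ∘ f := rfl
    rw [h', this]; rfl
  have e3 : L.apply f z = (∑ j, L.coeff z j * wirtDBarR (fun z => (f z).re) z j) +
      I * (∑ j, L.coeff z j * wirtDBarR (fun z => (f z).im) z j) := by
    unfold CRVectorField.apply wirtDBar wirtDBarR
    rw [Finset.mul_sum, ← Finset.sum_add_distrib]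
    refine Finset.sum_congr rfl fun j _ => ?_
    rw [e1, e1, e2, e2]
    conv_lhs => rw [← Complex.re_add_im (fderiv ℝ f z (cbasis j 1)), ← Complex.re_add_im (fderiv ℝ f z (cbasis j I))]
    ring
  rw [e3, h1 hzM, h2 hzM]; simp

def LV (L : CRVectorField M p) (h : Cn N → Fin N' → ℂ) : Cn N → Fin N' → ℂ :=
  fun z j => L.apply (fun z => h z j) z

inductive InMod {κ : Type} (M : Set (Cn N)) (p : Cn N) (g : κ → Cn N → Fin N' → ℂ) :
    ℕ → (Cn N → Fin N' → ℂ) → Prop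
  | base (n : ℕ) (Ls : List (CRVectorField M p)) (k : κ) (h : Ls.length ≤ n) :
      InMod M p g n (fun z j => CRApplyList Ls (fun z => g k z j) z)
  | zero (n : ℕ) : InMod M p g n 0
  | add (n : ℕ) (h h') : InMod M p g n h → InMod M p g n h' → InMod M p g n (h + h')
  | smul (n : ℕ) (b : Cn N → ℂ) (h) (hb : AnalyticAt ℝ b p) :
      InMod M p g n h → InMod M p g n (fun z j => b z * h z j)
  | congr (n : ℕ) (h h' : Cn N → Fin N' → ℂ) (hh : ∀ j, AnalyticAt ℝ (fun z => h' z j) p)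
      (he : ∀ᶠ z in 𝓝 p, z ∈ M → h' z = h z) : InMod M p g n h → InMod M p g n h'

variable {κ : Type} {g : κ → Cn N → Fin N' → ℂ}

lemma InMod.an (hg : ∀ k j, AnalyticAt ℝ (fun z => g k z j) p) {n : ℕ} {h} (H : InMod M p g n h) :
    ∀ j, AnalyticAt ℝ (fun z => h z j) p := by
  induction H with
  | base Ls k _ => exact fun j => CRApplyList_analytic Ls (hg k j)
  | zero => exact fun j => analyticAt_const
  | add h h' _ _ i1 i2 => exact fun j => (i1 j).add (i2 j)
  | smul b h hb _ i => exact fun j => hb.mul (i j)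
  | congr h h' hh he _ _ => exact hh

lemma InMod.mono {n n' : ℕ} (hn : n ≤ n') {h} (H : InMod M p g n h) : InMod M p g n' h := by
  induction H with
  | base Ls k hl => exact .base n' Ls k (hl.trans hn)
  | zero => exact .zero _
  | add h h' _ _ i1 i2 => exact .add _ _ _ i1 i2
  | smul b h hb _ i => exact .smul _ _ _ hb i
  | congr h h' hh he _ i => exact .congr _ _ _ hh he i

lemma LV_an (L : CRVectorField M p) {h : Cn N → Fin N' → ℂ} (hh : ∀ j, AnalyticAt ℝ (fun z => h z j) p) :
    ∀ j, AnalyticAt ℝ (fun z => LV L h z j) p := fun j => L.apply_analytic (hh j)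

lemma InMod.step (L : CRVectorField M p) (hg : ∀ k j, AnalyticAt ℝ (fun z => g k z j) p) {n : ℕ} {h}
    (H : InMod M p g n h) : InMod M p g (n+1) (LV L h) := by
  induction H with
  | base Ls k hl => exact InMod.base _ (L :: Ls) k (by simpa using hl)
  | zero =>
    refine .congr _ 0 _ (LV_an L fun j => analyticAt_const) (Filter.Eventually.of_forall fun z _ => ?_) (.zero _)
    ext j
    simp [LV, CRVectorField.apply, wirtDBar]
  | add h h' H H' i1 i2 =>
    refine .congr _ _ _ (LV_an L fun j => (H.an hg j).add (H'.an hg j)) ?_ (.add _ _ _ i1 i2)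
    filter_upwards [Filter.eventually_all.2 fun j => (H.an hg j).eventually_analyticAt,
      Filter.eventually_all.2 fun j => (H'.an hg j).eventually_analyticAt] with z h1 h2 _
    ext j
    have e : fderiv ℝ (fun z => (h + h') z j) z = fderiv ℝ (fun z => h z j) z + fderiv ℝ (fun z => h' z j) z :=
      fderiv_add (h1 j).differentiableAt (h2 j).differentiableAt
    simp only [LV, CRVectorField.apply, wirtDBar, Pi.add_apply] at e ⊢
    rw [← Finset.sum_add_distrib]
    refine Finset.sum_congr rfl fun i _ => ?_
    rw [e]; simp only [ContinuousLinearMap.add_apply]; ring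
  | smul b h hb H i =>
    refine .congr _ _ _ (LV_an L fun j => hb.mul (H.an hg j)) ?_
      (.add _ _ _ (.smul _ b _ hb i) (.smul _ (L.apply b) h (L.apply_analytic hb) (H.mono (Nat.le_succ _))))
    filter_upwards [Filter.eventually_all.2 fun j => (H.an hg j).eventually_analyticAt,
      hb.eventually_analyticAt] with z h1 h2 _
    ext j
    have e : fderiv ℝ (fun z => b z * h z j) z = b z • fderiv ℝ (fun z => h z j) z + h z j • fderiv ℝ b z :=
      fderiv_fun_mul h2.differentiableAt (h1 j).differentiableAt
    simp only [LV, CRVectorField.apply, wirtDBar, Pi.add_apply] at e ⊢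
    rw [Finset.mul_sum, Finset.sum_mul, ← Finset.sum_add_distrib]
    refine Finset.sum_congr rfl fun i _ => ?_
    rw [e]; simp only [ContinuousLinearMap.add_apply, ContinuousLinearMap.smul_apply, smul_eq_mul]; ring
  | congr h h' hh he H i =>
    refine .congr _ _ _ (LV_an L hh) ?_ i
    have h2 : ∀ j, ∀ᶠ z in 𝓝 p, z ∈ M → L.apply (fun z => h' z j - h z j) z = 0 := fun j =>
      L.tang ((hh j).sub (H.an hg j)) (he.mono fun z hz hm => by simp [hz hm])
    filter_upwards [Filter.eventually_all.2 h2, Filter.eventually_all.2 fun j => (H.an hg j).eventually_analyticAt,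
      Filter.eventually_all.2 fun j => (hh j).eventually_analyticAt] with z h3 h4 h5 hzM
    ext j
    have e : fderiv ℝ (fun z => h' z j - h z j) z = fderiv ℝ (fun z => h' z j) z - fderiv ℝ (fun z => h z j) z :=
      fderiv_fun_sub (h5 j).differentiableAt (h4 j).differentiableAt
    have := h3 j hzM
    rw [← sub_eq_zero, ← this]
    simp only [LV, CRVectorField.apply, wirtDBar]
    rw [← Finset.sum_sub_distrib]
    refine Finset.sum_congr rfl fun i _ => ?_
    rw [e]; simp only [ContinuousLinearMap.sub_apply]; ring

lemma InMod.list (Ls : List (CRVectorField M p)) (hg : ∀ k j, AnalyticAt ℝ (fun z => g k z j) p) {h}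
    (H : InMod M p g 0 h) : InMod M p g Ls.length (fun z j => CRApplyList Ls (fun z => h z j) z) := by
  induction Ls with
  | nil => exact H
  | cons L Ls ih => exact ih.step L hg

lemma InMod.span (hpM : p ∈ M) {n : ℕ} {h} (H : InMod M p g n h) : h p ∈ Submodule.span ℂ
    {v : Fin N' → ℂ | ∃ (Ls : List (CRVectorField M p)) (k : κ), Ls.length ≤ n ∧
      v = fun j => CRApplyList Ls (fun z => g k z j) p} := by
  induction H with
  | base Ls k hl => exact Submodule.subset_span ⟨Ls, k, hl, rfl⟩
  | zero => exact Submodule.zero_mem _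
  | add h h' _ _ i1 i2 => exact Submodule.add_mem _ i1 i2
  | smul b h hb _ i => exact Submodule.smul_mem _ (b p) i
  | congr h h' hh he _ i => rw [he.self_of_nhds hpM]; exact i

lemma lagrange {E : Type} [NormedAddCommGroup E] [NormedSpace ℝ E] [FiniteDimensional ℝ E]
    {r : E → Fin d → ℝ} {f : E → ℝ} {q : E}
    (hr : AnalyticAt ℝ r q) (hs : Function.Surjective (fderiv ℝ r q)) (hf : AnalyticAt ℝ f q)
    (h0 : ∀ᶠ w in 𝓝 q, r w = 0 → f w = 0) :
    ∃ a : E → (Fin d → ℝ) →L[ℝ] ℝ, AnalyticAt ℝ a q ∧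
      ∀ᶠ w in 𝓝 q, r w = 0 → fderiv ℝ f w = (a w).comp (fderiv ℝ r w) := by
  obtain ⟨κ', hκ⟩ := (fderiv ℝ r q : E →ₗ[ℝ] (Fin d → ℝ)).exists_rightInverse_of_surjective
    (LinearMap.range_eq_top.2 hs)
  set κ : (Fin d → ℝ) →L[ℝ] E := LinearMap.toContinuousLinearMap κ' with hκd
  let m : E → ((Fin d → ℝ) →L[ℝ] (Fin d → ℝ)) := fun w => (fderiv ℝ r w).comp κ
  have hmq : m q = 1 := by
    refine ContinuousLinearMap.ext fun v => ?_
    exact LinearMap.congr_fun hκ v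
  have hm : AnalyticAt ℝ m q :=
    (((ContinuousLinearMap.compL ℝ (Fin d → ℝ) E (Fin d → ℝ)).flip κ).analyticAt _).comp hr.fderiv
  have hu : ∀ᶠ w in 𝓝 q, IsUnit (m w) := by
    refine hm.continuousAt.eventually (Units.isOpen.mem_nhds ?_)
    rw [hmq]; exact isUnit_one
  have hinv : AnalyticAt ℝ (fun w => Ring.inverse (m w)) q := by
    have := analyticAt_inverse (𝕜 := ℝ) (1 : ((Fin d → ℝ) →L[ℝ] (Fin d → ℝ))ˣ)
    refine AnalyticAt.comp (g := Ring.inverse) (f := m) ?_ hm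
    rw [hmq]; exact this
  refine ⟨fun w => ((fderiv ℝ f w).comp κ).comp (Ring.inverse (m w)), ?_, ?_⟩
  · have h1 : AnalyticAt ℝ (fun w => (fderiv ℝ f w).comp κ) q :=
      (((ContinuousLinearMap.compL ℝ (Fin d → ℝ) E ℝ).flip κ).analyticAt _).comp hf.fderiv
    exact ((ContinuousLinearMap.compL ℝ (Fin d → ℝ) (Fin d → ℝ) ℝ).analyticAt_bilinear _).comp₂ h1 hinv
  · filter_upwards [hu, h0.eventually_nhds, hr.eventually_analyticAt, hf.eventually_analyticAt] with w hw h1 h2 h3 hrw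
    have hex : IsLocalExtrOn f {x | r x = r w} w := by
      refine Or.inl ?_
      have : ∀ᶠ x in 𝓝[{x | r x = r w}] w, f x = 0 := by
        filter_upwards [h1.filter_mono nhdsWithin_le_nhds, self_mem_nhdsWithin] with x hx hx2
        exact hx (by rw [hx2, hrw])
      have hfw := h1.self_of_nhds hrw
      filter_upwards [this] with x hx
      rw [hx, hfw]
    obtain ⟨Λ, Λ₀, hne, hL⟩ := hex.exists_linear_map_of_hasStrictFDerivAt
      h2.hasStrictFDerivAt h3.hasStrictFDerivAt
    have hrinv : (m w) * Ring.inverse (m w) = 1 := Ring.mul_inverse_cancel _ hw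
    have hsw : ∀ y, ∃ u, fderiv ℝ r w u = y := fun y =>
      ⟨κ (Ring.inverse (m w) y), congrArg (fun l : (Fin d → ℝ) →L[ℝ] (Fin d → ℝ) => l y) hrinv⟩
    have hΛ : Λ₀ ≠ 0 := by
      intro hz
      apply hne
      ext1
      · refine LinearMap.ext fun y => ?_
        obtain ⟨u, hu⟩ := hsw y
        have := hL u
        rw [hu, hz] at this; simpa using this
      · exact hz
    have hD : ∀ x, fderiv ℝ f w x = -(Λ₀⁻¹) * Λ (fderiv ℝ r w x) := fun x => by
      have := hL x
      rw [smul_eq_mul] at this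
      field_simp
      linarith
    ext x
    have h5 := congrArg (fun l : (Fin d → ℝ) →L[ℝ] (Fin d → ℝ) => l (fderiv ℝ r w x)) hrinv
    change fderiv ℝ r w (κ (Ring.inverse (m w) (fderiv ℝ r w x))) = fderiv ℝ r w x at h5
    simp only [ContinuousLinearMap.comp_apply]
    rw [hD x, hD (κ _), h5]


def spanSet (M : Set (Cn N)) (p : Cn N) (ℓ : ℕ) (r : Cn N' → Fin d → ℝ) (H : Cn N → Cn N') : Set (Fin N' → ℂ) :=
  {v | ∃ (Ls : List (CRVectorField M p)) (k : Fin d), Ls.length ≤ ℓ ∧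
      v = fun j => CRApplyList Ls (fun z => wirtD (fun w => r w k) (H z) j) p}

lemma wirtD_comp_analytic {f : Cn N' → ℝ} {H : Cn N → Cn N'} (hf : AnalyticAt ℝ f (H p))
    (hH : AnalyticAt ℝ H p) (j : Fin N') : AnalyticAt ℝ (fun z => wirtD f (H z) j) p := by
  have h1 : ∀ v, AnalyticAt ℝ (fun z => ((fderiv ℝ f (H z) v : ℝ) : ℂ)) p := fun v =>
    (Complex.ofRealCLM.analyticAt _).comp (((ContinuousLinearMap.apply ℝ ℝ v).analyticAt _).comp
      (AnalyticAt.comp (g := fderiv ℝ f) (f := H) hf.fderiv hH))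
  exact analyticAt_const.mul ((h1 _).sub (analyticAt_const.mul (h1 _)))

theorem fn_reduce {M' : Set (Cn N')} {ℓ : ℕ} {H : Cn N → Cn N'} {r : Cn N' → Fin d → ℝ}
    (hr : AnalyticAt ℝ r (H p)) (hs : Function.Surjective (fderiv ℝ r (H p)))
    (hrM : ∀ᶠ w in 𝓝 (H p), r w = 0 ↔ w ∈ M') (hH : AnalyticAt ℝ H p) (hpM : p ∈ M)
    (hHM : ∀ᶠ z in 𝓝 p, z ∈ M → r (H z) = 0) :
    FinNondeg M p M' ℓ H ↔ Submodule.span ℂ (spanSet M p ℓ r H) = ⊤ := by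
  have hrk : ∀ k, AnalyticAt ℝ (fun w => r w k) (H p) := fun k => (analyticAt_pi_iff.1 hr) k
  constructor
  · intro h
    rw [eq_top_iff, ← h]
    refine Submodule.span_le.2 ?_
    rintro v ⟨Ls, ρ', U', hl, hU', hpU', hρ', hz, rfl⟩
    obtain ⟨a, ha, hae⟩ := lagrange hr hs (hρ' _ hpU') (by
      filter_upwards [hrM, hU'.mem_nhds hpU'] with w h1 h2 h3 using hz w ⟨h1.1 h3, h2⟩)
    have hg : ∀ k j, AnalyticAt ℝ (fun z => (fun (k : Fin d) z j => wirtD (fun w => r w k) (H z) j) k z j) p :=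
      fun k j => wirtD_comp_analytic (hrk k) hH j
    have hb : ∀ k : Fin d, AnalyticAt ℝ (fun z => ((a (H z) (Pi.single k 1) : ℝ) : ℂ)) p := fun k =>
      (Complex.ofRealCLM.analyticAt _).comp
        (((ContinuousLinearMap.apply ℝ ℝ (Pi.single k 1 : Fin d → ℝ)).analyticAt _).comp
        (AnalyticAt.comp (g := a) (f := H) ha hH))
    have hsum : ∀ s : Finset (Fin d), InMod M p (fun (k : Fin d) z j => wirtD (fun w => r w k) (H z) j) 0
        (∑ k ∈ s, fun z j => ((a (H z) (Pi.single k 1) : ℝ) : ℂ) * wirtD (fun w => r w k) (H z) j) := by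
      intro s
      induction s using Finset.induction_on with
      | empty => exact .zero _
      | insert k s hk ih =>
        rw [Finset.sum_insert hk]
        exact .add _ _ _ (.smul _ _ _ (hb k) (.base _ [] k le_rfl)) ih
    have h1 : InMod M p (fun (k : Fin d) z j => wirtD (fun w => r w k) (H z) j) 0
        (fun z j => wirtD ρ' (H z) j) := by
      refine .congr _ _ _ (fun j => wirtD_comp_analytic (hρ' _ hpU') hH j) ?_ (hsum Finset.univ)
      filter_upwards [hHM, hH.continuousAt.eventually hae, hH.continuousAt.eventually hr.eventually_analyticAt] with z h2 h3 h5 hzM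
      have h4 := h3 (h2 hzM)
      have h6 : ∀ u, fderiv ℝ ρ' (H z) u = ∑ k, a (H z) (Pi.single k 1) * fderiv ℝ (fun w => r w k) (H z) u := by
        intro u
        rw [h4, ContinuousLinearMap.comp_apply]
        conv_lhs => rw [← Finset.univ_sum_single (fderiv ℝ r (H z) u), map_sum]
        refine Finset.sum_congr rfl fun k _ => ?_
        have : (Pi.single k (fderiv ℝ r (H z) u k) : Fin d → ℝ) = (fderiv ℝ r (H z) u k) • Pi.single k 1 := by
          rw [← Pi.single_smul]; simp
        rw [this, map_smul, fderiv_pi_apply h5.differentiableAt, smul_eq_mul, mul_comm]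
      ext j
      simp only [Finset.sum_apply, wirtD]
      rw [h6, h6]
      push_cast
      rw [Finset.mul_sum, ← Finset.sum_sub_distrib, Finset.mul_sum]
      refine Finset.sum_congr rfl fun k _ => ?_
      ring
    exact ((h1.list Ls hg).mono hl).span hpM
  · intro h
    unfold FinNondeg
    rw [eq_top_iff, ← h]
    refine Submodule.span_mono ?_
    rintro v ⟨Ls, k, hl, rfl⟩
    obtain ⟨U, hU, hUo, hpU⟩ := eventually_nhds_iff.1 ((hrk k).eventually_analyticAt.and hrM)
    exact ⟨Ls, _, U, hl, hUo, hpU, fun w hw => (hU w hw).1, fun w hw => by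
      rw [(hU w hw.2).2.2 hw.1]; rfl, rfl⟩

end FNt

section NonDegS
variable {N N' d dM : ℕ} {M : Set (Cn N)}

lemma lin_snd {n : ℕ} {F : Type} [NormedAddCommGroup F] [NormedSpace ℂ F] (D : YY n →L[ℂ] F) (v : Cn n) :
    D (0, v) = ∑ j, v j • D (0, cbasis j 1) := by
  have : ((0, v) : YY n) = ∑ j, v j • ((0, cbasis j 1) : YY n) := by
    conv_lhs => rw [cbasis_sum v]
    ext1
    · simp [Prod.fst_sum]
    · simp [Prod.snd_sum]
  rw [this, map_sum]; exact Finset.sum_congr rfl fun j _ => map_smul _ _ _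

lemma lin_fst {n : ℕ} {F : Type} [NormedAddCommGroup F] [NormedSpace ℂ F] (D : YY n →L[ℂ] F) (v : Cn n) :
    D (v, 0) = ∑ j, v j • D (cbasis j 1, 0) := by
  have : ((v, 0) : YY n) = ∑ j, v j • ((cbasis j 1, 0) : YY n) := by
    conv_lhs => rw [cbasis_sum v]
    ext1
    · simp [Prod.fst_sum]
    · simp [Prod.snd_sum]
  rw [this, map_sum]; exact Finset.sum_congr rfl fun j _ => map_smul _ _ _

lemma cont_ι {n : ℕ} (p : Cn n) : Filter.Tendsto (fun z : Cn n => (z, cj n z)) (𝓝 p) (𝓝 (p, cj n p)) :=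
  (continuous_id.prodMk (cj n).continuous).tendsto p

lemma fderiv_dir_analytic {E F Z : Type} [NormedAddCommGroup E] [NormedSpace ℂ E] [NormedAddCommGroup F] [NormedSpace ℂ F]
    [NormedAddCommGroup Z] [NormedSpace ℂ Z]
    [CompleteSpace F] {f : E → F} {m : Z → E} {a : Z → E} {x : Z} (hf : AnalyticAt ℂ f (m x)) (hm : AnalyticAt ℂ m x)
    (ha : AnalyticAt ℂ a x) :
    AnalyticAt ℂ (fun z => fderiv ℂ f (m z) (a z)) x :=
  ((ContinuousLinearMap.id ℂ (E →L[ℂ] F)).analyticAt_bilinear _).comp₂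
    (AnalyticAt.comp (g := fderiv ℂ f) (f := m) hf.fderiv hm) ha

lemma crc (G : Gen N dM) (hM : ∀ᶠ z in 𝓝 G.p, G.r z = 0 ↔ z ∈ M) (L : CRVectorField M G.p) :
    ∃ ac : YY N → Cn N, AnalyticAt ℂ ac G.P0 ∧ (∀ᶠ z in 𝓝 G.p, ∀ j, ac (z, cj N z) j = L.coeff z j) ∧
      ∀ᶠ X in 𝓝 G.P0, G.rc X = 0 → fderiv ℂ G.rc X (0, ac X) = 0 := by
  have h1 : AnalyticAt ℝ (fun z => (WithLp.toLp 2 (L.coeff z) : Cn N)) G.p := by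
    have h2 : AnalyticAt ℝ L.coeff G.p := analyticAt_pi_iff.2 fun j => L.analytic j _ L.mem
    exact ((((EuclideanSpace.equiv (Fin N) ℂ).symm : (Fin N → ℂ) →L[ℂ] Cn N).restrictScalars ℝ).analyticAt _).comp h2
  obtain ⟨ac, hac, he⟩ := (cplxC N).exists_ext h1
  simp only [cplxC_ι] at hac he
  have he' : ∀ᶠ z in 𝓝 G.p, ∀ j, ac (z, cj N z) j = L.coeff z j := he.mono fun z hz j => by rw [hz]
  refine ⟨ac, hac, he', ?_⟩
  let f : YY N → Fin dM → ℂ := fun X => fderiv ℂ G.rc X (0, ac X)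
  have hf : AnalyticAt ℂ f G.P0 := by
    have h2 : AnalyticAt ℂ (fun X : YY N => ((0, ac X) : YY N)) G.P0 := analyticAt_const.prod hac
    exact fderiv_dir_analytic (m := fun X => X) G.hrc' analyticAt_id h2
  obtain ⟨R, hR, hball⟩ := Metric.eventually_nhds_iff_ball.1 hf.eventually_analyticAt
  obtain ⟨V, hV, hVf⟩ := G.IP hR (F := Fin dM → ℂ)
  filter_upwards [hV] with X hX hX0
  refine hVf f (fun y hy => hball y hy) ?_ X hX hX0
  have hk : ∀ k, ∀ᶠ z in 𝓝 G.p, z ∈ M → (∑ j, L.coeff z j * wirtDBarR (fun z => G.r z k) z j) = 0 := by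
    intro k
    obtain ⟨U, hU, hUo, hpU⟩ := eventually_nhds_iff.1
      (((analyticAt_pi_iff.1 G.hr) k).eventually_analyticAt.and hM)
    obtain ⟨V, hV, hpV, hVz⟩ := L.tangent (fun z => G.r z k) U hUo hpU (fun z hz => (hU z hz).1)
      (fun z hz => by rw [(hU z hz.2).2.2 hz.1]; rfl)
    filter_upwards [hV.mem_nhds hpV] with z hz hzM using hVz z ⟨hzM, hz⟩
  filter_upwards [Filter.eventually_all.2 hk, hM, he', (cont_ι G.p).eventually G.hrc.eventually_analyticAt,
    G.ext.eventually_nhds, G.hr.eventually_analyticAt] with z h1 h2 h3 h4 h5 h6 h7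
  funext k
  have h8 := h1 k (h2.1 h7)
  simp only [f]
  rw [lin_snd, Finset.sum_apply, Pi.zero_apply, ← h8]
  refine Finset.sum_congr rfl fun j _ => ?_
  have h4k : DifferentiableAt ℂ (fun X => G.rc X k) (z, cj N z) := ((analyticAt_pi_iff.1 h4) k).differentiableAt
  rw [wirtDBarR_of_ext ((analyticAt_pi_iff.1 h6) k).differentiableAt h4k
    (h5.mono fun z hz => by rw [hz]), Pi.smul_apply, h3,
    fderiv_pi_apply h4.differentiableAt, smul_eq_mul]

lemma ord_of_O {E F : Type} [NormedAddCommGroup E] [NormedSpace ℂ E] [NormedAddCommGroup F] [NormedSpace ℂ F]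
    {f : E → F} {S : Set E} {q : E} {k : ℕ} (h : f =O[𝓝[S] q] fun ζ => ‖ζ - q‖ ^ k) {e : E → E} (he : DifferentiableAt ℂ e q)
    (heq : e q = q) (hS : ∀ᶠ ζ in 𝓝 q, e ζ ∈ S) : OrdGE k (fun ζ => f (e ζ)) q := by
  have ht : Filter.Tendsto (fun v : E => q + v) (𝓝 0) (𝓝 q) := by
    simpa using (by fun_prop : Continuous fun v : E => q + v).tendsto 0
  have h1 : (fun v => e (q + v) - q) =O[𝓝 0] fun v => v := by
    have := he.hasFDerivAt.isBigO_sub.comp_tendsto ht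
    refine this.congr (fun v => by simp [heq]) (fun v => by simp)
  have h2 : Filter.Tendsto (fun v : E => e (q + v)) (𝓝 0) (𝓝[S] q) := by
    refine tendsto_nhdsWithin_iff.2 ⟨?_, ht.eventually hS⟩
    have := he.continuousAt.tendsto.comp ht
    rwa [heq] at this
  exact (h.comp_tendsto h2).trans ((h1.norm_norm.pow k))

lemma O_of_ord {E F : Type} [NormedAddCommGroup E] [NormedSpace ℂ E] [NormedAddCommGroup F] [NormedSpace ℂ F]
    {f : E → F} {S : Set E} {q : E} {k : ℕ} {e : E → E} (h : OrdGE k (fun ζ => f (e ζ)) q)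
    (hS : ∀ᶠ ζ in 𝓝 q, ζ ∈ S → e ζ = ζ) : f =O[𝓝[S] q] fun ζ => ‖ζ - q‖ ^ k := by
  have ht : Filter.Tendsto (fun ζ : E => ζ - q) (𝓝 q) (𝓝 0) := by
    simpa using (by fun_prop : Continuous fun v : E => v - q).tendsto q
  have h1 := (h.comp_tendsto ht).mono (nhdsWithin_le_nhds (s := S))
  refine h1.congr' ?_ (Filter.EventuallyEq.refl _ _)
  filter_upwards [hS.filter_mono nhdsWithin_le_nhds, self_mem_nhdsWithin] with ζ h2 h3
  simp [h2 h3]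

/-- properties of `E ζ = B2 ((P.1, ζ), 0)` -/
lemma IsB2.E_props {E F G : Type} [NormedAddCommGroup E] [NormedSpace ℂ E] [FiniteDimensional ℂ E]
  [NormedAddCommGroup F] [NormedSpace ℂ F] [FiniteDimensional ℂ F]
  [NormedAddCommGroup G] [NormedSpace ℂ G] [FiniteDimensional ℂ G] {rc : E × F → G} {P : E × F} {B : (E × F) × G → F}
   (hrc : AnalyticAt ℂ rc P) (hB : IsB2 rc P B) (h0 : rc P = 0) :
    AnalyticAt ℂ (fun ζ => B ((P.1, ζ), 0)) P.2 ∧ B ((P.1, P.2), 0) = P.2 ∧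
    (∀ᶠ ζ in 𝓝 P.2, rc (P.1, B ((P.1, ζ), 0)) = 0) ∧
    (∀ᶠ ζ in 𝓝 P.2, rc (P.1, ζ) = 0 → B ((P.1, ζ), 0) = ζ) ∧
    (∀ᶠ ζ in 𝓝 P.2, rc (P.1, ζ) = 0 → ∀ v, fderiv ℂ rc (P.1, ζ) (0, v) = 0 →
      HasFDerivAt (fun ζ => B ((P.1, ζ), 0)) (fderiv ℂ (fun ζ => B ((P.1, ζ), 0)) ζ) ζ ∧
      fderiv ℂ (fun ζ => B ((P.1, ζ), 0)) ζ v = v) := by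
  have hm : AnalyticAt ℂ (fun ζ : F => (((P.1, ζ), 0) : (E × F) × G)) P.2 :=
    (analyticAt_const.prod analyticAt_id).prod analyticAt_const
  have hmP : (((P.1, P.2), 0) : (E × F) × G) = (P, rc P) := by rw [h0]
  have ht : Filter.Tendsto (fun ζ : F => (((P.1, ζ), 0) : (E × F) × G)) (𝓝 P.2) (𝓝 (P, rc P)) := by
    rw [← hmP]; exact hm.continuousAt.tendsto
  have ht2 : Filter.Tendsto (fun ζ : F => (P.1, ζ)) (𝓝 P.2) (𝓝 P) :=
    (by fun_prop : Continuous fun ζ : F => (P.1, ζ)).tendsto P.2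
  have han : AnalyticAt ℂ (fun ζ => B ((P.1, ζ), 0)) P.2 :=
    AnalyticAt.comp_of_eq (g := B) (f := fun ζ : F => (((P.1, ζ), 0) : (E × F) × G)) hB.an hm hmP
  refine ⟨han, ?_, ?_, ?_, ?_⟩
  · rw [hmP, hB.base]
  · exact (ht.eventually hB.sol)
  · filter_upwards [ht2.eventually hB.fix] with ζ h1 h2
    rw [h2] at h1; exact h1
  · filter_upwards [ht2.eventually (hB.deriv hrc), han.eventually_analyticAt] with ζ h1 h2 h3 v hv
    refine ⟨h2.differentiableAt.hasFDerivAt, ?_⟩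
    obtain ⟨h4, h5⟩ := h1 v hv
    have h6 : HasFDerivAt (fun t => B ((P.1, ζ + t), 0)) (fderiv ℂ (fun ζ => B ((P.1, ζ), 0)) ζ) 0 := by
      have h7 : HasFDerivAt (fun t : F => ζ + t) (ContinuousLinearMap.id ℂ F) 0 := (hasFDerivAt_id (𝕜 := ℂ) (0:F)).const_add ζ
      have h8 : HasFDerivAt (fun ζ => B ((P.1, ζ), 0)) (fderiv ℂ (fun ζ => B ((P.1, ζ), 0)) ζ) (ζ + 0) := by
        rw [add_zero]; exact h2.differentiableAt.hasFDerivAt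
      exact h8.comp 0 h7
    simp only [h3] at h4 h5
    rw [h6.unique h4]
    exact h5

/-- induction on lists of CR fields -/
lemma cr_order (G : Gen N dM) (hM : ∀ᶠ z in 𝓝 G.p, G.r z = 0 ↔ z ∈ M) {B2 : YY N × (Fin dM → ℂ) → Cn N}
    (hB : IsB2 G.rc G.P0 B2) {Θ : YY N → ℂ} {g : Cn N → ℂ} (hΘ : AnalyticAt ℂ Θ G.P0)
    (hg : ∀ᶠ z in 𝓝 G.p, Θ (z, cj N z) = g z) (Ls : List (CRVectorField M G.p)) :
    ∃ Θ' : YY N → ℂ, AnalyticAt ℂ Θ' G.P0 ∧ (∀ᶠ z in 𝓝 G.p, Θ' (z, cj N z) = CRApplyList Ls g z) ∧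
      ∀ l, OrdGE (l + Ls.length) (fun ζ => Θ (G.p, B2 ((G.p, ζ), 0))) (cj N G.p) →
        OrdGE l (fun ζ => Θ' (G.p, B2 ((G.p, ζ), 0))) (cj N G.p) := by
  induction Ls with
  | nil => exact ⟨Θ, hΘ, hg, fun l h => h⟩
  | cons L Ls ih =>
    obtain ⟨Θ1, h1, h2, h3⟩ := ih
    obtain ⟨ac, hac, hac1, hac2⟩ := crc G hM L
    obtain ⟨e1, e2, e3, e4, e5⟩ := hB.E_props G.hrc' G.rcP0
    have hmac : AnalyticAt ℂ (fun X : YY N => ((0, ac X) : YY N)) G.P0 := analyticAt_const.prod hac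
    refine ⟨fun X => fderiv ℂ Θ1 X (0, ac X), fderiv_dir_analytic (m := fun X => X) h1 analyticAt_id hmac, ?_, ?_⟩
    · filter_upwards [hac1, (cont_ι G.p).eventually h1.eventually_analyticAt, h2.eventually_nhds] with z k1 k2 k3
      change _ = L.apply (CRApplyList Ls g) z
      unfold CRVectorField.apply
      rw [lin_snd]
      refine Finset.sum_congr rfl fun j _ => ?_
      rw [k1, wirtDBar_of_ext k2.differentiableAt k3, smul_eq_mul]
    · intro l hl
      set e : Cn N → Cn N := fun ζ => B2 ((G.p, ζ), 0) with he
      have e1' : AnalyticAt ℂ e (cj N G.p) := e1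
      have e2' : e (cj N G.p) = cj N G.p := e2
      have hte : Filter.Tendsto e (𝓝 (cj N G.p)) (𝓝 (cj N G.p)) := by
        have := e1'.continuousAt.tendsto; rwa [e2'] at this
      have ht2 : Filter.Tendsto (fun ζ : Cn N => (G.p, ζ)) (𝓝 (cj N G.p)) (𝓝 G.P0) :=
        (by fun_prop : Continuous fun ζ : Cn N => (G.p, ζ)).tendsto _
      have hm : AnalyticAt ℂ (fun ζ : Cn N => ((G.p, e ζ) : YY N)) (cj N G.p) := analyticAt_const.prod e1'
      have hm0 : ((G.p, e (cj N G.p)) : YY N) = G.P0 := by rw [e2']; rfl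
      have hgt : AnalyticAt ℂ (fun ζ => Θ1 (G.p, e ζ)) (cj N G.p) :=
        AnalyticAt.comp_of_eq (g := Θ1) (f := fun ζ => (G.p, e ζ)) h1 hm hm0
      have o1 := h3 (l + 1) (by simpa [add_assoc, add_comm, add_left_comm] using hl)
      have o2 := OrdGE.fderiv (hgt.eventually_analyticAt.mono fun _ h => h.differentiableAt) o1
      have o3 := o2.comp e2' e1'.differentiableAt
      have o4 : OrdGE l (fun ζ => fderiv ℂ (fun ζ => Θ1 (G.p, e ζ)) (e ζ) (ac (G.p, e ζ))) (cj N G.p) := by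
        have hacm : AnalyticAt ℂ (fun ζ => ac (G.p, e ζ)) (cj N G.p) :=
          AnalyticAt.comp_of_eq (g := ac) (f := fun ζ => (G.p, e ζ)) hac hm hm0
        have hbd : (fun v => ac (G.p, e (cj N G.p + v))) =O[𝓝 0] fun _ => (1:ℝ) := by
          have ht : Filter.Tendsto (fun v : Cn N => cj N G.p + v) (𝓝 0) (𝓝 (cj N G.p)) := by
            simpa using (by fun_prop : Continuous fun v : Cn N => cj N G.p + v).tendsto 0
          exact (hacm.continuousAt.tendsto.comp ht).isBigO_one ℝ
        have := (Asymptotics.IsBigO.norm_left o3).mul hbd.norm_left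
        refine Asymptotics.IsBigO.trans ?_ (this.congr_right fun v => mul_one _)
        refine Asymptotics.IsBigO.of_bound 1 (Filter.Eventually.of_forall fun v => ?_)
        rw [one_mul, Real.norm_of_nonneg (by positivity)]
        exact ContinuousLinearMap.le_opNorm _ _
      refine o4.congr ?_
      filter_upwards [e3, hte.eventually e4, hte.eventually e5, hte.eventually (ht2.eventually hac2),
        hte.eventually (ht2.eventually h1.eventually_analyticAt)] with ζ k1 k2 k3 k4 k5
      have k6 : e (e ζ) = e ζ := k2 k1
      obtain ⟨k7, k8⟩ := k3 k1 _ (k4 k1)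
      have k9 : HasFDerivAt Θ1 (fderiv ℂ Θ1 (G.p, e ζ)) (G.p, e (e ζ)) := by
        rw [k6]; exact k5.differentiableAt.hasFDerivAt
      have k10 := k9.comp (e ζ) ((hasFDerivAt_const (𝕜 := ℂ) G.p (e ζ)).prodMk k7)
      have k11 : fderiv ℂ (fun ζ => Θ1 (G.p, e ζ)) (e ζ) = _ := k10.fderiv
      rw [k11]
      change fderiv ℂ Θ1 (G.p, e ζ) (0, fderiv ℂ (fun ζ => B2 ((G.P0.1, ζ), 0)) (e ζ) _) = _
      rw [k8]


lemma CRVectorField.apply_congr {p : Cn N} (L : CRVectorField M p) {f g : Cn N → ℂ} (h : f =ᶠ[𝓝 p] g) :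
    L.apply f =ᶠ[𝓝 p] L.apply g := by
  filter_upwards [h.eventuallyEq_nhds] with z hz
  unfold CRVectorField.apply wirtDBar
  rw [hz.fderiv_eq]

lemma CRApplyList_sum {p : Cn N} (Ls : List (CRVectorField M p)) {n : ℕ} (u : Fin n → ℂ) (g : Fin n → Cn N → ℂ)
    (hg : ∀ j, AnalyticAt ℝ (g j) p) :
    CRApplyList Ls (fun z => ∑ j, u j * g j z) =ᶠ[𝓝 p] fun z => ∑ j, u j * CRApplyList Ls (g j) z := by
  induction Ls with
  | nil => exact Filter.EventuallyEq.refl _ _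
  | cons L Ls ih =>
    refine (L.apply_congr ih).trans ?_
    filter_upwards [Filter.eventually_all.2 fun j => (CRApplyList_analytic Ls (hg j)).eventually_analyticAt] with z hz
    have e : fderiv ℝ (fun z => ∑ j, u j * CRApplyList Ls (g j) z) z = ∑ j, u j • fderiv ℝ (CRApplyList Ls (g j)) z := by
      rw [fderiv_fun_sum fun j _ => ((hz j).differentiableAt.const_mul _)]
      exact Finset.sum_congr rfl fun j _ => fderiv_const_mul (hz j).differentiableAt _
    change L.apply _ z = ∑ j, u j * L.apply (CRApplyList Ls (g j)) z
    unfold CRVectorField.apply wirtDBar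
    rw [e]
    simp only [Finset.mul_sum, ContinuousLinearMap.sum_apply, ContinuousLinearMap.smul_apply, smul_eq_mul,
      ← Finset.sum_add_distrib]
    rw [Finset.sum_comm]
    exact Finset.sum_congr rfl fun j _ => Finset.sum_congr rfl fun i _ => by ring

def NonDeg (ℓ : ℕ) (rc : YY N → Fin dM → ℂ) (P0 : YY N) (fc : YY N' → Fin d → ℂ) (w0 : Cn N') (K : Cn N → Cn N') : Prop :=
  ∀ u : Cn N', (fun ζ => fderiv ℂ fc (w0, K ζ) (u, 0)) =O[𝓝[{ζ | rc (P0.1, ζ) = 0}] P0.2]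
    (fun ζ => ‖ζ - P0.2‖ ^ (ℓ + 1)) → u = 0

theorem nondeg_of_span (G : Gen N dM) (hM : ∀ᶠ z in 𝓝 G.p, G.r z = 0 ↔ z ∈ M)
    {fc : YY N' → Fin d → ℂ} {f : Cn N' → Fin d → ℝ} {H : Cn N → Cn N'} {ℓ : ℕ}
    (hf : AnalyticAt ℝ f (H G.p))
    (hfc : AnalyticAt ℂ fc (H G.p, cj N' (H G.p)))
    (hext : ∀ᶠ w in 𝓝 (H G.p), fc (w, cj N' w) = fun k => (f w k : ℂ))
    (hH : AnalyticAt ℂ H G.p) (hspan : Submodule.span ℂ (spanSet M G.p ℓ f H) = ⊤) :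
    NonDeg ℓ G.rc G.P0 fc (H G.p) (fun ζ => cj N' (H (cj N ζ))) := by
  intro u hu
  obtain ⟨B2, hB⟩ := exists_B2 G.hrc' G.surj2
  obtain ⟨e1, e2, e3, e4, e5⟩ := hB.E_props G.hrc' G.rcP0
  have o1 := ord_of_O hu e1.differentiableAt e2 e3
  have hHR : AnalyticAt ℝ H G.p := hH.restrictScalars
  let Hb : Cn N → Cn N' := fun ζ => cj N' (H (cj N ζ))
  have hHb : AnalyticAt ℂ Hb (cj N G.p) := conj_analytic (cj N) (cj N') (by rw [cj_cj]; exact hH)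
  have hHbp : Hb (cj N G.p) = cj N' (H G.p) := by simp [Hb, cj_cj]
  let m : YY N → YY N' := fun X => (H X.1, Hb X.2)
  have hm : AnalyticAt ℂ m G.P0 :=
    (AnalyticAt.comp (g := H) (f := fun X : YY N => X.1) hH analyticAt_fst).prod
      (AnalyticAt.comp (g := Hb) (f := fun X : YY N => X.2) hHb analyticAt_snd)
  have hm0 : m G.P0 = (H G.p, cj N' (H G.p)) := by simp only [m, Gen.P0, hHbp]
  -- pairing vanishes on the span set
  have key : ∀ v ∈ spanSet M G.p ℓ f H, ∑ j, u j * v j = 0 := by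
    rintro v ⟨Ls, k, hl, rfl⟩
    let Θ : YY N → ℂ := fun X => fderiv ℂ fc (m X) (u, 0) k
    have hΘ : AnalyticAt ℂ Θ G.P0 := by
      have h1 := fderiv_dir_analytic (a := fun _ => ((u, 0) : YY N')) (by rw [hm0]; exact hfc) hm analyticAt_const
      exact (analyticAt_pi_iff.1 h1) k
    have hfk := (analyticAt_pi_iff.1 hf) k
    have hg : ∀ᶠ z in 𝓝 G.p, Θ (z, cj N z) = ∑ j, u j * wirtD (fun w => f w k) (H z) j := by
      have ht := hH.continuousAt.tendsto
      filter_upwards [ht.eventually hext.eventually_nhds, ht.eventually hfk.eventually_analyticAt,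
        ht.eventually ((cont_ι (H G.p)).eventually hfc.eventually_analyticAt)] with z h1 h2 h3
      have h4 : m (z, cj N z) = (H z, cj N' (H z)) := by simp [m, Hb, cj_cj]
      simp only [Θ]
      rw [h4, lin_fst, Finset.sum_apply]
      refine Finset.sum_congr rfl fun j _ => ?_
      have h3k : DifferentiableAt ℂ (fun X => fc X k) (H z, cj N' (H z)) := ((analyticAt_pi_iff.1 h3) k).differentiableAt
      rw [wirtD_of_ext h2.differentiableAt h3k (h1.mono fun w hw => by rw [hw]),
        fderiv_pi_apply h3.differentiableAt, Pi.smul_apply, smul_eq_mul]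
    obtain ⟨Θ', h1, h2, h3⟩ := cr_order G hM hB hΘ hg Ls
    have h4 := CRApplyList_sum Ls (fun j => u j) (fun j z => wirtD (fun w => f w k) (H z) j)
      (fun j => wirtD_comp_analytic hfk hHR j)
    have h5 := h4.eq_of_nhds
    rw [← h5, ← h2.self_of_nhds]
    have o2 : OrdGE (ℓ + 1) (fun ζ => Θ (G.p, B2 ((G.p, ζ), 0))) (cj N G.p) :=
      o1.clm (ContinuousLinearMap.proj (R := ℂ) (φ := fun _ : Fin d => ℂ) k)
    have o3 := h3 (ℓ - Ls.length + 1) (by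
      have : ℓ - Ls.length + 1 + Ls.length = ℓ + 1 := by omega
      rw [this]; exact o2)
    have o4 := o3.eq_zero
    have e2' : B2 ((G.p, cj N G.p), 0) = cj N G.p := e2
    rw [e2'] at o4
    exact o4
  have key2 : ∀ v : Fin N' → ℂ, ∑ j, u j * v j = 0 := by
    intro v
    have hv : v ∈ Submodule.span ℂ (spanSet M G.p ℓ f H) := by rw [hspan]; trivial
    induction hv using Submodule.span_induction with
    | mem v hv => exact key v hv
    | zero => simp
    | add x y _ _ hx hy => simp only [Pi.add_apply, mul_add, Finset.sum_add_distrib, hx, hy, add_zero]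
    | smul a x _ hx =>
      have : ∑ j, u j * (a • x) j = a * ∑ j, u j * x j := by
        rw [Finset.mul_sum]; exact Finset.sum_congr rfl fun j _ => by simp; ring
      rw [this, hx, mul_zero]
  ext j
  have := key2 (Pi.single j 1)
  simpa [Pi.single_apply] using this

end NonDegS

section reflect

variable {E F A B Q G G' : Type} [NormedAddCommGroup E] [NormedSpace ℂ E] [FiniteDimensional ℂ E]
  [NormedAddCommGroup F] [NormedSpace ℂ F] [FiniteDimensional ℂ F]
  [NormedAddCommGroup A] [NormedSpace ℂ A] [FiniteDimensional ℂ A]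
  [NormedAddCommGroup B] [NormedSpace ℂ B] [FiniteDimensional ℂ B]
  [NormedAddCommGroup Q] [NormedSpace ℂ Q] [FiniteDimensional ℂ Q]
  [NormedAddCommGroup G] [NormedSpace ℂ G] [FiniteDimensional ℂ G]
  [NormedAddCommGroup G'] [NormedSpace ℂ G'] [FiniteDimensional ℂ G']

lemma anF {𝕜 X Y Z : Type*} [NontriviallyNormedField 𝕜] [NormedAddCommGroup X] [NormedSpace 𝕜 X]
    [NormedAddCommGroup Y] [NormedSpace 𝕜 Y] [NormedAddCommGroup Z] [NormedSpace 𝕜 Z]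
    {f : X → Y × Z} {x : X} (h : AnalyticAt 𝕜 f x) : AnalyticAt 𝕜 (fun y => (f y).1) x :=
  AnalyticAt.comp (g := Prod.fst) (f := f) analyticAt_fst h

lemma anS {𝕜 X Y Z : Type*} [NontriviallyNormedField 𝕜] [NormedAddCommGroup X] [NormedSpace 𝕜 X]
    [NormedAddCommGroup Y] [NormedSpace 𝕜 Y] [NormedAddCommGroup Z] [NormedSpace 𝕜 Z]
    {f : X → Y × Z} {x : X} (h : AnalyticAt 𝕜 f x) : AnalyticAt 𝕜 (fun y => (f y).2) x :=
  AnalyticAt.comp (g := Prod.snd) (f := f) analyticAt_snd h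

lemma anC {𝕜 X Y Z : Type*} [NontriviallyNormedField 𝕜] [NormedAddCommGroup X] [NormedSpace 𝕜 X]
    [NormedAddCommGroup Y] [NormedSpace 𝕜 Y] [NormedAddCommGroup Z] [NormedSpace 𝕜 Z]
    {g : Y → Z} {f : X → Y} {x : X} {y : Y} (hg : AnalyticAt 𝕜 g y) (hf : AnalyticAt 𝕜 f x)
    (h : f x = y) : AnalyticAt 𝕜 (fun t => g (f t)) x := by
  subst h; exact AnalyticAt.comp (g := g) (f := f) hg hf

lemma comp_ord {g : F → G} {y0 : F} (hg : AnalyticAt ℂ g y0) {a b : E → F} {x : E} {k : ℕ}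
    (ha : ContinuousAt a x) (hb : ContinuousAt b x) (ha0 : a x = y0) (hb0 : b x = y0)
    (h : OrdGE k (fun t => a t - b t) x) : OrdGE k (fun t => g (a t) - g (b t)) x := by
  have h1 := hg.hasStrictFDerivAt.isBigO_sub
  have ht : Filter.Tendsto (fun v : E => x + v) (𝓝 0) (𝓝 x) := by
    simpa using (by fun_prop : Continuous fun v : E => x + v).tendsto 0
  have h2 : Filter.Tendsto (fun v => (a (x + v), b (x + v))) (𝓝 (0:E)) (𝓝 (y0, y0)) := by
    have ha' := ha.tendsto.comp ht
    have hb' := hb.tendsto.comp ht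
    rw [ha0] at ha'; rw [hb0] at hb'
    exact ha'.prodMk_nhds hb'
  exact (h1.comp_tendsto h2).trans h

lemma jet_ord {f : E → F} {x : E} (hf : AnalyticAt ℂ f x) {k l : ℕ} (h : OrdGE (k + l) f x) :
    OrdGE k (jet l f) x := by
  refine Asymptotics.isBigO_pi.2 fun i => ?_
  exact OrdGE.iter hf i (k := k) (h.mono (by have := i.2; omega))

lemma jet_shift (k : ℕ) (f : E → F) (x y : E) : jet k (fun v => f (v - x)) y = jet k f (y - x) := by
  funext i
  simp only [jet]
  rw [iteratedFDeriv_comp_sub]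

lemma jetP_analytic' {k : ℕ} (J : JetSp k E F) (v : E) : AnalyticAt ℂ (jetP J) v :=
  anC (g := fun c : JetSp k E F × E => jetP c.1 c.2) (f := fun v => (J, v)) (jetP_analytic (J, v)) (analyticAt_const.prod analyticAt_id) rfl

lemma anJetP {k : ℕ} {X : Type} [NormedAddCommGroup X] [NormedSpace ℂ X] {J : X → JetSp k E F} {v : X → E} {x : X}
    (hJ : AnalyticAt ℂ J x) (hv : AnalyticAt ℂ v x) : AnalyticAt ℂ (fun t => jetP (J t) (v t)) x :=
  anC (g := fun c : JetSp k E F × E => jetP c.1 c.2) (f := fun t => (J t, v t)) (jetP_analytic (J x, v x)) (hJ.prod hv) rfl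

lemma jet_jetP {k l : ℕ} (h : l ≤ k) {f : E → F} {x : E} (hf : AnalyticAt ℂ f x) :
    jet l (jetP (jet k f x)) 0 = jet l f x := by
  have h1 := (jetP_approx k hf).mono (show l + 1 ≤ k + 1 by omega)
  have h2 : AnalyticAt ℂ (fun y => jetP (jet k f x) (y - x)) x :=
    anC (jetP_analytic' (jet k f x) 0) (analyticAt_id.sub analyticAt_const) (by simp)
  have := (jet_eq_iff hf h2).2 h1
  rw [this, jet_shift, sub_self]

/-- a family of maps converging to the base map `i0` along `𝓛` -/
structure FamOK {ι : Type} (𝓛 : Filter ι) (i0 : ι) (H : ι → E → A) (K : ι → F → B) (ε : ι → Q)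
    (rc : E × F → G) (P : E × F) (ρc : (A × B) × Q → G') : Prop where
  jetH : ∀ k, Filter.Tendsto (fun c : ι × E => jet k (H c.1) c.2) (𝓛 ×ˢ 𝓝 P.1) (𝓝 (jet k (H i0) P.1))
  jetK : ∀ k, Filter.Tendsto (fun c : ι × F => jet k (K c.1) c.2) (𝓛 ×ˢ 𝓝 P.2) (𝓝 (jet k (K i0) P.2))
  eps : Filter.Tendsto ε 𝓛 (𝓝 (ε i0))
  anH : ∀ᶠ c in 𝓛 ×ˢ 𝓝 P.1, AnalyticAt ℂ (H c.1) c.2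
  anK : ∀ᶠ c in 𝓛 ×ˢ 𝓝 P.2, AnalyticAt ℂ (K c.1) c.2
  eqn : ∀ᶠ c in 𝓛 ×ˢ 𝓝 P, rc c.2 = 0 → ρc ((H c.1 c.2.1, K c.1 c.2.2), ε c.1) = 0
  base : pure i0 ≤ 𝓛

lemma ev_nhds {ι X : Type} [TopologicalSpace X] {𝓛 : Filter ι} {x : X} {p : ι × X → Prop}
    (h : ∀ᶠ c in 𝓛 ×ˢ 𝓝 x, p c) : ∀ᶠ c in 𝓛 ×ˢ 𝓝 x, ∀ᶠ y in 𝓝 c.2, p (c.1, y) := by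
  obtain ⟨pa, ha, pb, hb, hab⟩ := Filter.eventually_prod_iff.1 h
  refine Filter.eventually_prod_iff.2 ⟨pa, ha, fun x => ∀ᶠ y in 𝓝 x, pb y, hb.eventually_nhds, ?_⟩
  intro i hi y hy
  filter_upwards [hy] with y' hy'
  exact hab hi hy'

lemma ev_base {ι X : Type} [TopologicalSpace X] {𝓛 : Filter ι} {i0 : ι} (h0 : pure i0 ≤ 𝓛) {x : X} {p : ι × X → Prop}
    (h : ∀ᶠ c in 𝓛 ×ˢ 𝓝 x, p c) : ∀ᶠ y in 𝓝 x, p (i0, y) := by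
  have : Filter.Tendsto (fun y => (i0, y)) (𝓝 x) (𝓛 ×ˢ 𝓝 x) :=
    Filter.Tendsto.prodMk ((Filter.tendsto_pure.2 (Filter.Eventually.of_forall fun _ => rfl)).mono_right h0) Filter.tendsto_id
  exact this.eventually h

lemma FamOK.swap {ι : Type} {𝓛 : Filter ι} {i0 : ι} {H : ι → E → A} {K : ι → F → B} {ε : ι → Q}
    {rc : E × F → G} {P : E × F} {ρc : (A × B) × Q → G'} (h : FamOK 𝓛 i0 H K ε rc P ρc) :
    FamOK 𝓛 i0 K H ε (fun X => rc X.swap) P.swap (fun Z => ρc (Z.1.swap, Z.2)) where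
  jetH := h.jetK
  jetK := h.jetH
  eps := h.eps
  anH := h.anK
  anK := h.anH
  base := h.base
  eqn := by
    have : Filter.Tendsto (fun c : ι × (F × E) => (c.1, c.2.swap)) (𝓛 ×ˢ 𝓝 P.swap) (𝓛 ×ˢ 𝓝 P) :=
      Filter.Tendsto.prodMk Filter.tendsto_fst ((by simpa using continuous_swap.tendsto P.swap : Filter.Tendsto Prod.swap _ _).comp Filter.tendsto_snd)
    filter_upwards [this.eventually h.eqn] with c hc h1
    exact hc h1

/-- nondegeneracy, general form -/
def NonDegG (ℓ : ℕ) (rc : E × F → G) (P0 : E × F) (fc : A × B → G') (w0 : A) (K : F → B) : Prop :=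
  ∀ u : A, (fun ζ => fderiv ℂ fc (w0, K ζ) (u, 0)) =O[𝓝[{ζ | rc (P0.1, ζ) = 0}] P0.2]
    (fun ζ => ‖ζ - P0.2‖ ^ (ℓ + 1)) → u = 0

section fam
variable {ι : Type} {𝓛 : Filter ι} {i0 : ι} {H : ι → E → A} {K : ι → F → B} {ε : ι → Q}
    {rc : E × F → G} {P : E × F} {ρc : (A × B) × Q → G'}

lemma FamOK.tH (h : FamOK 𝓛 i0 H K ε rc P ρc) :
    Filter.Tendsto (fun c : ι × E => H c.1 c.2) (𝓛 ×ˢ 𝓝 P.1) (𝓝 (H i0 P.1)) := by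
  have h1 : ContinuousAt (fun J : JetSp 0 E A => jetP J 0) (jet 0 (H i0) P.1) :=
    (anJetP analyticAt_id analyticAt_const).continuousAt
  have h2 := h1.tendsto.comp (h.jetH 0)
  simpa [Function.comp_def, jetP_zero] using h2

theorem reflect {ℓ : ℕ} {B2 : (E × F) × G → F} (h : FamOK 𝓛 i0 H K ε rc P ρc) (hrc : AnalyticAt ℂ rc P)
    (h0 : rc P = 0) (hB : IsB2 rc P B2) (hρ : AnalyticAt ℂ ρc ((H i0 P.1, K i0 P.2), ε i0))
    (hN : NonDegG ℓ rc P (fun W => ρc (W, ε i0)) (H i0 P.1) (K i0)) :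
    ∃ Ψ : (E × F) × JetSp ℓ F B × Q → A, AnalyticAt ℂ Ψ (P, jet ℓ (K i0) P.2, ε i0) ∧
      ∀ᶠ c in 𝓛 ×ˢ 𝓝 P, rc c.2 = 0 → H c.1 c.2.1 = Ψ (c.2, jet ℓ (K c.1) c.2.2, ε c.1) := by
  set w0 := H i0 P.1 with hw0
  set J0 := jet ℓ (K i0) P.2 with hJ0
  set ε0 := ε i0 with hε0
  have hK0 : AnalyticAt ℂ (K i0) P.2 := (ev_base h.base h.anK).self_of_nhds
  let Par := (E × F) × JetSp ℓ F B × Q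
  let par0 : Par := (P, J0, ε0)
  let β : Par × F → F := fun c => B2 ((c.1.1.1, c.1.1.2 + c.2), rc c.1.1)
  let Gf : (Par × A) × F → G' := fun c =>
    ρc ((c.1.2, jetP c.1.1.2.1 (β (c.1.1, c.2) - c.1.1.1.2)), c.1.1.2.2)
  have hβ0 : β (par0, 0) = P.2 := by
    simp only [β, par0, add_zero]; exact hB.base
  have hβ : AnalyticAt ℂ β (par0, 0) := by
    refine anC hB.an (y := (P, rc P)) ?_ (by simp [par0])
    have hP := anF (𝕜 := ℂ) (f := fun c : Par × F => c.1) (x := (par0, 0)) (anF analyticAt_id)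
    exact ((anF hP).prod ((anS hP).add (anS analyticAt_id))).prod (anC hrc hP rfl)
  have hGf : AnalyticAt ℂ Gf ((par0, w0), 0) := by
    have i1 : AnalyticAt ℂ (fun c : (Par × A) × F => c.1.1) ((par0, w0), 0) := anF (anF analyticAt_id)
    have i2 : AnalyticAt ℂ (fun c : (Par × A) × F => β (c.1.1, c.2)) ((par0, w0), 0) :=
      anC hβ (i1.prod (anS analyticAt_id)) rfl
    refine anC hρ (y := ((w0, K i0 P.2), ε0)) (((anS (anF analyticAt_id)).prod ?_).prod (anS (anS i1))) ?_
    · exact anJetP (anF (anS i1)) (i2.sub (anS (anF i1)))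
    · simp only [hβ0]; simp [par0, hJ0, jetP_zero]
  let 𝓡 : Par × A → JetSp ℓ F G' := fun q => jet ℓ (fun t => Gf (q, t)) 0
  have hR : AnalyticAt ℂ 𝓡 (par0, w0) :=
    anC (jet_analytic ℓ hGf) (analyticAt_id.prod analyticAt_const) rfl
  obtain ⟨e1, e2, e3, e4, -⟩ := hB.E_props hrc h0
  have hpre : AnalyticAt ℂ (fun b : B => ((w0, b), ε0)) (K i0 P.2) := (analyticAt_const.prod analyticAt_id).prod analyticAt_const
  let f : A × B → G' := fun W => ρc (W, ε0)
  have hf : AnalyticAt ℂ f (w0, K i0 P.2) := anC hρ (analyticAt_id.prod analyticAt_const) rfl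
  have hβe : ∀ t, β (par0, t) = B2 ((P.1, P.2 + t), 0) := fun t => by simp [β, par0, h0]
  -- the derivative in `w` is injective
  have hinj : ∀ u : A, fderiv ℂ 𝓡 (par0, w0) (0, u) = 0 → u = 0 := by
    intro u hu
    apply hN u
    have c1 : fderiv ℂ (fun w => 𝓡 (par0, w)) w0 u = fderiv ℂ 𝓡 (par0, w0) (0, u) := by
      have hd : HasFDerivAt (fun w : A => (par0, w)) (ContinuousLinearMap.inr ℂ Par A) w0 :=
        hasFDerivAt_prodMk_right par0 w0
      have h' : (fun w => 𝓡 (par0, w)) = 𝓡 ∘ fun w : A => (par0, w) := rfl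
      rw [h', (HasFDerivAt.comp (g := 𝓡) (f := fun w : A => (par0, w)) w0 hR.differentiableAt.hasFDerivAt hd).fderiv]
      rfl
    let G2 : A × F → G' := fun c => Gf ((par0, c.1), c.2)
    have hG2 : AnalyticAt ℂ G2 (w0, 0) :=
      anC hGf ((analyticAt_const.prod (anF analyticAt_id)).prod (anS analyticAt_id)) rfl
    have c2 := jet_fderiv_param ℓ hG2 u
    have c3 : jet ℓ (fun t => fderiv ℂ (fun w => G2 (w, t)) w0 u) 0 = 0 := by
      rw [← hu, ← c1]; exact c2.symm
    let b : F → B := fun t => jetP J0 (β (par0, t) - P.2)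
    have hβt : AnalyticAt ℂ (fun t => β (par0, t)) 0 := anC hβ (analyticAt_const.prod analyticAt_id) rfl
    have hb : AnalyticAt ℂ b 0 :=
      anC (jetP_analytic' J0 0) (hβt.sub analyticAt_const) (by simp [hβ0])
    have hb0 : b 0 = K i0 P.2 := by simp [b, hβ0, hJ0, jetP_zero]
    have hgm : AnalyticAt ℂ (fun b : B => fderiv ℂ f (w0, b) (u, 0)) (K i0 P.2) :=
      fderiv_dir_analytic hf (analyticAt_const.prod analyticAt_id) analyticAt_const
    have c4 : (fun t => fderiv ℂ (fun w => G2 (w, t)) w0 u) =ᶠ[𝓝 0] fun t => fderiv ℂ f (w0, b t) (u, 0) := by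
      have ht : Filter.Tendsto (fun t => (w0, b t)) (𝓝 0) (𝓝 (w0, K i0 P.2)) := by
        have := hb.continuousAt.tendsto; rw [hb0] at this
        exact tendsto_const_nhds.prodMk_nhds this
      filter_upwards [ht.eventually hf.eventually_analyticAt] with t ht
      have hd : HasFDerivAt (fun w : A => (w, b t)) (ContinuousLinearMap.inl ℂ A B) w0 :=
        hasFDerivAt_prodMk_left w0 (b t)
      have := (HasFDerivAt.comp (g := f) (f := fun w : A => (w, b t)) w0 ht.differentiableAt.hasFDerivAt hd).fderiv
      have h' : (fun w => G2 (w, t)) = f ∘ fun w : A => (w, b t) := rfl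
      rw [h', this]; rfl
    rw [jet_congr c4] at c3
    have c5 : OrdGE (ℓ + 1) (fun t => fderiv ℂ f (w0, b t) (u, 0)) 0 :=
      (jet_eq_zero_iff (anC hgm hb hb0)).1 c3
    have hKe : AnalyticAt ℂ (fun t => K i0 (β (par0, t))) 0 := anC hK0 hβt hβ0
    have c6 : OrdGE (ℓ + 1) (fun t => K i0 (β (par0, t)) - b t) 0 :=
      (jetP_approx ℓ hK0).comp (γ := fun t => β (par0, t)) hβ0 hβt.differentiableAt
    have c7 := comp_ord hgm hKe.continuousAt hb.continuousAt (by simp [hβ0]) hb0 c6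
    have c8 : OrdGE (ℓ + 1) (fun t => fderiv ℂ f (w0, K i0 (β (par0, t))) (u, 0)) 0 := by
      simpa using c7.add c5
    refine O_of_ord (e := fun ζ => B2 ((P.1, ζ), 0)) ?_ e4
    refine c8.congr_left fun v => ?_
    simp only [zero_add, hβe]
    rfl
  let L : A →ₗ[ℂ] JetSp ℓ F G' := ((fderiv ℂ 𝓡 (par0, w0)).comp (ContinuousLinearMap.inr ℂ Par A)).toLinearMap
  obtain ⟨lam, hlam⟩ := LinearMap.exists_leftInverse_of_injective L
    (LinearMap.ker_eq_bot'.2 fun u hu => hinj u hu)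
  let Λ : JetSp ℓ F G' →L[ℂ] A := LinearMap.toContinuousLinearMap lam
  have hΛ : AnalyticAt ℂ (fun q => Λ (𝓡 q)) (par0, w0) := anC (Λ.analyticAt _) hR rfl
  have hΛd : ∀ u, fderiv ℂ (fun q => Λ (𝓡 q)) (par0, w0) (0, u) = u := by
    intro u
    have := (Λ.hasFDerivAt.comp (par0, w0) hR.differentiableAt.hasFDerivAt).fderiv
    have h' : (fun q => Λ (𝓡 q)) = Λ ∘ 𝓡 := rfl
    rw [h', this]
    exact congrArg (fun l => l u) hlam
  obtain ⟨ψ, hψ, -, -, hψ2⟩ := analytic_implicit (f := fun q => Λ (𝓡 q)) hΛ (by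
    have : (fun y => fderiv ℂ (fun q => Λ (𝓡 q)) (par0, w0) (0, y)) = id := funext hΛd
    rw [this]; exact Function.bijective_id)
  -- vanishing of `𝓡` on the family
  have tt1 : Filter.Tendsto (fun c : ι × (E × F) => (c.1, c.2.1)) (𝓛 ×ˢ 𝓝 P) (𝓛 ×ˢ 𝓝 P.1) :=
    Filter.Tendsto.prodMk Filter.tendsto_fst ((continuous_fst.tendsto P).comp Filter.tendsto_snd)
  have tt2 : Filter.Tendsto (fun c : ι × (E × F) => (c.1, c.2.2)) (𝓛 ×ˢ 𝓝 P) (𝓛 ×ˢ 𝓝 P.2) :=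
    Filter.Tendsto.prodMk Filter.tendsto_fst ((continuous_snd.tendsto P).comp Filter.tendsto_snd)
  let pc : ι × (E × F) → Par := fun c => (c.2, jet ℓ (K c.1) c.2.2, ε c.1)
  have tpc : Filter.Tendsto pc (𝓛 ×ˢ 𝓝 P) (𝓝 par0) :=
    Filter.tendsto_snd.prodMk_nhds (((h.jetK ℓ).comp tt2).prodMk_nhds (h.eps.comp Filter.tendsto_fst))
  have tq : Filter.Tendsto (fun c => (pc c, H c.1 c.2.1)) (𝓛 ×ˢ 𝓝 P) (𝓝 (par0, w0)) :=
    tpc.prodMk_nhds (h.tH.comp tt1)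
  have tK : Filter.Tendsto (fun c : ι × (E × F) => K c.1 c.2.2) (𝓛 ×ˢ 𝓝 P) (𝓝 (K i0 P.2)) := h.swap.tH.comp tt2
  have tρ : Filter.Tendsto (fun c : ι × (E × F) => ((H c.1 c.2.1, K c.1 c.2.2), ε c.1)) (𝓛 ×ˢ 𝓝 P) (𝓝 ((w0, K i0 P.2), ε0)) :=
    ((h.tH.comp tt1).prodMk_nhds tK).prodMk_nhds (h.eps.comp Filter.tendsto_fst)
  have tβ : Filter.Tendsto (fun c : ι × (E × F) => (pc c, (0:F))) (𝓛 ×ˢ 𝓝 P) (𝓝 (par0, 0)) :=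
    tpc.prodMk_nhds tendsto_const_nhds
  have tG : Filter.Tendsto (fun c : ι × (E × F) => ((pc c, H c.1 c.2.1), (0:F))) (𝓛 ×ˢ 𝓝 P) (𝓝 ((par0, w0), 0)) :=
    tq.prodMk_nhds tendsto_const_nhds
  have hvan : ∀ᶠ c in 𝓛 ×ˢ 𝓝 P, rc c.2 = 0 → 𝓡 (pc c, H c.1 c.2.1) = 0 := by
    have tfix : ∀ᶠ c in 𝓛 ×ˢ 𝓝 P, B2 (c.2, rc c.2) = c.2.2 := Filter.tendsto_snd.eventually hB.fix
    have tsol : ∀ᶠ c in 𝓛 ×ˢ 𝓝 P, ∀ᶠ b in 𝓝 (c.2, rc c.2), rc (b.1.1, B2 b) = b.2 := by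
      have : Filter.Tendsto (fun c : ι × (E × F) => (c.2, rc c.2)) (𝓛 ×ˢ 𝓝 P) (𝓝 (P, rc P)) :=
        Filter.tendsto_snd.prodMk_nhds (hrc.continuousAt.tendsto.comp Filter.tendsto_snd)
      exact this.eventually hB.sol.eventually_nhds
    filter_upwards [tG.eventually hGf.eventually_analyticAt, tρ.eventually hρ.eventually_analyticAt,
      tβ.eventually hβ.eventually_analyticAt, tt2.eventually h.anK, tfix, tsol, ev_nhds h.eqn]
      with c k1 k2 k3 k4 k5 k6 k7 hc
    have q1 : AnalyticAt ℂ (fun t => Gf ((pc c, H c.1 c.2.1), t)) 0 :=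
      anC k1 (analyticAt_const.prod analyticAt_id) rfl
    refine (jet_eq_zero_iff q1).2 ?_
    have hβt : AnalyticAt ℂ (fun t => β (pc c, t)) 0 := anC k3 (analyticAt_const.prod analyticAt_id) rfl
    have hβc : β (pc c, 0) = c.2.2 := by simpa [β, pc] using k5
    have hg : AnalyticAt ℂ (fun b : B => ρc ((H c.1 c.2.1, b), ε c.1)) (K c.1 c.2.2) :=
      anC k2 ((analyticAt_const.prod analyticAt_id).prod analyticAt_const) rfl
    have c6 : OrdGE (ℓ + 1) (fun t => K c.1 (β (pc c, t)) - jetP (jet ℓ (K c.1) c.2.2) (β (pc c, t) - c.2.2)) 0 :=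
      (jetP_approx ℓ k4).comp (γ := fun t => β (pc c, t)) hβc hβt.differentiableAt
    have hKe : AnalyticAt ℂ (fun t => K c.1 (β (pc c, t))) 0 := anC k4 hβt hβc
    have hb : AnalyticAt ℂ (fun t => jetP (jet ℓ (K c.1) c.2.2) (β (pc c, t) - c.2.2)) 0 :=
      anC (jetP_analytic' _ 0) (hβt.sub analyticAt_const) (by simp [hβc])
    have c7 := comp_ord hg hKe.continuousAt hb.continuousAt (by simp [hβc]) (by simp [hβc, jetP_zero]) c6
    have z1 : (fun t => ρc ((H c.1 c.2.1, K c.1 (β (pc c, t))), ε c.1)) =ᶠ[𝓝 0] fun _ => 0 := by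
      have u1 : Filter.Tendsto (fun t : F => (((c.2.1, c.2.2 + t), rc c.2) : (E × F) × G)) (𝓝 0) (𝓝 (c.2, rc c.2)) := by
        have : Continuous (fun t : F => (((c.2.1, c.2.2 + t), rc c.2) : (E × F) × G)) := by fun_prop
        simpa using this.tendsto 0
      have u2 : Filter.Tendsto (fun t : F => ((c.2.1, β (pc c, t)) : E × F)) (𝓝 0) (𝓝 c.2) := by
        have := hβt.continuousAt.tendsto; rw [hβc] at this
        exact tendsto_const_nhds.prodMk_nhds this
      filter_upwards [u1.eventually k6, u2.eventually k7] with t v1 v2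
      exact v2 (v1.trans hc)
    have c8 : OrdGE (ℓ + 1) (fun t => ρc ((H c.1 c.2.1, K c.1 (β (pc c, t))), ε c.1)) 0 := by
      refine OrdGE.congr (f := fun _ => (0:G')) ?_ z1.symm
      exact Asymptotics.isBigO_zero _ _
    have c9 := c8.sub c7
    refine c9.congr_left fun v => ?_
    simp only [sub_sub_cancel]
    rfl
  have hf0 : 𝓡 (par0, w0) = 0 := by
    have := (ev_base h.base hvan).self_of_nhds
    exact this h0
  refine ⟨fun par => ψ (par, 0), ?_, ?_⟩
  · refine anC hψ (analyticAt_id.prod analyticAt_const) ?_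
    simp [hf0]; rfl
  · filter_upwards [hvan, tq.eventually hψ2] with c k1 k2 hc
    have := k2
    simp only [k1 hc, map_zero] at this
    exact this.symm

end fam
end reflect

section prolong

variable {E F A B Q G G' : Type} [NormedAddCommGroup E] [NormedSpace ℂ E] [FiniteDimensional ℂ E]
  [NormedAddCommGroup F] [NormedSpace ℂ F] [FiniteDimensional ℂ F]
  [NormedAddCommGroup A] [NormedSpace ℂ A] [FiniteDimensional ℂ A]
  [NormedAddCommGroup B] [NormedSpace ℂ B] [FiniteDimensional ℂ B]
  [NormedAddCommGroup Q] [NormedSpace ℂ Q] [FiniteDimensional ℂ Q]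
  [NormedAddCommGroup G] [NormedSpace ℂ G] [FiniteDimensional ℂ G]
  [NormedAddCommGroup G'] [NormedSpace ℂ G'] [FiniteDimensional ℂ G']
variable {ι : Type} {𝓛 : Filter ι} {i0 : ι} {H : ι → E → A} {K : ι → F → B} {ε : ι → Q}
    {rc : E × F → G} {P : E × F} {ρc : (A × B) × Q → G'}

theorem prolong {ℓ : ℕ} (k : ℕ) {B2 : (E × F) × G → F} (h : FamOK 𝓛 i0 H K ε rc P ρc) (hrc : AnalyticAt ℂ rc P)
    (hB : IsB2 rc P B2) {Ψ : (E × F) × JetSp ℓ F B × Q → A} (hΨ : AnalyticAt ℂ Ψ (P, jet ℓ (K i0) P.2, ε i0))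
    (heq : ∀ᶠ c in 𝓛 ×ˢ 𝓝 P, rc c.2 = 0 → H c.1 c.2.1 = Ψ (c.2, jet ℓ (K c.1) c.2.2, ε c.1)) :
    ∃ Ψk : (E × F) × JetSp (k + ℓ) F B × Q → JetSp k E A,
      AnalyticAt ℂ Ψk (P, jet (k + ℓ) (K i0) P.2, ε i0) ∧
      ∀ᶠ c in 𝓛 ×ˢ 𝓝 P, rc c.2 = 0 → jet k (H c.1) c.2.1 = Ψk (c.2, jet (k + ℓ) (K c.1) c.2.2, ε c.1) := by
  set J0 := jet (k + ℓ) (K i0) P.2 with hJ0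
  set ε0 := ε i0 with hε0
  have hK0 : AnalyticAt ℂ (K i0) P.2 := (ev_base h.base h.anK).self_of_nhds
  let Par := (E × F) × JetSp (k + ℓ) F B × Q
  let par0 : Par := (P, J0, ε0)
  let β : Par × E → F := fun c => B2 ((c.1.1.1 + c.2, c.1.1.2), rc c.1.1)
  have hβ0 : β (par0, 0) = P.2 := by
    simp only [β, par0, add_zero]; exact hB.base
  have hβ : AnalyticAt ℂ β (par0, 0) := by
    refine anC hB.an (y := (P, rc P)) ?_ (by simp [par0])
    have hP := anF (𝕜 := ℂ) (f := fun c : Par × E => c.1) (x := (par0, 0)) (anF analyticAt_id)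
    exact (((anF hP).add (anS analyticAt_id)).prod (anS hP)).prod (anC hrc hP rfl)
  let τ : JetSp (k + ℓ) F B × F → JetSp ℓ F B := fun c => jet ℓ (jetP c.1) c.2
  have hτ : ∀ c, AnalyticAt ℂ τ c := fun c => jet_analytic ℓ (G := fun c : JetSp (k + ℓ) F B × F => jetP c.1 c.2) (jetP_analytic c)
  let Γ : Par × E → (E × F) × JetSp ℓ F B × Q := fun c =>
    ((c.1.1.1 + c.2, β c), τ (c.1.2.1, β c - c.1.1.2), c.1.2.2)
  have hΓ : AnalyticAt ℂ Γ (par0, 0) := by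
    have hP := anF (𝕜 := ℂ) (f := fun c : Par × E => c.1) (x := (par0, 0)) (anF analyticAt_id)
    refine (((anF hP).add (anS analyticAt_id)).prod hβ).prod (AnalyticAt.prod ?_ ?_)
    · exact anC (hτ _) ((anF (anS (anF analyticAt_id))).prod (hβ.sub (anS hP))) rfl
    · exact anS (anS (anF analyticAt_id))
  have hΓ0 : Γ (par0, 0) = (P, jet ℓ (K i0) P.2, ε0) := by
    simp only [Γ, hβ0]
    simp only [par0, add_zero, sub_self, τ, hJ0, jet_jetP (show ℓ ≤ k + ℓ by omega) hK0]
  have hG : AnalyticAt ℂ (fun c => Ψ (Γ c)) (par0, 0) := anC hΨ hΓ hΓ0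
  refine ⟨fun par => jet k (fun v => Ψ (Γ (par, v))) 0, ?_, ?_⟩
  · exact anC (jet_analytic k hG) (analyticAt_id.prod analyticAt_const) rfl
  have tt1 : Filter.Tendsto (fun c : ι × (E × F) => (c.1, c.2.1)) (𝓛 ×ˢ 𝓝 P) (𝓛 ×ˢ 𝓝 P.1) :=
    Filter.Tendsto.prodMk Filter.tendsto_fst ((continuous_fst.tendsto P).comp Filter.tendsto_snd)
  have tt2 : Filter.Tendsto (fun c : ι × (E × F) => (c.1, c.2.2)) (𝓛 ×ˢ 𝓝 P) (𝓛 ×ˢ 𝓝 P.2) :=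
    Filter.Tendsto.prodMk Filter.tendsto_fst ((continuous_snd.tendsto P).comp Filter.tendsto_snd)
  let pc : ι × (E × F) → Par := fun c => (c.2, jet (k + ℓ) (K c.1) c.2.2, ε c.1)
  have tpc : Filter.Tendsto pc (𝓛 ×ˢ 𝓝 P) (𝓝 par0) :=
    Filter.tendsto_snd.prodMk_nhds (((h.jetK (k + ℓ)).comp tt2).prodMk_nhds (h.eps.comp Filter.tendsto_fst))
  have tβ : Filter.Tendsto (fun c : ι × (E × F) => (pc c, (0:E))) (𝓛 ×ˢ 𝓝 P) (𝓝 (par0, 0)) :=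
    tpc.prodMk_nhds tendsto_const_nhds
  have tΨ : Filter.Tendsto (fun c : ι × (E × F) => (c.2, jet ℓ (K c.1) c.2.2, ε c.1)) (𝓛 ×ˢ 𝓝 P) (𝓝 (P, jet ℓ (K i0) P.2, ε0)) :=
    Filter.tendsto_snd.prodMk_nhds (((h.jetK ℓ).comp tt2).prodMk_nhds (h.eps.comp Filter.tendsto_fst))
  have tfix : ∀ᶠ c in 𝓛 ×ˢ 𝓝 P, B2 (c.2, rc c.2) = c.2.2 := Filter.tendsto_snd.eventually hB.fix
  have tsol : ∀ᶠ c in 𝓛 ×ˢ 𝓝 P, ∀ᶠ b in 𝓝 (c.2, rc c.2), rc (b.1.1, B2 b) = b.2 := by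
    have : Filter.Tendsto (fun c : ι × (E × F) => (c.2, rc c.2)) (𝓛 ×ˢ 𝓝 P) (𝓝 (P, rc P)) :=
      Filter.tendsto_snd.prodMk_nhds (hrc.continuousAt.tendsto.comp Filter.tendsto_snd)
    exact this.eventually hB.sol.eventually_nhds
  filter_upwards [tβ.eventually hG.eventually_analyticAt, tβ.eventually hΓ.eventually_analyticAt,
      tβ.eventually hβ.eventually_analyticAt, tt2.eventually h.anK, tt1.eventually h.anH, tfix, tsol, ev_nhds heq,
      tΨ.eventually hΨ.eventually_analyticAt]
      with c k1 k2 k3 k4 k5 k6 k7 k8 k9 hc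
  have hβt : AnalyticAt ℂ (fun t => β (pc c, t)) 0 := anC k3 (analyticAt_const.prod analyticAt_id) rfl
  have hβc : β (pc c, 0) = c.2.2 := by simpa [β, pc] using k6
  have hr : AnalyticAt ℂ (fun v => Ψ (Γ (pc c, v))) 0 := anC (g := fun c => Ψ (Γ c)) (f := fun v => (pc c, v)) k1 (analyticAt_const.prod analyticAt_id) rfl
  have hr2 : AnalyticAt ℂ (fun v => Γ (pc c, v)) 0 := anC k2 (analyticAt_const.prod analyticAt_id) rfl
  have hl : AnalyticAt ℂ (fun v => H c.1 (c.2.1 + v)) 0 := anC k5 (analyticAt_const.add analyticAt_id) (by simp)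
  rw [← jet_translate]
  refine (jet_eq_iff hl hr).2 ?_
  let Γ' : E → (E × F) × JetSp ℓ F B × Q := fun v =>
    ((c.2.1 + v, β (pc c, v)), jet ℓ (K c.1) (β (pc c, v)), ε c.1)
  have hjK : AnalyticAt ℂ (jet ℓ (K c.1)) c.2.2 := analyticAt_pi_iff.2 fun i => k4.iterF i
  have hΓ' : AnalyticAt ℂ Γ' 0 :=
    ((analyticAt_const.add analyticAt_id).prod hβt).prod ((anC hjK hβt hβc).prod analyticAt_const)
  have z1 : (fun v => H c.1 (c.2.1 + v)) =ᶠ[𝓝 0] fun v => Ψ (Γ' v) := by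
    have u1 : Filter.Tendsto (fun t : E => (((c.2.1 + t, c.2.2), rc c.2) : (E × F) × G)) (𝓝 0) (𝓝 (c.2, rc c.2)) := by
      have : Continuous (fun t : E => (((c.2.1 + t, c.2.2), rc c.2) : (E × F) × G)) := by fun_prop
      simpa using this.tendsto 0
    have u2 : Filter.Tendsto (fun t : E => ((c.2.1 + t, β (pc c, t)) : E × F)) (𝓝 0) (𝓝 c.2) := by
      have := hβt.continuousAt.tendsto; rw [hβc] at this
      exact Filter.Tendsto.prodMk_nhds (by simpa using (by fun_prop : Continuous fun t : E => c.2.1 + t).tendsto 0) this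
    filter_upwards [u1.eventually k7, u2.eventually k8] with t v1 v2
    exact v2 (v1.trans hc)
  have c5 : OrdGE (k + 1) (fun y => jet ℓ (K c.1) y - τ (jet (k + ℓ) (K c.1) c.2.2, y - c.2.2)) c.2.2 := by
    have a2 : AnalyticAt ℂ (fun y => jetP (jet (k + ℓ) (K c.1) c.2.2) (y - c.2.2)) c.2.2 :=
      anJetP analyticAt_const (analyticAt_id.sub analyticAt_const)
    have a1 := jet_ord (k4.fun_sub a2) (k := k + 1) (l := ℓ) ((jetP_approx (k + ℓ) k4).mono (by omega))
    refine a1.congr ?_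
    filter_upwards [k4.eventually_analyticAt, a2.eventually_analyticAt] with y b1 b2
    rw [jet_sub b1 b2, jet_shift]
  have c6 := c5.comp (γ := fun t => β (pc c, t)) hβc hβt.differentiableAt
  have c7 : OrdGE (k + 1) (fun v => Γ' v - Γ (pc c, v)) 0 := by
    let Lc : JetSp ℓ F B →L[ℂ] (E × F) × JetSp ℓ F B × Q :=
      (ContinuousLinearMap.inr ℂ (E × F) (JetSp ℓ F B × Q)).comp (ContinuousLinearMap.inl ℂ (JetSp ℓ F B) Q)
    refine (c6.clm Lc).congr_left fun v => ?_
    simp [Γ', Γ, Lc, pc]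
  have hΓ'0 : Γ' 0 = (c.2, jet ℓ (K c.1) c.2.2, ε c.1) := by
    simp only [Γ', hβc]; simp
  have hΓc0 : Γ (pc c, 0) = (c.2, jet ℓ (K c.1) c.2.2, ε c.1) := by
    simp only [Γ, hβc]
    simp only [pc, add_zero, sub_self, τ, jet_jetP (show ℓ ≤ k + ℓ by omega) k4]
  have c8 := comp_ord k9 hΓ'.continuousAt hr2.continuousAt hΓ'0 hΓc0 c7
  refine c8.congr ?_
  filter_upwards [z1] with v hv
  rw [hv]

end prolong

section tame

variable {N d : ℕ}
variable {A B Q G' : Type}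
  [NormedAddCommGroup A] [NormedSpace ℂ A] [FiniteDimensional ℂ A]
  [NormedAddCommGroup B] [NormedSpace ℂ B] [FiniteDimensional ℂ B]
  [NormedAddCommGroup Q] [NormedSpace ℂ Q] [FiniteDimensional ℂ Q]
  [NormedAddCommGroup G'] [NormedSpace ℂ G'] [FiniteDimensional ℂ G']
variable {ι : Type} {𝓛 : Filter ι} {i0 : ι} {H : ι → Cn N → A} {K : ι → Cn N → B} {ε : ι → Q}
    {rc : YY N → Fin d → ℂ} {P : YY N} {ρc : (A × B) × Q → G'}

lemma analyticAt_clm_comp' {X Y Z : Type} [NormedAddCommGroup X] [NormedSpace ℂ X] [NormedAddCommGroup Y] [NormedSpace ℂ Y]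
    [NormedAddCommGroup Z] [NormedSpace ℂ Z] (L : Y →L[ℂ] Z) {f : X → Y} {x : X} (h : AnalyticAt ℂ f x) :
    AnalyticAt ℂ (fun y => L (f y)) x := anC (L.analyticAt (f x)) h rfl

/-- jets at the moved point are functions of jets at the initial point -/
def Tame {N d : ℕ} {A B Q : Type}
    [NormedAddCommGroup A] [NormedSpace ℂ A]
    [NormedAddCommGroup B] [NormedSpace ℂ B]
    [NormedAddCommGroup Q] [NormedSpace ℂ Q]
    {ι : Type} (𝓛 : Filter ι) (i0 : ι) (H : ι → Cn N → A) (K : ι → Cn N → B) (ε : ι → Q)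
    (rc : YY N → Fin d → ℂ) (P : YY N) (V : Type) [NormedAddCommGroup V] [NormedSpace ℂ V]
    (f : V × YY N → YY N) : Prop :=
  ∀ k, ∃ (κ : ℕ) (T : V × YY N × JetSp κ (Cn N) A × JetSp κ (Cn N) B × Q → JetSp k (Cn N) A × JetSp k (Cn N) B),
    AnalyticAt ℂ T (0, P, jet κ (H i0) P.1, jet κ (K i0) P.2, ε i0) ∧
    ∀ᶠ c in 𝓛 ×ˢ 𝓝 ((0 : V), P), rc c.2.2 = 0 →
      (jet k (H c.1) (f c.2).1, jet k (K c.1) (f c.2).2) =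
        T (c.2.1, c.2.2, jet κ (H c.1) c.2.2.1, jet κ (K c.1) c.2.2.2, ε c.1)

lemma tame_one (h : FamOK 𝓛 i0 H K ε rc P ρc) {Am Bm : Cn N × YY N → YY N} {ℓ : ℕ}
    (hF : FlowOK rc P Am Bm) (hB1 : ∀ c, (Bm c).1 = c.2.1)
    (hΨ : ∀ k, ∃ Ψk : (Cn N × Cn N) × JetSp (k + ℓ) (Cn N) A × Q → JetSp k (Cn N) B,
      AnalyticAt ℂ Ψk (P.swap, jet (k + ℓ) (H i0) P.1, ε i0) ∧
      ∀ᶠ c in 𝓛 ×ˢ 𝓝 P.swap, rc c.2.swap = 0 → jet k (K c.1) c.2.1 = Ψk (c.2, jet (k + ℓ) (H c.1) c.2.2, ε c.1)) :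
    Tame 𝓛 i0 H K ε rc P (Cn N) Bm := by
  intro k
  obtain ⟨Ψk, hΨk, heq⟩ := hΨ k
  have hBP : Bm (0, P) = P := hF.idB.self_of_nhds
  have tB : Filter.Tendsto Bm (𝓝 (0, P)) (𝓝 P) := by
    have := hF.anB.continuousAt.tendsto; rwa [hBP] at this
  refine ⟨k + ℓ, fun c => (jetLow (by omega) c.2.2.1, Ψk ((Bm (c.1, c.2.1)).swap, c.2.2.1, c.2.2.2.2)), ?_, ?_⟩
  · have i3 : AnalyticAt ℂ (fun c : Cn N × YY N × JetSp (k + ℓ) (Cn N) A × JetSp (k + ℓ) (Cn N) B × Q => c.2.2)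
        (0, P, jet (k + ℓ) (H i0) P.1, jet (k + ℓ) (K i0) P.2, ε i0) := anS (anS analyticAt_id)
    have i4 := anF i3
    have i1 : AnalyticAt ℂ (fun c : Cn N × YY N × JetSp (k + ℓ) (Cn N) A × JetSp (k + ℓ) (Cn N) B × Q => Bm (c.1, c.2.1))
        (0, P, jet (k + ℓ) (H i0) P.1, jet (k + ℓ) (K i0) P.2, ε i0) :=
      anC hF.anB ((anF analyticAt_id).prod (anF (anS analyticAt_id))) rfl
    refine AnalyticAt.prod ?_ ?_
    · exact analyticAt_clm_comp' (jetLow (E := Cn N) (F := A) (show k ≤ k + ℓ by omega)) i4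
    · refine anC hΨk (((anS i1).prod (anF i1)).prod (i4.prod (anS (anS i3)))) ?_
      simp only [hBP]
  · have t1 : Filter.Tendsto (fun c : ι × (Cn N × YY N) => (c.1, (Bm c.2).swap)) (𝓛 ×ˢ 𝓝 (0, P)) (𝓛 ×ˢ 𝓝 P.swap) :=
      Filter.Tendsto.prodMk Filter.tendsto_fst ((continuous_swap.tendsto P).comp (tB.comp Filter.tendsto_snd))
    filter_upwards [t1.eventually heq, Filter.tendsto_snd.eventually hF.invB] with c k1 k2 hc
    have := k1 (by simpa [k2] using hc)
    simp only [Prod.fst_swap, Prod.snd_swap] at this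
    simp only [this, hB1, Prod.mk.injEq]
    exact ⟨rfl, trivial⟩

lemma tame_one' (h : FamOK 𝓛 i0 H K ε rc P ρc) {Am Bm : Cn N × YY N → YY N} {ℓ : ℕ}
    (hF : FlowOK rc P Am Bm) (hA2 : ∀ c, (Am c).2 = c.2.2)
    (hΨ : ∀ k, ∃ Ψk : (Cn N × Cn N) × JetSp (k + ℓ) (Cn N) B × Q → JetSp k (Cn N) A,
      AnalyticAt ℂ Ψk (P, jet (k + ℓ) (K i0) P.2, ε i0) ∧
      ∀ᶠ c in 𝓛 ×ˢ 𝓝 P, rc c.2 = 0 → jet k (H c.1) c.2.1 = Ψk (c.2, jet (k + ℓ) (K c.1) c.2.2, ε c.1)) :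
    Tame 𝓛 i0 H K ε rc P (Cn N) Am := by
  intro k
  obtain ⟨Ψk, hΨk, heq⟩ := hΨ k
  have hBP : Am (0, P) = P := hF.idA.self_of_nhds
  have tB : Filter.Tendsto Am (𝓝 (0, P)) (𝓝 P) := by
    have := hF.anA.continuousAt.tendsto; rwa [hBP] at this
  refine ⟨k + ℓ, fun c => (Ψk ((Am (c.1, c.2.1)), c.2.2.2.1, c.2.2.2.2), jetLow (by omega) c.2.2.2.1), ?_, ?_⟩
  · have i3 : AnalyticAt ℂ (fun c : Cn N × YY N × JetSp (k + ℓ) (Cn N) A × JetSp (k + ℓ) (Cn N) B × Q => c.2.2)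
        (0, P, jet (k + ℓ) (H i0) P.1, jet (k + ℓ) (K i0) P.2, ε i0) := anS (anS analyticAt_id)
    have i4 := anF (anS i3)
    have i1 : AnalyticAt ℂ (fun c : Cn N × YY N × JetSp (k + ℓ) (Cn N) A × JetSp (k + ℓ) (Cn N) B × Q => Am (c.1, c.2.1))
        (0, P, jet (k + ℓ) (H i0) P.1, jet (k + ℓ) (K i0) P.2, ε i0) :=
      anC hF.anA ((anF analyticAt_id).prod (anF (anS analyticAt_id))) rfl
    refine AnalyticAt.prod ?_ ?_
    · refine anC hΨk (i1.prod (i4.prod (anS (anS i3)))) ?_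
      simp only [hBP]
    · exact analyticAt_clm_comp' (jetLow (E := Cn N) (F := B) (show k ≤ k + ℓ by omega)) i4
  · have t1 : Filter.Tendsto (fun c : ι × (Cn N × YY N) => (c.1, (Am c.2))) (𝓛 ×ˢ 𝓝 (0, P)) (𝓛 ×ˢ 𝓝 P) :=
      Filter.Tendsto.prodMk Filter.tendsto_fst (tB.comp Filter.tendsto_snd)
    filter_upwards [t1.eventually heq, Filter.tendsto_snd.eventually hF.invA] with c k1 k2 hc
    have := k1 (by simpa [k2] using hc)
    simp only [hA2] at this
    simp only [this, hA2, Prod.mk.injEq]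
    exact ⟨trivial, rfl⟩

theorem tame_all (h : FamOK 𝓛 i0 H K ε rc P ρc) (h0 : rc P = 0) {Am Bm : Cn N × YY N → YY N}
    (hF : FlowOK rc P Am Bm) (tA : Tame 𝓛 i0 H K ε rc P (Cn N) Am) (tB : Tame 𝓛 i0 H K ε rc P (Cn N) Bm)
    {V : Type} [NormedAddCommGroup V] [NormedSpace ℂ V] [FiniteDimensional ℂ V]
    {f : V × YY N → YY N} (hf : Adm Am Bm V f) : Tame 𝓛 i0 H K ε rc P V f := by
  induction hf with
  | A => exact tA
  | B => exact tB
  | @comp V W _ _ _ _ _ _ f g af ag ihf ihg =>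
    intro k
    have pf := af.props hF
    obtain ⟨κg, Tg, hTg, eg⟩ := ihg k
    obtain ⟨κf, Tf, hTf, ef⟩ := ihf κg
    have hb : (jet κg (H i0) P.1, jet κg (K i0) P.2) = Tf (0, P, jet κf (H i0) P.1, jet κf (K i0) P.2, ε i0) := by
      have := (ev_base h.base ef).self_of_nhds h0
      simpa only [pf.base] using this
    refine ⟨κf, fun c => Tg (c.1.2, f (c.1.1, c.2.1), (Tf (c.1.1, c.2)).1, (Tf (c.1.1, c.2)).2, c.2.2.2.2), ?_, ?_⟩
    · have i0' : AnalyticAt ℂ (fun c : (V × W) × YY N × JetSp κf (Cn N) A × JetSp κf (Cn N) B × Q => c.1)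
        (0, P, jet κf (H i0) P.1, jet κf (K i0) P.2, ε i0) := anF analyticAt_id
      have i1' : AnalyticAt ℂ (fun c : (V × W) × YY N × JetSp κf (Cn N) A × JetSp κf (Cn N) B × Q => c.2)
        (0, P, jet κf (H i0) P.1, jet κf (K i0) P.2, ε i0) := anS analyticAt_id
      have i2 : AnalyticAt ℂ (fun c : (V × W) × YY N × JetSp κf (Cn N) A × JetSp κf (Cn N) B × Q => Tf (c.1.1, c.2))
        (0, P, jet κf (H i0) P.1, jet κf (K i0) P.2, ε i0) := anC hTf ((anF i0').prod i1') rfl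
      have i3 : AnalyticAt ℂ (fun c : (V × W) × YY N × JetSp κf (Cn N) A × JetSp κf (Cn N) B × Q => f (c.1.1, c.2.1))
        (0, P, jet κf (H i0) P.1, jet κf (K i0) P.2, ε i0) := anC pf.an ((anF i0').prod (anF i1')) rfl
      refine anC hTg ((anS i0').prod (i3.prod ((anF i2).prod ((anS i2).prod (anS (anS (anS i1'))))))) ?_
      have e1 : ((0, P, jet κf (H i0) P.1, jet κf (K i0) P.2, ε i0) : (V × W) × YY N × JetSp κf (Cn N) A × JetSp κf (Cn N) B × Q).1.1 = 0 := rfl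
      change ((0:W), f ((0:V), P), (Tf ((0:V), P, jet κf (H i0) P.1, jet κf (K i0) P.2, ε i0)).1,
        (Tf ((0:V), P, jet κf (H i0) P.1, jet κf (K i0) P.2, ε i0)).2, ε i0) = _
      rw [← hb, pf.base]
    · have t1 : Filter.Tendsto (fun c : ι × ((V × W) × YY N) => (c.1, (c.2.1.1, c.2.2))) (𝓛 ×ˢ 𝓝 (0, P)) (𝓛 ×ˢ 𝓝 (0, P)) :=
        Filter.Tendsto.prodMk Filter.tendsto_fst
          (((by fun_prop : Continuous (fun c : (V × W) × YY N => (c.1.1, c.2))).tendsto (0, P)).comp Filter.tendsto_snd)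
      have t2 : Filter.Tendsto (fun c : ι × ((V × W) × YY N) => (c.1, (c.2.1.2, f (c.2.1.1, c.2.2)))) (𝓛 ×ˢ 𝓝 (0, P)) (𝓛 ×ˢ 𝓝 (0, P)) :=
        Filter.Tendsto.prodMk Filter.tendsto_fst (pf.tend2.comp Filter.tendsto_snd)
      have t3 : Filter.Tendsto (fun c : ι × ((V × W) × YY N) => (c.2.1.1, c.2.2)) (𝓛 ×ˢ 𝓝 (0, P)) (𝓝 (0, P)) :=
        ((by fun_prop : Continuous (fun c : (V × W) × YY N => (c.1.1, c.2))).tendsto (0, P)).comp Filter.tendsto_snd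
      filter_upwards [t1.eventually ef, t2.eventually eg, t3.eventually pf.inv] with c k1 k2 k3 hc
      have q1 := k1 hc
      have q2 := k2 (k3.trans hc)
      rw [q2, ← q1]

/-- the jet parametrization -/
theorem param (h : FamOK 𝓛 i0 H K ε rc P ρc) (h0 : rc P = 0) {Am Bm : Cn N × YY N → YY N}
    (hF : FlowOK rc P Am Bm) (tA : Tame 𝓛 i0 H K ε rc P (Cn N) Am) (tB : Tame 𝓛 i0 H K ε rc P (Cn N) Bm)
    {V : Type} [NormedAddCommGroup V] [NormedSpace ℂ V] [FiniteDimensional ℂ V]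
    {g : V × YY N → YY N} (hg : Adm Am Bm V g)
    (hs : ∃ᶠ y in 𝓝 (0:V), g (y, P) = P ∧ AnalyticAt ℂ (fun y => g (y, P)) y ∧
      Function.Surjective (fderiv ℂ (fun y => (g (y, P)).1) y)) :
    ∃ (κ : ℕ) (Φ : Cn N × JetSp κ (Cn N) A × JetSp κ (Cn N) B × Q → A),
      AnalyticAt ℂ Φ (P.1, jet κ (H i0) P.1, jet κ (K i0) P.2, ε i0) ∧
      ∀ᶠ c in 𝓛 ×ˢ 𝓝 P.1, H c.1 c.2 = Φ (c.2, jet κ (H c.1) P.1, jet κ (K c.1) P.2, ε c.1) := by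
  obtain ⟨κ, T, hT, eT⟩ := tame_all h h0 hF tA tB hg 0
  have tg : Filter.Tendsto (fun y : V => (y, P)) (𝓝 0) (𝓝 (0, P)) :=
    Filter.tendsto_id.prodMk_nhds tendsto_const_nhds
  have tg2 : Filter.Tendsto (fun y : V => (y, P, jet κ (H i0) P.1, jet κ (K i0) P.2, ε i0)) (𝓝 0) (𝓝 (0, P, jet κ (H i0) P.1, jet κ (K i0) P.2, ε i0)) :=
    Filter.tendsto_id.prodMk_nhds tendsto_const_nhds
  obtain ⟨pa, ha, pb, hb, hab⟩ := Filter.eventually_prod_iff.1 eT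
  obtain ⟨y, ⟨hy1, hy2, hy3⟩, hy4, hy5⟩ := (hs.and_eventually ((tg2.eventually hT.eventually_analyticAt).and
    (tg.eventually hb).eventually_nhds)).exists
  have hgy : AnalyticAt ℂ (fun y => (g (y, P)).1) y := anF hy2
  obtain ⟨s, hs1, hs2, hs3⟩ := analytic_rightInv hgy hy3
  simp only [hy1] at hs1 hs2 hs3
  refine ⟨κ, fun c => jetP (T (s c.1, P, c.2)).1 0, ?_, ?_⟩
  · refine anJetP (anF (anC hy4 (f := fun c : Cn N × JetSp κ (Cn N) A × JetSp κ (Cn N) B × Q => (s c.1, P, c.2)) ((anC (f := fun c : Cn N × JetSp κ (Cn N) A × JetSp κ (Cn N) B × Q => c.1) hs1 (anF analyticAt_id) rfl).prod (analyticAt_const.prod (anS analyticAt_id))) ?_)) analyticAt_const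
    simp [hs2]
  · have ts : Filter.Tendsto s (𝓝 P.1) (𝓝 y) := by
      have := hs1.continuousAt.tendsto; rwa [hs2] at this
    filter_upwards [Filter.tendsto_fst.eventually ha, Filter.tendsto_snd.eventually hs3,
      Filter.tendsto_snd.eventually (ts.eventually hy5)] with c k1 k2 k3
    have := hab k1 k3 h0
    simp only at this
    rw [← this, k2, jetP_zero]

end tame

section pkg
variable {N N' dM d : ℕ}

lemma cf_norm (y : Fin d → ℂ) : ‖cf d y‖ = ‖y‖ := by
  simp only [Pi.norm_def]
  congr 2
  ext j
  simp

lemma cj_norm {n : ℕ} (y : Cn n) : ‖cj n y‖ = ‖y‖ := by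
  simp [EuclideanSpace.norm_eq]

lemma sym_fderiv {n : ℕ} {fc : Cn n × Cn n → Fin d → ℂ} {X : Cn n × Cn n}
    (h : ∀ᶠ Y in 𝓝 X, fc (sg n Y) = cf d (fc Y)) (hd : DifferentiableAt ℂ fc (sg n X)) (V : Cn n × Cn n) :
    fderiv ℂ fc X V = cf d (fderiv ℂ fc (sg n X) (sg n V)) := by
  have h1 : fc =ᶠ[𝓝 X] fun Y => cf d (fc (sg n Y)) := by
    filter_upwards [h] with Y hY
    rw [hY, cf_cf]
  rw [h1.fderiv_eq]
  have := (conj_hasFDerivAt (x := sg n X) (sg n) (cf d) hd.hasFDerivAt).fderiv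
  rw [this]
  rfl

lemma nondeg_swap (G : Gen N dM) (G' : Gen N' d) {ℓ : ℕ} {H : Cn N → Cn N'} (hH : AnalyticAt ℂ H G.p)
    (hHp : H G.p = G'.p)
    (hN : NonDeg ℓ G.rc G.P0 G'.rc (H G.p) (fun ζ => cj N' (H (cj N ζ)))) :
    NonDegG ℓ (fun X => G.rc X.swap) G.P0.swap (fun W => G'.rc W.swap) (cj N' (H G.p)) H := by
  intro u hu
  have key : cj N' u = 0 := by
    apply hN
    have tc : Filter.Tendsto (fun ζ => cj N ζ) (𝓝 (cj N G.p)) (𝓝 G.p) := by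
      have := (cj N).continuous.tendsto (cj N G.p)
      rwa [cj_cj] at this
    have t1 : Filter.Tendsto (fun ζ => cj N ζ) (𝓝[{ζ | G.rc (G.p, ζ) = 0}] (cj N G.p))
        (𝓝[{z | G.rc (z, cj N G.p) = 0}] G.p) := by
      refine tendsto_nhdsWithin_of_tendsto_nhds_of_eventually_within _ (tc.mono_left nhdsWithin_le_nhds) ?_
      have tt : Filter.Tendsto (fun ζ : Cn N => (G.p, ζ)) (𝓝 (cj N G.p)) (𝓝 (G.p, cj N G.p)) :=
        tendsto_const_nhds.prodMk_nhds Filter.tendsto_id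
      filter_upwards [nhdsWithin_le_nhds (tt.eventually G.sym), self_mem_nhdsWithin] with ζ h1 h2
      simp only [sg_apply, Set.mem_setOf_eq] at h1 h2 ⊢
      rw [h1, h2, map_zero]
    have O1 := (hu : _ =O[𝓝[{z | G.rc (z, cj N G.p) = 0}] G.p] fun ζ => ‖ζ - G.p‖ ^ (ℓ+1)).comp_tendsto t1
    refine Asymptotics.IsBigO.congr' (f₁ := fun ζ => cf d (fderiv ℂ (fun W => G'.rc W.swap) (cj N' (H G.p), H (cj N ζ)) (u, 0)))
      (g₁ := fun ζ => ‖cj N ζ - G.p‖ ^ (ℓ+1)) ?_ ?_ ?_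
    · refine Asymptotics.IsBigO.trans ?_ O1
      exact Asymptotics.isBigO_of_le _ fun ζ => by rw [cf_norm]; exact le_rfl
    · have hHc : Filter.Tendsto (fun ζ => H (cj N ζ)) (𝓝 (cj N G.p)) (𝓝 G'.p) := by
        have := hH.continuousAt.tendsto.comp tc
        rwa [hHp] at this
      have t2 : Filter.Tendsto (fun ζ => (H G.p, cj N' (H (cj N ζ)))) (𝓝 (cj N G.p)) (𝓝 (G'.p, cj N' G'.p)) := by
        rw [hHp]
        exact tendsto_const_nhds.prodMk_nhds (((cj N').continuous.tendsto _).comp hHc)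
      have t3 : Filter.Tendsto (fun ζ => (H (cj N ζ), cj N' (H G.p))) (𝓝 (cj N G.p)) (𝓝 (G'.p, cj N' G'.p)) := by
        rw [hHp]
        exact hHc.prodMk_nhds tendsto_const_nhds
      filter_upwards [nhdsWithin_le_nhds (t2.eventually G'.sym.eventually_nhds), nhdsWithin_le_nhds (t3.eventually (diffAt_iff_analytic G'.hrc))] with ζ h1 h2
      rw [sym_fderiv h1 (by simpa using h2)]
      congr 1
      have hsw : (fun W : Cn N' × Cn N' => G'.rc W.swap) = G'.rc ∘ (ContinuousLinearEquiv.prodComm ℂ (Cn N') (Cn N')) := rfl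
      rw [hsw, ContinuousLinearEquiv.comp_right_fderiv]
      simp
    · refine Filter.Eventually.of_forall fun ζ => ?_
      simp only [Gen.P0]
      rw [← cj_norm (cj N ζ - G.p), map_sub, cj_cj]
  rw [← cj_cj u, key, map_zero]

theorem param_pkg (G : Gen N dM) {M U : Set (Cn N)} (hU : IsOpen U) (hpU : G.p ∈ U)
    (hMU : M ∩ U = {z | z ∈ U ∧ G.r z = 0}) (hmin : IsMinimalAt M dM G.p) (G' : Gen N' d)
    {Q : Type} [NormedAddCommGroup Q] [NormedSpace ℂ Q] [FiniteDimensional ℂ Q]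
    {ι : Type} {𝓛 : Filter ι} {i0 : ι} {H K : ι → Cn N → Cn N'} {ε : ι → Q}
    {ρc : (Cn N' × Cn N') × Q → Fin d → ℂ} {ℓ : ℕ}
    (h : FamOK 𝓛 i0 H K ε G.rc G.P0 ρc) (hρ : AnalyticAt ℂ ρc ((G'.p, cj N' G'.p), ε i0))
    (hK : K i0 = fun ζ => cj N' (H i0 (cj N ζ))) (hHp : H i0 G.p = G'.p)
    (hG' : G'.rc = fun W => ρc (W, ε i0))
    (hspan : Submodule.span ℂ (spanSet M G.p ℓ G'.r (H i0)) = ⊤) :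
    ∃ (κ : ℕ) (Φ : Cn N × JetSp κ (Cn N) (Cn N') × JetSp κ (Cn N) (Cn N') × Q → Cn N'),
      AnalyticAt ℂ Φ (G.p, jet κ (H i0) G.p, jet κ (K i0) (cj N G.p), ε i0) ∧
      ∀ᶠ c in 𝓛 ×ˢ 𝓝 G.p, H c.1 c.2 = Φ (c.2, jet κ (H c.1) G.p, jet κ (K c.1) (cj N G.p), ε c.1) := by
  have hM : ∀ᶠ z in 𝓝 G.p, G.r z = 0 ↔ z ∈ M := by
    filter_upwards [hU.mem_nhds hpU] with z hz
    have := Set.ext_iff.1 hMU z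
    simp only [Set.mem_inter_iff, Set.mem_setOf_eq, hz, and_true, true_and] at this
    exact this.symm
  have hH : AnalyticAt ℂ (H i0) G.p := (ev_base h.base h.anH).self_of_nhds
  have hN : NonDeg ℓ G.rc G.P0 G'.rc (H i0 G.p) (fun ζ => cj N' (H i0 (cj N ζ))) :=
    nondeg_of_span G hM (by rw [hHp]; exact G'.hr) (by rw [hHp]; exact G'.hrc)
      (by rw [hHp]; exact G'.ext) hH hspan
  have hN' := nondeg_swap G G' hH hHp hN
  obtain ⟨B2, hB⟩ := exists_B2 G.hrc' G.surj2
  have hKp : K i0 (cj N G.p) = cj N' G'.p := by rw [hK]; simp [hHp]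
  have hrcs : AnalyticAt ℂ (fun X : Cn N × Cn N => G.rc X.swap) G.P0.swap :=
    anC G.hrc' ((anS analyticAt_id).prod (anF analyticAt_id)) (by simp)
  obtain ⟨B2', hB'⟩ := exists_B2 (rc := fun X : Cn N × Cn N => G.rc X.swap) (P := G.P0.swap) hrcs (by
    intro y
    obtain ⟨u, hu⟩ := G.surj1 y
    refine ⟨u, ?_⟩
    have hsw : (fun W : Cn N × Cn N => G.rc W.swap) = G.rc ∘ (ContinuousLinearEquiv.prodComm ℂ (Cn N) (Cn N)) := rfl
    rw [hsw, ContinuousLinearEquiv.comp_right_fderiv]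
    simpa [Gen.P0] using hu)
  obtain ⟨Ψ, hΨ, eΨ⟩ := reflect (ℓ := ℓ) h G.hrc' G.rcP0 hB (by simpa [Gen.P0, hHp, hKp] using hρ) (by
    rw [← hG', hK]; exact hN)
  obtain ⟨Ψ', hΨ', eΨ'⟩ := reflect (ℓ := ℓ) h.swap hrcs (by simpa using G.rcP0) hB'
    (by
      refine anC (g := ρc) hρ (f := fun Z : (Cn N' × Cn N') × Q => (Z.1.swap, Z.2)) (((anS (anF analyticAt_id)).prod (anF (anF analyticAt_id))).prod (anS analyticAt_id)) ?_
      simp [Gen.P0, hHp, hKp]) (by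
    have e : (fun W : Cn N' × Cn N' => ρc (W.swap, ε i0)) = fun W => G'.rc W.swap := by rw [hG']
    show NonDegG ℓ _ _ (fun W : Cn N' × Cn N' => ρc (W.swap, ε i0)) (K i0 (cj N G.p)) _
    rw [e, hKp, ← hHp]; exact hN')
  have hF := flowOK G hB
  have tA := tame_one' h hF (ℓ := ℓ) (fun c => by simp [Am, Bm]) (fun k => prolong k h G.hrc' hB hΨ eΨ)
  have tB := tame_one h hF (ℓ := ℓ) (fun c => rfl) (fun k => prolong k h.swap hrcs hB' hΨ' eΨ')
  obtain ⟨V, i1, i2, i3, g, hg, hs⟩ := minimal_flow G hU hpU hMU hmin hB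
  exact param h G.rcP0 hF tA tB hg hs
end pkg

section famok

lemma jet_tendsto {E F : Type} [NormedAddCommGroup E] [NormedSpace ℂ E] [FiniteDimensional ℂ E]
    [NormedAddCommGroup F] [NormedSpace ℂ F] [FiniteDimensional ℂ F] {ι : Type} {𝓛 : Filter ι} {i0 : ι}
    {f : ι → E → F} {x : E} {R : ℝ} (hR : 0 < R) (hd : ∀ i, DifferentiableOn ℂ (f i) (Metric.ball x R))
    (hu : ∀ η > 0, ∀ᶠ i in 𝓛, ∀ y ∈ Metric.ball x R, ‖f i y - f i0 y‖ ≤ η) (k : ℕ) :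
    Filter.Tendsto (fun c : ι × E => jet k (f c.1) c.2) (𝓛 ×ˢ 𝓝 x) (𝓝 (jet k (f i0) x)) := by
  have : CompleteSpace F := FiniteDimensional.complete ℂ F
  have han : ∀ i, ∀ y ∈ Metric.ball x R, AnalyticAt ℂ (f i) y := fun i y hy => by
    apply osgood
    filter_upwards [Metric.isOpen_ball.mem_nhds hy] with z hz
    exact (hd i).differentiableAt (Metric.isOpen_ball.mem_nhds hz)
  obtain ⟨C, hC0, hC⟩ := jet_small (E := E) (F := F) k hR
  have h0 : Filter.Tendsto (fun c : ι × E => jet k (f i0) c.2) (𝓛 ×ˢ 𝓝 x) (𝓝 (jet k (f i0) x)) := by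
    have h1 : AnalyticAt ℂ (fun c : E × E => jet k (fun y => f i0 y) c.2) (0, x) := jet_analytic (Q := E) k
      (G := fun c => f i0 c.2) (anC (han i0 x (Metric.mem_ball_self hR)) (anS analyticAt_id) rfl)
    have h2 : Filter.Tendsto (fun c : ι × E => ((0 : E), c.2)) (𝓛 ×ˢ 𝓝 x) (𝓝 (0, x)) :=
      tendsto_const_nhds.prodMk_nhds Filter.tendsto_snd
    exact h1.continuousAt.tendsto.comp h2
  have h1 : Filter.Tendsto (fun c : ι × E => jet k (f c.1) c.2 - jet k (f i0) c.2) (𝓛 ×ˢ 𝓝 x) (𝓝 0) := by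
    rw [Metric.tendsto_nhds]
    intro η hη
    have hη' : 0 < η / (C + 1) := by positivity
    refine Filter.eventually_prod_iff.2 ⟨_, hu _ hη', fun y => y ∈ Metric.ball x (R / 2), Metric.ball_mem_nhds _ (by positivity), ?_⟩
    intro i hi y hy
    have hyR : y ∈ Metric.ball x R := Metric.ball_subset_ball (by linarith) hy
    rw [dist_zero_right, ← jet_sub (han i y hyR) (han i0 y hyR)]
    refine (hC (fun y => f i y - f i0 y) x _ ((hd i).sub (hd i0)) hi y hy).trans_lt ?_
    rw [← mul_div_assoc, div_lt_iff₀ (by positivity)]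
    nlinarith
  have := h1.add h0
  simpa using this

variable {N N' dM d m : ℕ}

lemma ext_tendsto {E F : Type} [NormedAddCommGroup E] [NormedSpace ℂ E] [FiniteDimensional ℂ E]
    [NormedAddCommGroup F] [NormedSpace ℂ F] [FiniteDimensional ℂ F] {ι : Type} {𝓛 : Filter ι} {i0 : ι}
    {f : ι → E → F} {x : E} {R : ℝ} (hR : 0 < R) (hd : ∀ i, DifferentiableOn ℂ (f i) (Metric.ball x R))
    (hu : ∀ η > 0, ∀ᶠ i in 𝓛, ∀ y ∈ Metric.ball x R, ‖f i y - f i0 y‖ ≤ η) :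
    Filter.Tendsto (fun c : ι × E => f c.1 c.2) (𝓛 ×ˢ 𝓝 x) (𝓝 (f i0 x)) := by
  have h := jet_tendsto hR hd hu 0
  have h2 : AnalyticAt ℂ (fun J : JetSp 0 E F => jetP J 0) (jet 0 (f i0) x) := anJetP analyticAt_id analyticAt_const
  have h3 := h2.continuousAt.tendsto.comp h
  simpa [Function.comp_def, jetP_zero] using h3

theorem famOK (G : Gen N dM) {M U : Set (Cn N)} (hU : IsOpen U) (hpU : G.p ∈ U)
    (hMU : M ∩ U = {z | z ∈ U ∧ G.r z = 0}) {ι : Type} {𝓛 : Filter ι} {i0 : ι} (hb : pure i0 ≤ 𝓛)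
    {H : ι → Cn N → Cn N'} {e : ι → Rm m} {R : ℝ} (hR : 0 < R)
    (hd : ∀ i, DifferentiableOn ℂ (H i) (Metric.ball G.p R))
    (hu : ∀ η > 0, ∀ᶠ i in 𝓛, ∀ y ∈ Metric.ball G.p R, ‖H i y - H i0 y‖ ≤ η)
    (he : Filter.Tendsto e 𝓛 (𝓝 (e i0))) {p' : Cn N'} (hp : ∀ i, H i G.p = p')
    {ρ : Cn N' → Rm m → Fin d → ℝ}
    (hmap : ∀ i, ∀ z ∈ M ∩ Metric.ball G.p R, ∀ k, ρ (H i z) (e i) k = 0)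
    {ρc : (Cn N' × Cn N') × Cn m → Fin d → ℂ} (hρc : AnalyticAt ℂ ρc ((p', cj N' p'), (cplxR m).ι (e i0)))
    (hext : ∀ᶠ we in 𝓝 (p', e i0), ρc ((we.1, cj N' we.1), (cplxR m).ι we.2) = fun k => (ρ we.1 we.2 k : ℂ)) :
    FamOK 𝓛 i0 H (fun i ζ => cj N' (H i (cj N ζ))) (fun i => (cplxR m).ι (e i)) G.rc G.P0 ρc := by
  have hball : ∀ y, y ∈ Metric.ball (cj N G.p) R → cj N y ∈ Metric.ball G.p R := by
    intro y hy
    rw [Metric.mem_ball, dist_eq_norm] at hy ⊢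
    rw [← cj_norm, map_sub, cj_cj]; exact hy
  have hdK : ∀ i, DifferentiableOn ℂ (fun ζ => cj N' (H i (cj N ζ))) (Metric.ball (cj N G.p) R) := by
    intro i y hy
    have h1 := (hd i).differentiableAt (Metric.isOpen_ball.mem_nhds (hball y hy))
    exact (conj_hasFDerivAt (x := cj N y) (cj N) (cj N') h1.hasFDerivAt).differentiableAt.differentiableWithinAt
  have huK : ∀ η > 0, ∀ᶠ i in 𝓛, ∀ y ∈ Metric.ball (cj N G.p) R, ‖cj N' (H i (cj N y)) - cj N' (H i0 (cj N y))‖ ≤ η := by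
    intro η hη
    filter_upwards [hu η hη] with i hi y hy
    rw [← map_sub, cj_norm]
    exact hi _ (hball y hy)
  have han : ∀ {f : Cn N → Cn N'} {x : Cn N}, DifferentiableOn ℂ f (Metric.ball x R) → ∀ y ∈ Metric.ball x R, AnalyticAt ℂ f y := by
    intro f x hf y hy
    apply osgood
    filter_upwards [Metric.isOpen_ball.mem_nhds hy] with z hz
    exact hf.differentiableAt (Metric.isOpen_ball.mem_nhds hz)
  have heι : Filter.Tendsto (fun i => (cplxR m).ι (e i)) 𝓛 (𝓝 ((cplxR m).ι (e i0))) :=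
    ((cplxR m).ι.continuous.tendsto _).comp he
  refine ⟨fun k => jet_tendsto hR hd hu k, fun k => jet_tendsto hR hdK huK k, heι, ?_, ?_, ?_, hb⟩
  · refine Filter.eventually_prod_iff.2 ⟨fun _ => True, by simp, fun y => y ∈ Metric.ball G.p R, Metric.ball_mem_nhds _ hR, ?_⟩
    intro i _ y hy
    exact han (hd i) y hy
  · refine Filter.eventually_prod_iff.2 ⟨fun _ => True, by simp, fun y => y ∈ Metric.ball (cj N G.p) R, Metric.ball_mem_nhds _ hR, ?_⟩
    intro i _ y hy
    exact han (hdK i) y hy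
  · have tH := ext_tendsto hR hd hu
    have tK := ext_tendsto hR hdK huK
    simp only [cj_cj, hp] at tH tK
    have q1 : Filter.Tendsto (fun c : ι × (Cn N × Cn N) => (c.1, c.2.1)) (𝓛 ×ˢ 𝓝 G.P0) (𝓛 ×ˢ 𝓝 G.p) :=
      Filter.tendsto_fst.prodMk ((continuous_fst.tendsto G.P0).comp Filter.tendsto_snd)
    have q2 : Filter.Tendsto (fun c : ι × (Cn N × Cn N) => (c.1, c.2.2)) (𝓛 ×ˢ 𝓝 G.P0) (𝓛 ×ˢ 𝓝 (cj N G.p)) :=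
      Filter.tendsto_fst.prodMk ((continuous_snd.tendsto G.P0).comp Filter.tendsto_snd)
    have t3 : Filter.Tendsto (fun c : ι × (Cn N × Cn N) => ((H c.1 c.2.1, cj N' (H c.1 (cj N c.2.2))), (cplxR m).ι (e c.1)))
        (𝓛 ×ˢ 𝓝 G.P0) (𝓝 ((p', cj N' p'), (cplxR m).ι (e i0))) :=
      ((tH.comp q1).prodMk_nhds (tK.comp q2)).prodMk_nhds (heι.comp Filter.tendsto_fst)
    obtain ⟨pa, ha, pb, hpb, hab⟩ := Filter.eventually_prod_iff.1 (t3.eventually hρc.eventually_analyticAt)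
    obtain ⟨R1, hR1, hR1b⟩ := Metric.eventually_nhds_iff_ball.1 hpb
    obtain ⟨V, hV, hVf⟩ := G.IP (R := min R1 R) (by positivity) (F := Fin d → ℂ)
    have t4 : Filter.Tendsto (fun c : ι × Cn N => (H c.1 c.2, e c.1)) (𝓛 ×ˢ 𝓝 G.p) (𝓝 (p', e i0)) :=
      tH.prodMk_nhds (he.comp Filter.tendsto_fst)
    obtain ⟨qa, hqa, qb, hqb, hqab⟩ := Filter.eventually_prod_iff.1 (t4.eventually hext)
    refine Filter.eventually_prod_iff.2 ⟨_, ha.and hqa, _, hV, ?_⟩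
    rintro i ⟨hi, hi'⟩ X hX hX0
    refine hVf (fun X => ρc ((H i X.1, cj N' (H i (cj N X.2))), (cplxR m).ι (e i))) ?_ ?_ X hX hX0
    · intro Y hY
      have hY1 : Y ∈ Metric.ball G.P0 R1 := Metric.ball_subset_ball (min_le_left _ _) hY
      have hY2 : Y ∈ Metric.ball G.P0 R := Metric.ball_subset_ball (min_le_right _ _) hY
      rw [Metric.mem_ball, Prod.dist_eq, max_lt_iff] at hY2
      refine anC (hab hi (hR1b Y hY1)) (f := fun X : Cn N × Cn N => ((H i X.1, cj N' (H i (cj N X.2))), (cplxR m).ι (e i))) ?_ rfl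
      refine AnalyticAt.prod (AnalyticAt.prod ?_ ?_) analyticAt_const
      · exact anC (han (hd i) Y.1 hY2.1) (anF analyticAt_id) rfl
      · exact anC (g := fun ζ => cj N' (H i (cj N ζ))) (han (hdK i) Y.2 hY2.2) (anS analyticAt_id) rfl
    · filter_upwards [hqb, hU.mem_nhds hpU, Metric.ball_mem_nhds _ hR] with z h1 h2 h3 h4
      have hzM : z ∈ M := (hMU.symm ▸ (⟨h2, h4⟩ : z ∈ {z | z ∈ U ∧ G.r z = 0}) : z ∈ M ∩ U).1
      have := hqab hi' h1
      simp only [cj_cj]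
      simp only at this
      rw [this]
      funext k
      simp [hmap i z ⟨hzM, h3⟩ k]
end famok

section opens
variable {N N' d : ℕ} {M : Set (Cn N)} {p : Cn N}
variable {Q : Type} [NormedAddCommGroup Q] [NormedSpace ℝ Q]

lemma partial_fderiv {A F : Type} [NormedAddCommGroup A] [NormedSpace ℝ A] [NormedAddCommGroup F] [NormedSpace ℝ F]
    {G : A × Q → F} {c : A × Q} (h : DifferentiableAt ℝ G c) (v : A) :
    fderiv ℝ (fun z => G (z, c.2)) c.1 v = fderiv ℝ G c (v, 0) := by
  have h1 : HasFDerivAt G (fderiv ℝ G c) (c.1, c.2) := h.hasFDerivAt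
  have h2 := (HasFDerivAt.comp (f := fun z => (z, c.2)) c.1 h1 (hasFDerivAt_prodMk_left (𝕜 := ℝ) c.1 c.2)).fderiv
  have h' : (fun z => G (z, c.2)) = G ∘ (fun z => (z, c.2)) := rfl
  rw [h', h2]; simp

lemma partial_fderiv_an {A F : Type} [NormedAddCommGroup A] [NormedSpace ℝ A] [NormedAddCommGroup F] [NormedSpace ℝ F]
    [CompleteSpace F] {G : A × Q → F} {c : A × Q} (h : AnalyticAt ℝ G c) (v : A) :
    AnalyticAt ℝ (fun c : A × Q => fderiv ℝ (fun z => G (z, c.2)) c.1 v) c := by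
  have h1 : AnalyticAt ℝ (fun c => fderiv ℝ G c (v, 0)) c :=
    ((ContinuousLinearMap.apply ℝ F ((v, 0) : A × Q)).analyticAt _).comp h.fderiv
  refine h1.congr ?_
  filter_upwards [h.eventually_analyticAt] with c hc
  exact (partial_fderiv hc.differentiableAt v).symm

lemma apply_param (L : CRVectorField M p) {G : Cn N × Q → ℂ} {q0 : Q} (hG : AnalyticAt ℝ G (p, q0)) :
    AnalyticAt ℝ (fun c : Cn N × Q => L.apply (fun z => G (z, c.2)) c.1) (p, q0) := by
  unfold CRVectorField.apply wirtDBar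
  refine Finset.analyticAt_fun_sum _ fun j _ => AnalyticAt.mul ?_ ?_
  · exact anC (g := fun z => L.coeff z j) (f := fun c : Cn N × Q => c.1) (L.analytic j p L.mem) (anF analyticAt_id) rfl
  · exact analyticAt_const.mul ((partial_fderiv_an hG _).add (analyticAt_const.mul (partial_fderiv_an hG _)))

lemma CRApplyList_param (Ls : List (CRVectorField M p)) {g : Cn N × Q → ℂ} {q0 : Q} (hg : AnalyticAt ℝ g (p, q0)) :
    AnalyticAt ℝ (fun c : Cn N × Q => CRApplyList Ls (fun z => g (z, c.2)) c.1) (p, q0) := by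
  induction Ls with
  | nil => exact hg
  | cons L Ls ih =>
    have h2 := apply_param L (G := fun c : Cn N × Q => CRApplyList Ls (fun z => g (z, c.2)) c.1) ih
    exact h2

lemma wirtD_param {n : ℕ} {f : Cn n × Q → ℝ} {c : Cn n × Q} (hf : AnalyticAt ℝ f c) (j : Fin n) :
    AnalyticAt ℝ (fun c : Cn n × Q => wirtD (fun w => f (w, c.2)) c.1 j) c := by
  have h1 : ∀ v, AnalyticAt ℝ (fun c : Cn n × Q => ((fderiv ℝ (fun w => f (w, c.2)) c.1 v : ℝ) : ℂ)) c := fun v =>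
    (Complex.ofRealCLM.analyticAt _).comp (partial_fderiv_an hf v)
  exact analyticAt_const.mul ((h1 _).sub (analyticAt_const.mul (h1 _)))

lemma span_open {κ T : Type} [TopologicalSpace T] {q0 : T} {n : ℕ} {g : κ → T → (Fin n → ℂ)} (hc : ∀ k, ContinuousAt (g k) q0)
    (h : Submodule.span ℂ (Set.range fun k => g k q0) = ⊤) :
    ∀ᶠ q in 𝓝 q0, Submodule.span ℂ (Set.range fun k => g k q) = ⊤ := by
  let b := Module.Basis.ofSpan h.ge
  have hfin : Finite ↑(LinearIndepOn.extend (linearIndepOn_empty ℂ id) (Set.empty_subset (Set.range fun k => g k q0))) := by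
    exact Module.Finite.finite_basis b
  let b' : Module.Basis (Fin n) ℂ (Fin n → ℂ) := b.reindex (Finite.equivFinOfCardEq (by
    rw [← Module.finrank_eq_nat_card_basis b]; simp))
  have hb' : ∀ a, ∃ k, g k q0 = b' a := by
    intro a
    have : b' a ∈ Set.range fun k => g k q0 := by
      apply Module.Basis.ofSpan_subset h.ge
      simp [b', b]
    exact this
  choose k hk using hb'
  have hdet : (Matrix.of fun a => g (k a) q0).det ≠ 0 := by
    have : LinearIndependent ℂ (Matrix.of fun a => g (k a) q0).row := by
      have h2 : (Matrix.of fun a => g (k a) q0).row = b' := by funext a; exact hk a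
      rw [h2]; exact b'.linearIndependent
    rw [Matrix.linearIndependent_rows_iff_isUnit] at this
    exact ((Matrix.isUnit_iff_isUnit_det _).1 this).ne_zero
  have hcont : ContinuousAt (fun q => (Matrix.of fun a => g (k a) q).det) q0 := by
    have : ContinuousAt (fun q => Matrix.of fun a => g (k a) q) q0 := continuousAt_pi.2 fun a => hc (k a)
    exact (Continuous.matrix_det continuous_id).continuousAt.comp this
  filter_upwards [hcont.eventually_ne hdet] with q hq
  have h1 : LinearIndependent ℂ (Matrix.of fun a => g (k a) q).row := by
    rw [Matrix.linearIndependent_rows_iff_isUnit, Matrix.isUnit_iff_isUnit_det]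
    exact isUnit_iff_ne_zero.2 hq
  have h2 := h1.span_eq_top_of_card_eq_finrank' (by simp)
  rw [eq_top_iff, ← h2]
  apply Submodule.span_mono
  rintro _ ⟨a, rfl⟩
  exact ⟨k a, rfl⟩

lemma CRApplyList_congr (Ls : List (CRVectorField M p)) {g g' : Cn N → ℂ} (h : g =ᶠ[𝓝 p] g') :
    CRApplyList Ls g =ᶠ[𝓝 p] CRApplyList Ls g' := by
  induction Ls with
  | nil => exact h
  | cons L Ls ih =>
    exact L.apply_congr ih

lemma spanSet_congr {ℓ : ℕ} {r : Cn N' → Fin d → ℝ} {H H' : Cn N → Cn N'} (h : H =ᶠ[𝓝 p] H') :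
    spanSet M p ℓ r H = spanSet M p ℓ r H' := by
  have : ∀ (Ls : List (CRVectorField M p)) (k : Fin d), (fun j => CRApplyList Ls (fun z => wirtD (fun w => r w k) (H z) j) p) =
      (fun j => CRApplyList Ls (fun z => wirtD (fun w => r w k) (H' z) j) p) := by
    intro Ls k
    funext j
    refine (CRApplyList_congr Ls ?_).self_of_nhds
    filter_upwards [h] with z hz
    rw [hz]
  unfold spanSet
  simp only [this]

def spanVec {m ℓ : ℕ} (M : Set (Cn N)) (p : Cn N) (ρ : Cn N' → Rm m → Fin d → ℝ) (Θ : Cn N × Q → Cn N') (e : Q → Rm m)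
    (k : {Ls : List (CRVectorField M p) // Ls.length ≤ ℓ} × Fin d) (q : Q) : Fin N' → ℂ :=
  fun j => CRApplyList k.1.1 (fun z => wirtD (fun w => ρ w (e q) k.2) (Θ (z, q)) j) p

lemma spanSet_eq_range {m ℓ : ℕ} {ρ : Cn N' → Rm m → Fin d → ℝ} {Θ : Cn N × Q → Cn N'} {e : Q → Rm m} (q : Q) :
    spanSet M p ℓ (fun w => ρ w (e q)) (fun z => Θ (z, q)) = Set.range fun k => spanVec (ℓ := ℓ) M p ρ Θ e k q := by
  ext v
  constructor
  · rintro ⟨Ls, k, hl, hv⟩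
    exact ⟨⟨⟨Ls, hl⟩, k⟩, hv.symm⟩
  · rintro ⟨⟨⟨Ls, hl⟩, k⟩, hv⟩
    exact ⟨Ls, k, hl, hv.symm⟩

lemma spanVec_cont {m ℓ : ℕ} {ρ : Cn N' → Rm m → Fin d → ℝ} {Θ : Cn N × Q → Cn N'} {e : Q → Rm m} {q0 : Q}
    (hρ : ∀ k, AnalyticAt ℝ (fun we : Cn N' × Rm m => ρ we.1 we.2 k) (Θ (p, q0), e q0))
    (hΘ : AnalyticAt ℝ Θ (p, q0)) (he : AnalyticAt ℝ e q0)
    (k : {Ls : List (CRVectorField M p) // Ls.length ≤ ℓ} × Fin d) :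
    ContinuousAt (spanVec (ℓ := ℓ) M p ρ Θ e k) q0 := by
  obtain ⟨⟨Ls, hl⟩, k⟩ := k
  refine continuousAt_pi.2 fun j => ?_
  have h0 : AnalyticAt ℝ (fun c : Cn N × Q => (Θ c, e c.2)) (p, q0) :=
    hΘ.prod (anC (g := e) (f := fun c : Cn N × Q => c.2) he (anS analyticAt_id) rfl)
  have h01 := wirtD_param (hρ k) j
  have h1 : AnalyticAt ℝ (fun c : Cn N × Q => wirtD (fun w => ρ w (e c.2) k) (Θ c) j) (p, q0) :=
    AnalyticAt.comp (f := fun c : Cn N × Q => (Θ c, e c.2)) (g := fun c : Cn N' × Rm m => wirtD (fun w => ρ w c.2 k) c.1 j) h01 h0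
  have h2 := CRApplyList_param Ls (g := fun c : Cn N × Q => wirtD (fun w => ρ w (e c.2) k) (Θ c) j) h1
  have h3 : ContinuousAt (fun q : Q => (p, q)) q0 := by fun_prop
  have h4 := ContinuousAt.comp (f := fun q : Q => (p, q)) (x := q0) h2.continuousAt h3
  exact h4

/-- openness of the nondegeneracy condition -/
lemma spanSet_open {m ℓ : ℕ} {ρ : Cn N' → Rm m → Fin d → ℝ} {Θ : Cn N × Q → Cn N'} {e : Q → Rm m} {q0 : Q}
    (hρ : ∀ k, AnalyticAt ℝ (fun we : Cn N' × Rm m => ρ we.1 we.2 k) (Θ (p, q0), e q0))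
    (hΘ : AnalyticAt ℝ Θ (p, q0)) (he : AnalyticAt ℝ e q0)
    (h : Submodule.span ℂ (spanSet M p ℓ (fun w => ρ w (e q0)) (fun z => Θ (z, q0))) = ⊤) :
    ∀ᶠ q in 𝓝 q0, Submodule.span ℂ (spanSet M p ℓ (fun w => ρ w (e q)) (fun z => Θ (z, q))) = ⊤ := by
  rw [spanSet_eq_range] at h
  have h1 := span_open (fun k => spanVec_cont hρ hΘ he k) h
  filter_upwards [h1] with q hq
  rw [spanSet_eq_range]; exact hq

end opens

section good
variable {N N' dM d m : ℕ} {p' : Cn N'}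

lemma Deformation.an (D : Deformation N' m d p') {w : Cn N'} {ε : Rm m} (hw : w ∈ D.U') (hε : ε ∈ D.W) (k : Fin d) :
    AnalyticAt ℝ (fun we : Cn N' × Rm m => D.ρ we.1 we.2 k) (w, ε) := D.analytic_ρ k (w, ε) ⟨hw, hε⟩

lemma Deformation.an1 (D : Deformation N' m d p') {w : Cn N'} {ε : Rm m} (hw : w ∈ D.U') (hε : ε ∈ D.W) :
    AnalyticAt ℝ (fun w => D.ρ w ε) w := by
  rw [analyticAt_pi_iff]
  intro k
  exact AnalyticAt.comp (g := fun we : Cn N' × Rm m => D.ρ we.1 we.2 k) (f := fun w => (w, ε)) (D.an hw hε k)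
    (analyticAt_id.prod analyticAt_const)

lemma def_gen (D : Deformation N' m d p') {ε : Rm m} (hε : ε ∈ D.X) :
    ∃ (G' : Gen N' d) (ρc : (Cn N' × Cn N') × Cn m → Fin d → ℂ), G'.p = p' ∧ G'.r = (fun w => D.ρ w ε) ∧
      AnalyticAt ℂ ρc ((p', cj N' p'), (cplxR m).ι ε) ∧ G'.rc = (fun W => ρc (W, (cplxR m).ι ε)) ∧
      ∀ᶠ we in 𝓝 (p', ε), ρc ((we.1, cj N' we.1), (cplxR m).ι we.2) = fun k => (D.ρ we.1 we.2 k : ℂ) := by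
  have hW := D.X_subset_W hε
  have h0 : AnalyticAt ℝ (fun (we : Cn N' × Rm m) (k : Fin d) => (D.ρ we.1 we.2 k : ℂ)) (p', ε) := by
    rw [analyticAt_pi_iff]
    intro k
    exact (Complex.ofRealCLM.analyticAt _).comp (D.an D.basept_mem hW k)
  obtain ⟨ρc, hc, hext⟩ := Cplx.exists_ext (cplxProd (cplxC N') (cplxR m)) h0
  have hι : ∀ we : Cn N' × Rm m, (cplxProd (cplxC N') (cplxR m)).ι we = ((we.1, cj N' we.1), (cplxR m).ι we.2) := by
    intro we; rfl
  simp only [hι] at hc hext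
  have hrc : AnalyticAt ℂ (fun W : Cn N' × Cn N' => ρc (W, (cplxR m).ι ε)) (p', cj N' p') :=
    AnalyticAt.comp (g := ρc) (f := fun W : Cn N' × Cn N' => (W, (cplxR m).ι ε)) hc (analyticAt_id.prod analyticAt_const)
  have hct : ContinuousAt (fun w : Cn N' => (w, ε)) p' := by fun_prop
  obtain ⟨G', h1, h2, h3⟩ := exists_Gen (p := p') (r := fun w => D.ρ w ε) (rc := fun W => ρc (W, (cplxR m).ι ε))
    (D.an1 D.basept_mem hW) (by funext k; exact D.basept ε hW k) hrc (hct.eventually hext)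
    (D.generic ε hε p' D.basept_mem (D.basept ε hW))
  exact ⟨G', ρc, h1, h2, hc, h3, hext⟩

lemma def_fn (D : Deformation N' m d p') {ε : Rm m} (hε : ε ∈ D.X) {M : Set (Cn N)} {p : Cn N} {ℓ : ℕ} {H : Cn N → Cn N'}
    (hH : AnalyticAt ℂ H p) (hHp : H p = p') (hpM : p ∈ M) (hHM : ∀ᶠ z in 𝓝 p, z ∈ M → ∀ k, D.ρ (H z) ε k = 0) :
    FinNondeg M p (D.Mfib ε) ℓ H ↔ Submodule.span ℂ (spanSet M p ℓ (fun w => D.ρ w ε) H) = ⊤ := by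
  obtain ⟨G', ρc, h1, h2, -⟩ := def_gen D hε
  have hs := G'.surj_r
  rw [h1, h2] at hs
  refine fn_reduce ?_ ?_ ?_ hH.restrictScalars hpM ?_
  · rw [hHp]; exact D.an1 D.basept_mem (D.X_subset_W hε)
  · rw [hHp]; exact hs
  · rw [hHp]
    filter_upwards [D.isOpen_U'.mem_nhds D.basept_mem] with w hw
    constructor
    · intro h; exact ⟨hw, fun k => congrFun h k⟩
    · rintro ⟨-, h⟩; funext k; exact h k
  · filter_upwards [hHM] with z hz hzM
    funext k; exact hz hzM k

def GoodSet (M : Set (Cn N)) (p : Cn N) (D : Deformation N' m d p') (ℓ : ℕ) (A : Set (Rm m)) : Prop :=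
  ∃ (𝒥 : Type) (_ : NormedAddCommGroup 𝒥) (_ : NormedSpace ℂ 𝒥) (_ : FiniteDimensional ℂ 𝒥) (J0 : 𝒥) (ε0 : Rm m) (r : ℝ)
    (Φ : Cn N × 𝒥 × Cn m → Cn N'), 0 < r ∧
    (∀ z ∈ Metric.ball p r, ∀ J ∈ Metric.ball J0 r, ∀ ε ∈ Metric.ball ε0 r,
      AnalyticAt ℂ Φ (z, J, (cplxR m).ι ε) ∧ Φ (z, J, (cplxR m).ι ε) ∈ D.U' ∧ ε ∈ D.W) ∧
    (∀ J ∈ Metric.ball J0 r, ∀ ε ∈ Metric.ball ε0 r,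
      Submodule.span ℂ (spanSet M p ℓ (fun w => D.ρ w ε) (fun z => Φ (z, J, (cplxR m).ι ε))) = ⊤) ∧
    ∀ ε ∈ A, ε ∈ Metric.closedBall ε0 (r / 2) ∧ ∃ J ∈ Metric.closedBall J0 (r / 2), Φ (p, J, (cplxR m).ι ε) = p' ∧
      ∀ z ∈ M ∩ Metric.ball p r, ∀ k, D.ρ (Φ (z, J, (cplxR m).ι ε)) ε k = 0

lemma good_local (G : Gen N dM) {M U : Set (Cn N)} (hU : IsOpen U) (hpU : G.p ∈ U)
    (hMU : M ∩ U = {z | z ∈ U ∧ G.r z = 0}) (hmin : IsMinimalAt M dM G.p) (D : Deformation N' m d p')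
    {ι : Type} {𝓛 : Filter ι} {i0 : ι} (hb : pure i0 ≤ 𝓛)
    {H : ι → Cn N → Cn N'} {e : ι → Rm m} {R : ℝ} (hR : 0 < R)
    (hd : ∀ i, DifferentiableOn ℂ (H i) (Metric.ball G.p R))
    (hu : ∀ η > 0, ∀ᶠ i in 𝓛, ∀ y ∈ Metric.ball G.p R, ‖H i y - H i0 y‖ ≤ η)
    (he : Filter.Tendsto e 𝓛 (𝓝 (e i0))) (hp : ∀ i, H i G.p = p')
    (hmap : ∀ i, ∀ z ∈ M ∩ Metric.ball G.p R, H i z ∈ D.Mfib (e i)) (hX : e i0 ∈ D.X) {ℓ : ℕ}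
    (hfn : FinNondeg M G.p (D.Mfib (e i0)) ℓ (H i0)) : ∃ T ∈ 𝓛, GoodSet M G.p D ℓ (e '' T) := by
  obtain ⟨G', ρc, hG'p, hG'r, hρc, hG'rc, hext⟩ := def_gen D hX
  have hpM : G.p ∈ M := by
    have : G.p ∈ M ∩ U := by rw [hMU]; exact ⟨hpU, G.rp⟩
    exact this.1
  have hball : Metric.ball G.p R ∈ 𝓝 G.p := Metric.ball_mem_nhds _ hR
  have hHan : AnalyticAt ℂ (H i0) G.p := by
    apply osgood
    filter_upwards [hball] with z hz
    exact (hd i0).differentiableAt (Metric.isOpen_ball.mem_nhds hz)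
  have hspan := (def_fn D hX hHan (hp i0) hpM (by
    filter_upwards [hball] with z hz hzM
    exact (hmap i0 z ⟨hzM, hz⟩).2)).1 hfn
  have hFam := famOK G hU hpU hMU hb hR hd hu he hp (fun i z hz k => (hmap i z hz).2 k) hρc hext
  obtain ⟨κ, Φ, hΦ, hev⟩ := param_pkg G hU hpU hMU hmin G' hFam (by rw [hG'p]; exact hρc) rfl
    (by rw [hp, hG'p]) hG'rc (by rw [hG'r]; exact hspan)
  set K : ι → Cn N → Cn N' := fun i ζ => cj N' (H i (cj N ζ)) with hK
  let 𝒥 := JetSp κ (Cn N) (Cn N') × JetSp κ (Cn N) (Cn N')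
  let Φ' : Cn N × 𝒥 × Cn m → Cn N' := fun c => Φ (c.1, c.2.1.1, c.2.1.2, c.2.2)
  let Jf : ι → 𝒥 := fun i => (jet κ (H i) G.p, jet κ (K i) (cj N G.p))
  have hΦ' : AnalyticAt ℂ Φ' (G.p, Jf i0, (cplxR m).ι (e i0)) := by
    refine AnalyticAt.comp (g := Φ) (f := fun c : Cn N × 𝒥 × Cn m => (c.1, c.2.1.1, c.2.1.2, c.2.2)) hΦ ?_
    exact analyticAt_fst.prod (((analyticAt_fst.comp analyticAt_fst).comp analyticAt_snd).prod
      (((analyticAt_snd.comp analyticAt_fst).comp analyticAt_snd).prod (analyticAt_snd.comp analyticAt_snd)))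
  have hev' : ∀ᶠ c in 𝓛 ×ˢ 𝓝 G.p, H c.1 c.2 = Φ' (c.2, Jf c.1, (cplxR m).ι (e c.1)) := hev
  have hJf : Filter.Tendsto Jf 𝓛 (𝓝 (Jf i0)) := by
    refine Filter.Tendsto.prodMk_nhds ?_ ?_
    · have h1 := hFam.jetH κ
      exact h1.comp (f := fun i => (i, G.p)) (Filter.tendsto_id.prodMk tendsto_const_nhds)
    · have h1 := hFam.jetK κ
      exact h1.comp (f := fun i => (i, cj N G.p)) (Filter.tendsto_id.prodMk tendsto_const_nhds)
  have hev0 : H i0 =ᶠ[𝓝 G.p] fun z => Φ' (z, Jf i0, (cplxR m).ι (e i0)) := ev_base hb hev'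
  have hp0 : Φ' (G.p, Jf i0, (cplxR m).ι (e i0)) = p' := by
    have h := hev0.self_of_nhds
    exact h.symm.trans (hp i0)
  -- real analytic version
  let Θ : Cn N × 𝒥 × Rm m → Cn N' := fun c => Φ' (c.1, c.2.1, (cplxR m).ι c.2.2)
  have hΘ : AnalyticAt ℝ Θ (G.p, Jf i0, e i0) := by
    refine AnalyticAt.comp (g := Φ') (f := fun c : Cn N × 𝒥 × Rm m => (c.1, c.2.1, (cplxR m).ι c.2.2)) hΦ'.restrictScalars ?_
    refine analyticAt_fst.prod (AnalyticAt.prod ?_ ?_)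
    · exact analyticAt_fst.comp analyticAt_snd
    · exact ((cplxR m).ι.analyticAt _).comp (analyticAt_snd.comp analyticAt_snd)
  have hso := spanSet_open (M := M) (p := G.p) (ℓ := ℓ) (ρ := D.ρ) (Q := 𝒥 × Rm m) (Θ := Θ) (e := fun q => q.2) (q0 := (Jf i0, e i0))
    (fun k => by
      have : Θ (G.p, Jf i0, e i0) = p' := hp0
      rw [this]; exact D.an D.basept_mem (D.X_subset_W hX) k) hΘ analyticAt_snd (by
      rw [← spanSet_congr hev0]; exact hspan)
  have hall : ∀ᶠ c in 𝓝 ((G.p, Jf i0, e i0) : Cn N × 𝒥 × Rm m), AnalyticAt ℂ Φ' (c.1, c.2.1, (cplxR m).ι c.2.2) ∧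
      Φ' (c.1, c.2.1, (cplxR m).ι c.2.2) ∈ D.U' ∧ c.2.2 ∈ D.W := by
    have hc : ContinuousAt (fun c : Cn N × 𝒥 × Rm m => (c.1, c.2.1, (cplxR m).ι c.2.2)) (G.p, Jf i0, e i0) := by fun_prop
    have h1 := hc.eventually hΦ'.eventually_analyticAt
    have h2 : ∀ᶠ c in 𝓝 ((G.p, Jf i0, e i0) : Cn N × 𝒥 × Rm m), Θ c ∈ D.U' :=
      hΘ.continuousAt.eventually (D.isOpen_U'.mem_nhds (by
        have : Θ (G.p, Jf i0, e i0) = p' := hp0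
        rw [this]; exact D.basept_mem))
    have h3 : ∀ᶠ c in 𝓝 ((G.p, Jf i0, e i0) : Cn N × 𝒥 × Rm m), c.2.2 ∈ D.W :=
      (by fun_prop : ContinuousAt (fun c : Cn N × 𝒥 × Rm m => c.2.2) (G.p, Jf i0, e i0)).eventually
        (D.isOpen_W.mem_nhds (D.X_subset_W hX))
    filter_upwards [h1, h2, h3] with c a1 a2 a3
    exact ⟨a1, a2, a3⟩
  obtain ⟨r1, hr1, h1⟩ := Metric.eventually_nhds_iff_ball.1 hall
  obtain ⟨r2, hr2, h2⟩ := Metric.eventually_nhds_iff_ball.1 hso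
  obtain ⟨pa, hpa, pb, hpb, hab⟩ := Filter.eventually_prod_iff.1 hev'
  obtain ⟨r3, hr3, h3⟩ := Metric.eventually_nhds_iff_ball.1 hpb
  let r := min (min r1 r2) (min r3 R)
  have hr : 0 < r := lt_min (lt_min hr1 hr2) (lt_min hr3 hR)
  have e1 : r ≤ r1 := (min_le_left _ _).trans (min_le_left _ _)
  have e2 : r ≤ r2 := (min_le_left _ _).trans (min_le_right _ _)
  have e3 : r ≤ r3 := (min_le_right _ _).trans (min_le_left _ _)
  have e4 : r ≤ R := (min_le_right _ _).trans (min_le_right _ _)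
  have hr2' : 0 < r / 2 := by positivity
  refine ⟨{i | pa i} ∩ (e ⁻¹' Metric.closedBall (e i0) (r / 2) ∩ Jf ⁻¹' Metric.closedBall (Jf i0) (r / 2)), ?_, ?_⟩
  · exact Filter.inter_mem hpa (Filter.inter_mem (he (Metric.closedBall_mem_nhds _ hr2')) (hJf (Metric.closedBall_mem_nhds _ hr2')))
  · refine ⟨𝒥, inferInstance, inferInstance, inferInstance, Jf i0, e i0, r, Φ', hr, ?_, ?_, ?_⟩
    · intro z hz J hJ ε hε
      refine h1 (z, J, ε) ?_
      rw [← ball_prod_same, ← ball_prod_same]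
      exact ⟨Metric.ball_subset_ball e1 hz, Metric.ball_subset_ball e1 hJ, Metric.ball_subset_ball e1 hε⟩
    · intro J hJ ε hε
      refine h2 (J, ε) ?_
      rw [← ball_prod_same]
      exact ⟨Metric.ball_subset_ball e2 hJ, Metric.ball_subset_ball e2 hε⟩
    · rintro _ ⟨i, ⟨hi1, hi2, hi3⟩, rfl⟩
      have hz : ∀ z ∈ Metric.ball G.p r, H i z = Φ' (z, Jf i, (cplxR m).ι (e i)) := fun z hz =>
        hab hi1 (h3 z (Metric.ball_subset_ball e3 hz))
      refine ⟨hi2, Jf i, hi3, ?_, ?_⟩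
      · rw [← hz _ (Metric.mem_ball_self hr)]; exact hp i
      · intro z hz' k
        rw [← hz z hz'.2]
        exact (hmap i z ⟨hz'.1, Metric.ball_subset_ball e4 hz'.2⟩).2 k

end good

section cover
variable {N N' dM d m : ℕ} {p' : Cn N'}

lemma countable_cover_of {ι T : Type} [TopologicalSpace T] [SecondCountableTopology T] (φ : ι → T) {P : Set ι → Prop}
    (h : ∀ i, ∃ A ∈ Filter.comap φ (𝓝 (φ i)), P A) : ∃ 𝒜 : Set (Set ι), 𝒜.Countable ∧ (∀ A ∈ 𝒜, P A) ∧ ⋃₀ 𝒜 = Set.univ := by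
  letI : TopologicalSpace ι := TopologicalSpace.induced φ inferInstance
  haveI : SecondCountableTopology ι := TopologicalSpace.secondCountableTopology_induced ι T φ
  choose A hA hP using h
  have hA' : ∀ i, A i ∈ 𝓝 i := fun i => by rw [nhds_induced]; exact hA i
  obtain ⟨s, hs, hsu⟩ := TopologicalSpace.countable_cover_nhds hA'
  refine ⟨A '' s, hs.image _, ?_, ?_⟩
  · rintro _ ⟨i, -, rfl⟩; exact hP i
  · rw [Set.sUnion_image]; exact hsu

lemma good_cover_n (G : Gen N dM) {M U : Set (Cn N)} (hU : IsOpen U) (hpU : G.p ∈ U)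
    (hMU : M ∩ U = {z | z ∈ U ∧ G.r z = 0}) (hmin : IsMinimalAt M dM G.p) (D : Deformation N' m d p') (ℓ : ℕ)
    {R : ℝ} (hR : 0 < R) :
    ∃ 𝒜 : Set (Set (Rm m)), 𝒜.Countable ∧ (∀ A ∈ 𝒜, GoodSet M G.p D ℓ A) ∧ ∀ ε ∈ D.X, (∃ H : Cn N → Cn N',
      DifferentiableOn ℂ H (Metric.ball G.p R) ∧ H G.p = p' ∧ (∀ z ∈ M ∩ Metric.ball G.p R, H z ∈ D.Mfib ε) ∧
      FinNondeg M G.p (D.Mfib ε) ℓ H) → ε ∈ ⋃₀ 𝒜 := by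
  let ι := {i : (Cn N → Cn N') × Rm m // i.2 ∈ D.X ∧ DifferentiableOn ℂ i.1 (Metric.ball G.p R) ∧ i.1 G.p = p' ∧
    (∀ z ∈ M ∩ Metric.ball G.p R, i.1 z ∈ D.Mfib i.2) ∧ FinNondeg M G.p (D.Mfib i.2) ℓ i.1}
  have hR2 : R / 2 < R := by linarith
  let K := Metric.closedBall G.p (R / 2)
  haveI : CompactSpace K := isCompact_iff_compactSpace.1 (isCompact_closedBall _ _)
  have hsub : K ⊆ Metric.ball G.p R := Metric.closedBall_subset_ball hR2
  let φ1 : ι → C(K, Cn N') := fun i => ⟨K.restrict i.1.1, (i.2.2.1.continuousOn.mono hsub).restrict⟩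
  let φ : ι → C(K, Cn N') × Rm m := fun i => (φ1 i, i.1.2)
  obtain ⟨𝒜, hc, hg, hcov⟩ := countable_cover_of φ (P := fun T => GoodSet M G.p D ℓ ((fun i : ι => i.1.2) '' T)) (by
    intro i0
    have ht : Filter.Tendsto φ (Filter.comap φ (𝓝 (φ i0))) (𝓝 (φ i0)) := Filter.tendsto_comap
    have hb : pure i0 ≤ Filter.comap φ (𝓝 (φ i0)) := by
      rw [Filter.pure_le_iff]
      intro s hs
      obtain ⟨t, ht, hts⟩ := hs
      have h0 : φ i0 ∈ t := mem_of_mem_nhds ht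
      exact hts h0
    refine good_local G hU hpU hMU hmin D hb (H := fun i : ι => i.1.1) (e := fun i : ι => i.1.2) (R := R / 2) (by positivity)
      (fun i => i.2.2.1.mono (Metric.ball_subset_ball hR2.le)) ?_ ?_ (fun i => i.2.2.2.1)
      (fun i z hz => i.2.2.2.2.1 z ⟨hz.1, Metric.ball_subset_ball hR2.le hz.2⟩) i0.2.1 i0.2.2.2.2.2
    · intro η hη
      have h1 : Filter.Tendsto (fun i => φ1 i) (Filter.comap φ (𝓝 (φ i0))) (𝓝 (φ1 i0)) :=
        (continuous_fst.tendsto _).comp ht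
      have h2 := h1 (Metric.closedBall_mem_nhds (φ1 i0) hη)
      filter_upwards [h2] with i hi y hy
      have hy' : y ∈ K := Metric.ball_subset_closedBall hy
      have h3 := (ContinuousMap.dist_apply_le_dist (f := φ1 i) (g := φ1 i0) ⟨y, hy'⟩).trans hi
      rw [dist_eq_norm] at h3
      exact h3
    · have h1 : Filter.Tendsto (fun i => (φ i).2) (Filter.comap φ (𝓝 (φ i0))) (𝓝 (φ i0).2) :=
        (continuous_snd.tendsto _).comp ht
      exact h1)
  refine ⟨(fun T => (fun i : ι => i.1.2) '' T) '' 𝒜, hc.image _, ?_, ?_⟩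
  · rintro _ ⟨T, hT, rfl⟩; exact hg T hT
  · rintro ε hε ⟨H, hH⟩
    let i : ι := ⟨(H, ε), hε, hH⟩
    have : i ∈ ⋃₀ 𝒜 := by rw [hcov]; trivial
    obtain ⟨T, hT, hi⟩ := this
    exact ⟨_, ⟨T, hT, rfl⟩, ⟨i, hi, rfl⟩⟩

lemma good_cover (G : Gen N dM) {M U : Set (Cn N)} (hU : IsOpen U) (hpU : G.p ∈ U)
    (hMU : M ∩ U = {z | z ∈ U ∧ G.r z = 0}) (hmin : IsMinimalAt M dM G.p) (D : Deformation N' m d p') (ℓ : ℕ) :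
    ∃ 𝒜 : Set (Set (Rm m)), 𝒜.Countable ∧ (∀ A ∈ 𝒜, GoodSet M G.p D ℓ A) ∧ DefLocus M G.p D ℓ ⊆ ⋃₀ 𝒜 := by
  have h : ∀ n : ℕ, (0 : ℝ) < 1 / (n + 1) := fun n => Nat.one_div_pos_of_nat
  choose 𝒜 h1 h2 h3 using fun n => good_cover_n G hU hpU hMU hmin D ℓ (h n)
  refine ⟨⋃ n, 𝒜 n, Set.countable_iUnion h1, ?_, ?_⟩
  · intro A hA
    obtain ⟨n, hn⟩ := Set.mem_iUnion.1 hA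
    exact h2 n A hn
  · rintro ε ⟨hε, Ω, H, hΩ, hpΩ, hd, hHp, hm, hfn⟩
    obtain ⟨R, hR, hb⟩ := Metric.isOpen_iff.1 hΩ _ hpΩ
    obtain ⟨n, hn⟩ := exists_nat_one_div_lt hR
    have hs : Metric.ball G.p (1 / ((n : ℝ) + 1)) ⊆ Ω := (Metric.ball_subset_ball hn.le).trans hb
    obtain ⟨A, hA, hεA⟩ := h3 n ε hε ⟨H, hd.mono hs, hHp, fun z hz => hm z ⟨hz.1, hs hz.2⟩, hfn⟩
    exact ⟨A, Set.mem_iUnion.2 ⟨n, hA⟩, hεA⟩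

end cover

section chart
variable {N N' dM d m : ℕ} {p' : Cn N'}

lemma surj_of_linIndepR {E : Type} [NormedAddCommGroup E] [NormedSpace ℝ E] {c : ℕ} (f : E →L[ℝ] (Fin c → ℝ))
    (h : LinearIndependent ℝ fun k : Fin c => (ContinuousLinearMap.proj k).comp f) : Function.Surjective f := by
  suffices hs : LinearMap.range f.toLinearMap = ⊤ from LinearMap.range_eq_top.1 hs
  by_contra hne
  obtain ⟨g, hg, hle⟩ := Submodule.exists_le_ker_of_lt_top _ (lt_top_iff_ne_top.2 hne)
  apply hg
  have h1 := Fintype.linearIndependent_iff.1 h (fun k => g (Pi.single k 1)) (by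
    ext x
    have h2 : g (f x) = 0 := hle ⟨x, rfl⟩
    have h3 : f x = ∑ k, f x k • (Pi.single k 1 : Fin c → ℝ) := by
      ext j; simp [Finset.sum_apply, Pi.single_apply]
    rw [h3, map_sum] at h2
    simp only [map_smul] at h2
    simpa [ContinuousLinearMap.sum_apply, mul_comm] using h2)
  apply LinearMap.pi_ext'
  intro k
  ext
  simpa using h1 k

lemma chart {S : Set (Rm m)} {x : Rm m} (hx : x ∈ regPart S) :
    ∃ (k : ℕ) (ψ : (Fin k → ℝ) → Rm m) (lam : Rm m →L[ℝ] (Fin k → ℝ)) (O : Set (Rm m)), IsOpen O ∧ x ∈ O ∧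
      AnalyticAt ℝ ψ (lam x) ∧ ψ (lam x) = x ∧ (∀ᶠ t in 𝓝 (lam x), ψ t ∈ S ∧ lam (ψ t) = t) ∧
      (∀ η ∈ S ∩ O, ψ (lam η) = η) ∧ S ∩ O ⊆ regPart S := by
  obtain ⟨hxS, mdim, c, U, ρ, hU, hxU, hdim, han, hSU, hli⟩ := hx
  have hρ : AnalyticAt ℝ ρ x := by
    rw [analyticAt_pi_iff]; exact fun k => han k x hxU
  have hsurj : Function.Surjective (fderiv ℝ ρ x) := by
    apply surj_of_linIndepR
    have h := hli x ⟨hxS, hxU⟩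
    convert h using 2 with k
    ext u
    exact (fderiv_pi_apply hρ.differentiableAt k u).symm
  obtain ⟨k, lam, hlam⟩ := exists_compl _ hsurj
  have hf : AnalyticAt ℝ (fun z => (ρ z, lam z)) x := hρ.prod (lam.analyticAt x)
  have hfd : fderiv ℝ (fun z => (ρ z, lam z)) x = (fderiv ℝ ρ x).prod lam :=
    (hρ.differentiableAt.hasFDerivAt.prodMk lam.hasFDerivAt).fderiv
  obtain ⟨g, hg, hgx, hfg, hgf⟩ := analytic_inv hf (by rw [hfd]; exact hlam)
  have hzero : ∀ z ∈ S ∩ U, ρ z = 0 := by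
    intro z hz
    rw [hSU] at hz
    funext k; exact hz.2 k
  have hρx : ρ x = 0 := hzero x ⟨hxS, hxU⟩
  rw [hρx] at hg hgx hfg
  obtain ⟨O, hO, hOo, hxO⟩ := eventually_nhds_iff.1 (hgf.and (hU.mem_nhds hxU))
  have hψ : AnalyticAt ℝ (fun t => g (0, t)) (lam x) :=
    AnalyticAt.comp (g := g) (f := fun t => ((0 : Fin c → ℝ), t)) hg (analyticAt_const.prod analyticAt_id)
  refine ⟨k, fun t => g (0, t), lam, O, hOo, hxO, hψ, hgx, ?_, ?_, ?_⟩
  · have hct : ContinuousAt (fun t : Fin k → ℝ => ((0 : Fin c → ℝ), t)) (lam x) := by fun_prop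
    have h1 := hct.eventually hfg
    have h2 : ∀ᶠ t in 𝓝 (lam x), g (0, t) ∈ U := hψ.continuousAt.eventually (hU.mem_nhds (by change g (0, lam x) ∈ U; rw [hgx]; exact hxU))
    filter_upwards [h1, h2] with t a1 a2
    have b1 : ρ (g (0, t)) = 0 := congrArg Prod.fst a1
    have b2 : lam (g (0, t)) = t := congrArg Prod.snd a1
    refine ⟨?_, b2⟩
    have : g (0, t) ∈ S ∩ U := by rw [hSU]; exact ⟨a2, fun k => congrFun b1 k⟩
    exact this.1
  · rintro η ⟨hηS, hηO⟩
    obtain ⟨a1, a2⟩ := hO η hηO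
    have := hzero η ⟨hηS, a2⟩
    rw [this] at a1
    exact a1
  · rintro η ⟨hηS, hηO⟩
    exact ⟨hηS, mdim, c, U, ρ, hU, (hO η hηO).2, hdim, han, hSU, hli⟩

lemma baire_pick {E α : Type} [MetricSpace E] [CompleteSpace E] {B : Set E} (hB : IsOpen B) (hne : B.Nonempty) {𝒜 : Set α}
    (hc : 𝒜.Countable) {T : α → Set E} (h : B ⊆ ⋃ a ∈ 𝒜, T a) : ∃ a ∈ 𝒜, (interior (closure (T a))).Nonempty := by
  have hcO : (insert none (some '' 𝒜) : Set (Option α)).Countable := (hc.image _).insert _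
  let F : Option α → Set E := fun o => o.elim Bᶜ (fun a => closure (T a))
  have hd := dense_biUnion_interior_of_closed (S := insert none (some '' 𝒜)) (f := F) (by
    rintro o (rfl | ⟨a, ha, rfl⟩)
    · exact hB.isClosed_compl
    · exact isClosed_closure) hcO (by
    rw [Set.eq_univ_iff_forall]
    intro x
    by_cases hx : x ∈ B
    · obtain ⟨a, ha, hxa⟩ := Set.mem_iUnion₂.1 (h hx)
      exact Set.mem_iUnion₂.2 ⟨some a, Or.inr ⟨a, ha, rfl⟩, subset_closure hxa⟩
    · exact Set.mem_iUnion₂.2 ⟨none, Or.inl rfl, hx⟩)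
  obtain ⟨x, hxB, hx⟩ := hd.inter_open_nonempty B hB hne
  obtain ⟨o, ho, hxo⟩ := Set.mem_iUnion₂.1 hx
  rcases ho with rfl | ⟨a, ha, rfl⟩
  · exact absurd hxB (interior_subset hxo)
  · exact ⟨a, ha, ⟨x, hxo⟩⟩

end chart

section core
variable {N N' dM d m : ℕ} {p' : Cn N'}

def FamAt (M : Set (Cn N)) (p : Cn N) (D : Deformation N' m d p') (ℓ : ℕ) (S O : Set (Rm m)) : Prop :=
  ∃ (𝒥 : Type) (_ : NormedAddCommGroup 𝒥) (_ : NormedSpace ℂ 𝒥) (_ : FiniteDimensional ℂ 𝒥) (r : ℝ)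
    (Φ : Cn N × 𝒥 × Cn m → Cn N') (s : Rm m → 𝒥), 0 < r ∧
    (∀ η ∈ O, AnalyticAt ℝ s η ∧ η ∈ D.W ∧ ∀ z ∈ Metric.ball p r,
      AnalyticAt ℂ Φ (z, s η, (cplxR m).ι η) ∧ Φ (z, s η, (cplxR m).ι η) ∈ D.U') ∧
    ∀ η ∈ S ∩ O, Submodule.span ℂ (spanSet M p ℓ (fun w => D.ρ w η) (fun z => Φ (z, s η, (cplxR m).ι η))) = ⊤ ∧
      Φ (p, s η, (cplxR m).ι η) = p' ∧ ∀ z ∈ M ∩ Metric.ball p r, ∀ k, D.ρ (Φ (z, s η, (cplxR m).ι η)) η k = 0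

lemma eq_zero_closure {X : Type} [TopologicalSpace X] {C : Set X} {h : X → ℝ} {y : X} (hc : ContinuousAt h y)
    (hy : y ∈ closure C) (hz : ∀ x ∈ C, h x = 0) : h y = 0 := by
  have h1 := hc.continuousWithinAt.mem_closure_image hy
  have h2 : h '' C ⊆ {0} := by rintro _ ⟨x, hx, rfl⟩; exact hz x hx
  have h3 := closure_mono h2 h1
  simpa using h3

lemma core {M : Set (Cn N)} {p : Cn N} (D : Deformation N' m d p') {ℓ : ℕ} {S : Set (Rm m)} {𝒜 : Set (Set (Rm m))}
    (hc : 𝒜.Countable) (hgood : ∀ A ∈ 𝒜, GoodSet M p D ℓ A) (hcov : S ⊆ ⋃₀ 𝒜) {x : Rm m} (hx : x ∈ regPart S)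
    {O0 : Set (Rm m)} (hO0 : IsOpen O0) (hxO0 : x ∈ O0) :
    ∃ O2, IsOpen O2 ∧ O2 ⊆ O0 ∧ (regPart S ∩ O2).Nonempty ∧ FamAt M p D ℓ S O2 := by
  obtain ⟨k, ψ, lam, O, hO, hxO, hψ, hψx, hψS, hψlam, hreg⟩ := chart hx
  have hev : ∀ᶠ t in 𝓝 (lam x), AnalyticAt ℝ ψ t ∧ (ψ t ∈ S ∧ lam (ψ t) = t) ∧ ψ t ∈ O ∩ O0 :=
    hψ.eventually_analyticAt.and (hψS.and (hψ.continuousAt.eventually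
      ((hO.inter hO0).mem_nhds (by rw [hψx]; exact ⟨hxO, hxO0⟩))))
  obtain ⟨b, hb, hB⟩ := Metric.eventually_nhds_iff_ball.1 hev
  have hb2 : b / 2 < b := by linarith
  have hb2' : 0 < b / 2 := by positivity
  obtain ⟨A, hA, hInt⟩ := baire_pick (B := Metric.ball (lam x) (b / 2)) Metric.isOpen_ball ⟨_, Metric.mem_ball_self hb2'⟩ hc
    (T := fun A => {t | t ∈ Metric.closedBall (lam x) (b / 2) ∧ ψ t ∈ A}) (by
      intro t ht
      obtain ⟨A, hA, htA⟩ := hcov (hB t (Metric.ball_subset_ball hb2.le ht)).2.1.1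
      exact Set.mem_iUnion₂.2 ⟨A, hA, Metric.ball_subset_closedBall ht, htA⟩)
  obtain ⟨𝒥, i1, i2, i3, J0, ε0, r, Φ, hr, hΦ, hsp, hAε⟩ := hgood A hA
  have hr2 : r / 2 < r := by linarith
  have hψc : ∀ t ∈ Metric.ball (lam x) b, ContinuousAt ψ t := fun t ht => (hB t ht).1.continuousAt
  let U : Set ((Fin k → ℝ) × 𝒥) := (Metric.ball (lam x) b ∩ ψ ⁻¹' Metric.ball ε0 r) ×ˢ Metric.ball J0 r
  have hUo : IsOpen U := by
    refine IsOpen.prod ?_ Metric.isOpen_ball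
    exact ContinuousOn.isOpen_inter_preimage (fun t ht => (hψc t ht).continuousWithinAt) Metric.isOpen_ball Metric.isOpen_ball
  let K : Set ((Fin k → ℝ) × 𝒥) := (Metric.closedBall (lam x) (b / 2) ∩ ψ ⁻¹' Metric.closedBall ε0 (r / 2)) ×ˢ Metric.closedBall J0 (r / 2)
  have hcb : Metric.closedBall (lam x) (b / 2) ⊆ Metric.ball (lam x) b := Metric.closedBall_subset_ball hb2
  haveI : ProperSpace 𝒥 := FiniteDimensional.proper ℂ 𝒥
  have hKc : IsCompact K := by
    refine IsCompact.prod ?_ (isCompact_closedBall _ _)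
    refine (isCompact_closedBall (lam x) (b / 2)).of_isClosed_subset ?_ Set.inter_subset_left
    exact ContinuousOn.preimage_isClosed_of_isClosed (fun t ht => (hψc t (hcb ht)).continuousWithinAt)
      Metric.isClosed_closedBall Metric.isClosed_closedBall
  have hKU : K ⊆ U := by
    rintro ⟨t, J⟩ ⟨⟨h1, h2⟩, h3⟩
    exact ⟨⟨hcb h1, Metric.closedBall_subset_ball hr2 h2⟩, Metric.closedBall_subset_ball hr2 h3⟩
  let C0 : Set ((Fin k → ℝ) × 𝒥) := {y | y ∈ K ∧ Φ (p, y.2, (cplxR m).ι (ψ y.1)) = p' ∧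
    ∀ z ∈ M ∩ Metric.ball p r, ∀ k, D.ρ (Φ (z, y.2, (cplxR m).ι (ψ y.1))) (ψ y.1) k = 0}
  have hCK : closure C0 ⊆ K := closure_minimal (fun y hy => hy.1) hKc.isClosed
  have hCc : IsCompact (closure C0) := hKc.of_isClosed_subset isClosed_closure hCK
  have hfst : closure {t | t ∈ Metric.closedBall (lam x) (b / 2) ∧ ψ t ∈ A} ⊆ Prod.fst '' closure C0 := by
    refine closure_minimal ?_ (hCc.image continuous_fst).isClosed
    rintro t ⟨ht, htA⟩
    obtain ⟨h1, J, hJ, h2, h3⟩ := hAε _ htA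
    exact ⟨(t, J), subset_closure ⟨⟨⟨ht, h1⟩, hJ⟩, h2, h3⟩, rfl⟩
  haveI : FiniteDimensional ℝ 𝒥 := FiniteDimensional.complexToReal 𝒥
  obtain ⟨O1, s, hO1, hne, hs, hsU, hz⟩ := section_thm hUo hCc (hCK.trans hKU)
    (hInt.mono (interior_mono hfst))
  -- analyticity of the relevant functions
  have hanΦ : ∀ z ∈ Metric.ball p r, AnalyticOnNhd ℝ (fun y : (Fin k → ℝ) × 𝒥 => Φ (z, y.2, (cplxR m).ι (ψ y.1))) U := by
    rintro z hz' ⟨t, J⟩ ⟨⟨h1, h2⟩, h3⟩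
    have h4 : AnalyticAt ℝ Φ (z, J, (cplxR m).ι (ψ t)) := (hΦ z hz' J h3 (ψ t) h2).1.restrictScalars
    have h5 : AnalyticAt ℝ (fun y : (Fin k → ℝ) × 𝒥 => (cplxR m).ι (ψ y.1)) (t, J) :=
      ((cplxR m).ι.analyticAt _).comp (AnalyticAt.comp (g := ψ) (f := fun y : (Fin k → ℝ) × 𝒥 => y.1) (hB t h1).1 analyticAt_fst)
    exact AnalyticAt.comp (g := Φ) (f := fun y : (Fin k → ℝ) × 𝒥 => (z, y.2, (cplxR m).ι (ψ y.1))) h4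
      (analyticAt_const.prod (analyticAt_snd.prod h5))
  have hanψ : AnalyticOnNhd ℝ (fun y : (Fin k → ℝ) × 𝒥 => ψ y.1) U := by
    rintro ⟨t, J⟩ ⟨⟨h1, h2⟩, h3⟩
    exact AnalyticAt.comp (g := ψ) (f := fun y : (Fin k → ℝ) × 𝒥 => y.1) (hB t h1).1 analyticAt_fst
  have hmain : ∀ h : (Fin k → ℝ) × 𝒥 → ℝ, AnalyticOnNhd ℝ h U → (∀ y ∈ C0, h y = 0) → ∀ e ∈ O1, h (e, s e) = 0 := by
    intro h hh h0
    refine hz h hh fun y hy => ?_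
    exact eq_zero_closure (hh y (hKU (hCK hy))).continuousAt hy h0
  have hpp : p ∈ Metric.ball p r := Metric.mem_ball_self hr
  have hzp : ∀ e ∈ O1, Φ (p, s e, (cplxR m).ι (ψ e)) = p' := by
    intro e he
    have hre : ∀ L : Cn N' →L[ℝ] ℝ, L (Φ (p, s e, (cplxR m).ι (ψ e)) - p') = 0 := by
      intro L
      refine hmain (fun y => L (Φ (p, y.2, (cplxR m).ι (ψ y.1)) - p')) ?_ ?_ e he
      · intro y hy
        exact (L.analyticAt _).comp ((hanΦ p hpp y hy).sub analyticAt_const)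
      · rintro y ⟨-, hy, -⟩
        simp [hy]
    rw [← sub_eq_zero]
    ext j
    have a1 := hre (Complex.reCLM.comp ((EuclideanSpace.proj j : Cn N' →L[ℂ] ℂ).restrictScalars ℝ))
    have a2 := hre (Complex.imCLM.comp ((EuclideanSpace.proj j : Cn N' →L[ℂ] ℂ).restrictScalars ℝ))
    exact Complex.ext a1 a2
  have hzρ : ∀ e ∈ O1, ∀ z ∈ M ∩ Metric.ball p r, ∀ k, D.ρ (Φ (z, s e, (cplxR m).ι (ψ e))) (ψ e) k = 0 := by
    intro e he z hz' j
    refine hmain (fun y => D.ρ (Φ (z, y.2, (cplxR m).ι (ψ y.1))) (ψ y.1) j) ?_ ?_ e he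
    · intro y hy
      obtain ⟨⟨h1, h2⟩, h3⟩ := hy
      obtain ⟨b1, b2, b3⟩ := hΦ z hz'.2 y.2 h3 (ψ y.1) h2
      exact AnalyticAt.comp (g := fun we : Cn N' × Rm m => D.ρ we.1 we.2 j)
        (f := fun y : (Fin k → ℝ) × 𝒥 => (Φ (z, y.2, (cplxR m).ι (ψ y.1)), ψ y.1)) (D.an b2 b3 j)
        ((hanΦ z hz'.2 y ⟨⟨h1, h2⟩, h3⟩).prod (hanψ y ⟨⟨h1, h2⟩, h3⟩))
    · rintro y ⟨-, -, hy⟩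
      exact hy z hz' j
  refine ⟨O ∩ O0 ∩ (lam ⁻¹' O1 ∩ Metric.ball ε0 r), (hO.inter hO0).inter ((hO1.preimage lam.continuous).inter Metric.isOpen_ball),
    fun η hη => hη.1.2, ?_, 𝒥, i1, i2, i3, r, Φ, fun η => s (lam η), hr, ?_, ?_⟩
  · obtain ⟨t, ht⟩ := hne
    obtain ⟨⟨h1, h2⟩, h3⟩ := hsU t ht
    obtain ⟨-, ⟨h4, h5⟩, h6⟩ := hB t h1
    exact ⟨ψ t, hreg ⟨h4, h6.1⟩, h6, by rw [Set.mem_preimage, h5]; exact ht, h2⟩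
  · rintro η ⟨hη1, hη2, hη3⟩
    obtain ⟨-, h3⟩ := hsU _ hη2
    refine ⟨AnalyticAt.comp (g := s) (f := lam) (hs _ hη2) (lam.analyticAt _), (hΦ p hpp _ h3 η hη3).2.2, fun z hz' => ?_⟩
    exact ⟨(hΦ z hz' _ h3 η hη3).1, (hΦ z hz' _ h3 η hη3).2.1⟩
  · rintro η ⟨hηS, hη1, hη2, hη3⟩
    obtain ⟨-, h3⟩ := hsU _ hη2
    have h4 := hψlam η ⟨hηS, hη1.1⟩
    refine ⟨hsp _ h3 η hη3, ?_, ?_⟩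
    · have := hzp _ hη2
      rw [h4] at this; exact this
    · have := hzρ _ hη2
      rw [h4] at this; exact this

end core

section final
variable {N N' dM d m : ℕ} {p' : Cn N'}

lemma wirtD_dir {n : ℕ} (f : Cn n → ℝ) (q Y : Cn n) :
    2 * (∑ j, wirtD f q j * Y j).re = fderiv ℝ f q Y := by
  have hY : Y = ∑ j, ((Y j).re • cbasis j 1 + (Y j).im • cbasis j Complex.I) := by
    ext i
    simp only [cbasis, WithLp.ofLp_sum, Finset.sum_apply, PiLp.add_apply, PiLp.smul_apply, EuclideanSpace.single_apply]
    rw [Finset.sum_eq_single i]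
    · simp
    · intro b _ hb; simp [hb.symm]
    · simp
  conv_rhs => rw [hY]
  simp only [map_sum, map_add, map_smul, Complex.re_sum, Finset.mul_sum]
  refine Finset.sum_congr rfl fun j _ => ?_
  simp [wirtD, Complex.mul_re, Complex.mul_im]
  ring

lemma final_local {M : Set (Cn N)} {p : Cn N} (hpM : p ∈ M) (D : Deformation N' m d p') {ℓ : ℕ} {S O2 : Set (Rm m)}
    (hO2 : IsOpen O2) (hSE : S ⊆ DefLocus M p D ℓ) (h : FamAt M p D ℓ S O2) : ∀ δ ∈ regPart S ∩ O2,
    ∃ (O' : Set (Rm m)) (V' : Set (Cn N)) (F : Rm m → Cn N → Cn N'),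
          IsOpen O' ∧ δ ∈ O' ∧ IsOpen V' ∧ p ∈ V' ∧
          (∀ z ∈ V', ∀ η ∈ regPart S ∩ O',
            AnalyticWithinAt ℝ (fun e => F e z) (regPart S ∩ O') η) ∧
          (∀ η ∈ regPart S ∩ O', DifferentiableOn ℂ (F η) V' ∧ F η p = p' ∧
            (∀ z ∈ M ∩ V', F η z ∈ D.Mfib η) ∧ FinNondeg M p (D.Mfib η) ℓ (F η)) ∧
          ∀ v ∈ tangentSpaceAt (regPart S) δ,
            ∃ (Y : Cn N → Cn N') (ΩY : Set (Cn N)), IsOpen ΩY ∧ p ∈ ΩY ∧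
              DifferentiableOn ℂ Y ΩY ∧ Y p = 0 ∧
              ∀ i : Fin d, ∃ V, IsOpen V ∧ p ∈ V ∧ ∀ z ∈ M ∩ V,
                2 * (∑ j, wirtD (fun w => D.ρ w δ i) (F δ z) j * Y z j).re +
                  fderiv ℝ (fun e => D.ρ (F δ z) e i) δ v = 0 := by
  obtain ⟨𝒥, i1, i2, i3, r, Φ, s, hr, hO, hS⟩ := h
  rintro δ ⟨hδS, hδO⟩
  have hpp : p ∈ Metric.ball p r := Metric.mem_ball_self hr
  let F : Rm m → Cn N → Cn N' := fun η z => Φ (z, s η, (cplxR m).ι η)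
  have hanη : ∀ η ∈ O2, ∀ z ∈ Metric.ball p r, AnalyticAt ℝ (fun e => F e z) η := by
    intro η hη z hz
    exact AnalyticAt.comp (g := Φ) (f := fun e => (z, s e, (cplxR m).ι e)) ((hO η hη).2.2 z hz).1.restrictScalars
      (analyticAt_const.prod ((hO η hη).1.prod ((cplxR m).ι.analyticAt _)))
  have hanz : ∀ η ∈ O2, ∀ z ∈ Metric.ball p r, AnalyticAt ℂ (F η) z := by
    intro η hη z hz
    exact AnalyticAt.comp (g := Φ) (f := fun z => (z, s η, (cplxR m).ι η)) ((hO η hη).2.2 z hz).1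
      (analyticAt_id.prod analyticAt_const)
  refine ⟨O2, Metric.ball p r, F, hO2, hδO, Metric.isOpen_ball, hpp, ?_, ?_, ?_⟩
  · intro z hz η hη
    exact (hanη η hη.2 z hz).analyticWithinAt
  · rintro η ⟨hηS, hηO⟩
    obtain ⟨h1, h2, h3⟩ := hS η ⟨hηS.1, hηO⟩
    refine ⟨fun z hz => (hanz η hηO z hz).differentiableAt.differentiableWithinAt, h2,
      fun z hz => ⟨((hO η hηO).2.2 z hz.2).2, h3 z hz⟩, ?_⟩
    refine (def_fn D (hSE hηS.1).1 (hanz η hηO p hpp) h2 hpM ?_).2 h1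
    filter_upwards [Metric.ball_mem_nhds p hr] with z hz hzM
    exact h3 z ⟨hzM, hz⟩
  · intro v hv
    let a : 𝒥 := fderiv ℝ s δ v
    let Y : Cn N → Cn N' := fun z => fderiv ℂ Φ (z, s δ, (cplxR m).ι δ) (0, a, (cplxR m).ι v)
    have hY : ∀ z ∈ Metric.ball p r, fderiv ℝ (fun e => F e z) δ v = Y z := by
      intro z hz
      have h1 := (((hO δ hδO).2.2 z hz).1.differentiableAt.hasFDerivAt).restrictScalars ℝ
      have h2 : HasFDerivAt (fun e => (z, s e, (cplxR m).ι e)) ((0 : Rm m →L[ℝ] Cn N).prod ((fderiv ℝ s δ).prod (cplxR m).ι)) δ :=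
        (hasFDerivAt_const z δ).prodMk ((hO δ hδO).1.differentiableAt.hasFDerivAt.prodMk (cplxR m).ι.hasFDerivAt)
      have h3 := HasFDerivAt.comp (g := Φ) (f := fun e => (z, s e, (cplxR m).ι e)) δ h1 h2
      have h4 : fderiv ℝ (fun e => F e z) δ = _ := h3.fderiv
      rw [h4]
      rfl
    have hev : ∀ᶠ η in 𝓝 δ, η ∈ O2 := hO2.mem_nhds hδO
    refine ⟨Y, Metric.ball p r, Metric.isOpen_ball, hpp, ?_, ?_, ?_⟩
    · intro z hz
      refine AnalyticAt.differentiableWithinAt ?_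
      exact fderiv_dir_analytic (f := Φ) (m := fun z => (z, s δ, (cplxR m).ι δ)) (a := fun _ => (0, a, (cplxR m).ι v))
        ((hO δ hδO).2.2 z hz).1 (analyticAt_id.prod analyticAt_const) analyticAt_const
    · have h1 := tangentSpace_le_ker (r := fun e => F e p - p') (hanη δ hδO p hpp |>.differentiableAt.sub_const p') (by
        filter_upwards [hev] with η hη hηS
        exact sub_eq_zero.2 (hS η ⟨hηS.1, hη⟩).2.1) (sub_eq_zero.2 (hS δ ⟨hδS.1, hδO⟩).2.1) hv
      rw [fderiv_sub_const, hY p hpp] at h1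
      exact h1
    · intro i
      refine ⟨Metric.ball p r, Metric.isOpen_ball, hpp, fun z hz => ?_⟩
      have hρ := (D.an ((hO δ hδO).2.2 z hz.2).2 (hO δ hδO).2.1 i).differentiableAt
      have h2 := (hanη δ hδO z hz.2).differentiableAt
      have h3 : HasFDerivAt (fun e => (F e z, e)) ((fderiv ℝ (fun e => F e z) δ).prod (ContinuousLinearMap.id ℝ (Rm m))) δ :=
        h2.hasFDerivAt.prodMk (hasFDerivAt_id δ)
      have h4 := HasFDerivAt.comp (g := fun we : Cn N' × Rm m => D.ρ we.1 we.2 i) (f := fun e => (F e z, e)) δ hρ.hasFDerivAt h3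
      have h5 := tangentSpace_le_ker (r := fun e => D.ρ (F e z) e i) h4.differentiableAt (by
        filter_upwards [hev] with η hη hηS
        exact (hS η ⟨hηS.1, hη⟩).2.2 z hz i) ((hS δ ⟨hδS.1, hδO⟩).2.2 z hz i) hv
      have h6 : fderiv ℝ (fun e => D.ρ (F e z) e i) δ = _ := h4.fderiv
      rw [h6] at h5
      have h7 : fderiv ℝ (fun we : Cn N' × Rm m => D.ρ we.1 we.2 i) (F δ z, δ) (Y z, v) = 0 := by
        rw [← hY z hz.2]; exact h5
      have h8 : ((Y z, v) : Cn N' × Rm m) = (Y z, 0) + (0, v) := by simp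
      rw [h8, map_add] at h7
      have h9 := partial_fderiv hρ (Y z)
      have h10 := HasFDerivAt.comp (g := fun we : Cn N' × Rm m => D.ρ we.1 we.2 i) (f := fun e => (F δ z, e)) δ hρ.hasFDerivAt
        (hasFDerivAt_prodMk_right (𝕜 := ℝ) (F δ z) δ)
      have h11 : fderiv ℝ (fun e => D.ρ (F δ z) e i) δ = _ := h10.fderiv
      rw [wirtD_dir, h11]
      rw [← h9] at h7
      exact h7

end final

/-- **Theorem 3.2.** Let `S` be a semi-analytic subset of the mapping locus `E_ℓ` of a
deformation.  Then there is an open dense subset `D₀` of `S^{reg}` on which the maps can be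
selected analytically, and for every `δ ∈ D₀` the tangent space `T_δ S^{reg}` is contained in
the projection to the parameter space of the infinitesimal deformations of `H^δ`. -/
theorem tangentSpace_subset_infinitesimal_deformations
    {N N' m d dM ℓ : ℕ} (M : Set (Cn N)) (p : Cn N)
    (hM : IsGenericAt M dM p) (hmin : IsMinimalAt M dM p)
    (p' : Cn N') (D : Deformation N' m d p')
    (S : Set (Rm m)) (hSE : S ⊆ DefLocus M p D ℓ) (hSsa : SemiAnalyticSet S) :
    ∃ D₀ : Set (Rm m), D₀ ⊆ regPart S ∧
      (∀ x ∈ D₀, ∃ O : Set (Rm m), IsOpen O ∧ x ∈ O ∧ regPart S ∩ O ⊆ D₀) ∧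
      regPart S ⊆ closure D₀ ∧
      ∀ δ ∈ D₀,
        ∃ (O' : Set (Rm m)) (V' : Set (Cn N)) (F : Rm m → Cn N → Cn N'),
          IsOpen O' ∧ δ ∈ O' ∧ IsOpen V' ∧ p ∈ V' ∧
          (∀ z ∈ V', ∀ η ∈ regPart S ∩ O',
            AnalyticWithinAt ℝ (fun e => F e z) (regPart S ∩ O') η) ∧
          (∀ η ∈ regPart S ∩ O', DifferentiableOn ℂ (F η) V' ∧ F η p = p' ∧
            (∀ z ∈ M ∩ V', F η z ∈ D.Mfib η) ∧ FinNondeg M p (D.Mfib η) ℓ (F η)) ∧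
          ∀ v ∈ tangentSpaceAt (regPart S) δ,
            ∃ (Y : Cn N → Cn N') (ΩY : Set (Cn N)), IsOpen ΩY ∧ p ∈ ΩY ∧
              DifferentiableOn ℂ Y ΩY ∧ Y p = 0 ∧
              ∀ i : Fin d, ∃ V, IsOpen V ∧ p ∈ V ∧ ∀ z ∈ M ∩ V,
                2 * (∑ j, wirtD (fun w => D.ρ w δ i) (F δ z) j * Y z j).re +
                  fderiv ℝ (fun e => D.ρ (F δ z) e i) δ v = 0 := by
  obtain ⟨hpM, U, rM, hU, hpU, hran, hMU, hli⟩ := hM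
  have hr : AnalyticAt ℝ rM p := by
    rw [analyticAt_pi_iff]; exact fun k => hran k p hpU
  have hr0 : AnalyticAt ℝ (fun z (k : Fin dM) => (rM z k : ℂ)) p := by
    rw [analyticAt_pi_iff]
    intro k
    exact (Complex.ofRealCLM.analyticAt _).comp (hran k p hpU)
  obtain ⟨rc, hrc, hext⟩ := Cplx.exists_ext (cplxC N) hr0
  simp only [cplxC_ι] at hrc hext
  have hp0 : rM p = 0 := by
    have : p ∈ M ∩ U := ⟨hpM, hpU⟩
    rw [hMU] at this
    funext k; exact this.2 k
  obtain ⟨G, hGp, hGr, -⟩ := exists_Gen hr hp0 hrc hext (hli p ⟨hpM, hpU⟩)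
  subst hGp
  obtain ⟨𝒜, hc, hgood, hcov⟩ := good_cover G hU hpU (by
    rw [hMU, hGr]
    ext z
    simp only [Set.mem_setOf_eq, funext_iff, Pi.zero_apply]) hmin D ℓ
  refine ⟨{δ | δ ∈ regPart S ∧ ∃ O, IsOpen O ∧ δ ∈ O ∧ FamAt M G.p D ℓ S O}, fun δ hδ => hδ.1, ?_, ?_, ?_⟩
  · rintro x ⟨hx, O, hO, hxO, hF⟩
    exact ⟨O, hO, hxO, fun y hy => ⟨hy.1, O, hO, hy.2, hF⟩⟩
  · intro x hx
    rw [mem_closure_iff]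
    intro O0 hO0 hxO0
    obtain ⟨O2, hO2, hsub, ⟨y, hy, hyO⟩, hF⟩ := core D hc hgood (hSE.trans hcov) hx hO0 hxO0
    exact ⟨y, hsub hyO, hy, O2, hO2, hyO, hF⟩
  · rintro δ ⟨hδ, O, hO, hδO, hF⟩
    exact final_local hpM D hO hSE hF δ ⟨hδ, hδO⟩

end
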